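/- Let ∂G be piecewise analytic, with the smallest exterior angle λπ, 0 < λ < 2, at the junction points of its analytic arcs, and let F ⊂ G be compact. Then there is a constant C(G,F) > 0, depending only on G and F, such that for all z, ζ ∈ F and all n ∈ ℕ: |K(z,ζ) − Σ_{k=0}^n conj(p_k(ζ))·p_k(z)| ≤ C(G,F) · n^{−λ/(2−λ)}. -/

import Mathlib

open Complex MeasureTheory Set Filter Metric

noncomputable section

/-- A bounded Jordan domain `G ⊆ ℂ` whose boundary is a rectifiable Jordan curve
of length `l`, given together with a unit-speed (arclength) parametrization `γ`
of the boundary curve `L = frontier G`. -/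
structure JordanDomain where
  /-- the domain -/
  G : Set ℂ
  isOpen : IsOpen G
  nonempty : G.Nonempty
  bounded : Bornology.IsBounded G
  connected : IsConnected G
  simplyConnected : SimplyConnectedSpace ↥G
  /-- the length of the boundary curve -/
  l : ℝ
  l_pos : 0 < l
  /-- arclength parametrization of the boundary curve -/
  γ : ℝ → ℂ
  γ_cont : Continuous γ
  γ_periodic : Function.Periodic γ l
  γ_injOn : InjOn γ (Ico 0 l)
  γ_boundary : γ '' Ico 0 l = frontier G
  /-- `γ` is a unit-speed (arclength) parametrization; in particular the boundary
  is rectifiable with length `l`. -/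
  γ_unitSpeed : ∀ s t : ℝ, s ≤ t → t ≤ s + l →
    eVariationOn γ (Icc s t) = ENNReal.ofReal (t - s)

/-- The `E₂(G)`-norm of (the boundary trace of) a function, computed through the
arclength parametrization of the boundary: `‖g‖₂ = ((1/l) ∫₀^l ‖g(s)‖² ds)^{1/2}`. -/
def JordanDomain.bnorm (D : JordanDomain) (g : ℝ → ℂ) : ℝ :=
  Real.sqrt ((1 / D.l) * ∫ s in (0:ℝ)..D.l, ‖g s‖ ^ 2)

/-- `p` is the sequence of orthonormal polynomials of `E₂(G)` obtained by Gram–Schmidt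
orthonormalization of the monomials `1, z, z², …`: `deg p k = k`, the leading
coefficients are positive reals, and the polynomials are orthonormal with respect to
the arclength inner product `(f,g) = (1/l) ∫_L f conj(g) |dz|`. -/
def JordanDomain.IsONPolys (D : JordanDomain) (p : ℕ → Polynomial ℂ) : Prop :=
  (∀ k, (p k).natDegree = k) ∧
  (∀ k, ∃ c : ℝ, 0 < c ∧ (p k).leadingCoeff = (c : ℂ)) ∧
  (∀ j k, (1 / (D.l : ℂ)) * (∫ s in (0:ℝ)..D.l,
      (p j).eval (D.γ s) * (starRingEnd ℂ) ((p k).eval (D.γ s))) =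
    if j = k then 1 else 0)

/-- The `n`-th partial sum `Σ_{k=0}^n conj(p_k(ζ))·p_k(z)` of the Szegő kernel expansion. -/
def partialSum (p : ℕ → Polynomial ℂ) (ζ : ℂ) (n : ℕ) : ℂ → ℂ := fun z =>
  ∑ k ∈ Finset.range (n + 1), (starRingEnd ℂ) ((p k).eval ζ) * (p k).eval z

/-- The Szegő kernel `K(z,ζ) = Σ_{k=0}^∞ conj(p_k(ζ))·p_k(z)`. -/
def szegoKernel (p : ℕ → Polynomial ℂ) (ζ z : ℂ) : ℂ :=
  ∑' k : ℕ, (starRingEnd ℂ) ((p k).eval ζ) * (p k).eval z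

/-- The approximating polynomials
`J_{2n+1}(z) = (2π/l)·(∫_ζ^z (Σ_{k=0}^n conj(p_k(ζ))p_k(t))² dt) / (Σ_{k=0}^n |p_k(ζ)|²)`;
the (path-independent) integral of the polynomial integrand is written out explicitly,
using `∫_ζ^z t^i dt = (z^{i+1} - ζ^{i+1})/(i+1)`. -/
def Jfun (D : JordanDomain) (p : ℕ → Polynomial ℂ) (ζ : ℂ) (n : ℕ) : ℂ → ℂ := fun z =>
  let S : Polynomial ℂ :=
    (∑ k ∈ Finset.range (n + 1), Polynomial.C ((starRingEnd ℂ) ((p k).eval ζ)) * p k) ^ 2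
  (((2 * Real.pi / D.l : ℝ) : ℂ) / (∑ k ∈ Finset.range (n + 1), ((‖(p k).eval ζ‖ : ℂ)) ^ 2)) *
    ∑ i ∈ Finset.range (S.natDegree + 1),
      S.coeff i * ((z ^ (i + 1) - ζ ^ (i + 1)) / ((i : ℂ) + 1))

/-- `Q_n(z) = ((l/2π)·Σ_{k=0}^n |p_k(ζ)|²)^{-1/2} · Σ_{k=0}^n conj(p_k(ζ))·p_k(z)`,
so that `J'_{2n+1} = Q_n²`. -/
def Qfun (D : JordanDomain) (p : ℕ → Polynomial ℂ) (ζ : ℂ) (n : ℕ) : ℂ → ℂ := fun z =>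
  ((Real.sqrt ((D.l / (2 * Real.pi)) *
      ∑ k ∈ Finset.range (n + 1), ‖(p k).eval ζ‖ ^ 2) : ℝ) : ℂ)⁻¹ * partialSum p ζ n z

/-- The sup norm `⨆_{z ∈ K} ‖f(z)‖` on a set `K ⊆ ℂ`. -/
def supNormOn (K : Set ℂ) (f : ℂ → ℂ) : ℝ := ⨆ z : K, ‖f (z : ℂ)‖

/-- `g` has nontangential limit `v` at the boundary point `w` of `G`:
`g(z) → v` as `z → w` inside every cone `{z ∈ G : ‖z - w‖ ≤ M·dist(z, ∂G)}`. -/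
def NTLim (G : Set ℂ) (g : ℂ → ℂ) (w v : ℂ) : Prop :=
  ∀ M : ℝ, 1 < M →
    Tendsto g (nhdsWithin w {z | z ∈ G ∧ ‖z - w‖ ≤ M * infDist z (frontier G)}) (nhds v)

/-- `φ` is the conformal map of `G` onto the unit disk `D` normalized by
`φ(ζ) = 0` and `φ'(ζ) > 0`. -/
structure ConformalOnto (G : Set ℂ) (φ : ℂ → ℂ) (ζ : ℂ) : Prop where
  differentiable : ∀ z ∈ G, DifferentiableAt ℂ φ z
  bijOn : BijOn φ G (ball (0 : ℂ) 1)
  map_center : φ ζ = 0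
  deriv_center_pos : ∃ c : ℝ, 0 < c ∧ deriv φ ζ = (c : ℂ)

/-- `G` is a Smirnov domain: for any conformal map `ψ` of the unit disk onto `G`,
`log|ψ'|` is represented by the Poisson integral of its (radial) boundary values.
(By the Keldysh–Lavrentiev theorem this is equivalent to polynomials being dense
in the Smirnov classes `E_p(G)`.) -/
def IsSmirnovDomain (G : Set ℂ) : Prop :=
  ∀ ψ : ℂ → ℂ,
    (∀ w ∈ ball (0 : ℂ) 1, DifferentiableAt ℂ ψ w) →
    BijOn ψ (ball (0 : ℂ) 1) G →
    ∃ h : ℝ → ℝ,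
      IntervalIntegrable h volume 0 (2 * Real.pi) ∧
      (∀ᵐ (θ : ℝ) ∂(volume.restrict (Ioc (0 : ℝ) (2 * Real.pi))),
        Tendsto (fun r : ℝ => Real.log ‖deriv ψ ((r : ℂ) * Complex.exp ((θ : ℂ) * Complex.I))‖)
          (nhdsWithin 1 (Iio 1)) (nhds (h θ))) ∧
      (∀ w ∈ ball (0 : ℂ) 1,
        Real.log ‖deriv ψ w‖ =
          (1 / (2 * Real.pi)) * ∫ θ in (0 : ℝ)..(2 * Real.pi),
            ((1 - ‖w‖ ^ 2) / ‖Complex.exp ((θ : ℂ) * Complex.I) - w‖ ^ 2) * h θ)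

/-- The (interior) opening angle of `G` at the boundary point `z₀` equals `a`:
the angular measure of the set of directions in which `G` is seen from `z₀`
at distance `r` tends to `a` as `r → 0⁺`. -/
def HasCornerAngle (G : Set ℂ) (z₀ : ℂ) (a : ℝ) : Prop :=
  Tendsto (fun r : ℝ =>
      (volume {θ : ℝ | θ ∈ Ico 0 (2 * Real.pi) ∧
        z₀ + (r : ℂ) * Complex.exp ((θ : ℂ) * Complex.I) ∈ G}).toReal)
    (nhdsWithin 0 (Ioi 0)) (nhds a)

/-- The boundary of the Jordan domain `D` is piecewise analytic: it is a union of
finitely many analytic arcs `τ i '' [0,1]` (each `τ i` is conformal, i.e. injective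
and holomorphic, on an open neighborhood `U i` of the segment `[0,1]`), consecutive
arcs are joined at the junction points `τ i 1 = τ (i+1) 0`, and at the junction
point `τ i 1` the exterior angle of `G` is `extAngle i · π` (so the interior
opening angle there is `(2 - extAngle i) · π`). -/
structure PiecewiseAnalyticBoundary (D : JordanDomain) where
  /-- number of analytic arcs -/
  m : ℕ
  m_pos : 0 < m
  /-- conformal parametrizations of the arcs -/
  τ : Fin m → ℂ → ℂ
  /-- neighborhoods of the segment `[0,1]` on which the `τ i` are conformal -/
  U : Fin m → Set ℂ
  U_open : ∀ i, IsOpen (U i)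
  seg_sub : ∀ i, (Complex.ofReal '' Icc (0 : ℝ) 1) ⊆ U i
  analytic : ∀ i, DifferentiableOn ℂ (τ i) (U i)
  inj : ∀ i, InjOn (τ i) (U i)
  cover : (⋃ i, τ i '' (Complex.ofReal '' Icc (0 : ℝ) 1)) = frontier D.G
  junction : ∀ i : Fin m,
    τ i 1 = τ (Fin.mk ((i.val + 1) % m) (Nat.mod_lt _ m_pos)) 0
  /-- `extAngle i · π` is the exterior angle at the junction point `τ i 1` -/
  extAngle : Fin m → ℝ
  extAngle_mem : ∀ i, extAngle i ∈ Ioo (0 : ℝ) 2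
  extAngle_spec : ∀ i, HasCornerAngle D.G (τ i 1) ((2 - extAngle i) * Real.pi)

end

theorem holoSqrt {G : Set ℂ} (hG : IsOpen G) (hs : SimplyConnectedSpace G) {g : ℂ → ℂ}
    (hg : DifferentiableOn ℂ g G) (h0 : ∀ z ∈ G, g z ≠ 0) :
    ∃ f : ℂ → ℂ, DifferentiableOn ℂ f G ∧ ∀ z, f z ^ 2 = g z := by
  obtain ⟨f, hf, hf2⟩ := exists_continuousOn_pow_eq (n := 2) (U := G) (by
    exact hs) hG hg.continuousOn (by rintro ⟨z, hz, h⟩; exact h0 z hz h) two_ne_zero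
  refine ⟨f, fun z hz => ?_, hf2⟩
  have hz0 : f z ≠ 0 := fun h => h0 z hz (by rw [← hf2, h]; simp)
  have hfc : ContinuousAt f z := hf.continuousAt (hG.mem_nhds hz)
  have hgd : HasDerivAt g (deriv g z) z := (hg.differentiableAt (hG.mem_nhds hz)).hasDerivAt
  apply HasDerivAt.differentiableAt (f' := deriv g z / (2 * f z)) _ |>.differentiableWithinAt
  rw [hasDerivAt_iff_tendsto_slope] at hgd ⊢
  have hh : Tendsto (fun w => slope g z w / (f w + f z)) (nhdsWithin z {z}ᶜ)
      (nhds (deriv g z / (2 * f z))) := by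
    refine hgd.div ?_ (by simpa using hz0)
    have := (hfc.tendsto.mono_left (nhdsWithin_le_nhds (s := {z}ᶜ))).add_const (f z)
    simpa [two_mul] using this
  refine hh.congr' ?_
  have hne : ∀ᶠ w in nhdsWithin z {z}ᶜ, f w + f z ≠ 0 := by
    have : ContinuousAt (fun w => f w + f z) z := hfc.add continuousAt_const
    exact (this.eventually_ne (by simpa [← two_mul] using hz0)).filter_mono nhdsWithin_le_nhds
  filter_upwards [hne, self_mem_nhdsWithin] with w hw hwz
  have : w - z ≠ 0 := sub_ne_zero.2 hwz
  simp only [slope_def_field, ← hf2]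
  field_simp
  ring

theorem inj_deriv_ne {U : Set ℂ} (hU : IsOpen U) {f : ℂ → ℂ} (hf : DifferentiableOn ℂ f U)
    (hi : InjOn f U) {a : ℂ} (ha : a ∈ U) : deriv f a ≠ 0 := by
  have han : AnalyticAt ℂ f a := hf.analyticAt (hU.mem_nhds ha)
  have han2 : AnalyticAt ℂ (fun z => f z - f a) a := han.sub analyticAt_const
  have hnz : ¬ ∀ᶠ z in nhds a, f z - f a = 0 := by
    intro h
    have h2 : ∀ᶠ z in nhdsWithin a {a}ᶜ, f z - f a = 0 ∧ z ∈ U ∧ z ≠ a := by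
      filter_upwards [h.filter_mono nhdsWithin_le_nhds, (hU.mem_nhds ha : _) |> mem_nhdsWithin_of_mem_nhds, self_mem_nhdsWithin] with z h1 h2 h3 using ⟨h1, h2, h3⟩
    obtain ⟨z, h1, h2, h3⟩ := h2.exists
    exact h3 (hi h2 ha (sub_eq_zero.1 h1))
  obtain ⟨m, g, hg, hg0, hfg⟩ := han2.exists_eventuallyEq_pow_smul_nonzero_iff.2 hnz
  simp only [smul_eq_mul] at hfg
  intro hd
  have hm0 : m ≠ 0 := by
    rintro rfl
    have := hfg.self_of_nhds
    simp at this; exact hg0 this.symm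
  have hm1 : m ≠ 1 := by
    rintro rfl
    have h1 : HasDerivAt (fun z => f z - f a) (deriv f a) a := han.differentiableAt.hasDerivAt.sub_const _
    have h2 : HasDerivAt (fun z => (z - a) ^ 1 * g z) (g a) a := by
      have := ((hasDerivAt_id a).sub_const a).fun_mul hg.differentiableAt.hasDerivAt
      simpa using this
    have := (h1.congr_of_eventuallyEq (EventuallyEq.symm hfg)).unique h2
    exact hg0 (this ▸ hd)
  obtain ⟨c, hc⟩ := IsAlgClosed.exists_pow_nat_eq (g a) (Nat.pos_of_ne_zero hm0)
  have hc0 : c ≠ 0 := by rintro rfl; rw [zero_pow hm0] at hc; exact hg0 hc.symm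
  set k : ℂ → ℂ := fun z => (z - a) * (c * (g z / g a) ^ ((1 : ℂ) / m)) with hk
  have hga : AnalyticAt ℂ (fun z => g z / g a) a := hg.div_const
  have hpa : AnalyticAt ℂ (fun z => c * (g z / g a) ^ ((1 : ℂ) / m)) a :=
    analyticAt_const.mul (hga.cpow analyticAt_const (by simp [hg0]))
  have hka : AnalyticAt ℂ k a := (analyticAt_id.sub analyticAt_const).mul hpa
  have hkd : HasDerivAt k c a := by
    have := ((hasDerivAt_id a).sub_const a).fun_mul hpa.differentiableAt.hasDerivAt
    simpa [hk, hg0] using this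
  have hks : HasStrictDerivAt k c a := by
    have := hka.hasStrictDerivAt; rwa [hkd.deriv] at this
  have hkm : ∀ᶠ z in nhds a, f z - f a = k z ^ m := by
    filter_upwards [hfg] with z hz
    rw [hz, hk]; simp only [mul_pow, hc]
    rw [← Complex.cpow_nat_mul]
    have : (m : ℂ) ≠ 0 := Nat.cast_ne_zero.2 hm0
    rw [mul_one_div_cancel this, Complex.cpow_one, mul_div_cancel₀ _ hg0]
  have hmap := hks.map_nhds_eq hc0
  have hka0 : k a = 0 := by simp [hk]
  rw [hka0] at hmap
  have hS : k '' {z | z ∈ U ∧ f z - f a = k z ^ m} ∈ nhds (0 : ℂ) := by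
    rw [← hmap]; exact image_mem_map ((hU.mem_nhds ha : _) |> fun h => inter_mem h hkm)
  obtain ⟨ε, hε, hεS⟩ := Metric.mem_nhds_iff.1 hS
  set w : ℂ := Complex.exp (2 * Real.pi * I / m)
  have hw := Complex.isPrimitiveRoot_exp m hm0
  have hwn : ‖w‖ = 1 := hw.norm'_eq_one hm0
  have e1 : ((ε / 2 : ℝ) : ℂ) ∈ ball (0 : ℂ) ε := by
    simp only [mem_ball, dist_zero_right, Complex.norm_real, Real.norm_eq_abs]; rw [abs_of_pos (by linarith)]; linarith
  have e2 : w * ((ε / 2 : ℝ) : ℂ) ∈ ball (0 : ℂ) ε := by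
    simpa [hwn] using e1
  obtain ⟨z1, ⟨h1, h1'⟩, h1k⟩ := hεS e1
  obtain ⟨z2, ⟨h2, h2'⟩, h2k⟩ := hεS e2
  have : f z1 = f z2 := by
    have : f z1 - f a = f z2 - f a := by
      rw [h1', h2', h1k, h2k, mul_pow, hw.pow_eq_one, one_mul]
    simpa using this
  have h12 := hi h1 h2 this
  rw [← h12, h1k] at h2k
  have hε2 : ((ε / 2 : ℝ) : ℂ) ≠ 0 := by exact_mod_cast (by linarith : ε / 2 ≠ 0)
  have : w = 1 := (mul_right_cancel₀ hε2 (by rw [one_mul]; exact h2k.symm))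
  exact hw.ne_one (by omega) this

theorem hurwitz_inj {G : Set ℂ} (hG : IsOpen G) (hc : IsPreconnected G) {ι : Type*} {l : Filter ι} [l.NeBot]
    {F : ι → ℂ → ℂ} {f : ℂ → ℂ} (hF : ∀ i, DifferentiableOn ℂ (F i) G) (hi : ∀ i, InjOn (F i) G)
    (ht : TendstoLocallyUniformlyOn F f l G) {z₀ : ℂ} (hz : z₀ ∈ G) (hd : deriv f z₀ ≠ 0) : InjOn f G := by
  have hf : DifferentiableOn ℂ f G := ht.differentiableOn (Eventually.of_forall hF) hG
  intro a ha b hb hab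
  by_contra hne
  have hfa : AnalyticOnNhd ℂ f G := hf.analyticOnNhd hG
  have hev : ∀ᶠ z in nhdsWithin b {b}ᶜ, f z ≠ f a := by
    rcases (hfa b hb).eventually_eq_or_eventually_ne (analyticAt_const (v := f a)) with h | h
    · exfalso
      have := hfa.eqOn_of_preconnected_of_eventuallyEq (analyticOnNhd_const) hc hb h
      apply hd
      have h2 : f =ᶠ[nhds z₀] fun _ => f a := by
        filter_upwards [hG.mem_nhds hz] with z hz using this hz
      rw [h2.deriv_eq]; simp
    · exact h
  rw [eventually_nhdsWithin_iff] at hev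
  have hU : G ∩ {a}ᶜ ∈ nhds b := inter_mem (hG.mem_nhds hb) (isOpen_compl_singleton.mem_nhds (Ne.symm hne))
  obtain ⟨r, hr, hrs⟩ := Metric.nhds_basis_closedBall.mem_iff.1 (inter_mem hev hU)
  have hsph : sphere b r ⊆ closedBall b r := sphere_subset_closedBall
  have hcont : ContinuousOn (fun z => ‖f z - f a‖) (sphere b r) :=
    ((hf.continuousOn.mono fun z hz => (hrs (hsph hz)).2.1).sub continuousOn_const).norm
  obtain ⟨x, hx, hxm⟩ := (isCompact_sphere b r).exists_isMinOn (NormedSpace.sphere_nonempty.2 hr.le) hcont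
  set m := ‖f x - f a‖
  have hm : 0 < m := by
    refine norm_pos_iff.2 (sub_ne_zero.2 ((hrs (hsph hx)).1 ?_))
    rintro rfl; simp at hx; exact hr.ne hx
  have hK : IsCompact (closedBall b r ∪ {a}) := (isCompact_closedBall b r).union isCompact_singleton
  have hKG : closedBall b r ∪ {a} ⊆ G := union_subset (fun z hz => (hrs hz).2.1) (by simpa using ha)
  have hu := (tendstoLocallyUniformlyOn_iff_forall_isCompact hG).1 ht _ hKG hK
  rw [Metric.tendstoUniformlyOn_iff] at hu
  obtain ⟨i, hi'⟩ := (hu (m / 8) (by linarith)).exists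
  have hbd : ∀ z ∈ closedBall b r, ‖(F i z - F i a) - (f z - f a)‖ < m / 4 := by
    intro z hz
    have h1 := hi' z (Or.inl hz)
    have h2 := hi' a (Or.inr rfl)
    rw [dist_eq_norm] at h1 h2
    calc _ = ‖-(f z - F i z) + (f a - F i a)‖ := by ring_nf
      _ ≤ _ := norm_add_le _ _
      _ < _ := by rw [norm_neg]; linarith
  have hne0 : ∀ z ∈ closedBall b r, F i z - F i a ≠ 0 := fun z hz h =>
    (hrs hz).2.2 (hi i (hrs hz).2.1 ha (sub_eq_zero.1 h))
  have hdiff : DiffContOnCl ℂ (fun z => (F i z - F i a)⁻¹) (ball b r) := by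
    refine DifferentiableOn.diffContOnCl ?_
    rw [closure_ball _ hr.ne']
    exact (((hF i).mono fun z hz => (hrs hz).2.1).sub_const _).inv hne0
  have hmax := Complex.norm_le_of_forall_mem_frontier_norm_le (isBounded_ball) hdiff (C := 2 / m) (by
    intro z hz
    rw [frontier_ball _ hr.ne'] at hz
    have h1 := hbd z (hsph hz)
    have h2 : m ≤ ‖f z - f a‖ := hxm hz
    have h3 : m / 2 ≤ ‖F i z - F i a‖ := by
      have := norm_sub_norm_le (f z - f a) ((f z - f a) - (F i z - F i a))
      rw [sub_sub_cancel, norm_sub_rev (f z - f a)] at this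
      linarith
    rw [norm_inv, inv_le_comm₀ (by linarith) (by positivity), inv_div]; exact h3)
    (subset_closure (mem_ball_self hr))
  have h1 := hbd b (mem_closedBall_self hr.le)
  rw [hab, sub_self, sub_zero] at h1
  rw [norm_inv, inv_le_comm₀ (norm_pos_iff.2 (hne0 b (mem_closedBall_self hr.le))) (by positivity), inv_div] at hmax
  linarith

/-- Mobius map -/
noncomputable def mob (a w : ℂ) : ℂ := (w - a) / (1 - (starRingEnd ℂ) a * w)

theorem mob_den {a w : ℂ} (ha : ‖a‖ < 1) (hw : ‖w‖ < 1) : 1 - (starRingEnd ℂ) a * w ≠ 0 := by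
  intro h
  have : ‖(starRingEnd ℂ) a * w‖ = 1 := by rw [← sub_eq_zero.1 h]; simp
  rw [norm_mul, RCLike.norm_conj] at this
  nlinarith [norm_nonneg a, norm_nonneg w]

theorem mob_id (a w : ℂ) : ‖1 - (starRingEnd ℂ) a * w‖ ^ 2 - ‖w - a‖ ^ 2 = (1 - ‖a‖ ^ 2) * (1 - ‖w‖ ^ 2) := by
  simp only [← Complex.normSq_eq_norm_sq, Complex.normSq_apply]
  simp; ring

theorem mob_maps {a w : ℂ} (ha : ‖a‖ < 1) (hw : ‖w‖ < 1) : ‖mob a w‖ < 1 := by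
  rw [mob, norm_div, div_lt_one (norm_pos_iff.2 (mob_den ha hw))]
  have := mob_id a w
  have h1 : 0 < 1 - ‖a‖ ^ 2 := by nlinarith [norm_nonneg a]
  have h2 : 0 < 1 - ‖w‖ ^ 2 := by nlinarith [norm_nonneg w]
  have := mul_pos h1 h2
  exact lt_of_pow_lt_pow_left₀ 2 (norm_nonneg _) (by linarith)

theorem mob_inj {a w v : ℂ} (ha : ‖a‖ < 1) (hw : ‖w‖ < 1) (hv : ‖v‖ < 1) (h : mob a w = mob a v) : w = v := by
  have h1 := mob_den ha hw
  have h2 := mob_den ha hv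
  rw [mob, mob, div_eq_div_iff h1 h2] at h
  have h3 : (w - v) * (1 - (starRingEnd ℂ) a * a) = 0 := by linear_combination h
  rcases mul_eq_zero.1 h3 with h | h
  · exact sub_eq_zero.1 h
  · exact absurd h (mob_den ha ha)

theorem mob_deriv {a w : ℂ} (ha : ‖a‖ < 1) (hw : ‖w‖ < 1) :
    HasDerivAt (mob a) ((1 - (starRingEnd ℂ) a * a) / (1 - (starRingEnd ℂ) a * w) ^ 2) w := by
  have h1 := mob_den ha hw
  have := ((hasDerivAt_id w).sub_const a).fun_div (((hasDerivAt_id w).const_mul ((starRingEnd ℂ) a)).const_sub 1) h1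
  refine HasDerivAt.congr_deriv (f := mob a) this ?_
  simp only [id]; ring

theorem normal_ultra {G : Set ℂ} (hG : IsOpen G) {F : ℕ → ℂ → ℂ} (hF : ∀ i, DifferentiableOn ℂ (F i) G)
    (hb : ∀ i, ∀ z ∈ G, ‖F i z‖ ≤ 1) :
    ∃ f : ℂ → ℂ, TendstoLocallyUniformlyOn F f (hyperfilter ℕ : Filter ℕ) G := by
  have hlim : ∀ z ∈ G, ∃ y, Tendsto (fun i => F i z) (hyperfilter ℕ) (nhds y) := by
    intro z hz
    obtain ⟨y, -, hy⟩ := (isCompact_closedBall (0 : ℂ) 1).ultrafilter_le_nhds ((hyperfilter ℕ).map fun i => F i z)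
      (by simp only [le_principal_iff]; exact Ultrafilter.mem_map.2 (Filter.univ_mem' fun i => by simpa using hb i z hz))
    exact ⟨y, hy⟩
  choose! f hf using hlim
  refine ⟨f, ?_⟩
  rw [Metric.tendstoLocallyUniformlyOn_iff]
  intro ε hε x hx
  obtain ⟨r, hr, hrG⟩ := Metric.isOpen_iff.1 hG x hx
  have hL : ∀ i, ∀ y ∈ ball x (r / 2), ‖F i y - F i x‖ ≤ 4 / r * ‖y - x‖ := by
    intro i y hy
    have := (convex_ball x (r / 2)).norm_image_sub_le_of_norm_deriv_le (f := F i) (C := 4 / r) (x := x) (y := y)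
      (fun z hz => (hF i).differentiableAt (hG.mem_nhds (hrG (ball_subset_ball (by linarith) hz)))) ?_
      (mem_ball_self (by linarith)) hy
    · exact this
    · intro z hz
      have hsub : closedBall z (r / 4) ⊆ G := fun w hw => hrG (by
        simp only [mem_ball, mem_closedBall] at *
        linarith [dist_triangle w z x])
      have := Complex.norm_deriv_le_of_forall_mem_sphere_norm_le (c := z) (R := r / 4) (C := 1) (by linarith)
        (((hF i).mono (by rw [closure_ball _ (by linarith)]; exact hsub)).diffContOnCl)
        (fun w hw => hb i w (hsub (sphere_subset_closedBall hw)))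
      calc _ ≤ _ := this
        _ = _ := by field_simp
  have hfL : ∀ y ∈ ball x (r / 2), ‖f y - f x‖ ≤ 4 / r * ‖y - x‖ := fun y hy =>
    le_of_tendsto (((hf y (hrG (ball_subset_ball (by linarith) hy))).sub (hf x hx)).norm)
      (Eventually.of_forall fun i => hL i y hy)
  refine ⟨ball x (min (r / 2) (ε * r / 16)), mem_nhdsWithin_of_mem_nhds (ball_mem_nhds _ (by positivity)), ?_⟩
  have hx' := Metric.tendsto_nhds.1 (hf x hx) (ε / 4) (by linarith)
  filter_upwards [hx'] with i hi y hy
  simp only [mem_ball, lt_min_iff] at hy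
  have h1 := hL i y hy.1
  have h2 := hfL y hy.1
  have h3 : 4 / r * ‖y - x‖ ≤ ε / 4 := by
    rw [← dist_eq_norm]
    calc 4 / r * dist y x ≤ 4 / r * (ε * r / 16) := by gcongr; exact hy.2.le
      _ = ε / 4 := by field_simp; norm_num
  rw [dist_eq_norm] at hi ⊢
  calc ‖f y - F i y‖ = ‖(f y - f x) - (F i y - F i x) - (F i x - f x)‖ := by ring_nf
    _ ≤ ‖f y - f x‖ + ‖F i y - F i x‖ + ‖F i x - f x‖ := (norm_sub_le _ _).trans (by gcongr; exact norm_sub_le _ _)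
    _ < ε := by linarith

theorem rmt {G : Set ℂ} (hG : IsOpen G) (hs : SimplyConnectedSpace G) (hb : Bornology.IsBounded G)
    (hc : IsPreconnected G) {z₀ : ℂ} (hz : z₀ ∈ G) :
    ∃ φ : ℂ → ℂ, DifferentiableOn ℂ φ G ∧ BijOn φ G (ball 0 1) := by
  set A : Set (ℂ → ℂ) := {f | DifferentiableOn ℂ f G ∧ (∀ z ∈ G, ‖f z‖ < 1) ∧ InjOn f G ∧ f z₀ = 0} with hA
  set S : Set ℝ := (fun f => ‖deriv f z₀‖) '' A with hS
  obtain ⟨r, hr, hrG⟩ := Metric.isOpen_iff.1 hG z₀ hz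
  have hbdd : BddAbove S := by
    refine ⟨1 / r, ?_⟩
    rintro _ ⟨f, ⟨h1, h2, h3, h4⟩, rfl⟩
    refine Complex.norm_deriv_le_div_of_mapsTo_ball (h1.mono hrG) (fun z hz' => ?_) hr
    simpa [h4] using (h2 z (hrG hz')).le
  obtain ⟨R, hR⟩ := hb.subset_ball z₀
  have hR0 : 0 < R := by simpa using hR hz
  have hg0 : (fun z => (z - z₀) / (R : ℂ)) ∈ A := by
    refine ⟨by fun_prop, fun z hz' => ?_, fun z _ w _ h => ?_, by simp⟩
    · have := hR hz'
      rw [mem_ball, dist_eq_norm] at this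
      rw [norm_div, Complex.norm_real, Real.norm_eq_abs, abs_of_pos hR0, div_lt_one hR0]; exact this
    · have hRc : (R : ℂ) ≠ 0 := by exact_mod_cast hR0.ne'
      simpa [hRc, div_left_inj' hRc] using h
  have hpos : 0 < sSup S := by
    refine lt_of_lt_of_le ?_ (le_csSup hbdd ⟨_, hg0, rfl⟩)
    have : deriv (fun z => (z - z₀) / (R : ℂ)) z₀ = 1 / (R : ℂ) := by
      simp
    simp only [this]; rw [norm_div, Complex.norm_real, Real.norm_eq_abs]; simp [hR0.ne']
  obtain ⟨u, -, hu, huS⟩ := exists_seq_tendsto_sSup (S := S) ⟨_, _, hg0, rfl⟩ hbdd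
  choose F hFA hFu using huS
  obtain ⟨f, hf⟩ := normal_ultra hG (F := F) (fun i => (hFA i).1) (fun i z hz => ((hFA i).2.1 z hz).le)
  have hfd : DifferentiableOn ℂ f G := hf.differentiableOn (Eventually.of_forall fun i => (hFA i).1) hG
  have hder := hf.deriv (Eventually.of_forall fun i => (hFA i).1) hG
  have hhy : (hyperfilter ℕ : Filter ℕ) ≤ atTop := Nat.hyperfilter_le_atTop
  have hdS : ‖deriv f z₀‖ = sSup S := by
    have h1 := (hder.tendsto_at hz).norm
    refine tendsto_nhds_unique (h1.congr fun i => ?_) (hu.mono_left hhy)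
    exact hFu i
  have hd0 : deriv f z₀ ≠ 0 := by rw [← norm_pos_iff, hdS]; exact hpos
  have hinj : InjOn f G := hurwitz_inj hG hc (fun i => (hFA i).1) (fun i => (hFA i).2.2.1) hf hz hd0
  have hf0 : f z₀ = 0 := tendsto_nhds_unique (hf.tendsto_at hz) (by simp [fun i => (hFA i).2.2.2])
  have hle : ∀ z ∈ G, ‖f z‖ ≤ 1 := fun z hz => le_of_tendsto (hf.tendsto_at hz).norm
    (Eventually.of_forall fun i => ((hFA i).2.1 z hz).le)
  have hlt : ∀ z ∈ G, ‖f z‖ < 1 := by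
    intro z hz'
    refine lt_of_le_of_ne (hle z hz') fun h => hd0 ?_
    have hm : IsMaxOn (norm ∘ f) G z := fun w hw => by simpa [h] using hle w hw
    have := Complex.eqOn_of_isPreconnected_of_isMaxOn_norm hc hG hfd hz' hm
    have h2 : f =ᶠ[nhds z₀] fun _ => f z := by
      filter_upwards [hG.mem_nhds hz] with w hw using this hw
    rw [h2.deriv_eq]; simp
  refine ⟨f, hfd, fun z hz => by simpa using hlt z hz, hinj, fun p hp => ?_⟩
  by_contra hpf
  have hp1 : ‖p‖ < 1 := by simpa using hp
  have hfp : ∀ z ∈ G, f z ≠ p := fun z hz h => hpf ⟨z, hz, h⟩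
  have hp0 : p ≠ 0 := fun h => hfp z₀ hz (by rw [hf0, h])
  have hgd : DifferentiableOn ℂ (fun z => mob p (f z)) G := fun z hz' =>
    ((mob_deriv hp1 (hlt z hz')).differentiableAt.comp z (hfd.differentiableAt (hG.mem_nhds hz'))).differentiableWithinAt
  obtain ⟨g, hg, hg2⟩ := holoSqrt hG hs hgd (fun z hz' h => by
    rcases div_eq_zero_iff.1 h with h | h
    · exact hfp z hz' (sub_eq_zero.1 h)
    · exact mob_den hp1 (hlt z hz') h)
  have hg1 : ∀ z ∈ G, ‖g z‖ < 1 := by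
    intro z hz'
    have := mob_maps hp1 (hlt z hz')
    rw [← hg2, norm_pow] at this
    by_contra h; push Not at h; nlinarith
  set c := g z₀ with hc'
  have hc2 : c ^ 2 = -p := by rw [hc', hg2, hf0]; simp [mob]
  have hc1 : ‖c‖ < 1 := hg1 z₀ hz
  have hc0 : 0 < ‖c‖ := by
    rw [norm_pos_iff]; rintro h; rw [h] at hc2; simp at hc2; exact hp0 hc2
  have hmem : (fun z => mob c (g z)) ∈ A := by
    refine ⟨fun z hz' => ((mob_deriv hc1 (hg1 z hz')).differentiableAt.comp z
      (hg.differentiableAt (hG.mem_nhds hz'))).differentiableWithinAt, fun z hz' => mob_maps hc1 (hg1 z hz'),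
      fun z hz' w hw h => ?_, by simp [mob, hc']⟩
    have := mob_inj hc1 (hg1 z hz') (hg1 w hw) h
    have h2 : mob p (f z) = mob p (f w) := by rw [← hg2, ← hg2, this]
    exact hinj hz' hw (mob_inj hp1 (hlt z hz') (hlt w hw) h2)
  have hfz : HasDerivAt f (deriv f z₀) z₀ := (hfd.differentiableAt (hG.mem_nhds hz)).hasDerivAt
  have hgz : HasDerivAt g (deriv g z₀) z₀ := (hg.differentiableAt (hG.mem_nhds hz)).hasDerivAt
  have e1 : (1 - (starRingEnd ℂ) p * p) * deriv f z₀ = 2 * c * deriv g z₀ := by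
    have h1 := (mob_deriv hp1 (hlt z₀ hz)).comp z₀ hfz
    have h2 : HasDerivAt (fun z => g z ^ 2) _ z₀ := hgz.pow 2
    have h3 : (fun z => g z ^ 2) = mob p ∘ f := by ext z; rw [hg2]; rfl
    rw [h3] at h2
    have := h1.unique h2
    rw [hf0] at this
    simpa [hc'] using this
  have e2 : HasDerivAt (fun z => mob c (g z)) ((1 - (starRingEnd ℂ) c * c) / (1 - (starRingEnd ℂ) c * c) ^ 2 * deriv g z₀) z₀ :=
    (mob_deriv hc1 (hg1 z₀ hz)).comp z₀ hgz
  have hle2 := le_csSup hbdd ⟨_, hmem, rfl⟩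
  simp only [e2.deriv] at hle2
  rw [← hdS] at hle2
  have hcc : (1 - (starRingEnd ℂ) c * c) = ((1 - ‖c‖ ^ 2 : ℝ) : ℂ) := by
    rw [mul_comm, Complex.mul_conj, Complex.normSq_eq_norm_sq]; push_cast; ring
  have hpp : (1 - (starRingEnd ℂ) p * p) = ((1 - ‖c‖ ^ 4 : ℝ) : ℂ) := by
    have : ‖p‖ = ‖c‖ ^ 2 := by rw [← norm_pow, hc2, norm_neg]
    rw [mul_comm, Complex.mul_conj, Complex.normSq_eq_norm_sq, this]; push_cast; ring
  have hk : 0 < 1 - ‖c‖ ^ 2 := by nlinarith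
  have hk4 : 0 < 1 - ‖c‖ ^ 4 := by nlinarith
  rw [hcc] at hle2
  rw [hpp] at e1
  have e1' := congrArg norm e1
  simp only [norm_mul, norm_div, norm_pow, Complex.norm_real, Real.norm_eq_abs, abs_of_pos hk, abs_of_pos hk4, Complex.norm_two] at e1' hle2
  have hdp : 0 < ‖deriv f z₀‖ := norm_pos_iff.2 hd0
  rw [show (1 - ‖c‖ ^ 2) / (1 - ‖c‖ ^ 2) ^ 2 * ‖deriv g z₀‖ = ‖deriv g z₀‖ / (1 - ‖c‖ ^ 2) by field_simp, div_le_iff₀ hk] at hle2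
  have e3 : (1 - ‖c‖ ^ 4) * ‖deriv f z₀‖ ≤ 2 * ‖c‖ * (‖deriv f z₀‖ * (1 - ‖c‖ ^ 2)) := by
    rw [e1']; gcongr
  have e4 : (1 - ‖c‖ ^ 2) * (1 - ‖c‖) ^ 2 * ‖deriv f z₀‖ ≤ 0 := by nlinarith
  have : 0 < (1 - ‖c‖ ^ 2) * (1 - ‖c‖) ^ 2 * ‖deriv f z₀‖ := by
    have : 0 < 1 - ‖c‖ := by linarith
    positivity
  linarith

theorem conf_compact {G : Set ℂ} (hG : IsOpen G) {φ : ℂ → ℂ} (hφ : DifferentiableOn ℂ φ G)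
    (hb : BijOn φ G (ball 0 1)) {r : ℝ} (hr : r < 1) : IsCompact {z | z ∈ G ∧ ‖φ z‖ ≤ r} := by
  have hcont : ContinuousOn (Function.invFunOn φ G) (ball 0 1) := by
    intro w hw
    obtain ⟨z, hz, rfl⟩ := hb.surjOn hw
    have hinv : Function.invFunOn φ G (φ z) = z := hb.injOn.leftInvOn_invFunOn hz
    refine ContinuousAt.continuousWithinAt ?_
    rw [ContinuousAt, hinv]
    have hst : HasStrictDerivAt φ (deriv φ z) z := (hφ.analyticAt (hG.mem_nhds hz)).hasStrictDerivAt
    have hmap := hst.map_nhds_eq (inj_deriv_ne hG hφ hb.injOn hz)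
    rw [← hmap, tendsto_map'_iff]
    refine tendsto_id.congr' ?_
    filter_upwards [hG.mem_nhds hz] with y hy
    exact (hb.injOn.leftInvOn_invFunOn hy).symm
  have : {z | z ∈ G ∧ ‖φ z‖ ≤ r} = Function.invFunOn φ G '' (closedBall 0 r) := by
    ext z; constructor
    · rintro ⟨h1, h2⟩
      exact ⟨φ z, by simpa using h2, hb.injOn.leftInvOn_invFunOn h1⟩
    · rintro ⟨w, hw, rfl⟩
      have hw' : w ∈ ball (0 : ℂ) 1 := closedBall_subset_ball hr hw
      refine ⟨Function.invFunOn_mem (hb.surjOn hw'), ?_⟩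
      rw [Function.invFunOn_eq (hb.surjOn hw')]; simpa using hw
  rw [this]
  exact (isCompact_closedBall _ _).image_of_continuousOn (hcont.mono (closedBall_subset_ball hr))

/-- analytic arc -/
structure IsArc (σ : ℂ → ℂ) (V : Set ℂ) : Prop where
  op : IsOpen V
  seg : ∀ x ∈ Icc (0:ℝ) 1, (x : ℂ) ∈ V
  diff : DifferentiableOn ℂ σ V
  inj : InjOn σ V

theorem IsArc.comp {σ V} (h : IsArc σ V) {p q : ℝ} (hp : p ∈ Icc (0:ℝ) 1) (hq : q ∈ Icc (0:ℝ) 1) (hpq : p ≠ q) :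
    IsArc (fun ζ => σ (p + (q - p) * ζ)) ((fun ζ : ℂ => (p + (q - p) * ζ : ℂ)) ⁻¹' V) where
  op := h.op.preimage (by fun_prop)
  seg x hx := by
    have := h.seg (p + (q - p) * x) (by
      constructor <;> nlinarith [hp.1, hp.2, hq.1, hq.2, hx.1, hx.2, mul_nonneg hq.1 hx.1, mul_nonneg hp.1 (sub_nonneg.2 hx.2), mul_nonneg (sub_nonneg.2 hq.2) hx.1, mul_nonneg (sub_nonneg.2 hp.2) (sub_nonneg.2 hx.2)])
    simpa using this
  diff := h.diff.comp (by fun_prop) (fun z hz => hz)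
  inj := fun z hz w hw hzw => by
    have := h.inj hz hw hzw
    have hne : (q - p : ℂ) ≠ 0 := sub_ne_zero.2 (by exact_mod_cast hpq.symm)
    simpa [hne] using this

theorem IsArc.deriv_ne {σ V} (h : IsArc σ V) {z : ℂ} (hz : z ∈ V) : deriv σ z ≠ 0 := inj_deriv_ne h.op h.diff h.inj hz

theorem IsArc.hasDeriv {σ V} (h : IsArc σ V) {z : ℂ} (hz : z ∈ V) : HasDerivAt σ (deriv σ z) z :=
  (h.diff.differentiableAt (h.op.mem_nhds hz)).hasDerivAt

theorem IsArc.contR {σ V} (h : IsArc σ V) : ContinuousOn (fun x : ℝ => σ x) (Icc 0 1) :=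
  h.diff.continuousOn.comp (by fun_prop) (fun x hx => h.seg x hx)

theorem IsArc.injR {σ V} (h : IsArc σ V) : InjOn (fun x : ℝ => σ x) (Icc 0 1) := fun x hx y hy hxy => by
  exact_mod_cast h.inj (h.seg x hx) (h.seg y hy) hxy

theorem IsArc.contDeriv {σ V} (h : IsArc σ V) : ContinuousOn (deriv σ) V := (h.diff.deriv h.op).continuousOn

theorem IsArc.hasDerivR {σ V} (h : IsArc σ V) {x : ℝ} (hx : x ∈ Icc (0:ℝ) 1) :
    HasDerivAt (fun x : ℝ => σ x) (deriv σ x) x := (h.hasDeriv (h.seg x hx)).comp_ofReal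

section gam
variable (D : JordanDomain)

theorem gam_range : range D.γ = frontier D.G := by
  rw [← D.γ_boundary]
  refine Subset.antisymm ?_ (image_subset_range _ _)
  rintro _ ⟨u, rfl⟩
  refine ⟨toIcoMod D.l_pos 0 u, by simpa using toIcoMod_mem_Ico D.l_pos 0 u, ?_⟩
  rw [toIcoMod]; exact D.γ_periodic.sub_zsmul_eq _

theorem gam_inj (a : ℝ) : InjOn D.γ (Ico a (a + D.l)) := by
  intro s hs t ht h
  have key : ∀ u, D.γ (toIcoMod D.l_pos 0 u) = D.γ u := fun u => by
    rw [toIcoMod]; exact D.γ_periodic.sub_zsmul_eq _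
  have hm : ∀ u, toIcoMod D.l_pos 0 u ∈ Ico 0 D.l := fun u => by
    simpa using toIcoMod_mem_Ico D.l_pos 0 u
  have h1 : toIcoMod D.l_pos 0 s = toIcoMod D.l_pos 0 t :=
    D.γ_injOn (hm s) (hm t) (by rw [key, key, h])
  have h2 := (toIcoMod_eq_self D.l_pos).2 hs
  have h3 := (toIcoMod_eq_self D.l_pos).2 ht
  rw [← h2, ← h3, toIcoMod_inj]
  exact (toIcoMod_inj D.l_pos).1 h1

theorem gam_compact : IsCompact (frontier D.G) := by
  have : D.γ '' Icc 0 (D.l) = frontier D.G := by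
    refine Subset.antisymm ?_ ?_
    · rw [← gam_range]; exact image_subset_range _ _
    · rw [← D.γ_boundary]; exact image_mono Ico_subset_Icc_self
  rw [← this]; exact isCompact_Icc.image D.γ_cont

end gam

/-- Reparametrization of a subarc of γ -/
theorem arc_reparam (D : JordanDomain) {σ V} (hσ : IsArc σ V) {a b : ℝ} (hab : a < b) (hbl : b < a + D.l)
    (hmem : ∀ x ∈ Icc (0:ℝ) 1, σ x ∈ D.γ '' Icc a b) (h0 : σ 0 = D.γ a) (h1 : σ 1 = D.γ b) :
    ∃ h : ℝ → ℝ, ContinuousOn h (Icc 0 1) ∧ StrictMonoOn h (Icc 0 1) ∧ h 0 = a ∧ h 1 = b ∧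
      (∀ x ∈ Icc (0:ℝ) 1, σ x = D.γ (h x)) ∧ (∀ x ∈ Icc (0:ℝ) 1, h x ∈ Icc a b) := by
  have hinj : InjOn D.γ (Icc a b) := (gam_inj D a).mono (Icc_subset_Ico_right hbl)
  have hemb : Topology.IsClosedEmbedding (fun x : Icc a b => D.γ x) :=
    Continuous.isClosedEmbedding (D.γ_cont.comp continuous_subtype_val) (fun x y hxy => Subtype.ext (hinj x.2 y.2 hxy))
  choose! h hh1 hh2 using hmem
  have hcont : ContinuousOn h (Icc 0 1) := by
    rw [continuousOn_iff_continuous_domRestrict]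
    have : Continuous (fun x : Icc (0:ℝ) 1 => (⟨h x, hh1 x x.2⟩ : Icc a b)) := by
      rw [hemb.isEmbedding.continuous_iff]
      refine (continuousOn_iff_continuous_domRestrict.1 hσ.contR).congr fun x => ?_
      simp [hh2 x x.2]
    exact continuous_subtype_val.comp this
  have m0 : (0:ℝ) ∈ Icc (0:ℝ) 1 := by simp
  have m1 : (1:ℝ) ∈ Icc (0:ℝ) 1 := by simp
  have e0 : h 0 = a := hinj (hh1 0 m0) ⟨le_rfl, hab.le⟩ (by rw [hh2 0 m0, ← h0]; simp)
  have e1 : h 1 = b := hinj (hh1 1 m1) ⟨hab.le, le_rfl⟩ (by rw [hh2 1 m1, ← h1]; simp)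
  refine ⟨h, hcont, ?_, e0, e1, fun x hx => (hh2 x hx).symm, hh1⟩
  refine hcont.strictMonoOn_of_injOn_Icc zero_le_one (by rw [e0, e1]; exact hab.le) ?_
  intro x hx y hy hxy
  exact hσ.injR hx hy (by simp only; rw [← hh2 x hx, ← hh2 y hy, hxy])

theorem arc_h_var (D : JordanDomain) {σ V} (hσ : IsArc σ V) {a b : ℝ} (hbl : b < a + D.l) {h : ℝ → ℝ}
    (hc : ContinuousOn h (Icc 0 1)) (hm : StrictMonoOn h (Icc 0 1)) (hg : ∀ x ∈ Icc (0:ℝ) 1, σ x = D.γ (h x))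
    (hi : ∀ x ∈ Icc (0:ℝ) 1, h x ∈ Icc a b) {x y : ℝ} (hx : 0 ≤ x) (hxy : x ≤ y) (hy : y ≤ 1) :
    ‖σ y - σ x‖ ≤ h y - h x ∧ ∀ K : NNReal, (∀ u ∈ Icc x y, ‖deriv σ (u:ℂ)‖ ≤ K) → h y - h x ≤ K * (y - x) := by
  have hsub : Icc x y ⊆ Icc 0 1 := Icc_subset_Icc hx hy
  have hxm : x ∈ Icc x y := ⟨le_rfl, hxy⟩
  have hym : y ∈ Icc x y := ⟨hxy, le_rfl⟩
  have hle : h x ≤ h y := hm.monotoneOn (hsub hxm) (hsub hym) hxy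
  have himg : h '' Icc x y = Icc (h x) (h y) := by
    refine Subset.antisymm ?_ (intermediate_value_Icc hxy (hc.mono hsub))
    rintro _ ⟨u, hu, rfl⟩
    exact ⟨hm.monotoneOn (hsub hxm) (hsub hu) hu.1, hm.monotoneOn (hsub hu) (hsub hym) hu.2⟩
  have hvar : eVariationOn (fun u : ℝ => σ u) (Icc x y) = ENNReal.ofReal (h y - h x) := by
    rw [← D.γ_unitSpeed _ _ hle (by linarith [(hi x (hsub hxm)).1, (hi y (hsub hym)).2]), ← himg,
      ← eVariationOn.comp_eq_of_monotoneOn D.γ h (hm.monotoneOn.mono hsub)]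
    exact eVariationOn.eq_of_eqOn fun u hu => hg u (hsub hu)
  constructor
  · have := eVariationOn.edist_le (fun u : ℝ => σ u) hym hxm
    rw [hvar, edist_dist, ENNReal.ofReal_le_ofReal_iff (by linarith), dist_eq_norm] at this
    exact this
  · intro K hK
    have hL : LipschitzOnWith K (fun u : ℝ => σ u) (Icc x y) := by
      refine Convex.lipschitzOnWith_of_nnnorm_hasDerivWithin_le (s := Icc x y) (f := fun u : ℝ => σ u)
        (f' := fun u : ℝ => deriv σ (u:ℂ)) (convex_Icc x y) (fun u hu => (hσ.hasDerivR (hsub hu)).hasDerivWithinAt) (fun u hu => ?_)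
      exact_mod_cast hK u hu
    have := hL.comp_eVariationOn_le (g := id) (s := Icc x y) (fun u hu => hu)
    have hid : eVariationOn (id : ℝ → ℝ) (Icc x y) ≤ ENNReal.ofReal (y - x) := by
      have := (monotone_id.monotoneOn (Icc x y)).eVariationOn_eq hxm hym
      simpa using this.le
    have h3 : ENNReal.ofReal (h y - h x) ≤ ENNReal.ofReal (K * (y - x)) := by
      rw [← hvar, ENNReal.ofReal_mul K.coe_nonneg, ENNReal.ofReal_coe_nnreal]
      exact this.trans (by gcongr)
    rwa [ENNReal.ofReal_le_ofReal_iff (mul_nonneg K.coe_nonneg (by linarith))] at h3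

theorem arc_h_deriv (D : JordanDomain) {σ V} (hσ : IsArc σ V) {a b : ℝ} (hbl : b < a + D.l) {h : ℝ → ℝ}
    (hc : ContinuousOn h (Icc 0 1)) (hm : StrictMonoOn h (Icc 0 1)) (hg : ∀ x ∈ Icc (0:ℝ) 1, σ x = D.γ (h x))
    (hi : ∀ x ∈ Icc (0:ℝ) 1, h x ∈ Icc a b) {x : ℝ} (hx : x ∈ Ioo (0:ℝ) 1) :
    HasDerivWithinAt h ‖deriv σ x‖ (Ioi x) x := by
  have hxI := Ioo_subset_Icc_self hx
  rw [hasDerivWithinAt_iff_tendsto_slope' (by simp)]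
  have hs : Tendsto (fun y => ‖slope (fun u : ℝ => σ u) x y‖) (nhdsWithin x (Ioi x)) (nhds ‖deriv σ x‖) := by
    have := (hσ.hasDerivR hxI).hasDerivWithinAt (s := Ioi x)
    rw [hasDerivWithinAt_iff_tendsto_slope' (by simp)] at this
    exact this.norm
  rw [tendsto_order]
  have hIoo : ∀ᶠ y in nhdsWithin x (Ioi x), y ∈ Ioo x 1 := Ioo_mem_nhdsGT hx.2
  constructor
  · intro c hcl
    filter_upwards [(tendsto_order.1 hs).1 c hcl, hIoo] with y hy hy1
    refine hy.trans_le ?_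
    have := (arc_h_var D hσ hbl hc hm hg hi hx.1.le hy1.1.le hy1.2.le).1
    have hp : 0 < y - x := by linarith [hy1.1]
    rw [slope_def_field, slope_def_module, norm_smul, norm_inv, Real.norm_eq_abs, abs_of_pos hp, div_eq_inv_mul]
    gcongr
  · intro c hcl
    obtain ⟨K, hK1, hK2⟩ := exists_between hcl
    have hcd : ContinuousWithinAt (fun u : ℝ => ‖deriv σ (u:ℂ)‖) (Icc 0 1) x :=
      ((hσ.contDeriv.comp (by fun_prop) (fun u hu => hσ.seg u hu)).norm) x hxI
    have h2 : ∀ᶠ u in nhds x, ‖deriv σ ((u:ℝ):ℂ)‖ < K := by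
      have := hcd.continuousAt (Icc_mem_nhds hx.1 hx.2)
      exact this.eventually_lt_const hK1
    obtain ⟨ε, hε, hε2⟩ := Metric.eventually_nhds_iff.1 h2
    filter_upwards [hIoo, Ioo_mem_nhdsGT (show x < x + ε by linarith)] with y hy1 hy2
    have hp : 0 < y - x := by linarith [hy1.1]
    have hK0 : 0 ≤ K := (norm_nonneg _).trans hK1.le
    have := (arc_h_var D hσ hbl hc hm hg hi hx.1.le hy1.1.le hy1.2.le).2 ⟨K, hK0⟩ (fun u hu => by
      refine (hε2 ?_).le
      rw [Real.dist_eq, abs_of_nonneg (by linarith [hu.1])]; linarith [hu.2, hy2.2])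
    refine lt_of_le_of_lt ?_ hK2
    rw [slope_def_field, div_le_iff₀ hp]; exact this

theorem arc_integral (D : JordanDomain) {σ V} (hσ : IsArc σ V) {a b : ℝ} (hab : a < b) (hbl : b < a + D.l)
    (hmem : ∀ x ∈ Icc (0:ℝ) 1, σ x ∈ D.γ '' Icc a b) (h0 : σ 0 = D.γ a) (h1 : σ 1 = D.γ b) {f : ℂ → ℂ}
    (hf : ContinuousOn f (frontier D.G)) :
    ∫ s in a..b, f (D.γ s) = ∫ x in (0:ℝ)..1, (‖deriv σ x‖ : ℂ) * f (σ x) := by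
  obtain ⟨h, hc, hm, e0, e1, hg, hi⟩ := arc_reparam D hσ hab hbl hmem h0 h1
  have hfc : Continuous (fun s => f (D.γ s)) := hf.comp_continuous D.γ_cont fun s => by
    rw [← gam_range]; exact mem_range_self s
  have := intervalIntegral.integral_deriv_smul_comp'' (f := h) (f' := fun x => ‖deriv σ (x:ℂ)‖) (a := 0) (b := 1)
    (g := fun s => f (D.γ s)) (by rw [uIcc_of_le zero_le_one]; exact hc)
    (fun x hx => arc_h_deriv D hσ hbl hc hm hg hi (by simpa using hx))
    (by rw [uIcc_of_le zero_le_one]; exact (hσ.contDeriv.comp (by fun_prop) (fun u hu => hσ.seg u hu)).norm) hfc.continuousOn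
  rw [e0, e1] at this
  rw [← this]
  refine intervalIntegral.integral_congr fun x hx => ?_
  rw [uIcc_of_le zero_le_one] at hx
  simp [hg x hx, Function.comp]

/-- junction set -/
def Jset {D : JordanDomain} (B : PiecewiseAnalyticBoundary D) : Set ℂ := range (fun i => B.τ i 1)

theorem tau_arc {D : JordanDomain} (B : PiecewiseAnalyticBoundary D) (i) : IsArc (B.τ i) (B.U i) where
  op := B.U_open i
  seg x hx := B.seg_sub i ⟨x, hx, rfl⟩
  diff := B.analytic i
  inj := B.inj i

theorem tau_mem {D : JordanDomain} (B : PiecewiseAnalyticBoundary D) (i) {x : ℝ} (hx : x ∈ Icc (0:ℝ) 1) :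
    B.τ i x ∈ frontier D.G := by
  rw [← B.cover]; exact mem_iUnion.2 ⟨i, x, ⟨x, hx, rfl⟩, rfl⟩

theorem Jset_one {D : JordanDomain} (B : PiecewiseAnalyticBoundary D) (i) : B.τ i 1 ∈ Jset B := ⟨i, rfl⟩

theorem Jset_zero {D : JordanDomain} (B : PiecewiseAnalyticBoundary D) (i) : B.τ i 0 ∈ Jset B := by
  refine ⟨⟨(i.val + B.m - 1) % B.m, Nat.mod_lt _ B.m_pos⟩, ?_⟩
  simp only
  rw [B.junction]
  congr 2
  have hm := B.m_pos
  have hi := i.2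
  simp only [Nat.mod_add_mod]
  rw [Nat.sub_add_cancel (by omega), Nat.add_mod_right, Nat.mod_eq_of_lt hi]

theorem Jset_fin {D : JordanDomain} (B : PiecewiseAnalyticBoundary D) : (Jset B).Finite := finite_range _

theorem Jset_sub {D : JordanDomain} (B : PiecewiseAnalyticBoundary D) : Jset B ⊆ frontier D.G := by
  rintro _ ⟨i, rfl⟩
  simpa using tau_mem B i (x := 1) (by simp)

theorem piece_arc {D : JordanDomain} (B : PiecewiseAnalyticBoundary D) {a b : ℝ} (hab : a < b) (hbl : b < a + D.l)
    (ha : D.γ a ∈ Jset B) (hb : D.γ b ∈ Jset B) (hno : ∀ s ∈ Ioo a b, D.γ s ∉ Jset B) :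
    ∃ σ V, IsArc σ V ∧ σ 0 = D.γ a ∧ σ 1 = D.γ b ∧ ∀ x ∈ Icc (0:ℝ) 1, σ x ∈ D.γ '' Icc a b := by
  have hmid : (a + b) / 2 ∈ Ioo a b := ⟨by linarith, by linarith⟩
  have h1 : D.γ ((a + b) / 2) ∈ frontier D.G := by rw [← gam_range]; exact mem_range_self _
  rw [← B.cover] at h1
  obtain ⟨i, _, ⟨x, hx, rfl⟩, hxe⟩ := mem_iUnion.1 h1
  have hA := tau_arc B i
  set X : Set ℝ := {y | y ∈ Icc (0:ℝ) 1 ∧ B.τ i y ∈ Jset B} with hX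
  have hXc : IsClosed X := hA.contR.preimage_isClosed_of_isClosed isClosed_Icc (Jset_fin B).isClosed
  have h0X : (0:ℝ) ∈ X := ⟨by simp, by simpa using Jset_zero B i⟩
  have h1X : (1:ℝ) ∈ X := ⟨by simp, by simpa using Jset_one B i⟩
  have hxX : x ∉ X := fun h => hno _ hmid (by rw [← hxe]; exact h.2)
  obtain ⟨p, ⟨hpX, hpx⟩, hpmax⟩ := ((isCompact_Icc (a := (0:ℝ)) (b := x)).inter_left hXc).exists_isGreatest ⟨0, h0X, by simp, hx.1⟩
  obtain ⟨q, ⟨hqX, hqx⟩, hqmin⟩ := ((isCompact_Icc (a := x) (b := (1:ℝ))).inter_left hXc).exists_isLeast ⟨1, h1X, hx.2, by simp⟩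
  have hpx' : p < x := lt_of_le_of_ne hpx.2 (fun h => hxX (h ▸ hpX))
  have hqx' : x < q := lt_of_le_of_ne hqx.1 (fun h => hxX (h ▸ hqX))
  have hpq01 : Icc p q ⊆ Icc 0 1 := Icc_subset_Icc hpX.1.1 hqX.1.2
  have hfree : ∀ y ∈ Ioo p q, B.τ i y ∉ Jset B := by
    intro y hy hJ
    have hyX : y ∈ X := ⟨hpq01 (Ioo_subset_Icc_self hy), hJ⟩
    rcases le_total y x with h | h
    · exact absurd (hpmax ⟨hyX, hyX.1.1, h⟩) (not_le.2 hy.1)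
    · exact absurd (hqmin ⟨hyX, h, hyX.1.2⟩) (not_le.2 hy.2)
  -- closed pieces
  set K1 := D.γ '' Icc a b
  set K2 := D.γ '' Icc b (a + D.l)
  have hK1 : IsClosed K1 := (isCompact_Icc.image D.γ_cont).isClosed
  have hK2 : IsClosed K2 := (isCompact_Icc.image D.γ_cont).isClosed
  have hU : frontier D.G ⊆ K1 ∪ K2 := by
    rw [← gam_range]
    rintro _ ⟨s, rfl⟩
    have hm := toIcoMod_mem_Ico D.l_pos a s
    have he : D.γ (toIcoMod D.l_pos a s) = D.γ s := by
      rw [toIcoMod]; exact D.γ_periodic.sub_zsmul_eq _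
    rcases le_total (toIcoMod D.l_pos a s) b with h | h
    · exact Or.inl ⟨_, ⟨hm.1, h⟩, he⟩
    · exact Or.inr ⟨_, ⟨h, hm.2.le⟩, he⟩
  have hI : ∀ w ∈ K1, w ∈ Jset B → w = D.γ a ∨ w = D.γ b := by
    rintro _ ⟨s, hs, rfl⟩ hJ
    rcases eq_or_lt_of_le hs.1 with h | h
    · left; rw [h]
    rcases eq_or_lt_of_le hs.2 with h' | h'
    · right; rw [h']
    exact absurd hJ (hno s ⟨h, h'⟩)
  have hI2 : ∀ w ∈ K1, w ∈ K2 → w ∈ Jset B := by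
    rintro _ ⟨s, hs, rfl⟩ ⟨s', hs', h⟩
    rcases eq_or_lt_of_le hs'.2 with h1 | h1
    · rw [← h, h1, D.γ_periodic]; exact ha
    · have := gam_inj D a ⟨hab.le.trans hs'.1, h1⟩ ⟨hs.1, hs.2.trans_lt hbl⟩ h
      have : s' = b := le_antisymm (this ▸ hs.2) hs'.1
      rw [← h, this]; exact hb
  have hsub : ∀ y ∈ Ioo p q, B.τ i y ∈ K1 := by
    by_contra hcon
    push Not at hcon
    obtain ⟨y, hy, hyK⟩ := hcon
    have hpc : IsPreconnected ((fun y : ℝ => B.τ i y) '' Ioo p q) :=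
      isPreconnected_Ioo.image _ (hA.contR.mono (Ioo_subset_Icc_self.trans hpq01))
    have hs : (fun y : ℝ => B.τ i y) '' Ioo p q ⊆ K1 ∪ K2 := by
      rintro _ ⟨y, hy, rfl⟩
      exact hU (tau_mem B i (hpq01 (Ioo_subset_Icc_self hy)))
    obtain ⟨_, ⟨u, hu, rfl⟩, hu1, hu2⟩ := isPreconnected_closed_iff.1 hpc K1 K2 hK1 hK2 hs
      ⟨_, ⟨x, ⟨hpx', hqx'⟩, rfl⟩, ⟨_, Ioo_subset_Icc_self hmid, hxe.symm⟩⟩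
      ⟨_, ⟨y, hy, rfl⟩, (hs ⟨y, hy, rfl⟩).resolve_left hyK⟩
    exact hfree u hu (hI2 _ hu1 hu2)
  have hsub2 : ∀ y ∈ Icc p q, B.τ i y ∈ K1 := by
    have hcl : closure (Ioo p q) = Icc p q := closure_Ioo (by linarith)
    have := (hA.contR.mono hpq01).mono hcl.le |>.image_closure
    intro y hy
    have h2 : B.τ i y ∈ closure ((fun y : ℝ => B.τ i y) '' Ioo p q) := this ⟨y, by rw [hcl]; exact hy, rfl⟩
    refine closure_minimal ?_ hK1 h2
    rintro _ ⟨y, hy, rfl⟩; exact hsub y hy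
  have hpm : p ∈ Icc p q := ⟨le_rfl, by linarith⟩
  have hqm : q ∈ Icc p q := ⟨by linarith, le_rfl⟩
  have hne : B.τ i p ≠ B.τ i q := fun h => by
    have := hA.injR (hpq01 hpm) (hpq01 hqm) h
    linarith
  have key : ∀ p' ∈ Icc p q, ∀ q' ∈ Icc p q, p' ≠ q' → B.τ i p' = D.γ a → B.τ i q' = D.γ b →
      ∃ σ V, IsArc σ V ∧ σ 0 = D.γ a ∧ σ 1 = D.γ b ∧ ∀ x ∈ Icc (0:ℝ) 1, σ x ∈ D.γ '' Icc a b := by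
    intro p' hp' q' hq' hne' e1 e2
    refine ⟨_, _, hA.comp (hpq01 hp') (hpq01 hq') hne', by simpa using e1, by simpa using e2, ?_⟩
    intro y hy
    have := hsub2 (p' + (q' - p') * y) (by
      have := (convex_Icc p q).lineMap_mem hp' hq' hy
      rw [AffineMap.lineMap_apply_module'] at this
      simp only [smul_eq_mul] at this
      convert this using 1; ring)
    push_cast at this
    exact this
  rcases hI _ (hsub2 p hpm) hpX.2 with h3 | h3 <;> rcases hI _ (hsub2 q hqm) hqX.2 with h4 | h4
  · exact absurd (h3.trans h4.symm) hne
  · exact key p hpm q hqm (by linarith [hpx', hqx'] |> fun (h : p < q) => h.ne) h3 h4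
  · exact key q hqm p hpm (by linarith [hpx', hqx'] |> fun (h : p < q) => h.ne') h4 h3
  · exact absurd (h3.trans h4.symm) hne

theorem pieces {D : JordanDomain} (B : PiecewiseAnalyticBoundary D) : ∃ (N : ℕ) (t : ℕ → ℝ), 2 ≤ N ∧
    (∀ k < N, t k < t (k+1)) ∧ t N = t 0 + D.l ∧ (∀ k ≤ N, D.γ (t k) ∈ Jset B) ∧
    (∀ k < N, t (k+1) < t k + D.l) ∧ (∀ k < N, ∀ s ∈ Ioo (t k) (t (k+1)), D.γ s ∉ Jset B) := by
  have hm := B.m_pos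
  set i0 : Fin B.m := ⟨0, hm⟩
  have hJ0 := Jset_zero B i0
  have hJ1 := Jset_one B i0
  have hne : B.τ i0 0 ≠ B.τ i0 1 := fun h => by
    have := (tau_arc B i0).injR (x₁ := 0) (by simp) (x₂ := 1) (by simp) (by simpa using h)
    norm_num at this
  have hr : ∀ w ∈ Jset B, ∀ a, ∃ s ∈ Ico a (a + D.l), D.γ s = w := by
    intro w hw a
    have h := Jset_sub B hw
    rw [← gam_range] at h
    obtain ⟨u, rfl⟩ := h
    exact ⟨toIcoMod D.l_pos a u, toIcoMod_mem_Ico D.l_pos a u, by rw [toIcoMod]; exact D.γ_periodic.sub_zsmul_eq _⟩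
  obtain ⟨a, -, ha⟩ := hr _ hJ0 0
  obtain ⟨b, hb, hb1⟩ := hr _ hJ1 a
  have hab : a ≠ b := fun h => hne (by rw [← ha, ← hb1, h])
  set T : Set ℝ := {s | s ∈ Icc a (a + D.l) ∧ D.γ s ∈ Jset B} with hT
  have hTf : T.Finite := by
    have : T ⊆ ({s | s ∈ Ico a (a + D.l) ∧ D.γ s ∈ Jset B}) ∪ {a + D.l} := by
      rintro s ⟨h1, h2⟩
      rcases eq_or_lt_of_le h1.2 with h | h
      · right; exact h
      · left; exact ⟨⟨h1.1, h⟩, h2⟩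
    refine Finite.subset (Finite.union ?_ (finite_singleton _)) this
    refine Finite.of_injOn (f := D.γ) (t := Jset B) (fun s hs => hs.2) ((gam_inj D a).mono fun s hs => hs.1) (Jset_fin B)
  have hl := D.l_pos
  set S := hTf.toFinset
  have hS : ∀ s, s ∈ S ↔ s ∈ T := fun s => hTf.mem_toFinset
  have haT : a ∈ T := ⟨⟨le_rfl, by linarith⟩, by rw [ha]; exact hJ0⟩
  have hlT : a + D.l ∈ T := ⟨⟨by linarith, le_rfl⟩, by rw [D.γ_periodic, ha]; exact hJ0⟩
  have hbT : b ∈ T := ⟨⟨hb.1, hb.2.le⟩, by rw [hb1]; exact hJ1⟩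
  have hcard : 3 ≤ S.card := by
    have : ({a, b, a + D.l} : Finset ℝ) ⊆ S := by
      intro s hs
      simp only [Finset.mem_insert, Finset.mem_singleton] at hs
      rw [hS]
      rcases hs with rfl | rfl | rfl <;> assumption
    refine le_trans (le_of_eq ?_) (Finset.card_le_card this)
    rw [Finset.card_eq_three.2 ⟨a, b, a + D.l, hab, by linarith, hb.2.ne, rfl⟩]
  obtain ⟨N, hN⟩ : ∃ N, S.card = N + 1 := ⟨S.card - 1, by omega⟩
  set f := S.orderEmbOfFin hN
  have hfm : ∀ k, f k ∈ T := fun k => (hS _).1 (S.orderEmbOfFin_mem hN k)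
  have hfs : ∀ s ∈ T, ∃ k, f k = s := fun s hs => by
    have := S.range_orderEmbOfFin hN
    have h2 : s ∈ range f := by rw [this]; exact (hS s).2 hs
    exact h2
  let t : ℕ → ℝ := fun k => f ⟨min k N, by omega⟩
  have ht : ∀ k, ∀ hk : k ≤ N, t k = f ⟨k, by omega⟩ := fun k hk => by simp only [t]; congr 2; omega
  have hmono : ∀ j k, j < k → k ≤ N → t j < t k := fun j k hjk hk => by
    rw [ht j (by omega), ht k hk]
    exact f.strictMono (by simpa using hjk)
  have ht0 : t 0 = a := by
    obtain ⟨⟨k, hk⟩, hk2⟩ := hfs a haT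
    rw [ht 0 (by omega)]
    refine le_antisymm ?_ (hfm _).1.1
    exact (f.monotone (Fin.mk_le_mk.2 (Nat.zero_le _))).trans hk2.le
  have htN : t N = a + D.l := by
    obtain ⟨⟨k, hk⟩, hk2⟩ := hfs _ hlT
    rw [ht N le_rfl]
    refine le_antisymm (hfm _).1.2 ?_
    exact hk2.ge.trans (f.monotone (Fin.mk_le_mk.2 (by omega)))
  have htT : ∀ k, t k ∈ T := fun k => hfm _
  refine ⟨N, t, by omega, fun k hk => hmono _ _ (by omega) (by omega), by rw [ht0, htN], fun k hk => (htT k).2, ?_, ?_⟩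
  · intro k hk
    rcases Nat.eq_zero_or_pos k with rfl | hk0
    · rw [ht0, ← htN]; exact hmono _ _ (by omega) le_rfl
    · have h1 := hmono 0 k hk0 hk.le
      have h2 := (htT (k+1)).1.2
      rw [ht0] at h1; linarith
  · intro k hk s hs hJ
    have hsT : s ∈ T := ⟨⟨(htT k).1.1.trans hs.1.le, hs.2.le.trans (htT (k+1)).1.2⟩, hJ⟩
    obtain ⟨⟨j, hj⟩, hj2⟩ := hfs s hsT
    rw [ht k hk.le, ht (k+1) hk, ← hj2] at hs
    have h1 := f.lt_iff_lt.1 hs.1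
    have h2 := f.lt_iff_lt.1 hs.2
    simp only [Fin.mk_lt_mk] at h1 h2
    omega

/-- curved sector -/
def Sec (w0 e : ℂ) (h C r : ℝ) : Set ℂ :=
  {w | ∃ ρ θ : ℝ, 0 < ρ ∧ ρ < r ∧ |θ| < h - C * ρ ∧ w = w0 + e * (ρ * exp (θ * I))}

theorem Sec_mono {w0 e : ℂ} {h C r C' r' : ℝ} (hC : C ≤ C') (hr : r' ≤ r) : Sec w0 e h C' r' ⊆ Sec w0 e h C r := by
  rintro w ⟨ρ, θ, h1, h2, h3, h4⟩
  exact ⟨ρ, θ, h1, h2.trans_le hr, h3.trans_le (by nlinarith), h4⟩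

theorem Sec_preconn (w0 e : ℂ) (h C r : ℝ) : IsPreconnected (Sec w0 e h C r) := by
  have hc : Convex ℝ {p : ℝ × ℝ | 0 < p.1 ∧ p.1 < r ∧ |p.2| < h - C * p.1} := by
    intro p hp q hq a b ha hb hab
    simp only [mem_ofPred_eq, Prod.fst_add, Prod.smul_fst, Prod.snd_add, Prod.smul_snd, smul_eq_mul, abs_lt] at *
    have hb' : b = 1 - a := by linarith
    rcases eq_or_lt_of_le ha with h0 | h0
    · subst h0; simp at hab; subst hab; simpa using hq
    obtain ⟨h1, h2, h3, h4⟩ := hp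
    obtain ⟨g1, g2, g3, g4⟩ := hq
    subst hb'
    refine ⟨by nlinarith [mul_pos h0 h1, mul_nonneg hb g1.le], ?_, ?_, ?_⟩
    · nlinarith [mul_pos h0 (sub_pos.2 h2), mul_nonneg hb (sub_pos.2 g2).le]
    · nlinarith [mul_pos h0 (sub_pos.2 h3), mul_nonneg hb (sub_pos.2 g3).le]
    · nlinarith [mul_pos h0 (sub_pos.2 h4), mul_nonneg hb (sub_pos.2 g4).le]
  have : Sec w0 e h C r = (fun p : ℝ × ℝ => w0 + e * (p.1 * exp (p.2 * I))) '' {p : ℝ × ℝ | 0 < p.1 ∧ p.1 < r ∧ |p.2| < h - C * p.1} := by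
    ext w; constructor
    · rintro ⟨ρ, θ, h1, h2, h3, h4⟩; exact ⟨(ρ, θ), ⟨h1, h2, h3⟩, h4.symm⟩
    · rintro ⟨⟨ρ, θ⟩, ⟨h1, h2, h3⟩, h4⟩; exact ⟨ρ, θ, h1, h2, h3, h4.symm⟩
  rw [this]
  exact hc.isPreconnected.image _ (by fun_prop)

theorem preconn_side {G s : Set ℂ} (hG : IsOpen G) (hs : IsPreconnected s) (hd : ∀ w ∈ s, w ∉ frontier G) :
    s ⊆ G ∨ s ⊆ (closure G)ᶜ := by
  refine hs.subset_or_subset hG isClosed_closure.isOpen_compl ?_ ?_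
  · rw [disjoint_compl_right_iff_subset]; exact subset_closure
  · intro w hw
    by_cases h : w ∈ closure G
    · left; by_contra h2; exact hd w hw ⟨h, by rwa [hG.interior_eq]⟩
    · right; exact h

theorem vol_window {G : Set ℂ} (hG : IsOpen G) (w0 : ℂ) (ρ θ0 : ℝ) :
    volume {θ : ℝ | θ ∈ Ico 0 (2 * Real.pi) ∧ w0 + (ρ : ℂ) * exp ((θ : ℂ) * I) ∈ G} =
    volume {s : ℝ | s ∈ Ioc (-Real.pi) Real.pi ∧ w0 + exp (θ0 * I) * (ρ * exp ((s : ℂ) * I)) ∈ G} := by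
  have hpi := Real.pi_pos
  set A : Set ℝ := {θ : ℝ | w0 + (ρ : ℂ) * exp ((θ : ℂ) * I) ∈ G} with hA
  have hAo : IsOpen A := hG.preimage (by fun_prop)
  have h2 : (0:ℝ) < 2 * Real.pi := by positivity
  have hinv : ∀ g : AddSubgroup.zmultiples (2 * Real.pi), (fun x : ℝ => g +ᵥ x) ⁻¹' A = A := by
    rintro ⟨_, n, rfl⟩
    ext x
    simp only [hA, mem_preimage, mem_ofPred_eq, AddSubgroup.vadd_def, vadd_eq_add]
    have : exp (((n • (2 * Real.pi) + x : ℝ) : ℂ) * I) = exp ((x:ℂ) * I) := by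
      rw [Complex.exp_eq_exp_iff_exists_int]
      refine ⟨n, ?_⟩
      push_cast; simp; ring
    rw [this]
  have e1 := (isAddFundamentalDomain_Ioc h2 0).measure_set_eq (isAddFundamentalDomain_Ioc h2 (θ0 - Real.pi)) hAo.measurableSet hinv
  have e2 : {θ : ℝ | θ ∈ Ico 0 (2 * Real.pi) ∧ w0 + (ρ : ℂ) * exp ((θ : ℂ) * I) ∈ G} =ᵐ[volume] (A ∩ Ioc 0 (0 + 2 * Real.pi) : Set ℝ) := by
    have h3 : {θ : ℝ | θ ∈ Ico 0 (2 * Real.pi) ∧ w0 + (ρ : ℂ) * exp ((θ : ℂ) * I) ∈ G} = A ∩ Ico 0 (2 * Real.pi) := by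
      ext x; simp [hA, and_comm]
    rw [h3, zero_add]
    exact (ae_eq_refl A).inter Ico_ae_eq_Ioc
  rw [measure_congr e2, e1]
  rw [← measure_preimage_add volume θ0]
  congr 1
  ext s
  simp only [hA, mem_preimage, mem_inter_iff, mem_ofPred_eq, mem_Ioc]
  have : exp (((θ0 + s : ℝ) : ℂ) * I) = exp (θ0 * I) * exp (s * I) := by rw [← exp_add]; push_cast; ring_nf
  rw [this]
  constructor
  · rintro ⟨h1, h3, h4⟩; exact ⟨⟨by linarith, by linarith⟩, by convert h1 using 2; ring⟩
  · rintro ⟨⟨h3, h4⟩, h1⟩; exact ⟨by convert h1 using 2; ring, by linarith, by linarith⟩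

/-- the directions outside of the sector -/
theorem Sec_dir {w0 e : ℂ} {h C r ρ s : ℝ} (hρ : 0 < ρ) (hρr : ρ < r) (hs : s ∈ Ioc (-Real.pi) Real.pi) (hsh : h + C * ρ < |s|) :
    w0 + e * (ρ * exp (s * I)) ∈ Sec w0 (-e) (Real.pi - h) C r := by
  rcases le_total 0 s with h0 | h0
  · refine ⟨ρ, s - Real.pi, hρ, hρr, ?_, ?_⟩
    · rw [abs_of_nonneg h0] at hsh
      rw [abs_of_nonpos (by linarith [hs.2])]; linarith
    · have : exp (((s - Real.pi : ℝ) : ℂ) * I) = - exp (s * I) := by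
        push_cast; rw [sub_mul, exp_sub, exp_pi_mul_I, div_neg, div_one]
      rw [this]; ring
  · refine ⟨ρ, s + Real.pi, hρ, hρr, ?_, ?_⟩
    · rw [abs_of_nonpos h0] at hsh
      rw [abs_of_nonneg (by linarith [hs.1])]; linarith
    · have : exp (((s + Real.pi : ℝ) : ℂ) * I) = - exp (s * I) := by
        push_cast; rw [add_mul, exp_add, exp_pi_mul_I, mul_neg, mul_one]
      rw [this]; ring

theorem angle_cases {G : Set ℂ} (hG : IsOpen G) {w0 e : ℂ} (he : ‖e‖ = 1) {h C r a : ℝ} (hr : 0 < r) (hC : 0 ≤ C) (h0 : 0 ≤ h) (hh : h ≤ Real.pi)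
    (hang : HasCornerAngle G w0 a) :
    (Sec w0 e h C r ⊆ G → Sec w0 (-e) (Real.pi - h) C r ⊆ (closure G)ᶜ → a = 2 * h) ∧
    (Sec w0 e h C r ⊆ G → Sec w0 (-e) (Real.pi - h) C r ⊆ G → 2 * Real.pi ≤ a) ∧
    (Sec w0 e h C r ⊆ (closure G)ᶜ → Sec w0 (-e) (Real.pi - h) C r ⊆ (closure G)ᶜ → a ≤ 0) := by
  have hpi := Real.pi_pos
  obtain ⟨θ0, rfl⟩ : ∃ θ0 : ℝ, exp (θ0 * I) = e := ⟨arg e, by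
    have := norm_mul_exp_arg_mul_I e; rwa [he, ofReal_one, one_mul] at this⟩
  set A : ℝ → Set ℝ := fun ρ => {s : ℝ | s ∈ Ioc (-Real.pi) Real.pi ∧ w0 + exp (θ0 * I) * (ρ * exp ((s : ℂ) * I)) ∈ G} with hA
  have hT : Tendsto (fun ρ => volume.real (A ρ)) (nhdsWithin 0 (Ioi 0)) (nhds a) := by
    refine hang.congr fun ρ => ?_
    rw [vol_window hG w0 ρ θ0]; rfl
  have hev : ∀ᶠ ρ : ℝ in nhdsWithin 0 (Ioi 0), ρ ∈ Ioo 0 r := Ioo_mem_nhdsGT hr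
  have hfin : ∀ ρ, volume (A ρ) ≠ ⊤ := fun ρ => measure_ne_top_of_subset (fun s hs => hs.1) (by simp)
  have hlim : ∀ b : ℝ, ∀ c : ℝ, Tendsto (fun ρ : ℝ => b + c * ρ) (nhdsWithin 0 (Ioi 0)) (nhds b) := by
    intro b c
    have : Tendsto (fun ρ : ℝ => b + c * ρ) (nhds 0) (nhds (b + c * 0)) := Continuous.tendsto (by fun_prop) 0
    rw [mul_zero, add_zero] at this
    exact this.mono_left nhdsWithin_le_nhds
  have hno : ∀ w, w ∈ (closure G)ᶜ → w ∉ G := fun w hw hw2 => hw (subset_closure hw2)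
  have upper : Sec w0 (-exp (θ0 * I)) (Real.pi - h) C r ⊆ (closure G)ᶜ → ∀ ρ ∈ Ioo 0 r, A ρ ⊆ Icc (-(h + C * ρ)) (h + C * ρ) := by
    intro hE ρ hρ s hs
    by_contra hcon
    rw [mem_Icc, ← abs_le, not_le] at hcon
    exact hno _ (hE (Sec_dir hρ.1 hρ.2 hs.1 hcon)) hs.2
  refine ⟨fun hG1 hE => ?_, fun hG1 hG2 => ?_, fun hE1 hE2 => ?_⟩
  · refine le_antisymm ?_ ?_
    · refine le_of_tendsto_of_tendsto hT (hlim (2 * h) (2 * C)) ?_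
      filter_upwards [hev] with ρ hρ
      refine (measureReal_mono (upper hE ρ hρ) (by simp)).trans ?_
      rw [Real.volume_real_Icc_of_le (by nlinarith [hρ.1])]; linarith
    · refine le_of_tendsto_of_tendsto (hlim (2 * h) (-(2 * C))) hT ?_
      filter_upwards [hev] with ρ hρ
      have : Ioo (-(h - C * ρ)) (h - C * ρ) ⊆ A ρ := by
        intro s hs
        have := mul_nonneg hC hρ.1.le
        refine ⟨⟨by linarith [hs.1], by linarith [hs.2]⟩, hG1 ⟨ρ, s, hρ.1, hρ.2, ?_, rfl⟩⟩
        rw [abs_lt]; constructor <;> linarith [hs.1, hs.2]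
      have := measureReal_mono this (hfin ρ)
      refine le_trans ?_ this
      rw [measureReal_def, Real.volume_Ioo]
      refine (le_max_left _ _).trans' ?_ |>.trans_eq ENNReal.toReal_ofReal'.symm
      linarith
  · refine le_of_tendsto_of_tendsto (hlim (2 * Real.pi) (-(4 * C))) hT ?_
    filter_upwards [hev] with ρ hρ
    have hsub : Ioc (-Real.pi) Real.pi ⊆ A ρ ∪ (Icc (-(h + C * ρ)) (-(h - C * ρ)) ∪ Icc (h - C * ρ) (h + C * ρ)) := by
      intro s hs
      by_cases h1 : |s| < h - C * ρ
      · left; exact ⟨hs, hG1 ⟨ρ, s, hρ.1, hρ.2, h1, rfl⟩⟩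
      by_cases h2 : h + C * ρ < |s|
      · left; exact ⟨hs, hG2 (Sec_dir hρ.1 hρ.2 hs h2)⟩
      right
      push Not at h1 h2
      rcases abs_cases s with h3 | h3
      · right; constructor <;> linarith
      · left; constructor <;> linarith
    have h1 := measureReal_mono hsub (measure_union_lt_top (hfin ρ).lt_top (measure_union_lt_top (by simp) (by simp))).ne
    have h2 := h1.trans ((measureReal_union_le _ _).trans (add_le_add_right (measureReal_union_le _ _) _))
    rw [Real.volume_real_Ioc_of_le (by linarith), Real.volume_real_Icc_of_le (by nlinarith [hρ.1]), Real.volume_real_Icc_of_le (by nlinarith [hρ.1])] at h2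
    linarith
  · refine le_of_tendsto_of_tendsto hT (hlim 0 (4 * C)) ?_
    filter_upwards [hev] with ρ hρ
    have hsub : A ρ ⊆ (Icc (-(h + C * ρ)) (-(h - C * ρ)) ∪ Icc (h - C * ρ) (h + C * ρ)) := by
      intro s hs
      have h2 := abs_le.2 (upper hE2 ρ hρ hs)
      have h1 : h - C * ρ ≤ |s| := by
        by_contra hcon
        push Not at hcon
        exact hno _ (hE1 ⟨ρ, s, hρ.1, hρ.2, hcon, rfl⟩) hs.2
      rcases abs_cases s with h3 | h3
      · right; constructor <;> linarith
      · left; constructor <;> linarith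
    have h1 := measureReal_mono (μ := volume) hsub (measure_union_lt_top measure_Icc_lt_top measure_Icc_lt_top).ne
    have h2 := h1.trans (measureReal_union_le _ _)
    rw [Real.volume_real_Icc_of_le (by nlinarith [hρ.1]), Real.volume_real_Icc_of_le (by nlinarith [hρ.1])] at h2
    linarith

theorem exp_I_eq {a b : ℝ} (h : exp (a * I) = exp (b * I)) : ∃ n : ℤ, a = b + n * (2 * Real.pi) := by
  obtain ⟨n, hn⟩ := Complex.exp_eq_exp_iff_exists_int.1 h
  refine ⟨n, ?_⟩
  have := congrArg Complex.im hn
  simpa using this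

theorem int_pi {n : ℤ} {x : ℝ} (h : x = n * (2 * Real.pi)) (h1 : -(2 * Real.pi) < x) (h2 : x < 2 * Real.pi) : x = 0 := by
  have hpi := Real.pi_pos
  have : (-1 : ℝ) < n := by by_contra hc; push Not at hc; nlinarith
  have h3 : (n : ℝ) < 1 := by by_contra hc; push Not at hc; nlinarith
  have h4 : -1 < n := by exact_mod_cast this
  have h5 : n < 1 := by exact_mod_cast h3
  have : n = 0 := by omega
  rw [h, this]; simp

theorem corner {G : Set ℂ} (hG : IsOpen G) {w0 t1 t2 : ℂ} (ht1 : ‖t1‖ = 1) (ht2 : ‖t2‖ = 1) {C r α : ℝ} (hC : 0 ≤ C) (hr : 0 < r)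
    (hL : ∀ w ∈ frontier G, 0 < ‖w - w0‖ → ‖w - w0‖ < r →
      ∃ θ : ℝ, |θ| ≤ C * ‖w - w0‖ ∧ (w = w0 + t1 * (‖w - w0‖ * exp (θ * I)) ∨ w = w0 + t2 * (‖w - w0‖ * exp (θ * I))))
    (hα : 0 < α) (hα2 : α < 2) (hang : HasCornerAngle G w0 (α * Real.pi)) :
    ∃ e : ℂ, ‖e‖ = 1 ∧ Sec w0 e (α * Real.pi / 2) C r ⊆ G ∧ Sec w0 (-e) (Real.pi - α * Real.pi / 2) C r ⊆ (closure G)ᶜ ∧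
      ((t1 = e * exp ((α * Real.pi / 2 : ℝ) * I) ∧ t2 = e * exp (-(α * Real.pi / 2 : ℝ) * I)) ∨
       (t1 = e * exp (-(α * Real.pi / 2 : ℝ) * I) ∧ t2 = e * exp ((α * Real.pi / 2 : ℝ) * I))) := by
  have hpi := Real.pi_pos
  have hex : ∃ (e : ℂ) (h : ℝ), ‖e‖ = 1 ∧ 0 ≤ h ∧ h ≤ Real.pi / 2 ∧
      ((t1 = e * exp (h * I) ∧ t2 = e * exp (-h * I)) ∨ (t1 = e * exp (-h * I) ∧ t2 = e * exp (h * I))) := by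
    have ht20 : t2 ≠ 0 := by rintro rfl; simp at ht2
    set h0 := arg (t1 / t2) / 2 with hh0
    have a1 := neg_pi_lt_arg (t1 / t2)
    have a2 := arg_le_pi (t1 / t2)
    have e1 : t1 = t2 * exp (h0 * I) * exp (h0 * I) := by
      have := norm_mul_exp_arg_mul_I (t1 / t2)
      rw [norm_div, ht1, ht2, div_one, ofReal_one, one_mul] at this
      rw [mul_assoc, ← exp_add, ← add_mul, hh0]
      push_cast
      rw [add_halves, this, mul_div_cancel₀ _ ht20]
    have e2 : t2 = t2 * exp (h0 * I) * exp (-h0 * I) := by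
      rw [mul_assoc, ← exp_add]; simp
    refine ⟨t2 * exp (h0 * I), |h0|, by rw [norm_mul, ht2, norm_exp_ofReal_mul_I, one_mul], abs_nonneg _, ?_, ?_⟩
    · rw [abs_le]; constructor <;> rw [hh0] <;> linarith
    · rcases abs_cases h0 with h | h <;> rw [h.1]
      · exact Or.inl ⟨e1, e2⟩
      · push_cast; rw [neg_neg]; exact Or.inr ⟨e1, e2⟩
  obtain ⟨e, h, he, h0, hh, h12⟩ := hex
  have he0 : e ≠ 0 := by rintro rfl; simp at he
  have hL' : ∀ ρ φ : ℝ, 0 < ρ → ρ < r → w0 + e * (ρ * exp (φ * I)) ∈ frontier G →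
      ∃ θ : ℝ, |θ| ≤ C * ρ ∧ ((∃ n : ℤ, φ = h + θ + n * (2 * Real.pi)) ∨ (∃ n : ℤ, φ = -h + θ + n * (2 * Real.pi))) := by
    intro ρ φ hρ hρr hw
    have hn : ‖w0 + e * (ρ * exp (φ * I)) - w0‖ = ρ := by
      rw [add_sub_cancel_left, norm_mul, he, norm_mul, norm_exp_ofReal_mul_I]; simp [abs_of_pos hρ]
    obtain ⟨θ, hθ, hor⟩ := hL _ hw (by rw [hn]; exact hρ) (by rw [hn]; exact hρr)
    rw [hn] at hθ hor
    refine ⟨θ, hθ, ?_⟩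
    have key : ∀ h' : ℝ, ∀ t, t = e * exp (h' * I) → w0 + e * (ρ * exp (φ * I)) = w0 + t * (ρ * exp (θ * I)) →
        ∃ n : ℤ, φ = h' + θ + n * (2 * Real.pi) := by
      intro h' t ht heq
      apply exp_I_eq
      have hρ0 : (ρ : ℂ) ≠ 0 := by exact_mod_cast hρ.ne'
      rw [ht] at heq
      have h3 := add_left_cancel heq
      push_cast
      rw [add_mul, exp_add]
      have h4 : (e * ρ) * exp (φ * I) = (e * ρ) * (exp (h' * I) * exp (θ * I)) := by linear_combination h3
      exact mul_left_cancel₀ (mul_ne_zero he0 hρ0) h4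
    rcases hor with hor | hor <;> rcases h12 with ⟨h1, h2⟩ | ⟨h1, h2⟩
    · left; exact key _ _ h1 hor
    · right; exact key _ _ (by push_cast; exact h1) hor
    · right; exact key _ _ (by push_cast; exact h2) hor
    · left; exact key _ _ h2 hor
  have s1 : Sec w0 e h C r ⊆ G ∨ Sec w0 e h C r ⊆ (closure G)ᶜ := by
    refine preconn_side hG (Sec_preconn _ _ _ _ _) ?_
    rintro w ⟨ρ, φ, hρ, hρr, hφ, rfl⟩ hw
    have hCρ := mul_nonneg hC hρ.le
    obtain ⟨θ, hθ, ⟨n, hn⟩ | ⟨n, hn⟩⟩ := hL' ρ φ hρ hρr hw <;> rw [abs_lt] at hφ <;> rw [abs_le] at hθ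
    · have := int_pi (n := n) (x := φ - h - θ) (by linarith) (by linarith) (by linarith)
      linarith
    · have := int_pi (n := n) (x := φ + h - θ) (by linarith) (by linarith) (by linarith)
      linarith
  have s2 : Sec w0 (-e) (Real.pi - h) C r ⊆ G ∨ Sec w0 (-e) (Real.pi - h) C r ⊆ (closure G)ᶜ := by
    refine preconn_side hG (Sec_preconn _ _ _ _ _) ?_
    rintro w ⟨ρ, φ, hρ, hρr, hφ, rfl⟩ hw
    have hCρ := mul_nonneg hC hρ.le
    have : w0 + -e * (ρ * exp (φ * I)) = w0 + e * (ρ * exp (((φ + Real.pi : ℝ) : ℂ) * I)) := by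
      push_cast; rw [add_mul, exp_add, exp_pi_mul_I]; ring
    rw [this] at hw
    obtain ⟨θ, hθ, ⟨n, hn⟩ | ⟨n, hn⟩⟩ := hL' ρ _ hρ hρr hw <;> rw [abs_lt] at hφ <;> rw [abs_le] at hθ
    · have := int_pi (n := n) (x := φ + Real.pi - h - θ) (by linarith) (by linarith) (by linarith)
      linarith
    · have := int_pi (n := n) (x := φ + Real.pi + h - θ) (by linarith) (by linarith) (by linarith)
      linarith
  obtain ⟨c1, c2, c3⟩ := angle_cases hG he hr hC h0 (by linarith) hang
  rcases s1 with s1 | s1 <;> rcases s2 with s2 | s2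
  · have := c2 s1 s2; nlinarith
  · have := c1 s1 s2
    have hh' : α * Real.pi / 2 = h := by linarith
    rw [hh']
    exact ⟨e, he, s1, s2, h12⟩
  · have s1' : Sec w0 (- -e) (Real.pi - (Real.pi - h)) C r ⊆ (closure G)ᶜ := by simpa using s1
    have := (angle_cases hG (e := -e) (by simpa using he) hr hC (h := Real.pi - h) (by linarith) (by linarith) hang).1 s2 s1'
    have hh' : α * Real.pi / 2 = Real.pi - h := by linarith
    rw [hh']
    have e1 : exp (((Real.pi - h : ℝ) : ℂ) * I) = - exp (-h * I) := by
      push_cast; rw [sub_mul, sub_eq_add_neg, exp_add, exp_pi_mul_I]; ring_nf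
    have e2 : exp (-((Real.pi - h : ℝ) : ℂ) * I) = - exp (h * I) := by
      have : (-((Real.pi - h : ℝ) : ℂ) * I) = h * I - Real.pi * I := by push_cast; ring
      rw [this, exp_sub, exp_pi_mul_I, div_neg, div_one]
    refine ⟨-e, by simpa using he, s2, s1', ?_⟩
    rw [e1, e2, neg_mul_neg, neg_mul_neg]
    exact h12.symm
  · have := c3 s1 s2; nlinarith

theorem IsArc.rev {σ V} (h : IsArc σ V) : IsArc (fun ζ => σ (1 - ζ)) ((fun ζ : ℂ => 1 - ζ) ⁻¹' V) where
  op := h.op.preimage (by fun_prop)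
  seg x hx := by
    have := h.seg (1 - x) ⟨by linarith [hx.2], by linarith [hx.1]⟩
    simpa using this
  diff := h.diff.comp (by fun_prop) (fun z hz => hz)
  inj := fun z hz w hw hzw => by simpa using h.inj hz hw hzw

/-- unit tangent at the starting point -/
noncomputable def tdir (σ : ℂ → ℂ) : ℂ := deriv σ 0 / ‖deriv σ 0‖

theorem IsArc.tdir_norm {σ V} (h : IsArc σ V) : ‖tdir σ‖ = 1 := by
  have := h.deriv_ne (by simpa using h.seg 0 (by simp))
  have h2 := norm_ne_zero_iff.2 this
  rw [tdir, norm_div, norm_real, norm_norm, div_self h2]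

theorem IsArc.quad {σ V} (h : IsArc σ V) : ∃ K ε : ℝ, 0 < K ∧ 0 < ε ∧ ∀ ζ : ℂ, ‖ζ‖ < ε →
    ζ ∈ V ∧ ‖σ ζ - σ 0 - deriv σ 0 * ζ‖ ≤ K * ‖ζ‖ ^ 2 := by
  have h0 : (0:ℂ) ∈ V := by simpa using h.seg 0 (by simp)
  have hV := h.op.mem_nhds h0
  have hd := ((Complex.differentiableOn_dslope hV).2 h.diff).differentiableAt hV
  obtain ⟨K, hK, hb⟩ := hd.isBigO_sub.exists_pos
  have := (hb.bound.and hV)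
  obtain ⟨ε, hε, hε2⟩ := Metric.eventually_nhds_iff.1 this
  refine ⟨K, ε, hK, hε, fun ζ hζ => ?_⟩
  obtain ⟨h1, h2⟩ := hε2 (y := ζ) (by simpa using hζ)
  refine ⟨h2, ?_⟩
  have e := sub_smul_dslope σ 0 ζ
  rw [sub_zero, smul_eq_mul] at e
  rw [← e, ← dslope_same σ 0, mul_comm _ ζ, ← mul_sub, norm_mul]
  rw [sub_zero] at h1
  nlinarith [norm_nonneg ζ]

theorem arg_small {v : ℂ} (h : ‖v - 1‖ ≤ 1/2) : |arg v| ≤ 3/2 * ‖v - 1‖ := by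
  have := Complex.norm_log_one_add_half_le_self h
  rw [add_sub_cancel] at this
  refine le_trans ?_ this
  rw [← log_im]; exact abs_im_le_norm _

theorem IsArc.germ {σ V} (h : IsArc σ V) : ∃ C ε : ℝ, 1 ≤ C ∧ 0 < ε ∧ ε ≤ 1 ∧ ∀ ζ : ℂ, ζ ≠ 0 → ‖ζ‖ < ε →
    ζ ∈ V ∧ ‖ζ‖ ≤ C * ‖σ ζ - σ 0‖ ∧ ‖σ ζ - σ 0‖ ≤ C * ‖ζ‖ ∧ ∃ δ : ℝ, |δ| ≤ C * ‖σ ζ - σ 0‖ ∧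
      σ ζ = σ 0 + tdir σ * (‖σ ζ - σ 0‖ * exp ((arg ζ + δ : ℝ) * I)) := by
  obtain ⟨K, ε, hK, hε, hq⟩ := h.quad
  have hd0 := h.deriv_ne (by simpa using h.seg 0 (by simp))
  set d := ‖deriv σ 0‖ with hd
  have hdp : 0 < d := norm_pos_iff.2 hd0
  refine ⟨max 1 (max (2 * d) (max (2 / d) (3 * K / d ^ 2))), min (min 1 ε) (d / (2 * K)), le_max_left _ _, by positivity,
    (min_le_left _ _).trans (min_le_left _ _), fun ζ h0 hζ => ?_⟩
  set C := max 1 (max (2 * d) (max (2 / d) (3 * K / d ^ 2)))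
  have c1 : 2 * d ≤ C := (le_max_left _ _).trans (le_max_right _ _)
  have c2 : 2 / d ≤ C := (le_max_left _ _).trans ((le_max_right _ _).trans (le_max_right _ _))
  have c3 : 3 * K / d ^ 2 ≤ C := (le_max_right _ _).trans ((le_max_right _ _).trans (le_max_right _ _))
  have hζ1 : ‖ζ‖ < ε := hζ.trans_le ((min_le_left _ _).trans (min_le_right _ _))
  have hζ2 : ‖ζ‖ < d / (2 * K) := hζ.trans_le (min_le_right _ _)
  obtain ⟨hV, hb⟩ := hq ζ hζ1
  have hn : 0 < ‖ζ‖ := norm_pos_iff.2 h0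
  set v := (σ ζ - σ 0) / (deriv σ 0 * ζ) with hv
  have hv1 : ‖v - 1‖ ≤ K / d * ‖ζ‖ := by
    have : v - 1 = (σ ζ - σ 0 - deriv σ 0 * ζ) / (deriv σ 0 * ζ) := by
      rw [hv, sub_div _ (deriv σ 0 * ζ), div_self (mul_ne_zero hd0 h0)]
    rw [this, norm_div, norm_mul, ← hd, div_le_iff₀ (by positivity)]
    refine hb.trans_eq ?_; field_simp
  have hv2 : K / d * ‖ζ‖ ≤ 1 / 2 := by
    rw [lt_div_iff₀ (by positivity)] at hζ2
    rw [div_mul_eq_mul_div, div_le_iff₀ hdp]; linarith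
  have hvn : 1 / 2 ≤ ‖v‖ ∧ ‖v‖ ≤ 3 / 2 := by
    have h1 : ‖v - 1‖ ≤ 1/2 := hv1.trans hv2
    have h2 := norm_sub_norm_le (1:ℂ) (1 - v)
    have h3 := norm_add_le (v - 1) 1
    rw [norm_sub_rev 1 v] at h2
    simp at h2 h3
    constructor <;> linarith
  have he : σ ζ - σ 0 = deriv σ 0 * ζ * v := by rw [hv, mul_div_cancel₀ _ (mul_ne_zero hd0 h0)]
  have hen : ‖σ ζ - σ 0‖ = d * ‖ζ‖ * ‖v‖ := by rw [he, norm_mul, norm_mul]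
  have hlow : d * ‖ζ‖ / 2 ≤ ‖σ ζ - σ 0‖ := by rw [hen]; nlinarith [mul_pos hdp hn]
  have hz : ‖ζ‖ ≤ 2 / d * ‖σ ζ - σ 0‖ := by
    rw [div_mul_eq_mul_div, le_div_iff₀ hdp]; linarith
  refine ⟨hV, hz.trans (by gcongr), ?_, arg v, ?_, ?_⟩
  · rw [hen]
    calc d * ‖ζ‖ * ‖v‖ ≤ d * ‖ζ‖ * 2 := by gcongr; linarith
      _ = (2 * d) * ‖ζ‖ := by ring
      _ ≤ _ := by gcongr
  · calc |arg v| ≤ 3/2 * ‖v - 1‖ := arg_small (hv1.trans hv2)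
      _ ≤ 3/2 * (K / d * (2 / d * ‖σ ζ - σ 0‖)) := by gcongr; exact hv1.trans (by gcongr)
      _ = (3 * K / d^2) * ‖σ ζ - σ 0‖ := by field_simp
      _ ≤ _ := by gcongr
  · have e1 := norm_mul_exp_arg_mul_I ζ
    have e2 := norm_mul_exp_arg_mul_I v
    have hdc : (d : ℂ) ≠ 0 := by exact_mod_cast hdp.ne'
    have e3 : tdir σ * d = deriv σ 0 := by rw [tdir, ← hd, div_mul_cancel₀ _ hdc]
    rw [hen]; push_cast
    rw [add_mul, exp_add]
    calc σ ζ = σ 0 + (σ ζ - σ 0) := by ring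
      _ = σ 0 + (tdir σ * d) * (‖ζ‖ * exp (arg ζ * I)) * (‖v‖ * exp (arg v * I)) := by rw [he, e1, e2, e3]
      _ = _ := by ring

/-- piece of the boundary curve -/
structure Pc (D : JordanDomain) (σ : ℂ → ℂ) (V : Set ℂ) (a b : ℝ) : Prop where
  arc : IsArc σ V
  lt : a < b
  bl : b < a + D.l
  s0 : σ 0 = D.γ a
  s1 : σ 1 = D.γ b
  mem : ∀ x ∈ Icc (0:ℝ) 1, σ x ∈ D.γ '' Icc a b

theorem Pc.shift {D σ V a b} (h : Pc D σ V a b) : Pc D σ V (a - D.l) (b - D.l) where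
  arc := h.arc
  lt := by linarith [h.lt]
  bl := by linarith [h.bl]
  s0 := by rw [h.s0, D.γ_periodic.sub_eq]
  s1 := by rw [h.s1, D.γ_periodic.sub_eq]
  mem x hx := by
    obtain ⟨s, hs, h2⟩ := h.mem x hx
    exact ⟨s - D.l, ⟨by linarith [hs.1], by linarith [hs.2]⟩, by rw [← h2, D.γ_periodic.sub_eq]⟩

theorem Pc.img {D σ V a b} (h : Pc D σ V a b) : D.γ '' Icc a b = (fun x : ℝ => σ x) '' Icc 0 1 := by
  obtain ⟨f, h1, h2, h3, h4, h5, h6⟩ := arc_reparam D h.arc h.lt h.bl h.mem h.s0 h.s1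
  refine Subset.antisymm ?_ ?_
  · rintro _ ⟨s, hs, rfl⟩
    rw [← h3, ← h4] at hs
    obtain ⟨x, hx, rfl⟩ := intermediate_value_Icc zero_le_one h1 hs
    exact ⟨x, hx, h5 x hx⟩
  · rintro _ ⟨x, hx, rfl⟩; exact h.mem x hx

theorem gam_window (D : JordanDomain) (a : ℝ) {w : ℂ} (hw : w ∈ frontier D.G) : ∃ s ∈ Ico a (a + D.l), D.γ s = w := by
  rw [← gam_range] at hw
  obtain ⟨u, rfl⟩ := hw
  exact ⟨toIcoMod D.l_pos a u, toIcoMod_mem_Ico D.l_pos a u, by rw [toIcoMod]; exact D.γ_periodic.sub_zsmul_eq _⟩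

/-- the rest of the curve -/
theorem Pc.rest {D σ V a b} (h : Pc D σ V a b) {x : ℝ} (hx : x ∈ Ioo (0:ℝ) 1) : σ x ∉ D.γ '' Icc b (a + D.l) := by
  rintro ⟨s', hs', h'⟩
  obtain ⟨s, hs, h2⟩ := h.mem x (Ioo_subset_Icc_self hx)
  have hm : (x : ℝ) ∈ Icc (0:ℝ) 1 := Ioo_subset_Icc_self hx
  have n0 : σ x ≠ σ 0 := fun hh => hx.1.ne' (h.arc.injR hm (x₂ := 0) (by simp) (by simpa using hh))
  have n1 : σ x ≠ σ 1 := fun hh => hx.2.ne (h.arc.injR hm (x₂ := 1) (by simp) (by simpa using hh))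
  rcases eq_or_lt_of_le hs'.2 with h1 | h1
  · rw [h1, D.γ_periodic, ← h.s0] at h'; exact n0 h'.symm
  · have := gam_inj D a ⟨h.lt.le.trans hs'.1, h1⟩ ⟨hs.1, hs.2.trans_lt h.bl⟩ (h'.trans h2.symm)
    have : s' = b := le_antisymm (this ▸ hs.2) hs'.1
    rw [this, ← h.s1] at h'; exact n1 h'.symm

theorem Pc.split {D σ V a b} (h : Pc D σ V a b) {w : ℂ} (hw : w ∈ frontier D.G) :
    (∃ x ∈ Icc (0:ℝ) 1, w = σ x) ∨ w ∈ D.γ '' Icc b (a + D.l) := by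
  obtain ⟨s, hs, rfl⟩ := gam_window D a hw
  rcases le_total s b with h1 | h1
  · left
    have : D.γ s ∈ D.γ '' Icc a b := ⟨s, ⟨hs.1, h1⟩, rfl⟩
    rw [h.img] at this
    obtain ⟨x, hx, h2⟩ := this
    exact ⟨x, hx, h2.symm⟩
  · right; exact ⟨s, ⟨h1, hs.2.le⟩, rfl⟩

theorem Pc.local {D σ V σ' V' a b c} (h : Pc D σ V b c) (h' : Pc D σ' V' a b) {ε : ℝ} (hε : 0 < ε) :
    ∃ r > 0, ∀ w ∈ frontier D.G, ‖w - D.γ b‖ < r → ∃ x : ℝ, 0 ≤ x ∧ x < ε ∧ x ≤ 1 ∧ (w = σ x ∨ w = σ' (1 - x)) := by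
  have hr := h'.arc.rev
  set K : Set ℂ := (D.γ '' Icc c (a + D.l)) ∪ ((fun x : ℝ => σ x) '' Icc ε 1) ∪ ((fun x : ℝ => σ' (1 - x)) '' Icc ε 1) with hK
  have hsub : Icc ε 1 ⊆ Icc 0 1 := Icc_subset_Icc_left hε.le
  have hKc : IsCompact K := ((isCompact_Icc.image D.γ_cont).union (isCompact_Icc.image_of_continuousOn (h.arc.contR.mono hsub))).union
    (isCompact_Icc.image_of_continuousOn (hr.contR.mono hsub))
  have hn : D.γ b ∉ K := by
    rintro ((⟨s, hs, h1⟩ | ⟨x, hx, h1⟩) | ⟨x, hx, h1⟩)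
    · have := gam_inj D b ⟨h.lt.le.trans hs.1, by linarith [hs.2, h'.lt]⟩ ⟨le_rfl, by linarith [D.l_pos]⟩ h1
      linarith [hs.1, h.lt]
    · rw [← h.s0] at h1
      have := h.arc.injR (hsub hx) (x₂ := 0) (by simp) (by simpa using h1)
      linarith [hx.1]
    · rw [← h'.s1] at h1
      have := hr.injR (hsub hx) (x₂ := 0) (by simp) (by simpa using h1)
      linarith [hx.1]
  obtain ⟨r, hr0, hr1⟩ := Metric.mem_nhds_iff.1 (hKc.isClosed.isOpen_compl.mem_nhds hn)
  refine ⟨r, hr0, fun w hw hwr => ?_⟩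
  have hwK : w ∉ K := hr1 (by rw [mem_ball, dist_eq_norm]; exact hwr)
  rcases h.split hw with ⟨x, hx, rfl⟩ | ⟨s, hs, rfl⟩
  · refine ⟨x, hx.1, ?_, hx.2, Or.inl rfl⟩
    by_contra hc
    push Not at hc
    exact hwK (Or.inl (Or.inr ⟨x, ⟨hc, hx.2⟩, rfl⟩))
  · rcases le_total s (a + D.l) with h1 | h1
    · exact absurd (Or.inl (Or.inl ⟨s, ⟨hs.1, h1⟩, rfl⟩)) hwK
    · have h2 : D.γ s ∈ D.γ '' Icc a b := ⟨s - D.l, ⟨by linarith, by linarith [hs.2]⟩, D.γ_periodic.sub_eq s⟩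
      rw [h'.img] at h2
      obtain ⟨x, hx, h3⟩ := h2
      simp only at h3
      refine ⟨1 - x, by linarith [hx.2], ?_, by linarith [hx.1], Or.inr (by rw [← h3]; push_cast; congr 1; ring)⟩
      by_contra hc
      push Not at hc
      exact hwK (Or.inr ⟨1 - x, ⟨hc, by linarith [hx.1]⟩, by rw [← h3]; push_cast; congr 1; ring⟩)

structure Corner (G : Set ℂ) (w0 e : ℂ) (α C r : ℝ) : Prop where
  ne : ‖e‖ = 1
  a0 : 0 < α
  a2 : α < 2
  C1 : 1 ≤ C
  r0 : 0 < r
  inn : Sec w0 e (α * Real.pi / 2) C r ⊆ G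
  out : Sec w0 (-e) (Real.pi - α * Real.pi / 2) C r ⊆ (closure G)ᶜ

def EndAt (σ : ℂ → ℂ) (w0 e : ℂ) (α s C ε : ℝ) : Prop :=
  σ 0 = w0 ∧ 0 < ε ∧ ε ≤ 1 ∧ ∀ ζ : ℂ, ζ ≠ 0 → ‖ζ‖ < ε → ‖ζ‖ ≤ C * ‖σ ζ - w0‖ ∧ ‖σ ζ - w0‖ ≤ C * ‖ζ‖ ∧
    ∃ δ : ℝ, |δ| ≤ C * ‖σ ζ - w0‖ ∧ σ ζ = w0 + e * (‖σ ζ - w0‖ * exp ((-s * (α * Real.pi / 2) + arg ζ + δ : ℝ) * I))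

theorem cornerPiece {D : JordanDomain} {σ V σ' V' a b c} (h : Pc D σ V b c) (h' : Pc D σ' V' a b)
    {α : ℝ} (hα : 0 < α) (hα2 : α < 2) (hang : HasCornerAngle D.G (D.γ b) (α * Real.pi)) :
    ∃ (e : ℂ) (C r ε s : ℝ), (s = 1 ∨ s = -1) ∧ Corner D.G (D.γ b) e α C r ∧ EndAt σ (D.γ b) e α s C ε ∧
      EndAt (fun ζ => σ' (1 - ζ)) (D.γ b) e α (-s) C ε := by
  obtain ⟨C1, ε1, hC1, hε1, hε1', g1⟩ := h.arc.germ
  obtain ⟨C2, ε2, hC2, hε2, hε2', g2⟩ := h'.arc.rev.germ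
  have hs0 : σ' (1 - 0) = D.γ b := by simpa using h'.s1
  simp only [hs0] at g2
  rw [h.s0] at g1
  set t1 := tdir σ with ht1
  set t2 := tdir (fun ζ => σ' (1 - ζ)) with ht2
  set C := max C1 C2
  set ε := min ε1 ε2
  obtain ⟨r, hr, hl⟩ := h.local h' (ε := ε) (by positivity)
  have hCC1 : C1 ≤ C := le_max_left _ _
  have hCC2 : C2 ≤ C := le_max_right _ _
  have hL : ∀ w ∈ frontier D.G, 0 < ‖w - D.γ b‖ → ‖w - D.γ b‖ < r →
      ∃ θ : ℝ, |θ| ≤ C * ‖w - D.γ b‖ ∧ (w = D.γ b + t1 * (‖w - D.γ b‖ * exp (θ * I)) ∨ w = D.γ b + t2 * (‖w - D.γ b‖ * exp (θ * I))) := by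
    intro w hw h0 hwr
    obtain ⟨x, hx0, hxε, hx1, hx⟩ := hl w hw hwr
    have hxne : x ≠ 0 := by
      rintro rfl
      rcases hx with hx | hx
      · rw [hx] at h0; simp [h.s0] at h0
      · rw [hx] at h0; simp [h'.s1] at h0
    have hn : ‖(x:ℂ)‖ < ε := by simpa [abs_of_nonneg hx0] using hxε
    have ha : arg (x:ℂ) = 0 := arg_ofReal_of_nonneg hx0
    rcases hx with hx | hx
    · obtain ⟨_, _, _, δ, hδ, he⟩ := g1 x (by simpa using hxne) (hn.trans_le (min_le_left _ _))
      rw [ha, zero_add, ← hx] at he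
      rw [← hx] at hδ
      exact ⟨δ, hδ.trans (by gcongr), Or.inl he⟩
    · obtain ⟨_, _, _, δ, hδ, he⟩ := g2 x (by simpa using hxne) (hn.trans_le (min_le_right _ _))
      rw [ha, zero_add, ← hx] at he
      rw [← hx] at hδ
      exact ⟨δ, hδ.trans (by gcongr), Or.inr he⟩
  obtain ⟨e, he, i1, i2, ht⟩ := corner D.isOpen h.arc.tdir_norm h'.arc.rev.tdir_norm (by linarith) hr hL hα hα2 hang
  have fin1 : ∀ {τ : ℂ → ℂ} {t : ℂ} {s : ℝ} {K η : ℝ} {V : Set ℂ}, τ 0 = D.γ b → t = e * exp ((-s * (α * Real.pi / 2) : ℝ) * I) → K ≤ C → ε ≤ η →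
      (∀ ζ : ℂ, ζ ≠ 0 → ‖ζ‖ < η → ζ ∈ V ∧ ‖ζ‖ ≤ K * ‖τ ζ - D.γ b‖ ∧ ‖τ ζ - D.γ b‖ ≤ K * ‖ζ‖ ∧ ∃ δ : ℝ, |δ| ≤ K * ‖τ ζ - D.γ b‖ ∧
      τ ζ = D.γ b + t * (‖τ ζ - D.γ b‖ * exp ((arg ζ + δ : ℝ) * I))) → EndAt τ (D.γ b) e α s C ε := by
    intro τ t s K η V h0 ht hK hη hh
    refine ⟨h0, by positivity, (min_le_left _ _).trans hε1', fun ζ hz hzn => ?_⟩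
    obtain ⟨_, q1, q2, δ, q3, q4⟩ := hh ζ hz (hzn.trans_le hη)
    refine ⟨q1.trans (by gcongr), q2.trans (by gcongr), δ, q3.trans (by gcongr), q4.trans ?_⟩
    rw [ht, add_assoc (-s * (α * Real.pi / 2)), ofReal_add (-s * (α * Real.pi / 2)), add_mul, exp_add]; ring
  have hco : Corner D.G (D.γ b) e α C r := ⟨he, hα, hα2, hC1.trans hCC1, hr, i1, i2⟩
  rcases ht with ⟨e1, e2⟩ | ⟨e1, e2⟩
  · refine ⟨e, C, r, ε, -1, Or.inr rfl, hco, fin1 h.s0 (by rw [ht1, e1]; norm_num) hCC1 (min_le_left _ _) g1,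
      fin1 hs0 (by rw [ht2, e2]; norm_num) hCC2 (min_le_right _ _) g2⟩
  · refine ⟨e, C, r, ε, 1, Or.inl rfl, hco, fin1 h.s0 (by rw [ht1, e1]; norm_num) hCC1 (min_le_left _ _) g1,
      fin1 hs0 (by rw [ht2, e2]; norm_num) hCC2 (min_le_right _ _) g2⟩

theorem endFree {G : Set ℂ} {σ1 σ2 : ℂ → ℂ} {V : Set ℂ} {w0 e : ℂ} {α C r ε s : ℝ} (hs : s = 1 ∨ s = -1) (hco : Corner G w0 e α C r)
    (ha : IsArc σ1 V) (h1 : EndAt σ1 w0 e α s C ε) (h2 : EndAt σ2 w0 e α (-s) C ε)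
    (hl : ∀ ε > 0, ∃ r > 0, ∀ w ∈ frontier G, ‖w - w0‖ < r → ∃ x : ℝ, 0 ≤ x ∧ x < ε ∧ x ≤ 1 ∧ (w = σ1 x ∨ w = σ2 x)) :
    ∃ κ > 0, ∃ η > 0, η ≤ ε ∧ ∀ ζ : ℂ, ζ.im ≠ 0 → ‖ζ‖ < η → |arg ζ| ≤ κ → ζ ∈ V ∧ σ1 ζ ∉ frontier G := by
  obtain ⟨z1, p1, _, q1⟩ := h1
  obtain ⟨z2, p2, _, q2⟩ := h2
  have hpi := Real.pi_pos
  have ha0 := hco.a0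
  have ha2 := hco.a2
  have hC := hco.C1
  set h := α * Real.pi / 2 with hh
  have hh0 : 0 < h := by positivity
  have hh1 : h < Real.pi := by rw [hh]; nlinarith
  set κ := min (2 * h) (2 * Real.pi - 2 * h) / 4 with hκ
  have hm : 0 < min (2 * h) (2 * Real.pi - 2 * h) := lt_min (by linarith) (by linarith)
  have hκ1 : 4 * κ ≤ 2 * h := by rw [hκ]; linarith [min_le_left (2 * h) (2 * Real.pi - 2 * h)]
  have hκ2 : 4 * κ ≤ 2 * Real.pi - 2 * h := by rw [hκ]; linarith [min_le_right (2 * h) (2 * Real.pi - 2 * h)]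
  have hκ0 : 0 < κ := by rw [hκ]; linarith
  obtain ⟨r', hr', hl⟩ := hl ε p1
  have hV0 : V ∈ nhds (0:ℂ) := ha.op.mem_nhds (by simpa using ha.seg 0 (by simp))
  obtain ⟨η0, hη0, hηV⟩ := Metric.mem_nhds_iff.1 hV0
  refine ⟨κ, hκ0, min (min ε η0) (min (r' / C) (κ / C ^ 2)), by positivity, (min_le_left _ _).trans (min_le_left _ _), fun ζ him hn harg => ?_⟩
  have hn1 : ‖ζ‖ < ε := hn.trans_le ((min_le_left _ _).trans (min_le_left _ _))
  have hn2 : ‖ζ‖ < η0 := hn.trans_le ((min_le_left _ _).trans (min_le_right _ _))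
  have hn3 : ‖ζ‖ < r' / C := hn.trans_le ((min_le_right _ _).trans (min_le_left _ _))
  have hn4 : ‖ζ‖ < κ / C ^ 2 := hn.trans_le ((min_le_right _ _).trans (min_le_right _ _))
  rw [lt_div_iff₀ (by positivity)] at hn3 hn4
  have hζ0 : ζ ≠ 0 := by rintro rfl; simp at him
  have hζV : ζ ∈ V := hηV (by simpa using hn2)
  refine ⟨hζV, fun hL => ?_⟩
  obtain ⟨b1, b2, δ, hδ, he⟩ := q1 ζ hζ0 hn1
  obtain ⟨x, hx0, hxε, hx1, hx⟩ := hl _ hL (b2.trans_lt (by linarith))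
  rcases hx with hx | hx
  · have := ha.inj hζV (ha.seg x ⟨hx0, hx1⟩) hx
    rw [this] at him; simp at him
  · have hρ : 0 < ‖σ1 ζ - w0‖ := by
      have := norm_pos_iff.2 hζ0
      by_contra hc; nlinarith
    have hx0' : x ≠ 0 := by
      rintro rfl; rw [hx] at hρ; simp [z2] at hρ
    obtain ⟨c1, c2, δ', hδ', he'⟩ := q2 x (by simpa using hx0') (by simpa [abs_of_nonneg hx0] using hxε)
    rw [arg_ofReal_of_nonneg hx0] at he'
    rw [← hx] at he' hδ'
    have he := he'.symm.trans he
    have hne : e ≠ 0 := by rintro rfl; have := hco.ne; simp at this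
    have hρc : ((‖σ1 ζ - w0‖ : ℝ) : ℂ) ≠ 0 := by exact_mod_cast hρ.ne'
    have he2 := mul_left_cancel₀ hρc (mul_left_cancel₀ hne (add_left_cancel he))
    obtain ⟨n, hn⟩ := exp_I_eq he2
    have hCb := mul_le_mul_of_nonneg_left b2 (show 0 ≤ C by linarith)
    have hd1 : |δ| ≤ κ := hδ.trans (by nlinarith only [hCb, hn4])
    have hd2 : |δ'| ≤ κ := hδ'.trans (by nlinarith only [hCb, hn4])
    rw [abs_le] at hd1 hd2 harg
    have hx := int_pi (n := n) (x := 2 * s * h - arg ζ - δ + δ') (by linarith)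
    rcases hs with rfl | rfl
    · have := hx (by linarith) (by linarith); linarith
    · have := hx (by linarith) (by linarith); linarith

def Nset (c : ℝ) : Set ℂ := {ζ | |ζ.im| < c * ζ.re ∧ |ζ.im| < c * (1 - ζ.re)}

theorem Nset_open (c : ℝ) : IsOpen (Nset c) := by
  have h1 : IsOpen {ζ : ℂ | |ζ.im| < c * ζ.re} := isOpen_lt (by fun_prop) (by fun_prop)
  have h2 : IsOpen {ζ : ℂ | |ζ.im| < c * (1 - ζ.re)} := isOpen_lt (by fun_prop) (by fun_prop)
  exact h1.inter h2

theorem Nset_convex (c : ℝ) : Convex ℝ (Nset c) := by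
  intro p hp q hq a b ha hb hab
  obtain ⟨h1, h2⟩ := hp
  obtain ⟨h3, h4⟩ := hq
  simp only [Nset, mem_ofPred_eq, abs_lt, add_re, real_smul, mul_re, ofReal_re, ofReal_im, zero_mul, sub_zero, add_im, mul_im, add_zero] at *
  have hb' : b = 1 - a := by linarith
  rcases eq_or_lt_of_le ha with h0 | h0
  · subst h0; simp at hab; subst hab; simpa using ⟨h3, h4⟩
  subst hb'
  refine ⟨⟨?_, ?_⟩, ?_, ?_⟩ <;> nlinarith

theorem Nset_re {c : ℝ} (hc : 0 < c) {ζ : ℂ} (h : ζ ∈ Nset c) : 0 < ζ.re ∧ ζ.re < 1 := by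
  have h1 := (abs_nonneg _).trans_lt h.1
  have h2 := (abs_nonneg _).trans_lt h.2
  constructor <;> nlinarith

theorem Nset_real {c x : ℝ} (hc : 0 < c) : (x : ℂ) ∈ Nset c ↔ x ∈ Ioo (0:ℝ) 1 := by
  simp only [Nset, mem_ofPred_eq, ofReal_im, abs_zero, ofReal_re, mem_Ioo]
  constructor
  · rintro ⟨h1, h2⟩; constructor <;> nlinarith
  · rintro ⟨h1, h2⟩; constructor <;> nlinarith

theorem Nset_mono {c c' : ℝ} (hc : 0 < c) (h : c ≤ c') : Nset c ⊆ Nset c' := fun ζ hz => by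
  have := Nset_re hc hz
  exact ⟨hz.1.trans_le (by nlinarith), hz.2.trans_le (by nlinarith)⟩

theorem Nset_rev {c : ℝ} {ζ : ℂ} : 1 - ζ ∈ Nset c ↔ ζ ∈ Nset c := by
  simp only [Nset, mem_ofPred_eq, sub_im, one_im, zero_sub, abs_neg, sub_re, one_re]
  rw [sub_sub_cancel, and_comm]

theorem Nset_conj {c : ℝ} {ζ : ℂ} : (starRingEnd ℂ) ζ ∈ Nset c ↔ ζ ∈ Nset c := by
  simp [Nset]

theorem arg_cone {ζ : ℂ} {c : ℝ} (h0 : 0 < ζ.re) (h : |ζ.im| ≤ c * ζ.re) (hc : c ≤ 1/2) : |arg ζ| ≤ 3/2 * c := by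
  have h1 : (ζ.re⁻¹ : ℝ) * ζ - 1 = ((ζ.im / ζ.re : ℝ) : ℂ) * I := by
    have : (ζ.re : ℂ) ≠ 0 := by exact_mod_cast h0.ne'
    push_cast
    field_simp
    linear_combination -(re_add_im ζ)
  have h2 : ‖(ζ.re⁻¹ : ℝ) * ζ - 1‖ ≤ c := by
    rw [h1, norm_mul, norm_I, mul_one, norm_real, Real.norm_eq_abs, abs_div, abs_of_pos h0, div_le_iff₀ h0]; exact h
  have h3 := arg_small (h2.trans hc)
  rw [arg_real_mul _ (inv_pos.2 h0)] at h3
  linarith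

theorem Pc.free {D : JordanDomain} {σ V a b} (h : Pc D σ V a b) {κ η κ' η' : ℝ} (hκ : 0 < κ) (hη : 0 < η) (hκ' : 0 < κ') (hη' : 0 < η')
    (h0 : ∀ ζ : ℂ, ζ.im ≠ 0 → ‖ζ‖ < η → |arg ζ| ≤ κ → ζ ∈ V ∧ σ ζ ∉ frontier D.G)
    (h1 : ∀ ζ : ℂ, ζ.im ≠ 0 → ‖ζ‖ < η' → |arg ζ| ≤ κ' → 1 - ζ ∈ V ∧ σ (1 - ζ) ∉ frontier D.G) :
    ∃ c0 > 0, ∀ c, 0 < c → c ≤ c0 → Nset c ⊆ V ∧ ∀ ζ ∈ Nset c, ζ.im ≠ 0 → σ ζ ∉ frontier D.G := by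
  set ε := min (min η η' / 2) (1/2) with hε
  have hε0 : 0 < ε := by positivity
  have hεη : 2 * ε ≤ η := by
    have := (min_le_left (min η η' / 2) (1/2)).trans (div_le_div_of_nonneg_right (min_le_left η η') (by norm_num)); linarith
  have hεη' : 2 * ε ≤ η' := by
    have := (min_le_left (min η η' / 2) (1/2)).trans (div_le_div_of_nonneg_right (min_le_right η η') (by norm_num)); linarith
  set O : Set ℂ := V ∩ σ ⁻¹' (D.γ '' Icc b (a + D.l))ᶜ with hO
  have hOo : IsOpen O := h.arc.diff.continuousOn.isOpen_inter_preimage h.arc.op (isCompact_Icc.image D.γ_cont).isClosed.isOpen_compl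
  have hK : IsCompact ((fun x : ℝ => (x:ℂ)) '' Icc ε (1 - ε)) := isCompact_Icc.image continuous_ofReal
  have hKO : (fun x : ℝ => (x:ℂ)) '' Icc ε (1 - ε) ⊆ O := by
    rintro _ ⟨x, hx, rfl⟩
    exact ⟨h.arc.seg x ⟨by linarith [hx.1], by linarith [hx.2]⟩, h.rest ⟨by linarith [hx.1], by linarith [hx.2]⟩⟩
  obtain ⟨δ, hδ, hth⟩ := hK.exists_thickening_subset_open hOo hKO
  refine ⟨min (min (κ / 2) (κ' / 2)) (min (1/2) δ), by positivity, fun c hc hcc => ?_⟩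
  have hc1 : c ≤ κ / 2 := hcc.trans ((min_le_left _ _).trans (min_le_left _ _))
  have hc2 : c ≤ κ' / 2 := hcc.trans ((min_le_left _ _).trans (min_le_right _ _))
  have hc3 : c ≤ 1 / 2 := hcc.trans ((min_le_right _ _).trans (min_le_left _ _))
  have hc4 : c ≤ δ := hcc.trans ((min_le_right _ _).trans (min_le_right _ _))
  have key : ∀ ζ ∈ Nset c, ζ.im ≠ 0 → ζ ∈ V ∧ σ ζ ∉ frontier D.G := by
    intro ζ hz him
    obtain ⟨hr0, hr1⟩ := Nset_re hc hz
    rcases lt_or_ge ζ.re ε with h5 | h5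
    · refine h0 ζ him ?_ ((arg_cone hr0 hz.1.le hc3).trans (by linarith))
      have := Complex.norm_le_abs_re_add_abs_im ζ
      rw [abs_of_pos hr0] at this
      nlinarith [hz.1]
    rcases lt_or_ge (1 - ε) ζ.re with h6 | h6
    · have hr := (Nset_rev.2 hz)
      have q : 0 < (1 - ζ).re := by simp; linarith
      have := h1 (1 - ζ) (by simpa using him) ?_ ((arg_cone q hr.1.le hc3).trans (by linarith))
      · simpa using this
      have := Complex.norm_le_abs_re_add_abs_im (1 - ζ)
      rw [abs_of_pos q] at this
      have h7 := hr.1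
      have h8 : (1 - ζ).re < ε := by simp; linarith
      nlinarith
    · have : ζ ∈ O := hth (mem_thickening_iff.2 ⟨(ζ.re : ℂ), ⟨ζ.re, ⟨h5, h6⟩, rfl⟩, by
        rw [dist_eq_norm]
        have e1 : ζ - ζ.re = (ζ.im : ℂ) * I := by linear_combination -(re_add_im ζ)
        rw [e1, norm_mul, norm_I, mul_one, norm_real, Real.norm_eq_abs]
        nlinarith [hz.1]⟩)
      refine ⟨this.1, fun hL => ?_⟩
      rcases h.split hL with ⟨x, hx, hxe⟩ | hx
      · have := h.arc.inj this.1 (h.arc.seg x hx) hxe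
        rw [this] at him; simp at him
      · exact this.2 hx
  refine ⟨fun ζ hz => ?_, fun ζ hz him => (key ζ hz him).2⟩
  by_cases him : ζ.im = 0
  · obtain ⟨hr0, hr1⟩ := Nset_re hc hz
    have : ζ = (ζ.re : ℂ) := Complex.ext rfl (by simpa using him)
    rw [this]; exact h.arc.seg _ ⟨hr0.le, hr1.le⟩
  · exact (key ζ hz him).1

theorem arg_lower (ζ : ℂ) : |ζ.im| / ‖ζ‖ ≤ |arg ζ| := by
  have h := Complex.sin_arg ζ
  have h2 := Real.abs_sin_le_abs (x := arg ζ)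
  rwa [h, abs_div, abs_of_nonneg (norm_nonneg ζ)] at h2

theorem end_inn {σ : ℂ → ℂ} {w0 e : ℂ} {α s C ε : ℝ} (hs : s = 1 ∨ s = -1) (hE : EndAt σ w0 e α s C ε) {ζ : ℂ} (h0 : ζ ≠ 0)
    (hn : ‖ζ‖ < ε) (hp : 0 ≤ s * arg ζ) (hp2 : s * arg ζ ≤ α * Real.pi / 2) :
    ∃ θ : ℝ, |θ| ≤ α * Real.pi / 2 - |arg ζ| + C * ‖σ ζ - w0‖ ∧ σ ζ = w0 + e * (‖σ ζ - w0‖ * exp (θ * I)) := by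
  obtain ⟨_, _, δ, hδ, he⟩ := hE.2.2.2 ζ h0 hn
  refine ⟨_, ?_, he⟩
  rw [abs_le] at hδ ⊢
  rcases hs with rfl | rfl
  · rw [one_mul] at *; rw [abs_of_nonneg hp]; constructor <;> linarith
  · rw [abs_of_nonpos (by linarith)]; constructor <;> linarith

theorem end_out {σ : ℂ → ℂ} {w0 e : ℂ} {α s C ε : ℝ} (hs : s = 1 ∨ s = -1) (hE : EndAt σ w0 e α s C ε) {ζ : ℂ} (h0 : ζ ≠ 0)
    (hn : ‖ζ‖ < ε) (hp : s * arg ζ ≤ 0) (hp2 : -(s * arg ζ) ≤ Real.pi - α * Real.pi / 2) :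
    ∃ θ : ℝ, |θ| ≤ Real.pi - α * Real.pi / 2 - |arg ζ| + C * ‖σ ζ - w0‖ ∧ σ ζ = w0 + -e * (‖σ ζ - w0‖ * exp (θ * I)) := by
  obtain ⟨_, _, δ, hδ, he⟩ := hE.2.2.2 ζ h0 hn
  refine ⟨(-s * (α * Real.pi / 2) + arg ζ + δ) + s * Real.pi, ?_, he.trans ?_⟩
  · rw [abs_le] at hδ ⊢
    rcases hs with rfl | rfl
    · rw [one_mul] at *; rw [abs_of_nonpos hp]; constructor <;> linarith
    · rw [abs_of_nonneg (by linarith)]; constructor <;> linarith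
  · have : exp ((s * Real.pi : ℝ) * I) = -1 := by
      rcases hs with rfl | rfl
      · simp
      · simp [exp_neg]
    rw [ofReal_add _ (s * Real.pi), add_mul, exp_add, this]; ring

structure Lens (D : JordanDomain) (σ : ℂ → ℂ) (V : Set ℂ) (c : ℝ) : Prop where
  arc : IsArc σ V
  c0 : 0 < c
  c2 : c ≤ 1/2
  sub : Nset c ⊆ V
  up : ∀ ζ ∈ Nset c, 0 < ζ.im → σ ζ ∈ D.G
  lo : ∀ ζ ∈ Nset c, ζ.im < 0 → σ ζ ∈ (closure D.G)ᶜ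
  re : ∀ x ∈ Icc (0:ℝ) 1, σ x ∈ frontier D.G

theorem half_convex (c s : ℝ) : Convex ℝ (Nset c ∩ {ζ : ℂ | 0 < s * ζ.im}) :=
  (Nset_convex c).inter (convex_halfSpace_gt (f := fun ζ : ℂ => s * ζ.im) ⟨fun x y => by simp; ring, fun t x => by simp; ring⟩ 0)

/-- a test point in the cone near the corner -/
theorem cone_pt {σ : ℂ → ℂ} {w0 e : ℂ} {α s C ε c r : ℝ} {G : Set ℂ} (hco : Corner G w0 e α C r) (hE : EndAt σ w0 e α s C ε)
    (hc : 0 < c) (hc2 : c ≤ 1/2) (hs : s = 1 ∨ s = -1) :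
    (∃ ζ ∈ Nset c, 0 < s * ζ.im ∧ σ ζ ∈ Sec w0 e (α * Real.pi / 2) C r) ∧
    (∃ ζ ∈ Nset c, 0 < -s * ζ.im ∧ σ ζ ∈ Sec w0 (-e) (Real.pi - α * Real.pi / 2) C r) := by
  have hpi := Real.pi_pos
  have ha0 := hco.a0
  have ha2 := hco.a2
  have hC := hco.C1
  have hr := hco.r0
  have hε := hE.2.1
  have hε1 := hE.2.2.1
  set h := α * Real.pi / 2 with hh
  have hh0 : 0 < h := by positivity
  have hh1 : 0 < Real.pi - h := by rw [hh]; nlinarith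
  set k := min (c / 2) (min (h / 2) ((Real.pi - h) / 2)) with hk
  have hk0 : 0 < k := by positivity
  have hk1 : k ≤ c / 2 := min_le_left _ _
  have hk2 : k ≤ h / 2 := (min_le_right _ _).trans (min_le_left _ _)
  have hk3 : k ≤ (Real.pi - h) / 2 := (min_le_right _ _).trans (min_le_right _ _)
  set x := min (min (ε / 4) (r / (4 * C))) (k / (16 * C ^ 2)) with hx
  have hx0 : 0 < x := by positivity
  have hx1 : x ≤ ε / 4 := (min_le_left _ _).trans (min_le_left _ _)
  have hx2 : x ≤ r / (4 * C) := (min_le_left _ _).trans (min_le_right _ _)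
  have hx3 : x ≤ k / (16 * C ^ 2) := min_le_right _ _
  rw [le_div_iff₀ (by positivity)] at hx2 hx3
  have key : ∀ u : ℝ, (u = 1 ∨ u = -1) → ∀ ζ : ℂ, ζ = x + (u * k * x : ℝ) * I → ζ ≠ 0 ∧ ‖ζ‖ < ε ∧ ζ ∈ Nset c ∧ ζ.im = u * k * x ∧ 0 < u * arg ζ ∧
      |arg ζ| ≤ 3/2 * k ∧ k / 2 ≤ |arg ζ| ∧ C * ‖σ ζ - w0‖ ≤ k / 8 ∧ ‖σ ζ - w0‖ < r ∧ 0 < ‖σ ζ - w0‖ := by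
    intro u hu ζ hζ
    have hre : ζ.re = x := by rw [hζ]; simp
    have him : ζ.im = u * k * x := by rw [hζ]; simp
    have habs : |ζ.im| = k * x := by
      rw [him, abs_mul, abs_mul, abs_of_pos hk0, abs_of_pos hx0]; rcases hu with rfl | rfl <;> simp
    have hz0 : ζ ≠ 0 := by rintro rfl; simp at hre; linarith
    have hnn := Complex.norm_le_abs_re_add_abs_im ζ
    rw [hre, habs, abs_of_pos hx0] at hnn
    have kx : 0 < k * x := by positivity
    have hkc : k * x ≤ c / 2 * x := by gcongr
    have hcx : c * x ≤ 1 / 2 * x := by gcongr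
    have hn2 : ‖ζ‖ ≤ 2 * x := by linarith
    have hnp := norm_pos_iff.2 hz0
    have hN : ζ ∈ Nset c := by
      have : c * x * x ≤ c * x * (1/2) := by gcongr; linarith
      constructor <;> rw [habs, hre] <;> nlinarith only [hkc, this, mul_pos hc hx0, hx1, hε1, hcx]
    have hlow : k / 2 ≤ |arg ζ| := by
      refine le_trans ?_ (arg_lower ζ)
      rw [habs, le_div_iff₀ hnp]; nlinarith only [hn2, hk0]
    have hpos : 0 < u * arg ζ := by
      have hne : arg ζ ≠ 0 := fun h0 => by rw [h0] at hlow; simp at hlow; linarith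
      rcases hu with rfl | rfl
      · have := Complex.arg_nonneg_iff.2 (show 0 ≤ ζ.im by rw [him]; positivity)
        rw [one_mul]; exact lt_of_le_of_ne this hne.symm
      · have := Complex.arg_neg_iff.2 (show ζ.im < 0 by rw [him]; linarith)
        linarith
    have hlt : ‖ζ‖ < ε := by linarith
    obtain ⟨b1, b2, _⟩ := hE.2.2.2 ζ hz0 hlt
    refine ⟨hz0, hlt, hN, him, hpos, arg_cone (by rw [hre]; exact hx0) (by rw [habs, hre]) (by linarith), hlow, ?_, ?_, ?_⟩
    · nlinarith only [mul_le_mul_of_nonneg_left (b2.trans (mul_le_mul_of_nonneg_left hn2 (show 0 ≤ C by linarith))) (show 0 ≤ C by linarith), hx3]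
    · nlinarith only [b2, mul_le_mul_of_nonneg_left hn2 (show 0 ≤ C by linarith), hx2, hr]
    · by_contra hc; nlinarith only [hc, b1, hnp, hC]
  constructor
  · obtain ⟨a1, a2, a3, a4, a5, a6, a7, a8, a9, a10⟩ := key s hs _ rfl
    refine ⟨_, a3, ?_, ?_⟩
    · rw [a4]; have := mul_pos hk0 hx0; rcases hs with rfl | rfl <;> linarith
    · obtain ⟨θ, t1, t2⟩ := end_inn hs hE a1 a2 a5.le (by
        refine (le_abs_self _).trans ?_
        rw [abs_mul, show |s| = 1 by rcases hs with rfl | rfl <;> simp, one_mul]; linarith)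
      exact ⟨_, θ, a10, a9, by linarith, t2⟩
  · have hs' : -s = 1 ∨ -s = -1 := by rcases hs with rfl | rfl <;> simp
    obtain ⟨a1, a2, a3, a4, a5, a6, a7, a8, a9, a10⟩ := key (-s) hs' _ rfl
    refine ⟨_, a3, ?_, ?_⟩
    · rw [a4]; have := mul_pos hk0 hx0; rcases hs with rfl | rfl <;> linarith
    · obtain ⟨θ, t1, t2⟩ := end_out hs hE a1 a2 (by linarith) (by
        refine (neg_le_abs _).trans ?_
        rw [abs_mul, show |s| = 1 by rcases hs with rfl | rfl <;> simp, one_mul]; linarith)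
      exact ⟨_, θ, a10, a9, by linarith, t2⟩

theorem sides {G : Set ℂ} (hG : IsOpen G) {σ : ℂ → ℂ} {V : Set ℂ} (ha : IsArc σ V) {w0 e : ℂ} {α s C ε c r : ℝ} (hs : s = 1 ∨ s = -1)
    (hco : Corner G w0 e α C r) (hE : EndAt σ w0 e α s C ε) (hc : 0 < c) (hc2 : c ≤ 1/2) (hV : Nset c ⊆ V)
    (hf : ∀ ζ ∈ Nset c, ζ.im ≠ 0 → σ ζ ∉ frontier G) :
    ∀ ζ ∈ Nset c, (0 < s * ζ.im → σ ζ ∈ G) ∧ (0 < -s * ζ.im → σ ζ ∈ (closure G)ᶜ) := by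
  obtain ⟨⟨z1, m1, p1, q1⟩, ⟨z2, m2, p2, q2⟩⟩ := cone_pt hco hE hc hc2 hs
  have hsub : ∀ u : ℝ, σ '' (Nset c ∩ {ζ : ℂ | 0 < u * ζ.im}) ⊆ G ∨ σ '' (Nset c ∩ {ζ : ℂ | 0 < u * ζ.im}) ⊆ (closure G)ᶜ := by
    intro u
    refine preconn_side hG ((half_convex c u).isPreconnected.image σ (ha.diff.continuousOn.mono fun z hz => hV hz.1)) ?_
    rintro _ ⟨ζ, hz, rfl⟩
    exact hf ζ hz.1 fun h0 => by have := hz.2; simp [h0] at this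
  intro ζ hζ
  constructor
  · intro hp
    rcases hsub s with h | h
    · exact h ⟨ζ, ⟨hζ, hp⟩, rfl⟩
    · exact absurd (subset_closure (hco.inn q1)) (h ⟨z1, ⟨m1, p1⟩, rfl⟩)
  · intro hp
    rcases hsub (-s) with h | h
    · exact absurd (subset_closure (h ⟨z2, ⟨m2, p2⟩, rfl⟩)) (hco.out q2)
    · exact h ⟨ζ, ⟨hζ, hp⟩, rfl⟩

theorem chain {D : JordanDomain} (B : PiecewiseAnalyticBoundary D) : ∃ (N : ℕ) (T : ℕ → ℝ) (σ : ℕ → ℂ → ℂ) (V : ℕ → Set ℂ), 2 ≤ N ∧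
    (∀ k ≤ N, Pc D (σ k) (V k) (T k) (T (k+1))) ∧ T N = T 0 + D.l ∧ σ N = σ 0 ∧ V N = V 0 ∧ (∀ k ≤ N, D.γ (T k) ∈ Jset B) ∧
    (∀ k < N, ∀ x ∈ Ioo (0:ℝ) 1, σ k x ∉ Jset B) := by
  obtain ⟨N, t, hN, hlt, hl, hJ, hbl, hno⟩ := pieces B
  have : ∀ k, ∃ σV : (ℂ → ℂ) × Set ℂ, k < N → Pc D σV.1 σV.2 (t k) (t (k+1)) := by
    intro k
    by_cases hk : k < N
    · obtain ⟨σ, V, h1, h2, h3, h4⟩ := piece_arc B (hlt k hk) (hbl k hk) (hJ k hk.le) (hJ (k+1) hk) (hno k hk)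
      exact ⟨⟨σ, V⟩, fun _ => ⟨h1, hlt k hk, hbl k hk, h2, h3, h4⟩⟩
    · exact ⟨⟨id, ∅⟩, fun h => absurd h hk⟩
  choose f hf using this
  have h0 : (0:ℕ) < N := by omega
  have e1 : ∀ k < N, ∀ {α : Type} (a : α) (g : ℕ → α), (if k = N then a else g k) = g k := fun k hk α a g => if_neg hk.ne
  refine ⟨N, fun k => if k = N + 1 then t 1 + D.l else t k, fun k => if k = N then (f 0).1 else (f k).1,
    fun k => if k = N then (f 0).2 else (f k).2, hN, fun k hk => ?_, ?_, ?_, ?_, fun k hk => ?_, fun k hk x hx hxJ => ?_⟩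
  · rcases eq_or_lt_of_le hk with rfl | hk'
    · have := hf 0 h0
      simp only [if_true, show k ≠ k + 1 by omega, if_false]
      rw [hl]
      refine ⟨this.arc, by linarith [this.lt], by linarith [this.bl], by rw [this.s0, D.γ_periodic], by rw [this.s1, D.γ_periodic], fun x hx => ?_⟩
      obtain ⟨s, hs, h2⟩ := this.mem x hx
      exact ⟨s + D.l, ⟨by linarith [hs.1], by linarith [hs.2]⟩, by rw [← h2, D.γ_periodic]⟩
    · simpa [hk'.ne, show k ≠ N + 1 by omega] using hf k hk'
  · simpa [show N ≠ N + 1 by omega, show (0:ℕ) ≠ N + 1 by omega] using hl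
  · simp
  · simp
  · simpa [show k ≠ N + 1 by omega] using hJ k hk
  · simp only [hk.ne, if_false] at hxJ
    have h := hf k hk
    obtain ⟨s, hs, h2⟩ := h.mem x (Ioo_subset_Icc_self hx)
    have hm : (x : ℝ) ∈ Icc (0:ℝ) 1 := Ioo_subset_Icc_self hx
    have n0 : s ≠ t k := fun hh => hx.1.ne' (h.arc.injR hm (x₂ := 0) (by simp) (by simp only [← h2, hh, ofReal_zero, h.s0]))
    have n1 : s ≠ t (k+1) := fun hh => hx.2.ne (h.arc.injR hm (x₂ := 1) (by simp) (by simp only [← h2, hh, ofReal_one, h.s1]))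
    exact hno k hk s ⟨lt_of_le_of_ne hs.1 n0.symm, lt_of_le_of_ne hs.2 n1⟩ (h2 ▸ hxJ)

theorem Corner.mono {G w0 e α C r C' r'} (h : Corner G w0 e α C r) (hC : C ≤ C') (hr : r' ≤ r) (hr0 : 0 < r') : Corner G w0 e α C' r' :=
  ⟨h.ne, h.a0, h.a2, h.C1.trans hC, hr0, (Sec_mono hC hr).trans h.inn, (Sec_mono hC hr).trans h.out⟩

theorem EndAt.mono {σ w0 e α s C ε C' ε'} (h : EndAt σ w0 e α s C ε) (hC : C ≤ C') (hr : ε' ≤ ε) (hr0 : 0 < ε') : EndAt σ w0 e α s C' ε' :=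
  ⟨h.1, hr0, hr.trans h.2.2.1, fun ζ h0 h1 => by
    obtain ⟨a, b, δ, c, d⟩ := h.2.2.2 ζ h0 (h1.trans_le hr)
    exact ⟨a.trans (by gcongr), b.trans (by gcongr), δ, c.trans (by gcongr), d⟩⟩

structure Geo (D : JordanDomain) (lam : ℝ) (N : ℕ) (σ : ℕ → ℂ → ℂ) (V : ℕ → Set ℂ) (c M : ℝ) (J : Set ℂ) (ee : ℂ → ℂ) (al : ℂ → ℝ) : Prop where
  N0 : 0 < N
  lens : ∀ j < N, Lens D (σ j) (V j) c
  int : ∀ f : ℂ → ℂ, ContinuousOn f (frontier D.G) → ∫ s in (0:ℝ)..D.l, f (D.γ s) =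
    ∑ j ∈ Finset.range N, ∫ x in (0:ℝ)..1, (‖deriv (σ j) x‖ : ℂ) * f (σ j x)
  tele : ∀ v : ℂ → ℂ, ∑ j ∈ Finset.range N, (v (σ j 1) - v (σ j 0)) = 0
  cover : ∀ w ∈ frontier D.G, ∃ j < N, ∃ x ∈ Icc (0:ℝ) 1, w = σ j x
  link : ∀ j, j + 1 < N → σ j 1 = σ (j+1) 0 ∨ σ j 0 = σ (j+1) 1
  Jfin : J.Finite
  nJ : ∀ j < N, ∀ x ∈ Ioo (0:ℝ) 1, σ j x ∉ J
  J0 : ∀ j < N, σ j 0 ∈ J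
  J1 : ∀ j < N, σ j 1 ∈ J
  cor : ∀ w ∈ J, Corner D.G w (ee w) (al w) M M⁻¹ ∧ lam ≤ 2 - al w
  end0 : ∀ j < N, EndAt (σ j) (σ j 0) (ee (σ j 0)) (al (σ j 0)) 1 M M⁻¹
  end1 : ∀ j < N, EndAt (fun ζ => σ j (1 - ζ)) (σ j 1) (ee (σ j 1)) (al (σ j 1)) (-1) M M⁻¹

structure Cyc (D : JordanDomain) (lam : ℝ) (J : Set ℂ) (N : ℕ) (T : ℕ → ℝ) (σ : ℕ → ℂ → ℂ) (V : ℕ → Set ℂ) (e : ℕ → ℂ) (al C r ε s : ℕ → ℝ) : Prop where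
  N2 : 2 ≤ N
  pc : ∀ k < N, Pc D (σ k) (V k) (T k) (T (k+1))
  TN : T N = T 0 + D.l
  Jf : J.Finite
  jm : ∀ k < N, D.γ (T k) ∈ J
  nJ : ∀ k < N, ∀ x ∈ Ioo (0:ℝ) 1, σ k x ∉ J
  ss : ∀ k < N, s k = 1 ∨ s k = -1
  la : ∀ k < N, lam ≤ 2 - al k
  co : ∀ k < N, Corner D.G (D.γ (T k)) (e k) (al k) (C k) (r k)
  e0 : ∀ k < N, EndAt (σ k) (D.γ (T k)) (e k) (al k) (s k) (C k) (ε k)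
  e1 : ∀ k < N, EndAt (fun ζ => σ k (1 - ζ)) (D.γ (T (k+1))) (e ((k+1)%N)) (al ((k+1)%N)) (-s ((k+1)%N)) (C ((k+1)%N)) (ε ((k+1)%N))
  fr : ∀ k < N, ∃ c0 > 0, ∀ c, 0 < c → c ≤ c0 → Nset c ⊆ V k ∧ ∀ ζ ∈ Nset c, ζ.im ≠ 0 → σ k ζ ∉ frontier D.G

theorem cyc {D : JordanDomain} (B : PiecewiseAnalyticBoundary D) {lam : ℝ} (hmin : ∀ i, lam ≤ B.extAngle i) :
    ∃ N T σ V e al C r ε s, Cyc D lam (Jset B) N T σ V e al C r ε s := by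
  obtain ⟨N, T, σ, V, hN, hpc, hT, hσ, hV, hJ, hnJ⟩ := chain B
  have hT1 : T (N+1) = T 1 + D.l := by
    have h1 := hpc N le_rfl
    have h0 := hpc 0 (by omega)
    simp only [zero_add] at h0
    have := D.l_pos
    refine gam_inj D (T N) (x₁ := T (N+1)) (x₂ := T 1 + D.l) ⟨h1.lt.le, h1.bl⟩ ⟨by linarith [h0.lt], by linarith [h0.bl]⟩ ?_
    rw [← h1.s1, hσ, h0.s1, D.γ_periodic]
  have hang : ∀ k, ∃ a : ℝ, k ≤ N → 0 < a ∧ a < 2 ∧ lam ≤ 2 - a ∧ HasCornerAngle D.G (D.γ (T k)) (a * Real.pi) := by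
    intro k
    by_cases hk : k ≤ N
    · obtain ⟨i, hi⟩ := hJ k hk
      have h1 := B.extAngle_mem i
      exact ⟨2 - B.extAngle i, fun _ => ⟨by linarith [h1.2], by linarith [h1.1], by linarith [hmin i], hi ▸ B.extAngle_spec i⟩⟩
    · exact ⟨0, fun h => absurd h hk⟩
  choose al hal using hang
  have hcp : ∀ k, ∃ (e : ℂ) (C r ε s : ℝ), k < N → (s = 1 ∨ s = -1) ∧ Corner D.G (D.γ (T (k+1))) e (al (k+1)) C r ∧
      EndAt (σ (k+1)) (D.γ (T (k+1))) e (al (k+1)) s C ε ∧ EndAt (fun ζ => σ k (1 - ζ)) (D.γ (T (k+1))) e (al (k+1)) (-s) C ε := by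
    intro k
    by_cases hk : k < N
    · obtain ⟨a0, a2, _, a3⟩ := hal (k+1) hk
      obtain ⟨e, C, r, ε, s, h⟩ := cornerPiece (hpc (k+1) hk) (hpc k hk.le) a0 a2 a3
      exact ⟨e, C, r, ε, s, fun _ => h⟩
    · exact ⟨0, 0, 0, 0, 0, fun h => absurd h hk⟩
  choose e C r ε s hc using hcp
  have hf0 : ∀ k < N, ∃ κ > 0, ∃ η > 0, ∀ ζ : ℂ, ζ.im ≠ 0 → ‖ζ‖ < η → |arg ζ| ≤ κ → ζ ∈ V (k+1) ∧ σ (k+1) ζ ∉ frontier D.G := by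
    intro k hk
    obtain ⟨h1, h2, h3, h4⟩ := hc k hk
    obtain ⟨κ, hκ, η, hη, _, h⟩ := endFree h1 h2 (hpc (k+1) hk).arc h3 h4 (fun ε hε => (hpc (k+1) hk).local (hpc k hk.le) hε)
    exact ⟨κ, hκ, η, hη, h⟩
  have hf1 : ∀ k < N, ∃ κ > 0, ∃ η > 0, ∀ ζ : ℂ, ζ.im ≠ 0 → ‖ζ‖ < η → |arg ζ| ≤ κ → 1 - ζ ∈ V k ∧ σ k (1 - ζ) ∉ frontier D.G := by
    intro k hk
    obtain ⟨h1, h2, h3, h4⟩ := hc k hk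
    obtain ⟨κ, hκ, η, hη, _, h⟩ := endFree (s := -s k) (by rcases h1 with h | h <;> simp [h]) h2 (hpc k hk.le).arc.rev h4 (by simpa using h3)
      (fun ε hε => by
        obtain ⟨r, hr, h⟩ := (hpc (k+1) hk).local (hpc k hk.le) hε
        exact ⟨r, hr, fun w hw hw2 => by obtain ⟨x, a, b, c, d⟩ := h w hw hw2; exact ⟨x, a, b, c, d.symm⟩⟩)
    exact ⟨κ, hκ, η, hη, h⟩
  have hmod : ∀ k < N, (k + 1 < N ∧ (k+1)%N = k+1) ∨ (k + 1 = N ∧ (k+1)%N = 0) := by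
    intro k hk
    rcases eq_or_lt_of_le (Nat.succ_le_of_lt hk) with h | h
    · right; exact ⟨h, by rw [Nat.succ_eq_add_one] at h; rw [h, Nat.mod_self]⟩
    · left; exact ⟨h, Nat.mod_eq_of_lt h⟩
  refine ⟨N, fun k => T (k+1), fun k => σ (k+1), fun k => V (k+1), e, fun k => al (k+1), C, r, ε, s, hN, fun k hk => hpc (k+1) hk, by simpa using hT1, Jset_fin B, fun k hk => hJ (k+1) hk, fun k hk => ?_, fun k hk => (hc k hk).1, fun k hk => (hal (k+1) hk).2.2.1, fun k hk => (hc k hk).2.1, fun k hk => (hc k hk).2.2.1, fun k hk => ?_, fun k hk => ?_⟩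
  · rcases hmod k hk with ⟨h, _⟩ | ⟨h, _⟩
    · exact hnJ (k+1) h
    · rw [h, hσ]; exact hnJ 0 (by omega)
  · rcases hmod k hk with ⟨h, h'⟩ | ⟨h, h'⟩
    · rw [h']; exact (hc (k+1) h).2.2.2
    · have := (hc 0 (by omega)).2.2.2
      rw [h', h, hσ, hT1, D.γ_periodic]
      exact this
  · obtain ⟨κ, hκ, η, hη, h0⟩ := hf0 k hk
    have : ∃ κ > 0, ∃ η > 0, ∀ ζ : ℂ, ζ.im ≠ 0 → ‖ζ‖ < η → |arg ζ| ≤ κ → 1 - ζ ∈ V (k+1) ∧ σ (k+1) (1 - ζ) ∉ frontier D.G := by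
      rcases hmod k hk with ⟨h, h'⟩ | ⟨h, h'⟩
      · exact hf1 (k+1) h
      · rw [h, hσ, hV]; exact hf1 0 (by omega)
    obtain ⟨κ', hκ', η', hη', h1⟩ := this
    exact (hpc (k+1) hk).free hκ hη hκ' hη' h0 h1

theorem bdN (f : ℕ → ℝ) (N : ℕ) : ∃ M ≥ 1, ∀ k < N, f k ≤ M :=
  ⟨1 + ∑ k ∈ Finset.range N, |f k|, by have := Finset.sum_nonneg (fun k (_ : k ∈ Finset.range N) => abs_nonneg (f k)); linarith, fun k hk => by
    have := Finset.single_le_sum (f := fun k => |f k|) (fun k _ => abs_nonneg (f k)) (Finset.mem_range.2 hk)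
    have h2 := le_abs_self (f k)
    linarith⟩

theorem geo {D : JordanDomain} (B : PiecewiseAnalyticBoundary D) {lam : ℝ} (hmin : ∀ i, lam ≤ B.extAngle i) :
    ∃ N σ V c M J ee al, 1 ≤ M ∧ Geo D lam N σ V c M J ee al := by
  obtain ⟨N, T, σ, V, e, al, C, r, ε, s, h⟩ := cyc B hmin
  have hN := h.N2
  have hlt : ∀ j, j < N → T 0 ≤ T j ∧ T j < T 0 + D.l := by
    have mono : ∀ i j, i ≤ j → j ≤ N → T i ≤ T j := by
      intro i j hij
      induction j, hij using Nat.le_induction with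
      | base => simp
      | succ j hj ih => intro h2; exact (ih (by omega)).trans (h.pc j (by omega)).lt.le
    intro j hj
    exact ⟨mono 0 j (by omega) hj.le, by rw [← h.TN]; exact (h.pc j hj).lt.trans_le (mono _ _ hj le_rfl)⟩
  have smono : ∀ i j, i < j → j < N → T i < T j := by
    intro i j hij
    induction j, hij using Nat.le_induction with
    | base => intro h2; exact (h.pc i (by omega)).lt
    | succ j hj ih => intro h2; exact (ih (by omega)).trans (h.pc j (by omega)).lt
  have hinj : InjOn (fun j => D.γ (T j)) (Iio N) := by
    intro i hi j hj hij
    have := gam_inj D (T 0) (hlt i hi) (hlt j hj) hij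
    rcases lt_trichotomy i j with h1 | h1 | h1
    · exact absurd this (smono i j h1 hj).ne
    · exact h1
    · exact absurd this (smono j i h1 hi).ne'
  set iv := Function.invFunOn (fun j => D.γ (T j)) (Iio N) with hiv
  have hiv' : ∀ j < N, iv (D.γ (T j)) = j := fun j hj => hinj.leftInvOn_invFunOn hj
  have hmod : ∀ k < N, (k+1)%N < N ∧ D.γ (T (k+1)) = D.γ (T ((k+1)%N)) := by
    intro k hk
    refine ⟨Nat.mod_lt _ (by omega), ?_⟩
    rcases eq_or_lt_of_le (Nat.succ_le_of_lt hk) with h1 | h1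
    · rw [Nat.succ_eq_add_one] at h1; rw [h1, Nat.mod_self, h.TN, D.γ_periodic]
    · rw [Nat.mod_eq_of_lt h1]
  obtain ⟨M1, hM1, hM1'⟩ := bdN C N
  obtain ⟨M2, hM2, hM2'⟩ := bdN (fun k => (r k)⁻¹) N
  obtain ⟨M3, hM3, hM3'⟩ := bdN (fun k => (ε k)⁻¹) N
  have hfr : ∀ k, ∃ c0 : ℝ, k < N → 0 < c0 ∧ ∀ c, 0 < c → c ≤ c0 → Nset c ⊆ V k ∧ ∀ ζ ∈ Nset c, ζ.im ≠ 0 → σ k ζ ∉ frontier D.G := by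
    intro k
    by_cases hk : k < N
    · obtain ⟨c0, h1, h2⟩ := h.fr k hk; exact ⟨c0, fun _ => ⟨h1, h2⟩⟩
    · exact ⟨0, fun h => absurd h hk⟩
  choose c0 hc0 using hfr
  obtain ⟨M4, hM4, hM4'⟩ := bdN (fun k => (c0 k)⁻¹) N
  set c := min (1/2) M4⁻¹ with hcd
  have hc : 0 < c := lt_min (by norm_num) (by positivity)
  have hc2 : c ≤ 1/2 := min_le_left _ _
  have hcc : ∀ k < N, c ≤ c0 k := fun k hk => (min_le_right _ _).trans (inv_le_of_inv_le₀ (hc0 k hk).1 (hM4' k hk))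
  set M := M1 + M2 + M3 with hM
  have hM0 : 0 < M := by positivity
  have m1 : ∀ k < N, C k ≤ M := fun k hk => by have := hM1' k hk; linarith
  have m2 : ∀ k < N, M⁻¹ ≤ r k := fun k hk => inv_le_of_inv_le₀ (h.co k hk).r0 (by have := hM2' k hk; linarith)
  have m3 : ∀ k < N, M⁻¹ ≤ ε k := fun k hk => inv_le_of_inv_le₀ (h.e0 k hk).2.1 (by have := hM3' k hk; linarith)
  have hi0 : 0 < M⁻¹ := by positivity
  have sd0 : ∀ k < N, ∀ ζ ∈ Nset c, (0 < s k * ζ.im → σ k ζ ∈ D.G) ∧ (0 < -s k * ζ.im → σ k ζ ∈ (closure D.G)ᶜ) := fun k hk =>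
    sides D.isOpen (h.pc k hk).arc (h.ss k hk) (h.co k hk) (h.e0 k hk) hc hc2 ((hc0 k hk).2 c hc (hcc k hk)).1 ((hc0 k hk).2 c hc (hcc k hk)).2
  have sd1 : ∀ k < N, ∀ ζ ∈ Nset c, (0 < s ((k+1)%N) * ζ.im → σ k ζ ∈ D.G) ∧ (0 < -s ((k+1)%N) * ζ.im → σ k ζ ∈ (closure D.G)ᶜ) := by
    intro k hk ζ hζ
    obtain ⟨a, b⟩ := hmod k hk
    have hV := (hc0 k hk).2 c hc (hcc k hk)
    have := sides D.isOpen (h.pc k hk).arc.rev (s := -s ((k+1)%N)) (by rcases h.ss _ a with h | h <;> simp [h]) (b ▸ h.co _ a) (h.e1 k hk) hc hc2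
      (fun z hz => hV.1 (Nset_rev.2 hz)) (fun z hz hz2 => hV.2 _ (Nset_rev.2 hz) (by simpa using hz2)) (1 - ζ) (Nset_rev.2 hζ)
    simpa using this
  have hdis : ∀ w ∈ D.G, w ∉ (closure D.G)ᶜ := fun w hw h2 => h2 (subset_closure hw)
  have hpt : ∀ t : ℝ, |t| < c/2 → (1/2 + t * I : ℂ) ∈ Nset c := by
    intro t ht
    simp [Nset]
    norm_num
    linarith
  have hss : ∀ k < N, s k = s ((k+1)%N) := by
    intro k hk
    have a := h.ss k hk
    have b := h.ss _ (hmod k hk).1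
    have p1 := hpt (c/4) (by rw [abs_of_pos (by linarith)]; linarith)
    have q1 := sd0 k hk _ p1
    have q2 := sd1 k hk _ p1
    have him : (1/2 + ((c/4:ℝ):ℂ) * I : ℂ).im = c/4 := by simp
    rw [him] at q1 q2
    rcases a with a | a <;> rcases b with b | b <;> rw [a, b] <;> rw [a] at q1 <;> rw [b] at q2
    · exact absurd (q2.2 (by linarith)) (hdis _ (q1.1 (by linarith)))
    · exact absurd (q1.2 (by linarith)) (hdis _ (q2.1 (by linarith)))
  have hs0 : ∀ k, k < N → s k = s 0 := by
    intro k
    induction k with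
    | zero => simp
    | succ k ih => intro hk; rw [← ih (by omega), hss k (by omega), Nat.mod_eq_of_lt hk]
  have e0 : ∀ k < N, EndAt (σ k) (D.γ (T k)) (e (iv (D.γ (T k)))) (al (iv (D.γ (T k)))) (s 0) M M⁻¹ := by
    intro k hk
    rw [hiv' k hk, ← hs0 k hk]
    exact (h.e0 k hk).mono (m1 k hk) (m3 k hk) hi0
  have e1 : ∀ k < N, EndAt (fun ζ => σ k (1 - ζ)) (D.γ (T (k+1))) (e (iv (D.γ (T (k+1))))) (al (iv (D.γ (T (k+1))))) (-s 0) M M⁻¹ := by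
    intro k hk
    obtain ⟨a, b⟩ := hmod k hk
    rw [b, hiv' _ a, ← hs0 _ a, ← b]
    exact (h.e1 k hk).mono (m1 _ a) (m3 _ a) hi0
  have jm1 : ∀ k < N, D.γ (T (k+1)) ∈ (fun j => D.γ (T j)) '' Iio N := by
    intro k hk
    obtain ⟨a, b⟩ := hmod k hk
    exact ⟨_, a, b.symm⟩
  have hsub : (fun j => D.γ (T j)) '' Iio N ⊆ Jset B := by rintro _ ⟨j, hj, rfl⟩; exact h.jm j hj
  have cov : ∀ w ∈ frontier D.G, ∃ j < N, ∃ x ∈ Icc (0:ℝ) 1, w = σ j x := by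
    intro w hw
    obtain ⟨t, ht, rfl⟩ := gam_window D (T 0) hw
    have : ∀ k ≤ N, t < T k → ∃ j < N, t ∈ Icc (T j) (T (j+1)) := by
      intro k
      induction k with
      | zero => intro _ h2; linarith [ht.1]
      | succ k ih =>
        intro hk h2
        by_cases h3 : t < T k
        · exact ih (by omega) h3
        · exact ⟨k, by omega, not_lt.1 h3, h2.le⟩
    obtain ⟨j, hj, hj2⟩ := this N le_rfl (by rw [h.TN]; exact ht.2)
    have h3 := (h.pc j hj).img
    have h4 : D.γ t ∈ D.γ '' Icc (T j) (T (j+1)) := ⟨t, hj2, rfl⟩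
    rw [h3] at h4
    obtain ⟨x, hx, hx2⟩ := h4
    exact ⟨j, hj, x, hx, hx2.symm⟩
  have hcor : ∀ w ∈ (fun j => D.γ (T j)) '' Iio N, Corner D.G w (e (iv w)) (al (iv w)) M M⁻¹ ∧ lam ≤ 2 - al (iv w) := by
    rintro _ ⟨j, hj, rfl⟩
    simp only
    rw [hiv' j hj]
    exact ⟨(h.co j hj).mono (m1 j hj) (m2 j hj) hi0, h.la j hj⟩
  have hre : ∀ k < N, ∀ x ∈ Icc (0:ℝ) 1, σ k x ∈ frontier D.G := by
    intro k hk x hx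
    obtain ⟨t, _, ht⟩ := (h.pc k hk).mem x hx
    rw [← ht, ← gam_range]; exact mem_range_self _
  have hint : ∀ f : ℂ → ℂ, ContinuousOn f (frontier D.G) → ∫ s in (0:ℝ)..D.l, f (D.γ s) =
      ∑ j ∈ Finset.range N, ∫ x in (0:ℝ)..1, (‖deriv (σ j) x‖ : ℂ) * f (σ j x) := by
    intro f hf
    have hcf : Continuous fun t => f (D.γ t) := hf.comp_continuous D.γ_cont (fun t => by rw [← gam_range]; exact mem_range_self _)
    have hp : Function.Periodic (fun t => f (D.γ t)) D.l := fun t => by simp only [D.γ_periodic t]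
    have h1 := hp.intervalIntegral_add_eq 0 (T 0)
    rw [zero_add, ← h.TN] at h1
    rw [h1, ← intervalIntegral.sum_integral_adjacent_intervals (fun k _ => hcf.intervalIntegrable _ _)]
    refine Finset.sum_congr rfl fun k hk => ?_
    have hk := Finset.mem_range.1 hk
    have p := h.pc k hk
    exact arc_integral D p.arc p.lt p.bl p.mem p.s0 p.s1 hf
  have hfin : ((fun j => D.γ (T j)) '' Iio N).Finite := (finite_Iio N).image _
  rcases h.ss 0 (by omega) with hs | hs <;> rw [hs] at hs0 e0 e1
  · refine ⟨N, σ, V, c, M, (fun j => D.γ (T j)) '' Iio N, fun w => e (iv w), fun w => al (iv w), by linarith, by omega, fun k hk => ?_, hint, ?_, cov, ?_, hfin, fun k hk x hx hJ => h.nJ k hk x hx (hsub hJ), ?_, ?_, hcor, ?_, ?_⟩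
    · exact ⟨(h.pc k hk).arc, hc, hc2, ((hc0 k hk).2 c hc (hcc k hk)).1, fun ζ hζ h2 => (sd0 k hk ζ hζ).1 (by rw [hs0 k hk]; linarith),
        fun ζ hζ h2 => (sd0 k hk ζ hζ).2 (by rw [hs0 k hk]; linarith), hre k hk⟩
    · intro v
      rw [Finset.sum_congr rfl (g := fun j => v (D.γ (T (j+1))) - v (D.γ (T j))) (fun j hj => by rw [(h.pc j (Finset.mem_range.1 hj)).s0, (h.pc j (Finset.mem_range.1 hj)).s1]),
        Finset.sum_range_sub (fun j => v (D.γ (T j))), h.TN, D.γ_periodic, sub_self]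
    · intro j hj; left; rw [(h.pc j (by omega)).s1, (h.pc (j+1) hj).s0]
    · intro j hj; rw [(h.pc j hj).s0]; exact ⟨j, hj, rfl⟩
    · intro j hj; rw [(h.pc j hj).s1]; exact jm1 j hj
    · intro j hj; rw [(h.pc j hj).s0]; exact e0 j hj
    · intro j hj; rw [(h.pc j hj).s1]; exact e1 j hj
  · refine ⟨N, fun k ζ => σ k (1 - ζ), fun k => (fun ζ => 1 - ζ) ⁻¹' V k, c, M, (fun j => D.γ (T j)) '' Iio N, fun w => e (iv w), fun w => al (iv w), by linarith, by omega, fun k hk => ?_, ?_, ?_, ?_, ?_, hfin, fun k hk x hx hJ => h.nJ k hk (1-x) ⟨by linarith [hx.2], by linarith [hx.1]⟩ (hsub (by simpa using hJ)), ?_, ?_, hcor, ?_, ?_⟩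
    · exact ⟨(h.pc k hk).arc.rev, hc, hc2, fun z hz => ((hc0 k hk).2 c hc (hcc k hk)).1 (Nset_rev.2 hz),
        fun ζ hζ h2 => (sd0 k hk _ (Nset_rev.2 hζ)).1 (by rw [hs0 k hk]; simp; linarith),
        fun ζ hζ h2 => (sd0 k hk _ (Nset_rev.2 hζ)).2 (by rw [hs0 k hk]; simp; linarith), fun x hx => by
          have := hre k hk (1-x) ⟨by linarith [hx.2], by linarith [hx.1]⟩
          simpa using this⟩
    · intro f hf
      rw [hint f hf]
      refine Finset.sum_congr rfl fun k hk => ?_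
      have := intervalIntegral.integral_comp_sub_left (a := 0) (b := 1) (fun x : ℝ => (‖deriv (σ k) x‖ : ℂ) * f (σ k x)) 1
      simp only [sub_self, sub_zero] at this
      rw [← this]
      simp [deriv_comp_const_sub]
    · intro v
      rw [Finset.sum_congr rfl (g := fun j => v (D.γ (T j)) - v (D.γ (T (j+1)))) (fun j hj => by
        simp only [sub_self, sub_zero]; rw [(h.pc j (Finset.mem_range.1 hj)).s0, (h.pc j (Finset.mem_range.1 hj)).s1]),
        Finset.sum_range_sub' (fun j => v (D.γ (T j))), h.TN, D.γ_periodic, sub_self]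
    · intro w hw
      obtain ⟨j, hj, x, hx, h2⟩ := cov w hw
      exact ⟨j, hj, 1 - x, ⟨by linarith [hx.2], by linarith [hx.1]⟩, by simpa using h2⟩
    · intro j hj; right; simp only [sub_self, sub_zero]; rw [(h.pc j (by omega)).s1, (h.pc (j+1) hj).s0]
    · intro j hj; simp only [sub_zero]; rw [(h.pc j hj).s1]; exact jm1 j hj
    · intro j hj; simp only [sub_self]; rw [(h.pc j hj).s0]; exact ⟨j, hj, rfl⟩
    · intro j hj; simp only [sub_zero]; rw [(h.pc j hj).s1]; simpa using e1 j hj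
    · intro j hj; simp only [sub_self, sub_sub_cancel]; rw [(h.pc j hj).s0]; exact e0 j hj

theorem IsArc.nhds {σ : ℂ → ℂ} {V : Set ℂ} (h : IsArc σ V) {ζ : ℂ} (hζ : ζ ∈ V) : map σ (nhds ζ) = nhds (σ ζ) := by
  have hA : AnalyticAt ℂ σ ζ := h.diff.analyticAt (h.op.mem_nhds hζ)
  exact hA.hasStrictDerivAt.map_nhds_eq (h.deriv_ne hζ)

theorem Geo.acc {D lam N σ V c M J ee al} (g : Geo D lam N σ V c M J ee al) {A : Set ℂ} (hA : IsOpen A) (hAE : A ⊆ (closure D.G)ᶜ)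
    (hEA : IsOpen ((closure D.G)ᶜ \ A)) (hne : A.Nonempty) : ∀ j < N, (∀ ζ ∈ Nset c, ζ.im < 0 → σ j ζ ∈ A) ∧
      Sec (σ j 0) (-ee (σ j 0)) (Real.pi - al (σ j 0) * Real.pi / 2) M M⁻¹ ⊆ A ∧
      Sec (σ j 1) (-ee (σ j 1)) (Real.pi - al (σ j 1) * Real.pi / 2) M M⁻¹ ⊆ A := by
  have key : ∀ S : Set ℂ, IsPreconnected S → S ⊆ (closure D.G)ᶜ → (S ∩ A).Nonempty → S ⊆ A := fun S hS hSE hn =>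
    hS.subset_left_of_subset_union hA hEA disjoint_sdiff_self_right (fun z hz => by by_cases h : z ∈ A; exacts [Or.inl h, Or.inr ⟨hSE hz, h⟩]) hn
  have lens : ∀ j < N, (∃ ζ ∈ Nset c, ζ.im < 0 ∧ σ j ζ ∈ A) → ∀ ζ ∈ Nset c, ζ.im < 0 → σ j ζ ∈ A := by
    intro j hj ⟨z, hz, hz1, hz2⟩ ζ hζ h1
    have hl := g.lens j hj
    have hp : IsPreconnected (σ j '' {ζ | ζ ∈ Nset c ∧ 0 < (-1:ℝ) * ζ.im}) :=
      (half_convex c (-1)).isPreconnected.image _ (hl.arc.diff.continuousOn.mono (fun z hz => hl.sub hz.1))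
    refine key _ hp ?_ ⟨σ j z, ⟨z, ⟨hz, by linarith⟩, rfl⟩, hz2⟩ ⟨ζ, ⟨hζ, by linarith⟩, rfl⟩
    rintro _ ⟨y, ⟨hy, hy2⟩, rfl⟩
    exact hl.lo y hy (by linarith)
  have sec0 : ∀ j < N, (∀ ζ ∈ Nset c, ζ.im < 0 → σ j ζ ∈ A) ↔ Sec (σ j 0) (-ee (σ j 0)) (Real.pi - al (σ j 0) * Real.pi / 2) M M⁻¹ ⊆ A := by
    intro j hj
    have hl := g.lens j hj
    have hco := (g.cor _ (g.J0 j hj)).1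
    obtain ⟨-, z, hz, hz1, hz2⟩ := cone_pt hco (g.end0 j hj) hl.c0 hl.c2 (Or.inl rfl)
    exact ⟨fun h => key _ (Sec_preconn _ _ _ _ _) hco.out ⟨_, hz2, h z hz (by linarith)⟩, fun h => lens j hj ⟨z, hz, by linarith, h hz2⟩⟩
  have sec1 : ∀ j < N, (∀ ζ ∈ Nset c, ζ.im < 0 → σ j ζ ∈ A) ↔ Sec (σ j 1) (-ee (σ j 1)) (Real.pi - al (σ j 1) * Real.pi / 2) M M⁻¹ ⊆ A := by
    intro j hj
    have hl := g.lens j hj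
    have hco := (g.cor _ (g.J1 j hj)).1
    obtain ⟨-, z, hz, hz1, hz2⟩ := cone_pt hco (g.end1 j hj) hl.c0 hl.c2 (Or.inr rfl)
    exact ⟨fun h => key _ (Sec_preconn _ _ _ _ _) hco.out ⟨_, hz2, h _ (Nset_rev.2 hz) (by simp at hz1 ⊢; linarith)⟩,
      fun h => lens j hj ⟨1 - z, Nset_rev.2 hz, by simp at hz1 ⊢; linarith, h hz2⟩⟩
  have link : ∀ j, j + 1 < N → ((∀ ζ ∈ Nset c, ζ.im < 0 → σ j ζ ∈ A) ↔ (∀ ζ ∈ Nset c, ζ.im < 0 → σ (j+1) ζ ∈ A)) := by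
    intro j hj
    rcases g.link j hj with h | h
    · rw [sec1 j (by omega), sec0 (j+1) hj, h]
    · rw [sec0 j (by omega), sec1 (j+1) hj, h]
  have all : ∀ j < N, (∀ ζ ∈ Nset c, ζ.im < 0 → σ j ζ ∈ A) ↔ (∀ ζ ∈ Nset c, ζ.im < 0 → σ 0 ζ ∈ A) := by
    intro j
    induction j with
    | zero => simp
    | succ j ih => intro hj; rw [← link j hj, ih (by omega)]
  have ex : ∃ j < N, ∃ ζ ∈ Nset c, ζ.im < 0 ∧ σ j ζ ∈ A := by
    by_contra hno
    push Not at hno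
    have hGA : Disjoint D.G (closure A) := by
      refine Disjoint.closure_right ?_ D.isOpen
      exact disjoint_left.2 fun z hz hz2 => hAE hz2 (subset_closure hz)
    have hfr : frontier A ⊆ J := by
      intro t ht
      have htA : t ∉ A := by rw [hA.frontier_eq] at ht; exact ht.2
      have htc : t ∈ closure A := frontier_subset_closure ht
      have htE : t ∈ closure D.G := by
        by_contra h
        have h1 : t ∈ (closure D.G)ᶜ \ A := ⟨h, htA⟩
        have := mem_closure_iff.1 htc _ hEA h1
        obtain ⟨y, hy, hy2⟩ := this
        exact hy.2 hy2
      have htG : t ∉ D.G := fun h => disjoint_left.1 hGA h htc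
      obtain ⟨j, hj, x, hx, rfl⟩ := g.cover t (by rw [D.isOpen.frontier_eq]; exact ⟨htE, htG⟩)
      rcases eq_or_lt_of_le hx.1 with h0 | h0
      · rw [← h0]; simpa using g.J0 j hj
      rcases eq_or_lt_of_le hx.2 with h1 | h1
      · rw [h1]; simpa using g.J1 j hj
      exfalso
      have hl := g.lens j hj
      have hxN : (x:ℂ) ∈ Nset c := by
        have := hl.c0
        simp only [Nset, mem_ofPred_eq, ofReal_im, abs_zero, ofReal_re]
        exact ⟨by positivity, mul_pos this (by linarith)⟩
      have hn : σ j '' Nset c ∈ nhds (σ j x) := by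
        rw [← hl.arc.nhds (hl.sub hxN)]
        exact image_mem_map ((Nset_open c).mem_nhds hxN)
      obtain ⟨_, ⟨z, hz, rfl⟩, hz2⟩ := mem_closure_iff_nhds.1 htc _ hn
      rcases lt_trichotomy z.im 0 with h | h | h
      · exact hno j hj z hz h hz2
      · have hzr : z = (z.re : ℂ) := Complex.ext (by simp) (by simp [h])
        have := hl.re z.re (Ioo_subset_Icc_self (Nset_re hl.c0 hz))
        rw [← hzr] at this
        exact hAE hz2 (frontier_subset_closure this)
      · exact hAE hz2 (subset_closure (hl.up z hz h))
    have hcon : IsPreconnected Jᶜ := (Set.Countable.isPathConnected_compl_of_one_lt_rank (by rw [Complex.rank_real_complex]; norm_num) g.Jfin.countable).isConnected.isPreconnected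
    obtain ⟨p, hp, hpJ⟩ := (Set.Countable.dense_compl ℝ g.Jfin.countable).inter_open_nonempty _ D.isOpen D.nonempty
    obtain ⟨q, hq, hqJ⟩ := (Set.Countable.dense_compl ℝ g.Jfin.countable).inter_open_nonempty _ hA hne
    have := hcon.subset_left_of_subset_union hA isClosed_closure.isOpen_compl (disjoint_left.2 fun z hz hz2 => hz2 (subset_closure hz)) (v := (closure A)ᶜ) (fun z hz => by
      by_cases h : z ∈ A
      · exact Or.inl h
      · refine Or.inr fun h2 => hz (hfr ?_)
        rw [hA.frontier_eq]; exact ⟨h2, h⟩) ⟨q, hqJ, hq⟩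
    exact disjoint_left.1 hGA hp (subset_closure (this hpJ))
  obtain ⟨j0, hj0, hex⟩ := ex
  have h0 := (all j0 hj0).1 (lens j0 hj0 hex)
  intro j hj
  have h1 := (all j hj).2 h0
  exact ⟨h1, (sec0 j hj).1 h1, (sec1 j hj).1 h1⟩

theorem max_lim {U : Set ℂ} (hU : IsOpen U) (hb : Bornology.IsBounded U) {f : ℂ → ℂ} (hf : DifferentiableOn ℂ f U) {M : ℝ}
    (h : ∀ a ∈ frontier U, ∀ ε > 0, ∀ᶠ z in nhdsWithin a U, ‖f z‖ ≤ M + ε) : ∀ z ∈ U, ‖f z‖ ≤ M := by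
  intro z hz
  refine le_of_forall_pos_le_add fun ε hε => ?_
  set U' : Set ℂ := U ∩ {z | M + ε < ‖f z‖} with hU'
  have ho : IsOpen U' := hf.continuousOn.norm.isOpen_inter_preimage hU isOpen_Ioi
  have hcl : closure U' ⊆ U := by
    intro a ha
    by_contra haU
    have haf : a ∈ frontier U := by rw [hU.frontier_eq]; exact ⟨closure_mono inter_subset_left ha, haU⟩
    obtain ⟨t, ht, h2⟩ := mem_nhdsWithin_iff_exists_mem_nhds_inter.1 (h a haf ε hε)
    obtain ⟨y, hy1, hy2⟩ := mem_closure_iff_nhds.1 ha t ht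
    have h3 : ‖f y‖ ≤ M + ε := h2 ⟨hy1, hy2.1⟩
    exact absurd h3 (not_le.2 hy2.2)
  have hd : DiffContOnCl ℂ f U' := ⟨hf.mono inter_subset_left, hf.continuousOn.mono hcl⟩
  by_contra hlt
  push Not at hlt
  refine absurd (Complex.norm_le_of_forall_mem_frontier_norm_le (hb.subset inter_subset_left) hd (C := M + ε) (fun a ha => ?_) (subset_closure ⟨hz, hlt⟩)) (not_le.2 hlt)
  rw [ho.frontier_eq] at ha
  by_contra h3
  exact ha.2 ⟨hcl ha.1, not_le.1 h3⟩

theorem arg_neg_abs {u : ℂ} (hu : u ≠ 0) : |arg (-u)| = Real.pi - |arg u| := by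
  have hp := Real.pi_pos
  have h1 := neg_pi_lt_arg u
  have h2 := arg_le_pi u
  rcases lt_trichotomy u.im 0 with h | h | h
  · rw [arg_neg_eq_arg_add_pi_of_im_neg h, abs_of_nonneg (by linarith), abs_of_neg (arg_neg_iff.2 h)]; ring
  · have hr : u = (u.re : ℂ) := Complex.ext (by simp) (by simp [h])
    have hr0 : u.re ≠ 0 := fun h0 => hu (by rw [hr, h0]; simp)
    rcases lt_or_gt_of_ne hr0 with h3 | h3
    · rw [hr, ← ofReal_neg, arg_ofReal_of_nonneg (by linarith), arg_ofReal_of_neg h3, abs_of_pos hp]; simp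
    · rw [hr, ← ofReal_neg, arg_ofReal_of_neg (by linarith), arg_ofReal_of_nonneg h3.le, abs_of_pos hp]; simp
  · have h3 : 0 ≤ arg u := arg_nonneg_iff.2 h.le
    rw [arg_neg_eq_arg_sub_pi_of_im_pos h, abs_of_nonpos (by linarith), abs_of_nonneg h3]; ring

theorem polar_arg {w w0 e : ℂ} (he : ‖e‖ = 1) : w = w0 + e * ((‖w - w0‖ : ℝ) * exp ((arg ((w - w0) / e) : ℝ) * I)) := by
  have h0 : e ≠ 0 := by rintro rfl; simp at he
  have := norm_mul_exp_arg_mul_I ((w - w0) / e)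
  rw [norm_div, he, div_one] at this
  rw [this]; field_simp; ring

theorem polar_eq {w w0 e : ℂ} (he : ‖e‖ = 1) {ρ θ : ℝ} (hρ : 0 < ρ) (hθ : |θ| < Real.pi) (h : w = w0 + e * (ρ * exp (θ * I))) :
    ‖w - w0‖ = ρ ∧ arg ((w - w0) / e) = θ := by
  have h0 : e ≠ 0 := by rintro rfl; simp at he
  have h1 : (w - w0) / e = ρ * exp (θ * I) := by rw [h]; field_simp; ring
  have h2 : ‖(w - w0) / e‖ = ρ := by rw [h1, norm_mul, norm_exp_ofReal_mul_I, mul_one, norm_real, Real.norm_of_nonneg hρ.le]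
  rw [norm_div, he, div_one] at h2
  refine ⟨h2, ?_⟩
  rw [h1, arg_real_mul _ hρ, arg_exp_mul_I, toIocMod_eq_self]
  rw [abs_lt] at hθ
  exact ⟨hθ.1, by linarith [hθ.2]⟩

theorem notSec {w w0 e : ℂ} {h C r : ℝ} (he : ‖e‖ = 1) (hw : w ∉ Sec w0 e h C r) (h0 : w ≠ w0) (hr : ‖w - w0‖ < r) :
    h - C * ‖w - w0‖ ≤ |arg ((w - w0) / e)| := by
  by_contra hlt
  push Not at hlt
  exact hw ⟨‖w - w0‖, _, norm_pos_iff.2 (sub_ne_zero.2 h0), hr, hlt, polar_arg he⟩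

/-- points outside the sector with axis `-e`, seen from `e` -/
theorem notSec' {w w0 e : ℂ} {h C r : ℝ} (he : ‖e‖ = 1) (hw : w ∉ Sec w0 (-e) (Real.pi - h) C r) (h0 : w ≠ w0) (hr : ‖w - w0‖ < r) :
    |arg ((w - w0) / e)| ≤ h + C * ‖w - w0‖ := by
  have h1 := notSec (by rwa [norm_neg]) hw h0 hr
  have hne : (w - w0) / e ≠ 0 := div_ne_zero (sub_ne_zero.2 h0) (by rintro rfl; simp at he)
  rw [div_neg, arg_neg_abs hne] at h1
  linarith

theorem cpow_re (u : ℂ) (hu : u ≠ 0) (b : ℝ) : (u ^ (b : ℂ)).re = ‖u‖ ^ b * Real.cos (b * arg u) ∧ ‖u ^ (b:ℂ)‖ = ‖u‖ ^ b := by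
  constructor
  · rw [cpow_def_of_ne_zero hu, exp_re]
    have h1 : (log u * b).re = Real.log ‖u‖ * b := by simp [log_re]
    have h2 : (log u * b).im = b * arg u := by simp [log_im]; ring
    rw [h1, h2, Real.rpow_def_of_pos (norm_pos_iff.2 hu)]
  · exact norm_cpow_real u b

/-- the barrier `u^b + s u^(b+1/2)` -/
noncomputable def bar (b s : ℝ) (u : ℂ) : ℂ := u ^ (b:ℂ) + s * u ^ ((b + 1/2 : ℝ) : ℂ)

theorem bar_re (b s : ℝ) {u : ℂ} (hu : u ≠ 0) : (bar b s u).re =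
    ‖u‖ ^ b * ((1 + s * Real.sqrt ‖u‖ * Real.cos (|arg u|/2)) * Real.cos (b * |arg u|) - s * Real.sqrt ‖u‖ * Real.sin (b * |arg u|) * Real.sin (|arg u|/2)) := by
  have h1 := (cpow_re u hu b).1
  have h2 := (cpow_re u hu (b + 1/2)).1
  have hp := norm_pos_iff.2 hu
  rw [bar, add_re, re_ofReal_mul, h1, h2, Real.rpow_add hp, ← Real.sqrt_eq_rpow]
  have e1 : Real.cos (b * arg u) = Real.cos (b * |arg u|) := by
    rcases abs_choice (arg u) with h | h <;> rw [h]
    rw [mul_neg, Real.cos_neg]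
  have e2 : Real.cos ((b + 1/2) * arg u) = Real.cos (b * |arg u| + |arg u|/2) := by
    rcases abs_choice (arg u) with h | h <;> rw [h]
    · ring_nf
    · rw [← Real.cos_neg]; ring_nf
  rw [e1, e2, Real.cos_add]; ring

theorem bar_norm (b s : ℝ) (hs : |s| ≤ 1) {u : ℂ} (hu : u ≠ 0) (hu1 : ‖u‖ ≤ 1) : ‖bar b s u‖ ≤ 2 * ‖u‖ ^ b := by
  have hp := norm_pos_iff.2 hu
  have h3 : ‖u‖ ^ (b + 1/2) ≤ ‖u‖ ^ b := Real.rpow_le_rpow_of_exponent_ge hp hu1 (by linarith)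
  calc ‖bar b s u‖ ≤ ‖u ^ (b:ℂ)‖ + ‖(s:ℂ) * u ^ ((b + 1/2 : ℝ) : ℂ)‖ := norm_add_le _ _
    _ = ‖u‖ ^ b + |s| * ‖u‖ ^ (b + 1/2) := by rw [norm_mul, (cpow_re u hu b).2, (cpow_re u hu (b+1/2)).2, norm_real, Real.norm_eq_abs]
    _ ≤ _ := by nlinarith [Real.rpow_nonneg hp.le (b+1/2)]

theorem bar_diff (b s : ℝ) {u : ℂ} (hu : u ∈ slitPlane) : DifferentiableAt ℂ (bar b s) u := by
  unfold bar
  exact (differentiableAt_id.cpow_const hu).add ((differentiableAt_id.cpow_const hu).const_mul _)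

theorem small_ev (A : ℝ) {B : ℝ} (hB : 0 < B) : ∀ᶠ r : ℝ in nhdsWithin 0 (Ioi 0), A * r < B := by
  have h : Continuous fun r : ℝ => A * r := by fun_prop
  have := h.tendsto 0
  simp only [mul_zero] at this
  exact (this.mono_left nhdsWithin_le_nhds).eventually_lt_const hB

theorem bar_case {x t s0 K c sn : ℝ} (hx0 : 0 ≤ x) (hx1 : x ≤ K * (t * t)) (hx2 : x ≤ 1/2) (ht0 : 0 < t) (ht1 : t ≤ 1/2) (hc1 : c ≤ 1) (hc0 : 0 ≤ c)
    (hs : 0 < s0) (s3 : s0 ≤ sn) (k2 : 2 * K * t < s0) :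
    (1 + t * c) * Real.sin x < t * Real.cos x * sn + t * c * Real.sin x * 2 := by
  have c2 : Real.sin x ≤ K * (t * t) := (Real.sin_le hx0).trans hx1
  have s2 : 1/2 ≤ Real.cos x := by
    have := Real.one_sub_sq_div_two_le_cos (x := x)
    have : x ^ 2 ≤ 1 := by nlinarith
    linarith
  have s4 : 0 ≤ Real.sin x := Real.sin_nonneg_of_nonneg_of_le_pi hx0 (by linarith [Real.pi_gt_three])
  have k1 : 1/2 * s0 ≤ Real.cos x * sn := by gcongr
  have k4 := mul_lt_mul_of_pos_left k2 ht0
  have k5 := mul_le_mul_of_nonneg_left k1 ht0.le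
  have k6 : 0 ≤ t * c * Real.sin x := by positivity
  nlinarith

theorem bar_pos {h b C : ℝ} (h0 : 0 < h) (hπ : h < Real.pi) (hb : b * h = Real.pi / 2) (hC : 0 ≤ C) :
    ∃ r1 > 0, r1 ≤ 1 ∧ h + C * r1 < Real.pi ∧ ∀ u : ℂ, u ≠ 0 → ‖u‖ ≤ r1 → |arg u| ≤ h + C * ‖u‖ → 0 < (bar b (-1) u).re := by
  have hp := Real.pi_pos
  have hb0 : 0 < b := by by_contra hn; push Not at hn; nlinarith
  set s0 := Real.sin (h/2) with hs0
  have hs : 0 < s0 := Real.sin_pos_of_pos_of_lt_pi (by linarith) (by linarith)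
  have hs1 : s0 ≤ 1 := Real.sin_le_one _
  obtain ⟨r1, hr1, hr2⟩ : ∃ r1 > 0, r1 ≤ 1/4 ∧ C * r1 < Real.pi - h ∧ b * C * r1 ≤ 1/2 ∧ 4 * (b * C) ^ 2 * r1 < s0 ^ 2 := by
    obtain ⟨r, h1, h2, h3, h4, h5⟩ := ((eventually_mem_nhdsWithin (s := Ioi (0:ℝ)) (a := 0)).and ((small_ev 1 (B := 1/4) (by norm_num)).and
      ((small_ev C (B := Real.pi - h) (by linarith)).and ((small_ev (b * C) (B := 1/2) (by norm_num)).and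
        (small_ev (4 * (b * C) ^ 2) (B := s0 ^ 2) (by positivity)))))).exists
    exact ⟨r, h1, by linarith, h3, h4.le, h5⟩
  obtain ⟨hr2, hr3, hr4, hr5⟩ := hr2
  refine ⟨r1, hr1, by linarith, by linarith, fun u hu hur harg => ?_⟩
  have hun := norm_pos_iff.2 hu
  rw [bar_re _ _ hu]
  refine mul_pos (Real.rpow_pos_of_pos hun _) ?_
  set t := Real.sqrt ‖u‖ with ht
  have htt : t * t = ‖u‖ := Real.mul_self_sqrt hun.le
  have ht0 : 0 < t := Real.sqrt_pos.2 hun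
  have ht1 : t ≤ 1/2 := by nlinarith only [htt, hur, hr2, ht0]
  set θ := |arg u| with hθ
  have hθ0 : 0 ≤ θ := abs_nonneg _
  have hCu : C * ‖u‖ ≤ C * r1 := by gcongr
  have hc1 : Real.cos (θ/2) ≤ 1 := Real.cos_le_one _
  have hc0 : 0 ≤ Real.cos (θ/2) := Real.cos_nonneg_of_mem_Icc ⟨by linarith, by linarith⟩
  have hA : 1/2 ≤ 1 + -1 * t * Real.cos (θ/2) := by nlinarith only [ht0, ht1, hc0, hc1]
  rcases le_or_gt θ h with hle | hgt
  · have hbθ : b * θ ≤ Real.pi / 2 := by rw [← hb]; gcongr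
    have c1 : 0 ≤ Real.cos (b * θ) := Real.cos_nonneg_of_mem_Icc ⟨by linarith [mul_nonneg hb0.le hθ0], hbθ⟩
    rcases eq_or_lt_of_le hθ0 with hz | hz
    · rw [← hz]; simp; linarith
    · have s1 : 0 < Real.sin (b * θ) := Real.sin_pos_of_pos_of_lt_pi (by positivity) (by linarith)
      have s2 : 0 < Real.sin (θ/2) := Real.sin_pos_of_pos_of_lt_pi (by linarith) (by linarith)
      have := mul_pos (mul_pos ht0 s1) s2
      nlinarith only [this, c1, s1, hA, ht0, s2, mul_nonneg (show 0 ≤ 1 + -1 * t * Real.cos (θ/2) by linarith) c1]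
  · have hx0 : 0 ≤ b * (θ - h) := mul_nonneg hb0.le (by linarith)
    have hx1 : b * (θ - h) ≤ b * C * ‖u‖ := by rw [mul_assoc]; gcongr; linarith
    have hx2 : b * C * ‖u‖ ≤ 1/2 := le_trans (by gcongr) hr4
    have e1 : b * θ = b * (θ - h) + Real.pi/2 := by rw [← hb]; ring
    have c1 : Real.cos (b * θ) = - Real.sin (b * (θ - h)) := by rw [e1, Real.cos_add_pi_div_two]
    have s1 : Real.sin (b * θ) = Real.cos (b * (θ - h)) := by rw [e1, Real.sin_add_pi_div_two]
    have s3 : s0 ≤ Real.sin (θ/2) := Real.sin_le_sin_of_le_of_le_pi_div_two (by linarith) (by linarith) (by linarith)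
    have k2 : 2 * (b * C) * t < s0 := by
      have : (2 * (b * C) * t)^2 < s0^2 := by
        have : (2 * (b * C) * t)^2 = 4 * (b*C)^2 * ‖u‖ := by rw [← htt]; ring
        rw [this]
        exact lt_of_le_of_lt (by gcongr) hr5
      exact lt_of_pow_lt_pow_left₀ 2 hs.le this
    have := bar_case hx0 (by rw [htt]; exact hx1) (hx1.trans hx2) ht0 ht1 hc1 hc0 hs s3 k2
    rw [c1, s1]
    linarith

theorem par_diff {a b d : ℝ} {p g : ℝ → ℂ} (hp : IntervalIntegrable p volume a b) (hg : ContinuousOn g (uIoc a b)) {w0 : ℂ} (hd : 0 < d)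
    (h : ∀ s ∈ uIoc a b, d ≤ ‖w0 - g s‖) : HasDerivAt (fun w => ∫ s in a..b, p s / (w - g s)) (∫ s in a..b, -p s / (w0 - g s) ^ 2) w0 := by
  have key : ∀ s ∈ uIoc a b, ∀ w ∈ ball w0 (d/2), d/2 ≤ ‖w - g s‖ := fun s hs w hw => by
    rw [mem_ball, dist_eq_norm] at hw
    have h1 := h s hs
    have h2 : ‖w0 - g s‖ ≤ ‖w - g s‖ + ‖w - w0‖ := by
      rw [show w0 - g s = (w - g s) - (w - w0) by ring]; exact norm_sub_le _ _
    linarith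
  have hm : AEStronglyMeasurable g (volume.restrict (uIoc a b)) := hg.aestronglyMeasurable measurableSet_uIoc
  have hpm : AEStronglyMeasurable p (volume.restrict (uIoc a b)) := (intervalIntegrable_iff.1 hp).aestronglyMeasurable
  have hb0 : ball w0 (d/2) ∈ nhds w0 := ball_mem_nhds _ (by linarith)
  refine (intervalIntegral.hasDerivAt_integral_of_dominated_loc_of_deriv_le (F := fun w s => p s / (w - g s)) (F' := fun w s => -p s / (w - g s)^2)
    (s := ball w0 (d/2)) (bound := fun s => ‖p s‖ * ((d/2)^2)⁻¹) hb0 ?_ ?_ ?_ ?_ ?_ ?_).2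
  · refine Eventually.of_forall fun w => ?_
    exact (hpm.aemeasurable.div (aemeasurable_const.sub hm.aemeasurable)).aestronglyMeasurable
  · refine (hp.norm.mul_const (d⁻¹)).mono_fun (hpm.aemeasurable.div (aemeasurable_const.sub hm.aemeasurable)).aestronglyMeasurable ?_
    refine (ae_restrict_iff' measurableSet_uIoc).2 (Eventually.of_forall fun s hs => ?_)
    beta_reduce; rw [norm_div, norm_mul, norm_norm, div_eq_mul_inv, norm_inv, Real.norm_of_nonneg hd.le]
    exact mul_le_mul_of_nonneg_left (inv_anti₀ hd (h s hs)) (norm_nonneg _)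
  · exact (hpm.aemeasurable.neg.div ((aemeasurable_const.sub hm.aemeasurable).pow_const 2)).aestronglyMeasurable
  · refine Eventually.of_forall fun s hs w hw => ?_
    rw [norm_div, norm_neg, norm_pow, div_eq_mul_inv]
    have := key s hs w hw
    gcongr
  · exact hp.norm.mul_const _
  · refine Eventually.of_forall fun s hs w hw => ?_
    have hne : w - g s ≠ 0 := norm_pos_iff.1 (lt_of_lt_of_le (by linarith) (key s hs w hw))
    refine ((hasDerivAt_const w (p s)).fun_div ((hasDerivAt_id w).sub_const (g s)) hne).congr_deriv ?_
    simp

noncomputable def Cau (D : JordanDomain) (P : Polynomial ℂ) (w : ℂ) : ℂ :=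
  ∫ s in (0:ℝ)..D.l, (starRingEnd ℂ) (P.eval (D.γ s)) / (w - D.γ s)

structure Orth (D : JordanDomain) (P : Polynomial ℂ) (n : ℕ) : Prop where
  orth : ∀ Q : Polynomial ℂ, Q.natDegree ≤ n → ∫ s in (0:ℝ)..D.l, (starRingEnd ℂ) (P.eval (D.γ s)) * Q.eval (D.γ s) = 0
  norm : ∫ s in (0:ℝ)..D.l, ‖P.eval (D.γ s)‖ ^ 2 ≤ D.l

theorem cs_int {l s B : ℝ} (hl : 0 ≤ l) (hs : 0 < s) {f g : ℝ → ℂ} (hf : Continuous f) (hg : Continuous g) (h1 : ∫ x in (0:ℝ)..l, ‖f x‖^2 ≤ B)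
    (h2 : ∫ x in (0:ℝ)..l, ‖g x‖^2 ≤ B * s^2) : ‖∫ x in (0:ℝ)..l, f x * g x‖ ≤ B * s := by
  calc _ ≤ ∫ x in (0:ℝ)..l, ‖f x * g x‖ := intervalIntegral.norm_integral_le_integral_norm hl
    _ ≤ ∫ x in (0:ℝ)..l, (s/2 * ‖f x‖^2 + (2*s)⁻¹ * ‖g x‖^2) := by
      refine intervalIntegral.integral_mono_on hl (by apply Continuous.intervalIntegrable; fun_prop) (by apply Continuous.intervalIntegrable; fun_prop) fun x _ => ?_
      rw [norm_mul]
      have : s/2 * ‖f x‖^2 + (2*s)⁻¹ * ‖g x‖^2 - ‖f x‖ * ‖g x‖ = (2*s)⁻¹ * (s * ‖f x‖ - ‖g x‖)^2 := by field_simp; ring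
      nlinarith [mul_nonneg (inv_nonneg.2 (by linarith : (0:ℝ) ≤ 2*s)) (sq_nonneg (s * ‖f x‖ - ‖g x‖))]
    _ = s/2 * (∫ x in (0:ℝ)..l, ‖f x‖^2) + (2*s)⁻¹ * ∫ x in (0:ℝ)..l, ‖g x‖^2 := by
      rw [intervalIntegral.integral_add, intervalIntegral.integral_const_mul, intervalIntegral.integral_const_mul]
      all_goals apply Continuous.intervalIntegrable; fun_prop
    _ ≤ s/2 * B + (2*s)⁻¹ * (B * s^2) := by gcongr
    _ = _ := by field_simp; ring

section cau
variable (D : JordanDomain)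

theorem gam_mem (s : ℝ) : D.γ s ∈ frontier D.G := by rw [← gam_range]; exact mem_range_self s

theorem fr_ne : (frontier D.G).Nonempty := ⟨_, gam_mem D 0⟩

theorem d_pos {w : ℂ} (hw : w ∉ frontier D.G) : 0 < infDist w (frontier D.G) :=
  (isClosed_frontier.notMem_iff_infDist_pos (fr_ne D)).1 hw

theorem d_le (w : ℂ) (s : ℝ) : infDist w (frontier D.G) ≤ ‖w - D.γ s‖ := by
  rw [← dist_eq_norm]; exact infDist_le_dist_of_mem (gam_mem D s)

theorem gam_sub_ne {w : ℂ} (hw : w ∉ frontier D.G) (s : ℝ) : w - D.γ s ≠ 0 :=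
  norm_pos_iff.1 ((d_pos D hw).trans_le (d_le D w s))

theorem Cau_diff (P : Polynomial ℂ) {w : ℂ} (hw : w ∉ frontier D.G) : DifferentiableAt ℂ (Cau D P) w := by
  have := D.γ_cont
  refine (par_diff (p := fun s => (starRingEnd ℂ) (P.eval (D.γ s))) ?_ this.continuousOn (d_pos D hw) fun s _ => d_le D w s).differentiableAt
  apply Continuous.intervalIntegrable
  exact continuous_conj.comp (P.continuous.comp this)

/-- one step of the decay estimate -/
theorem Cau_pow {P : Polynomial ℂ} {n : ℕ} (hP : Orth D P n) {w : ℂ} (hw : w ∉ frontier D.G) (Q : Polynomial ℂ) {η : ℝ} (hη : 0 < η)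
    (h : ∀ t ∈ frontier D.G, ‖1 - (w - t) * Q.eval t‖ ≤ η) (m : ℕ) (hm : m * (Q.natDegree + 1) ≤ n) :
    ‖Cau D P w‖ ≤ D.l * (η ^ m / infDist w (frontier D.G)) := by
  have hd := d_pos D hw
  have hγ := D.γ_cont
  obtain ⟨R, hR⟩ : (Polynomial.C w - Polynomial.X) ∣ 1 - (1 - (Polynomial.C w - Polynomial.X) * Q) ^ m := by
    have h1 : (1 - (1 - (Polynomial.C w - Polynomial.X) * Q)) ∣ 1 ^ m - (1 - (Polynomial.C w - Polynomial.X) * Q) ^ m := sub_dvd_pow_sub_pow _ _ _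
    rw [one_pow, sub_sub_cancel] at h1
    exact (dvd_mul_right _ _).trans h1
  have hdegX : (Polynomial.C w - Polynomial.X : Polynomial ℂ).natDegree = 1 := by
    rw [← Polynomial.natDegree_neg, neg_sub]; exact Polynomial.natDegree_X_sub_C w
  have hdeg : R.natDegree ≤ n := by
    by_cases hR0 : R = 0
    · simp [hR0]
    have h0 : (Polynomial.C w - Polynomial.X : Polynomial ℂ) ≠ 0 := fun h => by rw [h] at hdegX; simp at hdegX
    have h2 : (1 - (1 - (Polynomial.C w - Polynomial.X) * Q) ^ m).natDegree ≤ m * (Q.natDegree + 1) := by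
      have h3 : (1 - (Polynomial.C w - Polynomial.X) * Q).natDegree ≤ Q.natDegree + 1 := by
        refine (Polynomial.natDegree_sub_le _ _).trans ?_
        have := Polynomial.natDegree_mul_le (p := (Polynomial.C w - Polynomial.X)) (q := Q)
        simp only [Polynomial.natDegree_one]
        omega
      refine (Polynomial.natDegree_sub_le _ _).trans ?_
      have h4 := (Polynomial.natDegree_pow_le (p := 1 - (Polynomial.C w - Polynomial.X) * Q) (n := m)).trans (Nat.mul_le_mul_left m h3)
      simp only [Polynomial.natDegree_one]
      omega
    rw [hR, Polynomial.natDegree_mul h0 hR0, hdegX] at h2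
    omega
  have hev : ∀ t, (w - t) * R.eval t = 1 - (1 - (w - t) * Q.eval t) ^ m := fun t => by
    have := congrArg (Polynomial.eval t) hR
    simp at this
    exact this.symm
  have hPc : Continuous fun s => (starRingEnd ℂ) (P.eval (D.γ s)) := continuous_conj.comp (P.continuous.comp hγ)
  have hQc : Continuous fun s => Q.eval (D.γ s) := Q.continuous.comp hγ
  have hRc : Continuous fun s => R.eval (D.γ s) := R.continuous.comp hγ
  have hgc : Continuous fun s => (1 - (w - D.γ s) * Q.eval (D.γ s)) ^ m / (w - D.γ s) :=
    Continuous.div (by fun_prop) (by fun_prop) (gam_sub_ne D hw)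
  have e1 : Cau D P w = ∫ s in (0:ℝ)..D.l, (starRingEnd ℂ) (P.eval (D.γ s)) * ((1 - (w - D.γ s) * Q.eval (D.γ s)) ^ m / (w - D.γ s)) := by
    rw [← sub_zero (Cau D P w), ← hP.orth R hdeg, Cau, ← intervalIntegral.integral_sub]
    · refine intervalIntegral.integral_congr fun s _ => ?_
      have h1 := hev (D.γ s)
      have h2 := gam_sub_ne D hw s
      beta_reduce
      field_simp
      linear_combination (-(starRingEnd ℂ) (P.eval (D.γ s))) * h1
    · exact (Continuous.div hPc (by fun_prop) (gam_sub_ne D hw)).intervalIntegrable _ _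
    · exact (hPc.mul hRc).intervalIntegrable _ _
  rw [e1]
  refine cs_int D.l_pos.le (by positivity) hPc hgc (by simpa using hP.norm) ?_
  calc _ ≤ ∫ s in (0:ℝ)..D.l, (η ^ m / infDist w (frontier D.G)) ^ 2 := by
        refine intervalIntegral.integral_mono_on D.l_pos.le ((hgc.norm.pow 2).intervalIntegrable _ _) (by simp) fun s _ => ?_
        rw [norm_div, norm_pow]
        have := h _ (gam_mem D s)
        have := d_le D w s
        gcongr
    _ = _ := by simp

/-- the set of exterior points where Runge approximation works -/
def RA : Set ℂ := {w | w ∈ (closure D.G)ᶜ ∧ ∃ Q : Polynomial ℂ, ∀ t ∈ frontier D.G, ‖1 - (w - t) * Q.eval t‖ ≤ 1/2}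

theorem RA_step {w w' : ℂ} (hw : w ∈ RA D) (hw' : w' ∈ (closure D.G)ᶜ) (h : ‖w' - w‖ ≤ infDist w (frontier D.G) / 8) : w' ∈ RA D := by
  obtain ⟨hE, Q, hQ⟩ := hw
  have hwf : w ∉ frontier D.G := fun h => hE (frontier_subset_closure h)
  have hd := d_pos D hwf
  refine ⟨hw', Q * (2 - (Polynomial.C w - Polynomial.X) * Q), fun t ht => ?_⟩
  have h1 := hQ t ht
  have hdt : infDist w (frontier D.G) ≤ ‖w - t‖ := by rw [← dist_eq_norm]; exact infDist_le_dist_of_mem ht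
  set q := Q.eval t
  have e1 : 1 - (w' - t) * (Q * (2 - (Polynomial.C w - Polynomial.X) * Q)).eval t = (1 - (w - t) * q)^2 - (w' - w) * (q * (2 - (w - t) * q)) := by
    simp; ring
  rw [e1]
  have e2 : (w - t) * (q * (2 - (w - t) * q)) = 1 - (1 - (w - t) * q)^2 := by ring
  have h2 : ‖(1 - (w - t) * q)^2‖ ≤ 1/4 := by
    rw [norm_pow]; nlinarith [norm_nonneg (1 - (w - t) * q)]
  have h3 : ‖w - t‖ * ‖q * (2 - (w - t) * q)‖ ≤ 5/4 := by
    rw [← norm_mul, e2]; refine (norm_sub_le _ _).trans ?_; rw [norm_one]; linarith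
  have h4 : ‖(w' - w) * (q * (2 - (w - t) * q))‖ ≤ 1/4 := by
    rw [norm_mul]
    calc _ ≤ ‖w - t‖ / 8 * ‖q * (2 - (w - t) * q)‖ := by gcongr; linarith
      _ ≤ _ := by linarith
  refine (norm_sub_le _ _).trans (by linarith)

theorem RA_open : IsOpen (RA D) := by
  rw [Metric.isOpen_iff]
  intro w hw
  have hwf : w ∉ frontier D.G := fun h => hw.1 (frontier_subset_closure h)
  obtain ⟨ε, hε, hb⟩ := Metric.isOpen_iff.1 isClosed_closure.isOpen_compl w hw.1
  refine ⟨min ε (infDist w (frontier D.G) / 8), lt_min hε (by linarith [d_pos D hwf]), fun w' hw' => RA_step D hw (hb (ball_subset_ball (min_le_left _ _) hw')) ?_⟩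
  rw [← dist_eq_norm]; exact (mem_ball.1 hw').le.trans (min_le_right _ _)

theorem RA_coopen : IsOpen ((closure D.G)ᶜ \ RA D) := by
  rw [Metric.isOpen_iff]
  intro w hw
  have hwf : w ∉ frontier D.G := fun h => hw.1 (frontier_subset_closure h)
  have hd := d_pos D hwf
  obtain ⟨ε, hε, hb⟩ := Metric.isOpen_iff.1 isClosed_closure.isOpen_compl w hw.1
  refine ⟨min ε (infDist w (frontier D.G) / 9), lt_min hε (by linarith), fun w' hw' => ⟨hb (ball_subset_ball (min_le_left _ _) hw'), fun hA => hw.2 (RA_step D hA hw.1 ?_)⟩⟩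
  have h1 : dist w w' < infDist w (frontier D.G) / 9 := by rw [dist_comm]; exact (mem_ball.1 hw').trans_le (min_le_right _ _)
  have h2 : infDist w (frontier D.G) ≤ infDist w' (frontier D.G) + dist w w' := infDist_le_infDist_add_dist
  rw [← dist_eq_norm]; linarith

theorem RA_ne : (RA D).Nonempty := by
  obtain ⟨R, hR⟩ := D.bounded.closure.exists_norm_le
  have h0 : 0 ≤ R := by obtain ⟨z, hz⟩ := D.nonempty; exact (norm_nonneg z).trans (hR z (subset_closure hz))
  have hn : ‖((2 * (R + 1) : ℝ) : ℂ)‖ = 2 * (R + 1) := by rw [norm_real, Real.norm_of_nonneg (by linarith)]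
  refine ⟨((2 * (R + 1) : ℝ) : ℂ), fun h => ?_, Polynomial.C (((2 * (R + 1) : ℝ) : ℂ))⁻¹, fun t ht => ?_⟩
  · have := hR _ h; rw [hn] at this; linarith
  · have := hR t (frontier_subset_closure ht)
    have hne : ((2 * (R + 1) : ℝ) : ℂ) ≠ 0 := norm_pos_iff.1 (by rw [hn]; linarith)
    rw [Polynomial.eval_C, show 1 - (((2 * (R + 1) : ℝ) : ℂ) - t) * (((2 * (R + 1) : ℝ) : ℂ))⁻¹ = t / ((2 * (R + 1) : ℝ) : ℂ) by field_simp; ring, norm_div, hn,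
      div_le_iff₀ (by linarith)]
    linarith

theorem Cau_loc {w0 : ℂ} (hw0 : w0 ∈ RA D) : ∃ C > 0, ∃ κ > 0, ∃ ε > 0, ∀ w ∈ ball w0 ε, ∀ n P, Orth D P n → ‖Cau D P w‖ ≤ C * Real.exp (-(κ * n)) := by
  obtain ⟨hE, Q, hQ⟩ := hw0
  have hwf : w0 ∉ frontier D.G := fun h => hE (frontier_subset_closure h)
  have hd := d_pos D hwf
  set d := infDist w0 (frontier D.G) with hdd
  obtain ⟨B, hB⟩ := ((gam_compact D).image_of_continuousOn Q.continuous.continuousOn).isBounded.exists_norm_le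
  have hl := D.l_pos
  have hlog : 0 < Real.log (4/3) := Real.log_pos (by norm_num)
  refine ⟨D.l * (4/3 / (d/2)), by positivity, Real.log (4/3) / (Q.natDegree + 1), by positivity, min (d/2) (1 / (4 * (|B| + 1))), by positivity, fun w hw n P hP => ?_⟩
  have hw1 : dist w w0 < d/2 := (mem_ball.1 hw).trans_le (min_le_left _ _)
  have hw2 : dist w w0 < 1 / (4 * (|B| + 1)) := (mem_ball.1 hw).trans_le (min_le_right _ _)
  have hdw : d/2 ≤ infDist w (frontier D.G) := by
    have : infDist w0 (frontier D.G) ≤ infDist w (frontier D.G) + dist w0 w := infDist_le_infDist_add_dist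
    rw [dist_comm] at this; linarith
  have hwn : w ∉ frontier D.G := (isClosed_frontier.notMem_iff_infDist_pos (fr_ne D)).2 (by linarith)
  set m := n / (Q.natDegree + 1) with hm
  have hmn : m * (Q.natDegree + 1) ≤ n := Nat.div_mul_le_self _ _
  refine (Cau_pow D hP hwn Q (η := 3/4) (by norm_num) (fun t ht => ?_) m hmn).trans ?_
  · have h1 := hQ t ht
    have h2 : ‖Q.eval t‖ ≤ |B| := (hB _ ⟨t, ht, rfl⟩).trans (le_abs_self B)
    rw [lt_div_iff₀ (by positivity), dist_eq_norm] at hw2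
    rw [show 1 - (w - t) * Q.eval t = (1 - (w0 - t) * Q.eval t) - (w - w0) * Q.eval t by ring]
    refine (norm_sub_le _ _).trans ?_
    rw [norm_mul]
    have := mul_le_mul_of_nonneg_left h2 (norm_nonneg (w - w0))
    nlinarith [norm_nonneg (w - w0)]
  · have h1 : (3/4 : ℝ) ^ m ≤ 4/3 * Real.exp (-(Real.log (4/3) / (Q.natDegree + 1) * n)) := by
      have h2 : (n:ℝ) ≤ (m + 1) * (Q.natDegree + 1) := by
        have : n < (m + 1) * (Q.natDegree + 1) := by
          rw [hm, Nat.mul_comm]; exact Nat.lt_mul_div_succ n (Nat.succ_pos _)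
        exact_mod_cast this.le
      have h3 : (3/4 : ℝ) ^ m = Real.exp (-(Real.log (4/3) * m)) := by
        rw [Real.exp_neg, Real.exp_mul, Real.exp_log (by norm_num), Real.rpow_natCast, ← inv_pow]; norm_num
      have h4 : (4/3 : ℝ) = Real.exp (Real.log (4/3)) := (Real.exp_log (by norm_num)).symm
      rw [h3]; nth_rewrite 2 [h4]; rw [← Real.exp_add, Real.exp_le_exp]
      have : Real.log (4/3) / (Q.natDegree + 1) * n ≤ Real.log (4/3) * (m + 1) := by
        rw [div_mul_eq_mul_div, div_le_iff₀ (by positivity), mul_assoc]; gcongr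
      linarith
    calc D.l * ((3/4) ^ m / infDist w (frontier D.G)) ≤ D.l * ((4/3 * Real.exp (-(Real.log (4/3) / (Q.natDegree + 1) * n))) / (d/2)) := by gcongr
      _ = _ := by ring

theorem Cau_cpt {K : Set ℂ} (hK : IsCompact K) (hKA : K ⊆ RA D) : ∃ C > 0, ∃ κ > 0, ∀ w ∈ K, ∀ n P, Orth D P n → ‖Cau D P w‖ ≤ C * Real.exp (-(κ * n)) := by
  refine hK.induction_on (p := fun K => ∃ C > 0, ∃ κ > 0, ∀ w ∈ K, ∀ n P, Orth D P n → ‖Cau D P w‖ ≤ C * Real.exp (-(κ * n))) ?_ ?_ ?_ ?_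
  · exact ⟨1, one_pos, 1, one_pos, by simp⟩
  · rintro s t hst ⟨C, hC, κ, hκ, h⟩; exact ⟨C, hC, κ, hκ, fun w hw => h w (hst hw)⟩
  · rintro s t ⟨C, hC, κ, hκ, h⟩ ⟨C', hC', κ', hκ', h'⟩
    refine ⟨max C C', by positivity, min κ κ', by positivity, ?_⟩
    rintro w (hw | hw) n P hP
    · refine (h w hw n P hP).trans ?_
      gcongr; exacts [le_max_left _ _, min_le_left _ _]
    · refine (h' w hw n P hP).trans ?_
      gcongr; exacts [le_max_right _ _, min_le_right _ _]
  · intro w hw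
    obtain ⟨C, hC, κ, hκ, ε, hε, h⟩ := Cau_loc D (hKA hw)
    exact ⟨ball w ε, mem_nhdsWithin_of_mem_nhds (ball_mem_nhds _ hε), C, hC, κ, hκ, h⟩

end cau

theorem arc_bilip {σ V} (h : IsArc σ V) : ∃ m > 0, ∀ x ∈ Icc (0:ℝ) 1, ∀ y ∈ Icc (0:ℝ) 1, m * |x - y| ≤ ‖σ x - σ y‖ := by
  have hK : IsCompact (Icc (0:ℝ) 1 ×ˢ Icc (0:ℝ) 1) := isCompact_Icc.prod isCompact_Icc
  suffices hh : ∃ m > 0, ∀ p ∈ Icc (0:ℝ) 1 ×ˢ Icc (0:ℝ) 1, m * |p.1 - p.2| ≤ ‖σ p.1 - σ p.2‖ by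
    obtain ⟨m, hm, h1⟩ := hh
    exact ⟨m, hm, fun x hx y hy => h1 (x, y) ⟨hx, hy⟩⟩
  refine hK.induction_on (p := fun S => ∃ m > 0, ∀ p ∈ S, m * |p.1 - p.2| ≤ ‖σ p.1 - σ p.2‖) ⟨1, one_pos, by simp⟩ ?_ ?_ ?_
  · rintro s t hst ⟨m, hm, h1⟩; exact ⟨m, hm, fun p hp => h1 p (hst hp)⟩
  · rintro s t ⟨m, hm, h1⟩ ⟨m', hm', h2⟩
    refine ⟨min m m', by positivity, ?_⟩
    rintro p (hp | hp)
    · refine le_trans ?_ (h1 p hp); gcongr; exact min_le_left _ _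
    · refine le_trans ?_ (h2 p hp); gcongr; exact min_le_right _ _
  · rintro ⟨x, y⟩ ⟨hx, hy⟩
    simp only at hx hy
    by_cases hxy : x = y
    · subst hxy
      have hA : AnalyticAt ℂ σ x := h.diff.analyticAt (h.op.mem_nhds (h.seg x hx))
      have hd := norm_pos_iff.2 (h.deriv_ne (h.seg x hx))
      have h1 := (hasStrictDerivAt_iff_hasStrictFDerivAt.1 hA.hasStrictDerivAt).isLittleO.bound (half_pos hd)
      have hc : Tendsto (fun p : ℝ × ℝ => ((p.1 : ℂ), (p.2 : ℂ))) (nhds (x, x)) (nhds ((x:ℂ), (x:ℂ))) := by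
        have : Continuous fun p : ℝ × ℝ => ((p.1 : ℂ), (p.2 : ℂ)) := by fun_prop
        exact this.tendsto (x, x)
      refine ⟨_, mem_nhdsWithin_of_mem_nhds (hc.eventually h1), ‖deriv σ x‖/2, half_pos hd, fun p hp => ?_⟩
      simp only [mem_ofPred_eq, ContinuousLinearMap.toSpanSingleton_apply, smul_eq_mul] at hp
      have e1 : ‖((p.1:ℂ) - p.2)‖ = |p.1 - p.2| := by rw [← ofReal_sub, norm_real, Real.norm_eq_abs]
      have h2 := norm_sub_norm_le (((p.1:ℂ) - p.2) * deriv σ x) (((p.1:ℂ) - p.2) * deriv σ x - (σ p.1 - σ p.2))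
      rw [sub_sub_cancel, norm_mul, e1, norm_sub_rev (((p.1:ℂ) - p.2) * deriv σ x)] at h2
      rw [e1] at hp
      linarith
    · have hne : 0 < ‖σ x - σ y‖ := norm_pos_iff.2 (sub_ne_zero.2 fun he => hxy (h.injR hx hy he))
      have hc : ContinuousAt (fun p : ℝ × ℝ => ‖σ p.1 - σ p.2‖) (x, y) := by
        have c1 : ContinuousAt (fun p : ℝ × ℝ => σ p.1) (x, y) :=
          ContinuousAt.comp (f := fun p : ℝ × ℝ => (p.1 : ℂ)) (g := σ) (h.hasDeriv (h.seg x hx)).continuousAt (by fun_prop)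
        have c2 : ContinuousAt (fun p : ℝ × ℝ => σ p.2) (x, y) :=
          ContinuousAt.comp (f := fun p : ℝ × ℝ => (p.2 : ℂ)) (g := σ) (h.hasDeriv (h.seg y hy)).continuousAt (by fun_prop)
        exact (c1.sub c2).norm
      have h1 : ∀ᶠ p : ℝ × ℝ in nhds (x, y), ‖σ x - σ y‖ / 2 < ‖σ p.1 - σ p.2‖ := hc.eventually_const_lt (half_lt_self hne)
      have hK2 : ∀ᶠ p : ℝ × ℝ in nhds (x, y), |p.1 - p.2| < 2 := by
        have : ContinuousAt (fun p : ℝ × ℝ => |p.1 - p.2|) (x, y) := by fun_prop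
        refine this.eventually_lt_const ?_
        simp only [abs_lt]; constructor <;> linarith [hx.1, hx.2, hy.1, hy.2]
      refine ⟨_, mem_nhdsWithin_of_mem_nhds (h1.and hK2), ‖σ x - σ y‖/4, by positivity, fun p hp => ?_⟩
      obtain ⟨q1, q2⟩ := hp
      nlinarith [abs_nonneg (p.1 - p.2)]

theorem arc_inv_sq {σ V} (h : IsArc σ V) : ∃ C > 0, ∀ w : ℂ, ∀ d > 0, (∀ x ∈ Icc (0:ℝ) 1, d ≤ ‖w - σ x‖) →
    ∫ x in (0:ℝ)..1, ‖deriv σ x‖ * (‖w - σ x‖ ^ 2)⁻¹ ≤ C / d := by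
  obtain ⟨m, hm, hb⟩ := (arc_bilip h)
  have hdc : ContinuousOn (fun x : ℝ => ‖deriv σ x‖) (Icc 0 1) := (h.contDeriv.comp (by fun_prop) (fun x hx => h.seg x hx)).norm
  obtain ⟨B, hB⟩ := isCompact_Icc.exists_bound_of_continuousOn hdc
  have hB' : ∀ x ∈ Icc (0:ℝ) 1, ‖deriv σ x‖ ≤ |B| + 1 := fun x hx => by
    have := hB x hx; rw [norm_norm] at this; linarith [le_abs_self B]
  refine ⟨(|B| + 1) * 9 * (Real.pi / m), by have := Real.pi_pos; positivity, fun w d hd hw => ?_⟩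
  obtain ⟨x0, hx0, hmin⟩ := isCompact_Icc.exists_isMinOn (nonempty_Icc.2 (zero_le_one (α := ℝ))) (continuousOn_const.sub h.contR).norm (f := fun x : ℝ => ‖w - σ x‖)
  have key : ∀ x ∈ Icc (0:ℝ) 1, (‖w - σ x‖ ^ 2)⁻¹ ≤ 9 * (d^2 + m^2 * (x - x0)^2)⁻¹ := fun x hx => by
    have h1 : ‖w - σ x0‖ ≤ ‖w - σ x‖ := hmin hx
    have h2 := hb x hx x0 hx0
    have h3 : ‖σ x - σ x0‖ ≤ ‖w - σ x0‖ + ‖w - σ x‖ := by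
      rw [show σ x - σ x0 = (w - σ x0) - (w - σ x) by ring]; exact norm_sub_le _ _
    have h4 := hw x hx
    have h5 : d + m * |x - x0| ≤ 3 * ‖w - σ x‖ := by linarith
    have h6 : d^2 + m^2 * (x - x0)^2 ≤ 9 * ‖w - σ x‖ ^ 2 := by
      have h7 : (d + m * |x - x0|)^2 ≤ (3 * ‖w - σ x‖)^2 := by gcongr
      have : 0 ≤ d * (m * |x - x0|) := by positivity
      rw [← sq_abs (x - x0)]; nlinarith
    rw [show 9 * (d^2 + m^2 * (x - x0)^2)⁻¹ = ((d^2 + m^2 * (x - x0)^2)/9)⁻¹ by rw [inv_div]; ring]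
    exact inv_anti₀ (by positivity) (by linarith)
  have hI : ∫ x in (0:ℝ)..1, (d^2 + m^2 * (x - x0)^2)⁻¹ ≤ Real.pi / m / d := by
    have hder : ∀ x ∈ uIcc (0:ℝ) 1, HasDerivAt (fun x => Real.arctan (m / d * (x - x0)) / (d * m)) ((d^2 + m^2 * (x - x0)^2)⁻¹) x := fun x _ => by
      have := ((((hasDerivAt_id x).sub_const x0).const_mul (m/d)).arctan).div_const (d * m)
      refine this.congr_deriv ?_
      simp only [id]
      have : 0 < d^2 + m^2 * (x - x0)^2 := by positivity
      have h2 : 1 + (m / d * (x - x0))^2 = (d^2 + m^2 * (x - x0)^2) / d^2 := by field_simp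
      rw [h2]; field_simp
    rw [intervalIntegral.integral_eq_sub_of_hasDerivAt hder]
    · have a1 := Real.arctan_lt_pi_div_two (m / d * (1 - x0))
      have a2 := Real.neg_pi_div_two_lt_arctan (m / d * (0 - x0))
      rw [← sub_div, div_div, mul_comm m d]
      gcongr; linarith
    · apply Continuous.intervalIntegrable
      exact Continuous.inv₀ (by fun_prop) (fun x => by positivity)
  have hcw : ContinuousOn (fun x : ℝ => (‖w - σ x‖^2)⁻¹) (Icc 0 1) := ContinuousOn.inv₀ ((continuousOn_const.sub h.contR).norm.pow 2) (fun x hx => by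
    have := hd.trans_le (hw x hx); positivity)
  calc _ ≤ ∫ x in (0:ℝ)..1, (|B| + 1) * 9 * (d^2 + m^2 * (x - x0)^2)⁻¹ := by
        refine intervalIntegral.integral_mono_on zero_le_one ?_ ?_ fun x hx => ?_
        · apply ContinuousOn.intervalIntegrable; rw [uIcc_of_le zero_le_one]; exact hdc.mul hcw
        · apply Continuous.intervalIntegrable
          exact continuous_const.mul (Continuous.inv₀ (by fun_prop) (fun x => by positivity))
        · have := key x hx
          have := hB' x hx
          rw [mul_assoc (|B| + 1)]; gcongr
    _ = (|B| + 1) * 9 * ∫ x in (0:ℝ)..1, (d^2 + m^2 * (x - x0)^2)⁻¹ := intervalIntegral.integral_const_mul _ _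
    _ ≤ (|B| + 1) * 9 * (Real.pi / m / d) := by gcongr
    _ = _ := by ring

theorem Geo.Cau_dist {D lam N σ V c M J ee al} (g : Geo D lam N σ V c M J ee al) :
    ∃ C > 0, ∀ w ∉ frontier D.G, ∀ n P, Orth D P n → ‖Cau D P w‖ ≤ C * infDist w (frontier D.G) ^ (-(1/2) : ℝ) := by
  have h1 : ∀ j, ∃ C > 0, j < N → ∀ w : ℂ, ∀ d > 0, (∀ x ∈ Icc (0:ℝ) 1, d ≤ ‖w - σ j x‖) →
    ∫ x in (0:ℝ)..1, ‖deriv (σ j) x‖ * (‖w - σ j x‖ ^ 2)⁻¹ ≤ C / d := fun j => by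
    by_cases hj : j < N
    · obtain ⟨C, hC, h⟩ := arc_inv_sq (g.lens j hj).arc; exact ⟨C, hC, fun _ => h⟩
    · exact ⟨1, one_pos, fun h => absurd h hj⟩
  choose C hC h1 using h1
  set S := ∑ j ∈ Finset.range N, C j with hS
  have hS0 : 0 < S := Finset.sum_pos (fun j _ => hC j) ⟨0, Finset.mem_range.2 g.N0⟩
  have hl := D.l_pos
  refine ⟨D.l * Real.sqrt (S / D.l), by positivity, fun w hw n P hP => ?_⟩
  have hd := d_pos D hw
  set d := infDist w (frontier D.G) with hdd
  have hγ := D.γ_cont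
  have h2 : ∫ s in (0:ℝ)..D.l, ‖(w - D.γ s)⁻¹‖ ^ 2 ≤ S / d := by
    have e1 := g.int (fun t => (((‖w - t‖ ^ 2)⁻¹ : ℝ) : ℂ)) (by
      refine continuous_ofReal.comp_continuousOn (ContinuousOn.inv₀ (by fun_prop) fun t ht => ?_)
      have : w - t ≠ 0 := sub_ne_zero.2 fun h => hw (h ▸ ht)
      positivity)
    have e2 : ∫ s in (0:ℝ)..D.l, ‖(w - D.γ s)⁻¹‖ ^ 2 = ∑ j ∈ Finset.range N, ∫ x in (0:ℝ)..1, ‖deriv (σ j) x‖ * (‖w - σ j x‖ ^ 2)⁻¹ := by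
      simp only [← ofReal_mul, intervalIntegral.integral_ofReal] at e1
      simp only [norm_inv, inv_pow]
      exact_mod_cast e1
    rw [e2, hS, Finset.sum_div]
    refine Finset.sum_le_sum fun j hj => h1 j (Finset.mem_range.1 hj) w d hd fun x hx => ?_
    rw [← dist_eq_norm]; exact infDist_le_dist_of_mem ((g.lens j (Finset.mem_range.1 hj)).re x hx)
  have h3 : D.l * Real.sqrt (S / D.l) * d ^ (-(1/2) : ℝ) = D.l * Real.sqrt (S / D.l / d) := by
    rw [Real.sqrt_div (by positivity) d, Real.sqrt_eq_rpow d, Real.rpow_neg hd.le]; ring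
  rw [h3]
  have h4 : Cau D P w = ∫ s in (0:ℝ)..D.l, (starRingEnd ℂ) (P.eval (D.γ s)) * (w - D.γ s)⁻¹ := by simp only [Cau, div_eq_mul_inv]
  rw [h4]
  refine cs_int hl.le (by positivity) (continuous_conj.comp (P.continuous.comp hγ)) (Continuous.inv₀ (by fun_prop) (gam_sub_ne D hw)) (by simpa using hP.norm) (h2.trans (le_of_eq ?_))
  rw [Real.sq_sqrt (by positivity)]; field_simp

theorem rp_ratio {x y : ℝ} (p : ℝ) (hx : 0 < x) (h1 : x / 2 ≤ y) (h2 : y ≤ 2 * x) : y ^ p ≤ 2 ^ |p| * x ^ p := by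
  have hy : 0 < y := by linarith
  rcases le_total 0 p with h | h
  · rw [abs_of_nonneg h, ← Real.mul_rpow (by norm_num) hx.le]
    exact Real.rpow_le_rpow hy.le h2 h
  · rw [abs_of_nonpos h]
    have : (x/2) ^ p = 2 ^ (-p) * x ^ p := by
      rw [Real.div_rpow hx.le (by norm_num), Real.rpow_neg (by norm_num)]; field_simp
    rw [← this]
    exact Real.rpow_le_rpow_of_nonpos (by linarith) h1 h

theorem arg_near_one {v : ℂ} {s : ℝ} (hs : s ≤ 1/2) (hv : ‖v - 1‖ ≤ s) : |arg v| ≤ 4 * s := by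
  have hre : 1 - s ≤ v.re := by
    have := (abs_re_le_norm (v - 1)).trans hv
    rw [abs_le] at this; simp at this; linarith [this.1]
  have him : |v.im| ≤ s := by
    have := (abs_im_le_norm (v - 1)).trans hv
    simpa using this
  have hn : 1/2 ≤ ‖v‖ := by linarith [(le_abs_self v.re).trans (abs_re_le_norm v)]
  have hs0 := (norm_nonneg _).trans hv
  have h1 : |arg v| ≤ Real.pi / 2 := abs_arg_le_pi_div_two_iff.2 (by linarith)
  have h2 := Real.mul_le_sin (abs_nonneg (arg v)) h1
  have h3 : Real.sin |arg v| = |v.im| / ‖v‖ := by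
    have : Real.sin |arg v| = |Real.sin (arg v)| := by
      rw [Real.abs_sin_eq_sin_abs_of_abs_le_pi (h1.trans (by linarith [Real.pi_pos]))]
    rw [this, sin_arg, abs_div, abs_of_nonneg (norm_nonneg v)]
  rw [h3] at h2
  have h4 : |v.im| / ‖v‖ ≤ 2 * s := by
    rw [div_le_iff₀ (by linarith)]; nlinarith
  have h5 := Real.pi_lt_four
  have h6 : 2 / Real.pi * |arg v| ≤ 2 * s := h2.trans h4
  rw [div_mul_eq_mul_div, div_le_iff₀ Real.pi_pos] at h6
  nlinarith

theorem arg_ball {u u' : ℂ} {s : ℝ} (hu : u ≠ 0) (hs : s ≤ 1/2) (h : ‖u' - u‖ ≤ s * ‖u‖) (hπ : |arg u| + 4 * s < Real.pi) :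
    ‖u‖ / 2 ≤ ‖u'‖ ∧ ‖u'‖ ≤ 2 * ‖u‖ ∧ |arg u'| ≤ |arg u| + 4 * s := by
  have hn := norm_pos_iff.2 hu
  have h1 : ‖u‖ / 2 ≤ ‖u'‖ := by
    have := norm_sub_norm_le u u'
    rw [norm_sub_rev] at this; nlinarith
  refine ⟨h1, ?_, ?_⟩
  · have := norm_sub_norm_le u' u; nlinarith
  · have hv : ‖u' / u - 1‖ ≤ s := by
      rw [show u' / u - 1 = (u' - u) / u by field_simp, norm_div, div_le_iff₀ hn]; exact h
    have h2 := arg_near_one hs hv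
    have hu' : u' ≠ 0 := norm_pos_iff.1 (by linarith)
    have h3 : |arg u + arg (u'/u)| ≤ |arg u| + 4 * s := (abs_add_le _ _).trans (by linarith)
    have h4 := abs_lt.1 (h3.trans_lt hπ)
    have h5 := arg_mul hu (div_ne_zero hu' hu) ⟨h4.1, h4.2.le⟩
    rw [mul_div_cancel₀ _ hu] at h5
    rw [h5]; exact h3

theorem slit_of_arg {u : ℂ} (hu : u ≠ 0) (h : |arg u| < Real.pi) : u ∈ slitPlane := by
  rw [mem_slitPlane_iff_arg]; exact ⟨fun he => by rw [he, abs_of_pos Real.pi_pos] at h; exact lt_irrefl _ h, hu⟩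

theorem sec_ball {w0 e : ℂ} {h M r δ : ℝ} (he : ‖e‖ = 1) (hπ : h < Real.pi) (hδ : 0 < δ) (hδh : δ < h) (hM : 1 ≤ M) (hr : 0 < r) :
    ∃ κ > 0, ∃ r2 > 0, κ ≤ 1/2 ∧ r2 ≤ 1 ∧ ∀ w ∈ Sec w0 e (h - δ) 0 r2, ball w (κ * ‖w - w0‖) ⊆ Sec w0 e h M r := by
  refine ⟨min (1/2) (δ/16), by positivity, min (min (r/2) (δ/(4*M))) 1, by positivity, min_le_left _ _, min_le_right _ _, ?_⟩
  rintro w ⟨ρ, θ, h1, h2, h3, h4⟩ w' hw'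
  rw [zero_mul, sub_zero] at h3
  have hp := polar_eq he h1 (h3.trans (by linarith)) h4
  set u := (w - w0)/e with hu
  have he0 : e ≠ 0 := by rintro rfl; simp at he
  have hun : ‖u‖ = ρ := by rw [hu, norm_div, he, div_one, hp.1]
  have hw2 : ‖(w' - w0)/e - u‖ ≤ min (1/2) (δ/16) * ‖u‖ := by
    rw [mem_ball, dist_eq_norm, hp.1] at hw'
    rw [hu, ← sub_div, norm_div, he, div_one, show w' - w0 - (w - w0) = w' - w by ring, ← hu, hun]; exact hw'.le
  have hs := min_le_right (1/2) (δ/16)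
  obtain ⟨a1, a2, a3⟩ := arg_ball (norm_pos_iff.1 (by rw [hun]; exact h1)) (min_le_left _ _) hw2 (by rw [hp.2]; linarith)
  rw [hun, norm_div, he, div_one] at a1 a2
  rw [hp.2] at a3
  have b1 := (h2.trans_le (min_le_left _ _)).trans_le (min_le_left _ _)
  have b2 := (h2.trans_le (min_le_left _ _)).trans_le (min_le_right _ _)
  rw [lt_div_iff₀ (by linarith)] at b2
  refine ⟨‖w' - w0‖, _, by linarith, by linarith, ?_, polar_arg he⟩
  nlinarith

theorem bar_neg_case {x t s0 K c sn : ℝ} (h0 : 0 ≤ x) (h1 : x ≤ K * (t * t)) (h2 : x ≤ 1/2) (ht : 0 < t) (ht1 : t ≤ 1/2)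
    (hc : 0 ≤ c) (hc1 : c ≤ 1) (hs : 0 < s0) (hsn : s0 ≤ sn) (hK : 4 * K * t < s0) : (1 + t * c) * Real.sin x ≤ t * Real.cos x * sn := by
  have c2 : Real.sin x ≤ K * (t * t) := (Real.sin_le h0).trans h1
  have s4 : 0 ≤ Real.sin x := Real.sin_nonneg_of_nonneg_of_le_pi h0 (by linarith [Real.pi_gt_three])
  have s2 : 1/2 ≤ Real.cos x := by
    have := Real.one_sub_sq_div_two_le_cos (x := x)
    nlinarith
  have k1 : 1/2 * s0 ≤ Real.cos x * sn := by gcongr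
  have k3 : (1 + t * c) * Real.sin x ≤ 2 * (K * (t * t)) := by
    have : 1 + t * c ≤ 2 := by nlinarith
    gcongr
  have k4 := mul_le_mul_of_nonneg_left k1 ht.le
  have k5 := mul_lt_mul_of_pos_left hK ht
  linarith

theorem bar_neg {h a C : ℝ} (h0 : 0 < h) (hπ : h < Real.pi) (ha : a * h = Real.pi / 2) (hC : 0 ≤ C) :
    ∃ r1 > 0, r1 ≤ 1/4 ∧ C * r1 < h ∧ ∀ u : ℂ, u ≠ 0 → ‖u‖ ≤ r1 → h - C * ‖u‖ ≤ |arg u| → |arg u| ≤ h + h / 2 → (bar a 1 u).re ≤ 0 := by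
  have hp := Real.pi_pos
  have ha0 : 0 < a := by by_contra hn; push Not at hn; nlinarith
  set s0 := Real.sin (h/4) with hs0
  have hs : 0 < s0 := Real.sin_pos_of_pos_of_lt_pi (by linarith) (by linarith)
  obtain ⟨r1, hr1, hr2, hr3, hr4, hr5⟩ : ∃ r1 > 0, r1 ≤ 1/4 ∧ C * r1 < h/2 ∧ a * C * r1 ≤ 1/2 ∧ 16 * (a * C) ^ 2 * r1 < s0 ^ 2 := by
    obtain ⟨r, h1, h2, h3, h4, h5⟩ := ((eventually_mem_nhdsWithin (s := Ioi (0:ℝ)) (a := 0)).and ((small_ev 1 (B := 1/4) (by norm_num)).and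
      ((small_ev C (B := h/2) (by linarith)).and ((small_ev (a * C) (B := 1/2) (by norm_num)).and
        (small_ev (16 * (a * C) ^ 2) (B := s0 ^ 2) (by positivity)))))).exists
    exact ⟨r, h1, by linarith, h3, h4.le, h5⟩
  refine ⟨r1, hr1, hr2, by linarith, fun u hu hur harg hle => ?_⟩
  have hun := norm_pos_iff.2 hu
  rw [bar_re _ _ hu]
  refine mul_nonpos_of_nonneg_of_nonpos (Real.rpow_nonneg hun.le _) ?_
  set t := Real.sqrt ‖u‖ with ht
  have htt : t * t = ‖u‖ := Real.mul_self_sqrt hun.le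
  have ht0 : 0 < t := Real.sqrt_pos.2 hun
  have ht1 : t ≤ 1/2 := by nlinarith only [htt, hur, hr2, ht0]
  set θ := |arg u| with hθ
  have hθ0 : 0 ≤ θ := abs_nonneg _
  have hθπ : θ ≤ Real.pi := abs_arg_le_pi u
  have hCu : C * ‖u‖ ≤ C * r1 := by gcongr
  have hc1 : Real.cos (θ/2) ≤ 1 := Real.cos_le_one _
  have hc0 : 0 ≤ Real.cos (θ/2) := Real.cos_nonneg_of_mem_Icc ⟨by linarith, by linarith⟩
  have s3 : s0 ≤ Real.sin (θ/2) := Real.sin_le_sin_of_le_of_le_pi_div_two (by linarith) (by linarith) (by linarith)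
  have hb1 : a * θ ≤ 3 * Real.pi / 4 := by nlinarith only [ha, mul_le_mul_of_nonneg_left hle ha0.le]
  have hb0 : 0 ≤ a * θ := by positivity
  have hsin : 0 ≤ Real.sin (a * θ) := Real.sin_nonneg_of_nonneg_of_le_pi hb0 (by linarith)
  rcases le_or_gt h θ with hge | hlt
  · have hc : Real.cos (a * θ) ≤ 0 := Real.cos_nonpos_of_pi_div_two_le_of_le (by rw [← ha]; gcongr) (by linarith)
    have := mul_nonneg (mul_nonneg ht0.le hsin) (hs.le.trans s3)
    nlinarith only [this, hc, mul_nonneg ht0.le hc0]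
  · have hx0 : 0 ≤ a * (h - θ) := mul_nonneg ha0.le (by linarith)
    have hx1 : a * (h - θ) ≤ a * C * ‖u‖ := by rw [mul_assoc]; gcongr; linarith
    have hx2 : a * C * ‖u‖ ≤ 1/2 := le_trans (by gcongr) hr4
    have e1 : a * θ = Real.pi/2 - a * (h - θ) := by rw [← ha]; ring
    rw [e1, Real.cos_pi_div_two_sub, Real.sin_pi_div_two_sub]
    have k2 : 4 * (a * C) * t < s0 := by
      have : (4 * (a * C) * t)^2 < s0^2 := by
        have : (4 * (a * C) * t)^2 = 16 * (a*C)^2 * ‖u‖ := by rw [← htt]; ring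
        rw [this]
        exact lt_of_le_of_lt (by gcongr) hr5
      exact lt_of_pow_lt_pow_left₀ 2 hs.le this
    have := bar_neg_case hx0 (by rw [htt]; exact hx1) (hx1.trans hx2) ht0 ht1 hc0 hc1 hs s3 k2
    linarith

theorem bar_lip {a : ℝ} (ha : 0 < a) : ∃ K > 0, ∀ u u' : ℂ, ∀ s : ℝ, u ≠ 0 → ‖u‖ ≤ 1/2 → s ≤ 1/2 → ‖u' - u‖ ≤ s * ‖u‖ → |arg u| + 4 * s < Real.pi →
    ‖bar a 1 u' - bar a 1 u‖ ≤ K * ‖u‖ ^ (a - 1) * ‖u' - u‖ := by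
  refine ⟨(2 * a + 1/2) * 2 ^ |a - 1|, by positivity, fun u u' s hu hu1 hs h hπ => ?_⟩
  have hn := norm_pos_iff.2 hu
  have key : ∀ v ∈ closedBall u (s * ‖u‖), v ∈ slitPlane ∧ ‖u‖/2 ≤ ‖v‖ ∧ ‖v‖ ≤ 2 * ‖u‖ := fun v hv => by
    rw [mem_closedBall, dist_eq_norm] at hv
    obtain ⟨a1, a2, a3⟩ := arg_ball hu hs hv hπ
    exact ⟨slit_of_arg (norm_pos_iff.1 (by linarith)) (a3.trans_lt hπ), a1, a2⟩
  have hder : ∀ v ∈ closedBall u (s * ‖u‖), HasDerivWithinAt (bar a 1) (a * v ^ ((a:ℂ) - 1) + 1 * (((a + 1/2 : ℝ) : ℂ) * v ^ (((a + 1/2 : ℝ) : ℂ) - 1))) (closedBall u (s * ‖u‖)) v := fun v hv => by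
    have hv1 := (key v hv).1
    have d1 := (hasDerivAt_id v).cpow_const (c := (a:ℂ)) hv1
    have d2 := (hasDerivAt_id v).cpow_const (c := ((a + 1/2 : ℝ) : ℂ)) hv1
    have := (d1.fun_add (d2.const_mul ((1:ℝ):ℂ))).hasDerivWithinAt (s := closedBall u (s * ‖u‖))
    refine HasDerivWithinAt.congr_deriv (f := bar a 1) this ?_
    simp
  refine (convex_closedBall u (s * ‖u‖)).norm_image_sub_le_of_norm_hasDerivWithin_le hder (fun v hv => ?_) (mem_closedBall_self ((norm_nonneg _).trans h)) (by rw [mem_closedBall, dist_eq_norm]; exact h)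
  obtain ⟨k1, k2, k3⟩ := key v hv
  have hv0 : v ≠ 0 := slitPlane_ne_zero k1
  have hvn := norm_pos_iff.2 hv0
  have n1 : ‖v ^ ((a:ℂ) - 1)‖ = ‖v‖ ^ (a - 1) := by have := (cpow_re v hv0 (a - 1)).2; push_cast at this; exact this
  have n2 : ‖v ^ (((a + 1/2 : ℝ) : ℂ) - 1)‖ = ‖v‖ ^ (a - 1/2) := by
    have := (cpow_re v hv0 (a - 1/2)).2
    rw [← this]; congr 2; push_cast; ring
  have n3 : ‖v‖ ^ (a - 1/2) ≤ ‖v‖ ^ (a - 1) := Real.rpow_le_rpow_of_exponent_ge hvn (by linarith) (by linarith)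
  have n4 := rp_ratio (a - 1) hn k2 k3
  refine (norm_add_le _ _).trans ?_
  rw [one_mul, norm_mul, norm_mul, n1, n2, norm_real, norm_real, Real.norm_of_nonneg ha.le, Real.norm_of_nonneg (by linarith)]
  calc _ ≤ a * ‖v‖ ^ (a - 1) + (a + 1/2) * ‖v‖ ^ (a - 1) := by gcongr
    _ = (2 * a + 1/2) * ‖v‖ ^ (a - 1) := by ring
    _ ≤ (2 * a + 1/2) * (2 ^ |a - 1| * ‖u‖ ^ (a - 1)) := by gcongr
    _ = _ := by ring

theorem sqrt_exp {k y : ℝ} (hk : 0 < k) (hy : 0 ≤ y) : Real.sqrt y * Real.exp (-(k * y)) ≤ (1 + 2 / k) * Real.exp (-(k / 2 * y)) := by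
  have h1 : Real.sqrt y ≤ 1 + y := by
    rw [Real.sqrt_le_left (by linarith)]; nlinarith
  have h2 : 1 + y ≤ (1 + 2/k) * Real.exp (k / 2 * y) := by
    have h3 := Real.add_one_le_exp (k/2*y)
    have h4 : 1 ≤ Real.exp (k/2*y) := Real.one_le_exp (by positivity)
    have h5 : y = 2/k * (k/2*y) := by field_simp
    nlinarith [mul_le_mul_of_nonneg_left h3 (show 0 ≤ 2/k by positivity), show 0 < 2/k by positivity]
  have h6 : Real.exp (-(k/2*y)) = Real.exp (k/2*y) * Real.exp (-(k*y)) := by rw [← Real.exp_add]; ring_nf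
  rw [h6, ← mul_assoc]
  gcongr
  exact h1.trans h2

theorem bar_ball {Λ a M r : ℝ} (h0 : 0 < Λ) (hπ : Λ < Real.pi) (ha : a * Λ = Real.pi / 2) (hM : 1 ≤ M) (hr : 0 < r) :
    ∃ r1 > 0, r1 < r ∧ r1 ≤ 1/4 ∧ (∀ u : ℂ, u ≠ 0 → ‖u‖ ≤ r1 → |arg u| ≤ Λ → 0 < (bar a 1 u).re → |arg u| < Λ - 2 * M * ‖u‖) ∧
    ∃ c > 0, ∀ u : ℂ, u ≠ 0 → ‖u‖ ≤ r1 → |arg u| ≤ Λ → ∀ ε > 0, (bar a 1 u).re = ε →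
      ∀ u' ∈ ball u (c * ‖u‖ ^ (1 - a) * ε), u' ≠ 0 ∧ ‖u'‖ < r ∧ |arg u'| < Λ - M * ‖u'‖ := by
  have ha0 : 0 < a := by by_contra hn; push Not at hn; nlinarith [Real.pi_pos]
  obtain ⟨ρ, hρ, hρ1, hρ2, hb⟩ := bar_neg h0 hπ ha (C := 2 * M) (by linarith)
  obtain ⟨K, hK, hlip⟩ := bar_lip ha0
  have key : ∀ u : ℂ, u ≠ 0 → ‖u‖ ≤ ρ → |arg u| ≤ Λ + Λ / 2 → 0 < (bar a 1 u).re → |arg u| < Λ - 2 * M * ‖u‖ := fun u hu h1 h2 h3 => by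
    by_contra hn
    push Not at hn
    linarith [hb u hu h1 hn h2]
  refine ⟨min (ρ/2) (r/4), by positivity, (min_le_right _ _).trans_lt (by linarith), (min_le_left _ _).trans (by linarith),
    fun u hu h1 h2 => key u hu (h1.trans ((min_le_left _ _).trans (by linarith))) (by linarith), ?_⟩
  obtain ⟨s, hs, hs1, hs2, hs3⟩ : ∃ s > 0, s ≤ 1/2 ∧ 4 * s < Real.pi - Λ ∧ 4 * s ≤ Λ/2 :=
    ⟨min (1/2) (min ((Real.pi - Λ)/8) (Λ/8)), by have : 0 < Real.pi - Λ := by linarith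
                                                 positivity, min_le_left _ _,
      by linarith [min_le_right (1/2) (min ((Real.pi - Λ)/8) (Λ/8)), min_le_left ((Real.pi - Λ)/8) (Λ/8)],
      by linarith [min_le_right (1/2) (min ((Real.pi - Λ)/8) (Λ/8)), min_le_right ((Real.pi - Λ)/8) (Λ/8)]⟩
  refine ⟨min (s/2) (1/(2*K)), by positivity, fun u hu h1 h2 ε hε he u' hu' => ?_⟩
  have hn := norm_pos_iff.2 hu
  have g1 : ‖u‖ ≤ ρ / 2 := h1.trans (min_le_left _ _)
  have g2 : ‖u‖ ≤ r / 4 := h1.trans (min_le_right _ _)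
  have he2 : ε ≤ 2 * ‖u‖ ^ a := by
    rw [← he]; exact (re_le_norm _).trans (bar_norm a 1 (by simp) hu (by linarith))
  have hpw : ‖u‖ ^ (1 - a) * ‖u‖ ^ a = ‖u‖ := by rw [← Real.rpow_add hn]; simp
  have hpw2 : ‖u‖ ^ (a - 1) * ‖u‖ ^ (1 - a) = 1 := by rw [← Real.rpow_add hn]; simp
  have hp1 : 0 < ‖u‖ ^ (1 - a) := Real.rpow_pos_of_pos hn _
  have hp2 : 0 < ‖u‖ ^ (a - 1) := Real.rpow_pos_of_pos hn _
  rw [mem_ball, dist_eq_norm] at hu'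
  have k1 : ‖u' - u‖ ≤ s * ‖u‖ := by
    refine hu'.le.trans ?_
    calc _ ≤ s/2 * ‖u‖ ^ (1 - a) * (2 * ‖u‖ ^ a) := by gcongr; exact min_le_left _ _
      _ = s * (‖u‖ ^ (1 - a) * ‖u‖ ^ a) := by ring
      _ = _ := by rw [hpw]
  obtain ⟨b1, b2, b3⟩ := arg_ball hu hs1 k1 (by linarith)
  have k2 := hlip u u' s hu (by linarith) hs1 k1 (by linarith)
  have k3 : ‖bar a 1 u' - bar a 1 u‖ ≤ ε / 2 := by
    refine k2.trans ?_
    calc _ ≤ K * ‖u‖ ^ (a - 1) * (1/(2*K) * ‖u‖ ^ (1 - a) * ε) := by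
          gcongr; refine hu'.le.trans ?_; gcongr; exact min_le_right _ _
      _ = (‖u‖ ^ (a - 1) * ‖u‖ ^ (1 - a)) * ε / 2 := by field_simp
      _ = _ := by rw [hpw2]; ring
  have k4 : 0 < (bar a 1 u').re := by
    have := (abs_re_le_norm _).trans k3
    rw [sub_re, abs_le] at this; linarith [this.1]
  have hu0 : u' ≠ 0 := norm_pos_iff.1 (by linarith)
  have := key u' hu0 (by linarith) (by linarith) k4
  refine ⟨hu0, by linarith, this.trans_le ?_⟩
  nlinarith [norm_nonneg u']

theorem slit_of_re {u : ℂ} {Λ : ℝ} (h0 : 0 < Λ) (hπ : Λ < Real.pi) (hu : u ≠ 0) (h : ‖u‖ * Real.cos Λ ≤ u.re) : u ∈ slitPlane := by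
  rw [mem_slitPlane_iff]
  by_contra hn
  push Not at hn
  have h1 : ‖u‖ = -u.re := by
    rw [← abs_of_nonpos hn.1]; exact (abs_re_eq_norm.2 hn.2).symm
  have h2 : Real.cos Real.pi < Real.cos Λ := Real.cos_lt_cos_of_nonneg_of_le_pi h0.le le_rfl hπ
  rw [Real.cos_pi] at h2
  have := norm_pos_iff.2 hu
  nlinarith

theorem corner_max {Λ a M r : ℝ} (h0 : 0 < Λ) (hπ : Λ < Real.pi) (ha : a * Λ = Real.pi / 2) (hM : 1 ≤ M) (hr : 0 < r) :
    ∃ r1 > 0, r1 < r ∧ r1 ≤ 1/4 ∧ ∀ C0 > 0, ∀ C1 > 0, ∀ κ1 > 0, ∃ C > 0, ∃ κ > 0, ∀ (Φ : ℂ → ℂ) (n : ℝ), 1 ≤ n →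
      (∀ u : ℂ, u ≠ 0 → ‖u‖ < r → |arg u| < Λ - M * ‖u‖ → DifferentiableAt ℂ Φ u) →
      (∀ u : ℂ, u ≠ 0 → ∀ d > 0, (∀ u' ∈ ball u d, u' ≠ 0 ∧ ‖u'‖ < r ∧ |arg u'| < Λ - M * ‖u'‖) → ‖Φ u‖ ≤ C0 * d ^ (-(1/2) : ℝ)) →
      (∀ u : ℂ, ‖u‖ = r1 → |arg u| ≤ Λ - 2 * M * r1 → ‖Φ u‖ ≤ C1 * Real.exp (-(κ1 * n))) →
      ∀ u : ℂ, u ≠ 0 → ‖u‖ < r1 → |arg u| < Λ → 1 / n < (bar a 1 u).re →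
        ‖Φ u‖ ≤ C * n ^ (1/2:ℝ) * ‖u‖ ^ ((a-1)/2) * Real.exp (-(κ * n * (bar a 1 u).re)) := by
  have ha0 : 0 < a := by by_contra hn; push Not at hn; nlinarith [Real.pi_pos]
  obtain ⟨r1, hr1, hr1r, hr14, hin, c, hc, hball⟩ := bar_ball h0 hπ ha hM hr
  refine ⟨r1, hr1, hr1r, hr14, fun C0 hC0 C1 hC1 κ1 hκ1 => ⟨max (C1 * r1 ^ ((1-a)/2)) (C0 * c ^ (-(1/2):ℝ) * Real.exp (κ1/2)), by positivity, κ1/2, by positivity, ?_⟩⟩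
  intro Φ n hn hd hH2 hH3 u hu hur huΛ hV
  set Cm := max (C1 * r1 ^ ((1-a)/2)) (C0 * c ^ (-(1/2):ℝ) * Real.exp (κ1/2)) with hCm
  have hn0 : 0 < n := by linarith
  let U : Set ℂ := {u | u ∈ slitPlane ∧ ‖u‖ < r1 ∧ |arg u| < Λ ∧ 1 / n < (bar a 1 u).re}
  have hsl : ∀ u : ℂ, u ≠ 0 → |arg u| < Λ → u ∈ slitPlane := fun u hu h => slit_of_arg hu (h.trans hπ)
  have hUo : IsOpen U := by
    rw [isOpen_iff_mem_nhds]
    rintro v ⟨v1, v2, v3, v4⟩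
    have c1 : ContinuousAt (fun u => |arg u|) v := (continuousAt_arg v1).abs
    have c2 : ContinuousAt (fun u => (bar a 1 u).re) v := continuous_re.continuousAt.comp (bar_diff a 1 v1).continuousAt
    filter_upwards [isOpen_slitPlane.mem_nhds v1, continuous_norm.continuousAt.eventually_lt_const v2, c1.eventually_lt_const v3, c2.eventually_const_lt v4] with z z1 z2 z3 z4
    exact ⟨z1, z2, z3, z4⟩
  have hUb : Bornology.IsBounded U := (isBounded_ball (x := (0:ℂ)) (r := r1)).subset fun v hv => by rw [mem_ball_zero_iff]; exact hv.2.1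
  let f : ℂ → ℂ := fun u => Φ u * u ^ (((1-a)/2 : ℝ) : ℂ) * exp ((κ1/2 * n : ℝ) * bar a 1 u)
  have hnorm : ∀ v : ℂ, v ≠ 0 → ‖f v‖ = ‖Φ v‖ * ‖v‖ ^ ((1-a)/2) * Real.exp (κ1/2 * n * (bar a 1 v).re) := fun v hv => by
    simp only [f]
    rw [norm_mul, norm_mul, (cpow_re v hv _).2, norm_exp, re_ofReal_mul]
  have hfd : ∀ v ∈ slitPlane, ‖v‖ ≤ r1 → |arg v| < Λ - M * ‖v‖ → DifferentiableAt ℂ f v := fun v v1 v2 v3 =>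
    ((hd v (slitPlane_ne_zero v1) (v2.trans_lt hr1r) v3).mul (differentiableAt_id.cpow_const v1)).mul ((bar_diff a 1 v1).const_mul _).cexp
  have hpos : ∀ v : ℂ, 1 / n ≤ (bar a 1 v).re → 0 < (bar a 1 v).re := fun v hv => lt_of_lt_of_le (by positivity) hv
  have hlt : ∀ v : ℂ, v ≠ 0 → ‖v‖ ≤ r1 → |arg v| ≤ Λ → 1 / n ≤ (bar a 1 v).re → |arg v| < Λ - M * ‖v‖ := fun v v1 v2 v3 v4 => by
    have := hin v v1 v2 v3 (hpos v v4)
    nlinarith [norm_nonneg v]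
  have hmain := max_lim hUo hUb (f := f) (M := Cm * n ^ (1/2:ℝ)) (fun v hv => (hfd v hv.1 hv.2.1.le (hlt v (slitPlane_ne_zero hv.1) hv.2.1.le hv.2.2.1.le hv.2.2.2.le)).differentiableWithinAt) ?_ u ⟨hsl u hu huΛ, hur, huΛ, hV⟩
  · rw [hnorm u hu] at hmain
    have hup := norm_pos_iff.2 hu
    have e1 : ‖u‖ ^ ((1-a)/2) * ‖u‖ ^ ((a-1)/2) = 1 := by rw [← Real.rpow_add hup, show (1-a)/2 + (a-1)/2 = 0 by ring, Real.rpow_zero]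
    have e2 : Real.exp (κ1/2 * n * (bar a 1 u).re) * Real.exp (-(κ1/2 * n * (bar a 1 u).re)) = 1 := by rw [← Real.exp_add, add_neg_cancel, Real.exp_zero]
    calc ‖Φ u‖ = (‖Φ u‖ * ‖u‖ ^ ((1-a)/2) * Real.exp (κ1/2 * n * (bar a 1 u).re)) * (‖u‖ ^ ((a-1)/2) * Real.exp (-(κ1/2 * n * (bar a 1 u).re))) := by
          linear_combination (-‖Φ u‖) * e1 - ‖Φ u‖ * ‖u‖ ^ ((1-a)/2) * ‖u‖ ^ ((a-1)/2) * e2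
      _ ≤ (Cm * n ^ (1/2:ℝ)) * (‖u‖ ^ ((a-1)/2) * Real.exp (-(κ1/2 * n * (bar a 1 u).re))) := by gcongr
      _ = _ := by ring
  · intro v hv ε hε
    have hvc : v ∈ closure U := frontier_subset_closure hv
    have hvU : v ∉ U := by rw [hUo.frontier_eq] at hv; exact hv.2
    have hv0 : v ≠ 0 := by
      rintro rfl
      have hcont : ContinuousAt (fun u : ℂ => 2 * ‖u‖ ^ a) 0 := ContinuousAt.const_mul (ContinuousAt.rpow_const continuous_norm.continuousAt (Or.inr ha0.le)) 2
      have h1 := hcont.tendsto.mono_left (nhdsWithin_le_nhds (s := U))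
      rw [norm_zero, Real.zero_rpow ha0.ne', mul_zero] at h1
      have h2 := h1.eventually_lt_const (show 0 < 1 / n by positivity)
      have : (nhdsWithin (0:ℂ) U).NeBot := mem_closure_iff_nhdsWithin_neBot.1 hvc
      obtain ⟨z, hz1, hz2⟩ := (h2.and self_mem_nhdsWithin).exists
      have hz0 := slitPlane_ne_zero hz2.1
      linarith [hz2.2.2.2, re_le_norm (bar a 1 z), bar_norm a 1 (by simp) hz0 (by linarith [hz2.2.1])]
    have hvs : v ∈ slitPlane := by
      refine slit_of_re h0 hπ hv0 ?_
      have : closure U ⊆ {u : ℂ | ‖u‖ * Real.cos Λ ≤ u.re} := by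
        refine closure_minimal (fun z hz => ?_) (isClosed_le (by fun_prop) (by fun_prop))
        have := norm_mul_cos_arg z
        rw [mem_ofPred_eq, ← this]
        gcongr
        rw [← Real.cos_abs (arg z)]
        exact Real.cos_le_cos_of_nonneg_of_le_pi (abs_nonneg _) hπ.le hz.2.2.1.le
      exact this hvc
    have hne : (nhdsWithin v U).NeBot := mem_closure_iff_nhdsWithin_neBot.1 hvc
    have c1 : ContinuousAt (fun u => |arg u|) v := (continuousAt_arg hvs).abs
    have c2 : ContinuousAt (fun u => (bar a 1 u).re) v := continuous_re.continuousAt.comp (bar_diff a 1 hvs).continuousAt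
    have v1 : ‖v‖ ≤ r1 := le_of_tendsto (continuous_norm.continuousAt.tendsto.mono_left nhdsWithin_le_nhds) (eventually_mem_nhdsWithin.mono fun z (hz : z ∈ U) => hz.2.1.le)
    have v2 : |arg v| ≤ Λ := le_of_tendsto (c1.tendsto.mono_left nhdsWithin_le_nhds) (eventually_mem_nhdsWithin.mono fun z (hz : z ∈ U) => hz.2.2.1.le)
    have v3 : 1 / n ≤ (bar a 1 v).re := ge_of_tendsto (c2.tendsto.mono_left nhdsWithin_le_nhds) (eventually_mem_nhdsWithin.mono fun z (hz : z ∈ U) => hz.2.2.2.le)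
    have v4 := hin v hv0 v1 v2 (hpos v v3)
    have hvn := norm_pos_iff.2 hv0
    suffices hfin : ‖f v‖ ≤ Cm * n ^ (1/2:ℝ) by
      have c3 := (hfd v hvs v1 (hlt v hv0 v1 v2 v3)).continuousAt.norm
      exact ((c3.eventually_lt_const (show ‖f v‖ < Cm * n ^ (1/2:ℝ) + ε by linarith)).mono fun z hz => hz.le).filter_mono nhdsWithin_le_nhds
    rw [hnorm v hv0]
    have hnn : 1 ≤ n ^ (1/2:ℝ) := Real.one_le_rpow hn (by norm_num)
    rcases eq_or_lt_of_le v1 with he | hl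
    · have b1 := hH3 v he (by rw [← he]; exact v4.le)
      have b2 : (bar a 1 v).re ≤ 2 := by
        refine (re_le_norm _).trans ((bar_norm a 1 (by simp) hv0 (by linarith)).trans ?_)
        have : ‖v‖ ^ a ≤ 1 := Real.rpow_le_one hvn.le (by linarith) ha0.le
        linarith
      have b3 : Real.exp (κ1/2 * n * (bar a 1 v).re) ≤ Real.exp (κ1 * n) := by
        apply Real.exp_le_exp.2
        nlinarith [mul_pos hκ1 hn0]
      have b4 : Real.exp (-(κ1 * n)) * Real.exp (κ1 * n) = 1 := by rw [← Real.exp_add, neg_add_cancel, Real.exp_zero]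
      calc _ ≤ (C1 * Real.exp (-(κ1 * n))) * ‖v‖ ^ ((1-a)/2) * Real.exp (κ1 * n) := by gcongr
        _ = C1 * r1 ^ ((1-a)/2) := by rw [he]; linear_combination (C1 * r1 ^ ((1-a)/2)) * b4
        _ ≤ Cm := le_max_left _ _
        _ ≤ Cm * n ^ (1/2:ℝ) := le_mul_of_one_le_right (by positivity) hnn
    · have he : (bar a 1 v).re = 1 / n := by
        refine le_antisymm (not_lt.1 fun h => hvU ⟨hvs, hl, v4.trans_le ?_, h⟩) v3
        nlinarith
      have hcp : 0 < ‖v‖ ^ (1 - a) := Real.rpow_pos_of_pos hvn _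
      have b1 := hH2 v hv0 (c * ‖v‖ ^ (1 - a) * (1/n)) (by positivity) (hball v hv0 v1 v2 (1/n) (by positivity) he)
      have b2 : (c * ‖v‖ ^ (1 - a) * (1/n)) ^ (-(1/2):ℝ) = c ^ (-(1/2):ℝ) * ‖v‖ ^ ((a-1)/2) * n ^ (1/2:ℝ) := by
        rw [Real.mul_rpow (by positivity) (by positivity), Real.mul_rpow hc.le hcp.le, ← Real.rpow_mul hvn.le, one_div n, Real.inv_rpow hn0.le, ← Real.rpow_neg hn0.le]
        congr 3 <;> ring
      have e1 : ‖v‖ ^ ((1-a)/2) * ‖v‖ ^ ((a-1)/2) = 1 := by rw [← Real.rpow_add hvn, show (1-a)/2 + (a-1)/2 = 0 by ring, Real.rpow_zero]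
      rw [b2] at b1
      have e3 : κ1/2 * n * (1/n) = κ1/2 := by field_simp
      calc _ ≤ (C0 * (c ^ (-(1/2):ℝ) * ‖v‖ ^ ((a-1)/2) * n ^ (1/2:ℝ))) * ‖v‖ ^ ((1-a)/2) * Real.exp (κ1/2) := by rw [he, e3]; gcongr
        _ = (C0 * c ^ (-(1/2):ℝ) * Real.exp (κ1/2)) * n ^ (1/2:ℝ) := by linear_combination (C0 * c ^ (-(1/2):ℝ) * Real.exp (κ1/2) * n ^ (1/2:ℝ)) * e1
        _ ≤ _ := by gcongr; exact le_max_right _ _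

theorem corner_decay {Λ a M r δ : ℝ} (h0 : 0 < Λ) (hπ : Λ < Real.pi) (ha : a * Λ = Real.pi / 2) (hM : 1 ≤ M) (hr : 0 < r) (hδ : 0 < δ) (hδΛ : δ < Λ) :
    ∃ r1 > 0, r1 < r ∧ ∀ C0 > 0, ∀ C1 > 0, ∀ κ1 > 0, ∀ κ2 > 0, ∃ C > 0, ∃ κ > 0, ∃ r2 > 0, r2 ≤ 1 ∧ ∀ (Φ : ℂ → ℂ) (n : ℝ), 1 ≤ n →
      (∀ u : ℂ, u ≠ 0 → ‖u‖ < r → |arg u| < Λ - M * ‖u‖ → DifferentiableAt ℂ Φ u) →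
      (∀ u : ℂ, u ≠ 0 → ∀ d > 0, (∀ u' ∈ ball u d, u' ≠ 0 ∧ ‖u'‖ < r ∧ |arg u'| < Λ - M * ‖u'‖) → ‖Φ u‖ ≤ C0 * d ^ (-(1/2) : ℝ)) →
      (∀ u : ℂ, ‖u‖ = r1 → |arg u| ≤ Λ - 2 * M * r1 → ‖Φ u‖ ≤ C1 * Real.exp (-(κ1 * n))) →
      ∀ u : ℂ, u ≠ 0 → ‖u‖ ≤ r2 → |arg u| ≤ Λ - δ → (∀ u' ∈ ball u (κ2 * ‖u‖), u' ≠ 0 ∧ ‖u'‖ < r ∧ |arg u'| < Λ - M * ‖u'‖) →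
        ‖Φ u‖ ≤ C * ‖u‖ ^ (-(1/2) : ℝ) * Real.exp (-(κ * n * ‖u‖ ^ a)) := by
  have hpi := Real.pi_pos
  have ha0 : 0 < a := by by_contra hn; push Not at hn; nlinarith
  obtain ⟨r1, hr1, hr1r, hr14, H⟩ := corner_max h0 hπ ha hM hr
  refine ⟨r1, hr1, hr1r, fun C0 hC0 C1 hC1 κ1 hκ1 κ2 hκ2 => ?_⟩
  obtain ⟨C, hC, κ, hκ, H⟩ := H C0 hC0 C1 hC1 κ1 hκ1
  set s := Real.sin (a * δ) / 2 with hs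
  have hs0 : 0 < s := half_pos (Real.sin_pos_of_pos_of_lt_pi (by positivity) (by nlinarith))
  set Cm := max (C * (1 + 2/(κ*s))) (C0 * κ2 ^ (-(1/2):ℝ) * Real.exp (κ/2)) with hCm
  refine ⟨Cm, by positivity, κ * s / 2, by positivity, min (r1/2) (s^2), by positivity, (min_le_left _ _).trans (by linarith), ?_⟩
  intro Φ n hn hd hH2 hH3 u hu hur huΛ hub
  have hn0 : 0 < n := by linarith
  have hun := norm_pos_iff.2 hu
  have hxa : 0 < ‖u‖ ^ a := Real.rpow_pos_of_pos hun _
  have hV : s * ‖u‖ ^ a ≤ (bar a 1 u).re := by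
    rw [bar_re _ _ hu, mul_comm]
    gcongr
    have hq : Real.sqrt ‖u‖ ≤ s := by rw [Real.sqrt_le_left hs0.le]; exact hur.trans (min_le_right _ _)
    have hq0 := Real.sqrt_nonneg ‖u‖
    have hθ := abs_nonneg (arg u)
    have t1 : 2 * s ≤ Real.cos (a * |arg u|) := by
      have : 2 * s = Real.cos (Real.pi/2 - a * δ) := by rw [Real.cos_pi_div_two_sub, hs]; ring
      rw [this]
      exact Real.cos_le_cos_of_nonneg_of_le_pi (by positivity) (by nlinarith) (by nlinarith)
    have t2 : 0 ≤ Real.cos (|arg u|/2) := Real.cos_nonneg_of_mem_Icc ⟨by linarith, by linarith⟩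
    have t3 : Real.sqrt ‖u‖ * Real.sin (a * |arg u|) * Real.sin (|arg u|/2) ≤ s := by
      calc _ ≤ |Real.sqrt ‖u‖ * Real.sin (a * |arg u|) * Real.sin (|arg u|/2)| := le_abs_self _
        _ = Real.sqrt ‖u‖ * |Real.sin (a * |arg u|)| * |Real.sin (|arg u|/2)| := by rw [abs_mul, abs_mul, abs_of_nonneg hq0]
        _ ≤ s * 1 * 1 := by gcongr <;> exact Real.abs_sin_le_one _
        _ = s := by ring
    have t4 : 0 ≤ Real.sqrt ‖u‖ * Real.cos (|arg u|/2) * Real.cos (a * |arg u|) := mul_nonneg (mul_nonneg hq0 t2) (by linarith)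
    linarith
  have hy : n ^ (1/2:ℝ) * ‖u‖ ^ ((a-1)/2) = Real.sqrt (n * ‖u‖ ^ a) * ‖u‖ ^ (-(1/2):ℝ) := by
    rw [Real.sqrt_eq_rpow, Real.mul_rpow hn0.le hxa.le, ← Real.rpow_mul hun.le, mul_assoc, ← Real.rpow_add hun]
    congr 2; ring
  have hup : 0 < ‖u‖ ^ (-(1/2):ℝ) := Real.rpow_pos_of_pos hun _
  rcases lt_or_ge (1/n) (bar a 1 u).re with h | h
  · have := H Φ n hn hd hH2 hH3 u hu (hur.trans_lt ((min_le_left _ _).trans_lt (by linarith))) (by linarith) h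
    refine this.trans ?_
    have e := sqrt_exp (k := κ * s) (y := n * ‖u‖ ^ a) (by positivity) (by positivity)
    calc _ ≤ C * n ^ (1/2:ℝ) * ‖u‖ ^ ((a-1)/2) * Real.exp (-(κ * n * (s * ‖u‖ ^ a))) := by gcongr
      _ = C * ‖u‖ ^ (-(1/2):ℝ) * (Real.sqrt (n * ‖u‖ ^ a) * Real.exp (-(κ * s * (n * ‖u‖ ^ a)))) := by
          rw [mul_assoc C, hy]; ring_nf
      _ ≤ C * ‖u‖ ^ (-(1/2):ℝ) * ((1 + 2 / (κ * s)) * Real.exp (-(κ * s / 2 * (n * ‖u‖ ^ a)))) := by gcongr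
      _ = (C * (1 + 2/(κ*s))) * ‖u‖ ^ (-(1/2):ℝ) * Real.exp (-(κ * s / 2 * n * ‖u‖ ^ a)) := by ring_nf
      _ ≤ _ := by gcongr; exact le_max_left _ _
  · have b := hH2 u hu (κ2 * ‖u‖) (by positivity) hub
    rw [Real.mul_rpow hκ2.le hun.le] at b
    have hb : κ * s / 2 * n * ‖u‖ ^ a ≤ κ / 2 := by
      have : n * (s * ‖u‖ ^ a) ≤ 1 := by
        have := mul_le_mul_of_nonneg_left (hV.trans h) hn0.le
        rwa [mul_one_div_cancel hn0.ne'] at this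
      nlinarith
    have e1 : 1 ≤ Real.exp (κ/2) * Real.exp (-(κ * s / 2 * n * ‖u‖ ^ a)) := by
      rw [← Real.exp_add]; exact Real.one_le_exp (by linarith)
    calc _ ≤ C0 * (κ2 ^ (-(1/2):ℝ) * ‖u‖ ^ (-(1/2):ℝ)) * 1 := by rw [mul_one]; exact b
      _ ≤ C0 * (κ2 ^ (-(1/2):ℝ) * ‖u‖ ^ (-(1/2):ℝ)) * (Real.exp (κ/2) * Real.exp (-(κ * s / 2 * n * ‖u‖ ^ a))) := by gcongr
      _ = (C0 * κ2 ^ (-(1/2):ℝ) * Real.exp (κ/2)) * ‖u‖ ^ (-(1/2):ℝ) * Real.exp (-(κ * s / 2 * n * ‖u‖ ^ a)) := by ring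
      _ ≤ _ := by gcongr; exact le_max_right _ _

theorem Geo.Cau_corner {D lam N σ V c M J ee al} (g : Geo D lam N σ V c M J ee al) {w0 e : ℂ} {Λ a M' r δ : ℝ} (he : ‖e‖ = 1) (h0 : 0 < Λ) (hπ : Λ < Real.pi)
    (ha : a * Λ = Real.pi / 2) (hM : 1 ≤ M') (hr : 0 < r) (hδ : 0 < δ) (hδΛ : δ < Λ) (hA : Sec w0 e Λ M' r ⊆ RA D) :
    ∃ C > 0, ∃ κ > 0, ∃ r2 > 0, ∀ w ∈ Sec w0 e (Λ - δ) 0 r2, ∀ (n : ℕ) P, 1 ≤ n → Orth D P n →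
      ‖Cau D P w‖ ≤ C * ‖w - w0‖ ^ (-(1/2) : ℝ) * Real.exp (-(κ * n * ‖w - w0‖ ^ a)) := by
  have he0 : e ≠ 0 := by rintro rfl; simp at he
  obtain ⟨r1, hr1, hr1r, H⟩ := corner_decay h0 hπ ha hM hr hδ hδΛ
  obtain ⟨C0, hC0, hdist⟩ := g.Cau_dist
  obtain ⟨C1, hC1, κ1, hκ1, hcpt⟩ := Cau_cpt D (K := (fun θ : ℝ => w0 + e * (r1 * exp (θ * I))) '' Icc (-(Λ - 2 * M' * r1)) (Λ - 2 * M' * r1))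
    (isCompact_Icc.image (by fun_prop)) (by
      rintro _ ⟨θ, hθ, rfl⟩
      refine hA ⟨r1, θ, hr1, hr1r, ?_, rfl⟩
      have := abs_le.2 hθ
      nlinarith)
  obtain ⟨κ2, hκ2, r3, hr3, -, -, hsb⟩ := sec_ball (w0 := w0) he hπ hδ hδΛ hM hr
  obtain ⟨C, hC, κ, hκ, r2, hr2, -, H⟩ := H C0 hC0 C1 hC1 κ1 hκ1 κ2 hκ2
  have hin : ∀ u : ℂ, u ≠ 0 → ‖u‖ < r → |arg u| < Λ - M' * ‖u‖ → w0 + e * u ∈ Sec w0 e Λ M' r := fun u h1 h2 h3 =>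
    ⟨‖u‖, arg u, norm_pos_iff.2 h1, h2, h3, by rw [norm_mul_exp_arg_mul_I]⟩
  have hnf : ∀ w ∈ RA D, w ∉ frontier D.G := fun w hw h => hw.1 (frontier_subset_closure h)
  refine ⟨C, hC, κ, hκ, min r2 r3, by positivity, ?_⟩
  rintro w ⟨ρ, θ, q1, q2, q3, q4⟩ n P hn hO
  have hp := polar_eq he q1 (by linarith) q4
  have key := H (fun u => Cau D P (w0 + e * u)) n (by exact_mod_cast hn) ?_ ?_ ?_ ((w - w0)/e) ?_ ?_ ?_ ?_
  · rw [norm_div, he, div_one, mul_div_cancel₀ _ he0, add_sub_cancel] at key; exact key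
  · intro u h1 h2 h3
    exact DifferentiableAt.comp (g := Cau D P) (f := fun u => w0 + e * u) u (Cau_diff D P (hnf _ (hA (hin u h1 h2 h3)))) (by fun_prop)
  · intro u hu d hd hb
    have hb0 := hb u (mem_ball_self hd)
    have hw := hA (hin u hb0.1 hb0.2.1 hb0.2.2)
    refine (hdist _ (hnf _ hw) n P hO).trans ?_
    gcongr 1
    refine Real.rpow_le_rpow_of_nonpos hd ?_ (by norm_num)
    refine (le_infDist (fr_ne D)).2 fun y hy => ?_
    by_contra hlt
    push Not at hlt
    have := hb ((y - w0)/e) (by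
      rw [mem_ball, dist_eq_norm, show (y - w0)/e - u = (y - (w0 + e * u))/e by field_simp; ring, norm_div, he, div_one, ← dist_eq_norm, dist_comm]; exact hlt)
    have h2 := hA (hin _ this.1 this.2.1 this.2.2)
    rw [mul_div_cancel₀ _ he0, add_sub_cancel] at h2
    exact hnf _ h2 hy
  · intro u h1 h2
    refine hcpt _ ⟨arg u, abs_le.1 h2, ?_⟩ n P hO
    simp only [← h1, norm_mul_exp_arg_mul_I]
  · rw [← norm_pos_iff, norm_div, he, div_one, hp.1]; exact q1
  · rw [norm_div, he, div_one, hp.1]; exact (q2.trans_le (min_le_left _ _)).le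
  · rw [hp.2]; linarith
  · intro u' hu'
    rw [norm_div, he, div_one, mem_ball, dist_eq_norm] at hu'
    obtain ⟨ρ', θ', z1, z2, z3, z4⟩ := hsb w ⟨ρ, θ, q1, q2.trans_le (min_le_right _ _), q3, q4⟩ (show w0 + e * u' ∈ ball w (κ2 * ‖w - w0‖) by
      rw [mem_ball, dist_eq_norm, show w0 + e * u' - w = e * (u' - (w - w0)/e) by field_simp; ring, norm_mul, he, one_mul]; exact hu')
    have hp' := polar_eq he z1 (by nlinarith) z4
    rw [add_sub_cancel_left, norm_mul, he, one_mul, mul_div_cancel_left₀ _ he0] at hp'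
    rw [hp'.1, hp'.2]
    exact ⟨norm_pos_iff.1 (by rw [hp'.1]; exact z1), z2, z3⟩

theorem sp_pick {f : ℂ → ℂ} {ζ : ℂ} {R : ℝ} (hR : 0 < R) (hf : DifferentiableOn ℂ f (ball ζ R)) (hm : ∀ w ∈ ball ζ R, ‖f w‖ < 1) :
    ‖deriv f ζ‖ ≤ 2 * (1 - ‖f ζ‖) / R := by
  have h1 := hm ζ (mem_ball_self hR)
  have hd : DifferentiableOn ℂ (fun w => mob (f ζ) (f w)) (ball ζ R) := fun w hw =>
    (mob_deriv h1 (hm w hw)).differentiableAt.comp_differentiableWithinAt w (hf w hw)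
  have h0 : mob (f ζ) (f ζ) = 0 := by simp [mob]
  have := norm_deriv_le_div_of_mapsTo_ball hd (R₂ := 1) (fun w hw => by
    rw [h0, mem_closedBall_zero_iff]; exact (mob_maps h1 (hm w hw)).le) hR
  have h2 := ((mob_deriv h1 h1).comp ζ ((hf.differentiableAt (ball_mem_nhds ζ hR)).hasDerivAt)).deriv
  have h3 : 1 - (starRingEnd ℂ) (f ζ) * f ζ = ((1 - ‖f ζ‖ ^ 2 : ℝ) : ℂ) := by rw [conj_mul']; push_cast; rfl
  have hp : 0 < 1 - ‖f ζ‖ ^ 2 := by nlinarith [norm_nonneg (f ζ)]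
  rw [show (fun w => mob (f ζ) (f w)) = mob (f ζ) ∘ f from rfl, h2, norm_mul, norm_div, norm_pow, h3, norm_real, Real.norm_of_nonneg hp.le] at this
  have h4 : (1 - ‖f ζ‖^2) / (1 - ‖f ζ‖^2)^2 * ‖deriv f ζ‖ = ‖deriv f ζ‖ / (1 - ‖f ζ‖^2) := by field_simp
  rw [h4, div_le_div_iff₀ hp hR] at this
  rw [le_div_iff₀ hR]
  nlinarith [norm_nonneg (f ζ)]

/-- conformal map onto the disk -/
structure CM (D : JordanDomain) (φ : ℂ → ℂ) : Prop where
  d : DifferentiableOn ℂ φ D.G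
  b : BijOn φ D.G (ball 0 1)

variable {D : JordanDomain} {φ : ℂ → ℂ}

theorem CM.lt (h : CM D φ) {z : ℂ} (hz : z ∈ D.G) : ‖φ z‖ < 1 := mem_ball_zero_iff.1 (h.b.mapsTo hz)

theorem CM.bd (h : CM D φ) {a : ℂ} (ha : a ∉ D.G) {ρ : ℝ} (hρ : ρ < 1) : ∀ᶠ z in nhdsWithin a D.G, ρ < ‖φ z‖ := by
  have hc := (conf_compact D.isOpen h.d h.b hρ).isClosed.isOpen_compl.mem_nhds (show a ∈ {z | z ∈ D.G ∧ ‖φ z‖ ≤ ρ}ᶜ from fun hh => ha hh.1)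
  filter_upwards [nhdsWithin_le_nhds hc, self_mem_nhdsWithin] with z h1 h2
  by_contra hn
  exact h1 ⟨h2, not_lt.1 hn⟩

theorem inv_exp_le {x m : ℝ} (hx : 0 < x) (h : x⁻¹ * Real.exp (-m) ≤ 1) : 1 - x ≤ m := by
  have h1 : Real.exp (-m) ≤ x := by rwa [inv_mul_le_iff₀ hx, mul_one] at h
  linarith [Real.add_one_le_exp (-m)]

theorem CM.corner (h : CM D φ) {w0 e : ℂ} {α C r : ℝ} (hc : Corner D.G w0 e α C r) (hw0 : w0 ∉ D.G) :
    ∃ K > 0, ∃ r1 > 0, ∀ w ∈ D.G, ‖w - w0‖ < r1 → 1 - ‖φ w‖ ≤ K * ‖w - w0‖ ^ (1/α) := by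
  have hpi := Real.pi_pos
  have a0 := hc.a0
  have a2 := hc.a2
  have he := hc.ne
  have hb : 1/α * (α * Real.pi/2) = Real.pi/2 := by field_simp
  have hh0 : 0 < α * Real.pi / 2 := by positivity
  have hhπ : α * Real.pi / 2 < Real.pi := by nlinarith
  obtain ⟨r0, hr0, hr01, hA, hV⟩ := bar_pos hh0 hhπ hb (C := C) (by linarith [hc.C1])
  obtain ⟨r3, hr3, hφ⟩ := Metric.mem_nhdsWithin_iff.1 (h.bd hw0 (show (1/2:ℝ) < 1 by norm_num))
  obtain ⟨r1, hr1, hr10, hr13, hr1r⟩ : ∃ r1 > 0, r1 ≤ r0 ∧ r1 < r3 ∧ r1 < r := ⟨min r0 (min (r3/2) (r/2)), by have := hc.r0; positivity, min_le_left _ _,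
    (min_le_right _ _).trans_lt ((min_le_left _ _).trans_lt (by linarith)), (min_le_right _ _).trans_lt ((min_le_right _ _).trans_lt (by linarith [hc.r0]))⟩
  have hhf : ∀ w ∈ D.G, ‖w - w0‖ < r3 → 1/2 < ‖φ w‖ := fun w hw hlt => hφ ⟨by rwa [mem_ball, dist_eq_norm], hw⟩
  let u : ℂ → ℂ := fun w => (w - w0)/e
  have hun : ∀ w, ‖u w‖ = ‖w - w0‖ := fun w => by simp only [u]; rw [norm_div, he, div_one]
  have hu0 : ∀ w ∈ D.G, u w ≠ 0 := fun w hw => norm_pos_iff.1 (by rw [hun, norm_pos_iff, sub_ne_zero]; rintro rfl; exact hw0 hw)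
  have hC0 : 0 < C := by linarith [hc.C1]
  have harg : ∀ w ∈ D.G, ‖w - w0‖ ≤ r1 → |arg (u w)| ≤ α * Real.pi/2 + C * ‖u w‖ := fun w hw hlt => by
    rw [hun]
    exact notSec' he (fun hs => hc.out hs (subset_closure hw)) (by rintro rfl; exact hw0 hw) (hlt.trans_lt hr1r)
  have hpos : ∀ w ∈ D.G, ‖w - w0‖ ≤ r1 → 0 < (bar (1/α) (-1) (u w)).re := fun w hw hlt =>
    hV _ (hu0 w hw) (by rw [hun]; linarith) (harg w hw hlt)
  have hslit : ∀ w ∈ D.G, ‖w - w0‖ ≤ r1 → u w ∈ slitPlane := fun w hw hlt => slit_of_arg (hu0 w hw) (by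
    have := harg w hw hlt; rw [hun] at this; nlinarith)
  obtain ⟨m, hm, hmin⟩ : ∃ m > 0, ∀ w ∈ D.G, ‖w - w0‖ = r1 → Real.log 2 ≤ m * (bar (1/α) (-1) (u w)).re := by
    obtain ⟨B, hB⟩ : ∃ B : ℝ, B = α * Real.pi/2 + C * r1 := ⟨_, rfl⟩
    have hBπ : B < Real.pi := by nlinarith
    have hB0 : 0 ≤ B := by rw [hB]; positivity
    let k : ℝ → ℝ := fun θ => r1 ^ (1/α) * ((1 + (-1) * Real.sqrt r1 * Real.cos (θ/2)) * Real.cos (1/α * θ) - (-1) * Real.sqrt r1 * Real.sin (1/α * θ) * Real.sin (θ/2))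
    obtain ⟨θ0, hθ0, hk⟩ := isCompact_Icc.exists_isMinOn (s := Icc 0 B) ⟨0, le_rfl, hB0⟩ (f := k) (by fun_prop)
    have hk0 : 0 < k θ0 := by
      have e1 : ‖(r1 : ℂ) * exp (θ0 * I)‖ = r1 := by rw [norm_mul, norm_exp_ofReal_mul_I, mul_one, norm_real, Real.norm_of_nonneg hr1.le]
      have e2 : arg ((r1 : ℂ) * exp (θ0 * I)) = θ0 := by
        rw [arg_real_mul _ hr1, arg_exp_mul_I, toIocMod_eq_self]; exact ⟨by linarith [hθ0.1], by linarith [hθ0.2]⟩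
      have := hV ((r1 : ℂ) * exp (θ0 * I)) (norm_pos_iff.1 (by rw [e1]; exact hr1)) (by rw [e1]; exact hr10) (by rw [e1, e2, abs_of_nonneg hθ0.1, ← hB]; exact hθ0.2)
      rwa [bar_re _ _ (norm_pos_iff.1 (by rw [e1]; exact hr1)), e1, e2, abs_of_nonneg hθ0.1] at this
    refine ⟨Real.log 2 / k θ0, div_pos (Real.log_pos (by norm_num)) hk0, fun w hw hww => ?_⟩
    have h1 := harg w hw hww.le
    rw [hun, hww, ← hB] at h1
    have h2 := hk (show |arg (u w)| ∈ Icc 0 B from ⟨abs_nonneg _, h1⟩)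
    rw [bar_re _ _ (hu0 w hw), hun, hww, div_mul_eq_mul_div, le_div_iff₀ hk0]
    exact mul_le_mul_of_nonneg_left h2 (Real.log_pos (by norm_num)).le
  refine ⟨2 * m, by positivity, r1, hr1, fun w hw hlt => ?_⟩
  have hUo : IsOpen (D.G ∩ ball w0 r1) := D.isOpen.inter isOpen_ball
  have hd : ∀ w ∈ D.G, ‖w - w0‖ ≤ r1 → DifferentiableAt ℂ (fun w => (φ w)⁻¹ * exp (-(m * bar (1/α) (-1) (u w)))) w := fun w hw hle => by
    have := hhf w hw (hle.trans_lt hr13)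
    have d1 := (h.d.differentiableAt (D.isOpen.mem_nhds hw)).inv (norm_pos_iff.1 (by linarith))
    have d2 : DifferentiableAt ℂ (fun w => bar (1/α) (-1) (u w)) w := DifferentiableAt.comp (g := bar (1/α) (-1)) w (bar_diff _ _ (hslit w hw hle)) (by fun_prop)
    exact d1.mul (d2.const_mul _).neg.cexp
  have hnorm : ∀ w, ‖(φ w)⁻¹ * exp (-(m * bar (1/α) (-1) (u w)))‖ = ‖φ w‖⁻¹ * Real.exp (-(m * (bar (1/α) (-1) (u w)).re)) := fun w => by
    rw [norm_mul, norm_inv, norm_exp, neg_re, re_ofReal_mul]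
  have := max_lim hUo (D.bounded.subset inter_subset_left) (f := fun w => (φ w)⁻¹ * exp (-(m * bar (1/α) (-1) (u w)))) (M := 1)
    (fun w hw => (hd w hw.1 (by rw [← dist_eq_norm]; exact (mem_ball.1 hw.2).le)).differentiableWithinAt) ?_ w ⟨hw, by rwa [mem_ball, dist_eq_norm]⟩
  · rw [hnorm] at this
    have h1 := inv_exp_le (by linarith [hhf w hw (hlt.trans hr13)]) this
    have h2 := (re_le_norm _).trans (bar_norm (1/α) (-1) (by simp) (hu0 w hw) (by rw [hun]; linarith))
    rw [hun] at h2
    nlinarith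
  · intro a ha ε hε
    have hac := frontier_subset_closure ha
    have haU : a ∉ D.G ∩ ball w0 r1 := by rw [hUo.frontier_eq] at ha; exact ha.2
    have har : ‖a - w0‖ ≤ r1 := by
      rw [← dist_eq_norm]; exact closure_ball_subset_closedBall (closure_mono inter_subset_right hac)
    by_cases haG : a ∈ D.G
    · have har2 : ‖a - w0‖ = r1 := har.antisymm (not_lt.1 fun hl => haU ⟨haG, by rwa [mem_ball, dist_eq_norm]⟩)
      have h1 := hmin a haG har2
      have hle : ‖(φ a)⁻¹ * exp (-(m * bar (1/α) (-1) (u a)))‖ < 1 + ε := by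
        rw [hnorm]
        have h2 := hhf a haG (by linarith)
        have h3 : ‖φ a‖⁻¹ ≤ 2 := by rw [inv_le_comm₀ (by linarith) (by norm_num)]; linarith
        have h4 : Real.exp (-(m * (bar (1/α) (-1) (u a)).re)) ≤ 1/2 := by
          calc _ ≤ Real.exp (-Real.log 2) := by gcongr
            _ = 1/2 := by rw [Real.exp_neg, Real.exp_log (by norm_num)]; norm_num
        calc _ ≤ 2 * (1/2 : ℝ) := by gcongr
          _ < 1 + ε := by linarith
      exact (((hd a haG har).continuousAt.norm.eventually_lt_const hle).mono fun z hz => hz.le).filter_mono nhdsWithin_le_nhds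
    · have h1 := (h.bd haG (show 1/(1+ε) < 1 by rw [div_lt_one (by linarith)]; linarith)).filter_mono (nhdsWithin_mono a (inter_subset_left (s := D.G) (t := ball w0 r1)))
      filter_upwards [h1, self_mem_nhdsWithin] with z hz1 hz2
      rw [hnorm]
      have h2 := hpos z hz2.1 (by rw [← dist_eq_norm]; exact (mem_ball.1 hz2.2).le)
      have h3 : Real.exp (-(m * (bar (1/α) (-1) (u z)).re)) ≤ 1 := Real.exp_le_one_iff.2 (by have := mul_pos hm h2; linarith)
      have h4 : ‖φ z‖⁻¹ ≤ 1 + ε := by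
        rw [inv_le_comm₀ (lt_trans (by positivity) hz1) (by linarith), ← one_div]; exact hz1.le
      calc _ ≤ (1 + ε) * 1 := by gcongr
        _ = 1 + ε := mul_one _

/-- upper half disc -/
def HD (x0 R : ℝ) : Set ℂ := {ζ | ‖ζ - x0‖ < R ∧ 0 < ζ.im}

theorem half_disc {f : ℂ → ℂ} {x0 R M0 : ℝ} (hR : 0 < R) (hf : DifferentiableOn ℂ f (HD x0 R))
    (h1 : ∀ ζ ∈ HD x0 R, 1/2 ≤ ‖f ζ‖ ∧ ‖f ζ‖ < 1 ∧ 1 - ‖f ζ‖ ≤ M0)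
    (hb : ∀ t : ℝ, |t - x0| < R → ∀ ρ < 1, ∀ᶠ ζ in nhdsWithin (t:ℂ) (HD x0 R), ρ < ‖f ζ‖) {y : ℝ} (hy : 0 < y) (hyR : y < R/2) :
    ‖deriv f (x0 + y * I)‖ ≤ 8 * M0 / R := by
  have ho : IsOpen (HD x0 R) := by
    have a1 : IsOpen {ζ : ℂ | ‖ζ - x0‖ < R} := isOpen_lt (by fun_prop) (by fun_prop)
    have a2 : IsOpen {ζ : ℂ | 0 < ζ.im} := isOpen_lt (by fun_prop) (by fun_prop)
    exact a1.inter a2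
  let B : ℂ → ℂ := fun ζ => ((ζ - x0)/R)^2 - 2 * I * ((ζ - x0)/R)
  have hBre : ∀ ζ : ℂ, (B ζ).re = ((ζ.re - x0)^2 - ζ.im^2)/R^2 + 2 * ζ.im/R := fun ζ => by
    have : (ζ - x0)/R = (((ζ.re - x0)/R : ℝ) : ℂ) + ((ζ.im/R : ℝ) : ℂ) * I := by
      nth_rewrite 1 [← re_add_im ζ]; push_cast; ring
    simp only [B, this]; simp [pow_two]; field_simp
  have hn2 : ∀ ζ : ℂ, ‖ζ - x0‖^2 = (ζ.re - x0)^2 + ζ.im^2 := fun ζ => by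
    rw [Complex.sq_norm, normSq_apply]; simp; ring
  have hBc : Continuous B := by fun_prop
  have hmem : ∀ ζ ∈ ball ((x0:ℂ) + y * I) y, ζ ∈ HD x0 R := fun ζ hζ => by
    rw [mem_ball, dist_eq_norm] at hζ
    constructor
    · calc ‖ζ - x0‖ = ‖(ζ - (x0 + y * I)) + y * I‖ := by ring_nf
        _ ≤ ‖ζ - (x0 + y * I)‖ + ‖(y:ℂ) * I‖ := norm_add_le _ _
        _ < R := by rw [norm_mul, norm_I, norm_real, Real.norm_of_nonneg hy.le]; linarith
    · have := (abs_im_le_norm _).trans_lt hζ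
      simp [abs_lt] at this; linarith [this.1]
  have hm := hmem _ (mem_ball_self hy)
  have hM0 : 0 ≤ M0 := by have := h1 _ hm; linarith
  have hB0 : ∀ ζ ∈ HD x0 R, 0 ≤ (B ζ).re := fun ζ hζ => by
    rw [hBre]
    have h2 : ζ.im ≤ R := ((le_abs_self _).trans (by simpa using abs_im_le_norm (ζ - x0))).trans hζ.1.le
    have : 0 ≤ (ζ.im/R) * (2 - ζ.im/R) := mul_nonneg (div_nonneg hζ.2.le hR.le) (by rw [sub_nonneg, div_le_iff₀ hR]; linarith)
    have h3 : ((ζ.re - x0)^2 - ζ.im^2)/R^2 + 2 * ζ.im/R = ((ζ.re - x0)/R)^2 + (ζ.im/R) * (2 - ζ.im/R) := by field_simp; ring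
    rw [h3]; positivity
  have hnorm : ∀ w, ‖(f w)⁻¹ * exp (-((2 * M0 : ℝ) * B w))‖ = ‖f w‖⁻¹ * Real.exp (-(2 * M0 * (B w).re)) := fun w => by
    rw [norm_mul, norm_inv, norm_exp, neg_re, re_ofReal_mul]
  have hBd : Differentiable ℂ fun w => exp (-((2 * M0 : ℝ) * B w)) := by simp only [B]; fun_prop
  have key := max_lim ho (isBounded_ball.subset fun ζ hζ => show ζ ∈ ball (x0:ℂ) R by rw [mem_ball, dist_eq_norm]; exact hζ.1) (f := fun w => (f w)⁻¹ * exp (-((2 * M0 : ℝ) * B w))) (M := 1)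
    (fun w hw => ((hf w hw).inv (norm_pos_iff.1 (by linarith [(h1 w hw).1]))).mul (hBd w).differentiableWithinAt) ?_ _ hm
  · rw [hnorm] at key
    have h2 := h1 _ hm
    have h3 := inv_exp_le (by linarith) key
    have h4 := sp_pick hy (hf.mono hmem) fun w hw => (h1 w (hmem w hw)).2.1
    refine h4.trans ?_
    rw [hBre] at h3
    simp at h3
    have h5 : -y^2/R^2 + 2*y/R ≤ 2*y/R := by
      have : 0 ≤ y^2/R^2 := by positivity
      rw [neg_div]; linarith
    have h6 : 1 - ‖f (x0 + y * I)‖ ≤ 2 * M0 * (2*y/R) := by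
      have := mul_le_mul_of_nonneg_left h5 (show 0 ≤ 2 * M0 by positivity); linarith
    rw [div_le_div_iff₀ hy hR]
    calc _ ≤ 2 * (2 * M0 * (2*y/R)) * R := by gcongr
      _ = _ := by field_simp; ring
  · intro a ha ε hε
    have haU : a ∉ HD x0 R := by rw [ho.frontier_eq] at ha; exact ha.2
    have ha2 : a ∈ {ζ : ℂ | ‖ζ - x0‖ ≤ R ∧ 0 ≤ ζ.im} := by
      refine closure_minimal (fun ζ hζ => ?_) ?_ (frontier_subset_closure ha)
      · exact ⟨hζ.1.le, hζ.2.le⟩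
      · have a1 : IsClosed {ζ : ℂ | ‖ζ - x0‖ ≤ R} := isClosed_le (by fun_prop) (by fun_prop)
        have a2 : IsClosed {ζ : ℂ | 0 ≤ ζ.im} := isClosed_le (by fun_prop) (by fun_prop)
        exact a1.inter a2
    rcases ha2.1.lt_or_eq with hlt | heq
    · have him : a.im = 0 := ha2.2.antisymm' (not_lt.1 fun h => haU ⟨hlt, h⟩)
      have har : a = (a.re : ℂ) := by apply Complex.ext <;> simp [him]
      have hlt2 : |a.re - x0| < R := by rw [har, ← ofReal_sub, norm_real] at hlt; exact hlt
      have h2 := hb a.re hlt2 (1/(1+ε)) (by rw [div_lt_one (by linarith)]; linarith)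
      rw [← har] at h2
      filter_upwards [h2, self_mem_nhdsWithin] with z hz1 hz2
      rw [hnorm]
      have h3 : Real.exp (-(2 * M0 * (B z).re)) ≤ 1 := Real.exp_le_one_iff.2 (by
        have h3 : 0 ≤ 2 * M0 * (B z).re := mul_nonneg (by positivity) (hB0 z hz2)
        linarith)
      have h4 : ‖f z‖⁻¹ ≤ 1 + ε := by
        rw [inv_le_comm₀ (lt_trans (by positivity) hz1) (by linarith), ← one_div]; exact hz1.le
      calc _ ≤ (1 + ε) * 1 := by gcongr
        _ = 1 + ε := mul_one _
    · have hBa : 1 ≤ (B a).re := by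
        rw [hBre]
        have h2 := hn2 a
        rw [heq] at h2
        have h3 : a.im ≤ R := (le_abs_self _).trans ((by simpa using abs_im_le_norm (a - x0) : |a.im| ≤ ‖a - x0‖).trans heq.le)
        have h4 : ((a.re - x0)^2 - a.im^2)/R^2 + 2 * a.im/R = 1 + 2 * (a.im/R) * (1 - a.im/R) := by
          rw [show (a.re - x0)^2 = R^2 - a.im^2 by linarith]; field_simp; ring
        rw [h4]
        have : 0 ≤ 2 * (a.im/R) * (1 - a.im/R) := mul_nonneg (by have := ha2.2; positivity) (by rw [sub_nonneg, div_le_one hR]; exact h3)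
        linarith
      have hc : Continuous fun z => Real.exp (2 * M0) * Real.exp (-(2 * M0 * (B z).re)) := continuous_const.mul (Real.continuous_exp.comp (continuous_const.mul (continuous_re.comp hBc)).neg)
      have hlt : Real.exp (2 * M0) * Real.exp (-(2 * M0 * (B a).re)) < 1 + ε := by
        rw [← Real.exp_add]
        have : Real.exp (2 * M0 + -(2 * M0 * (B a).re)) ≤ 1 := Real.exp_le_one_iff.2 (by nlinarith)
        linarith
      filter_upwards [nhdsWithin_le_nhds (hc.continuousAt.eventually_lt_const hlt), self_mem_nhdsWithin] with z hz1 hz2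
      rw [hnorm]
      have h3 : ‖f z‖⁻¹ ≤ Real.exp (2 * M0) := by
        obtain ⟨b1, b2, b3⟩ := h1 z hz2
        rw [inv_le_iff_one_le_mul₀ (by linarith)]
        have := Real.add_one_le_exp (2 * M0)
        nlinarith
      exact (mul_le_mul_of_nonneg_right h3 (Real.exp_pos _).le).trans hz1.le

theorem shrink {c : ℝ} (hc : 0 < c) {p : ℂ → Prop} (h : ∀ x ∈ Icc (0:ℝ) 1, ∀ᶠ ζ in nhds (x:ℂ), ζ ∈ Nset c → 0 < ζ.im → p ζ) :
    ∃ c' > 0, c' ≤ c ∧ ∀ ζ ∈ Nset c', 0 < ζ.im → p ζ := by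
  have hK : IsCompact (ofReal '' Icc (0:ℝ) 1) := isCompact_Icc.image continuous_ofReal
  obtain ⟨δ, hδ, hs⟩ := hK.exists_thickening_subset_open (isOpen_interior (s := {ζ | ζ ∈ Nset c → 0 < ζ.im → p ζ})) (by
    rintro _ ⟨x, hx, rfl⟩; exact mem_interior_iff_mem_nhds.2 (h x hx))
  refine ⟨min c δ, by positivity, min_le_left _ _, fun ζ hζ h0 => ?_⟩
  have hr := Nset_re (by positivity) hζ
  refine interior_subset (hs ?_) (Nset_mono (by positivity) (min_le_left _ _) hζ) h0
  rw [mem_thickening_iff]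
  refine ⟨_, ⟨ζ.re, ⟨hr.1.le, hr.2.le⟩, rfl⟩, ?_⟩
  have : ζ - (ζ.re:ℝ) = ζ.im * I := by nth_rewrite 1 [← re_add_im ζ]; ring
  rw [dist_eq_norm, this, norm_mul, norm_I, mul_one, norm_real]
  have h1 := hζ.1
  have h2 : min c δ ≤ δ := min_le_right _ _
  calc |ζ.im| < min c δ * ζ.re := h1
    _ ≤ δ * 1 := mul_le_mul h2 hr.2.le hr.1.le hδ.le
    _ = δ := mul_one _

/-- weight -/
noncomputable def wt (a b x : ℝ) : ℝ := x ^ a * (1 - x) ^ b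

theorem wt_pos {a b x : ℝ} (h0 : 0 < x) (h1 : x < 1) : 0 < wt a b x :=
  mul_pos (Real.rpow_pos_of_pos h0 _) (Real.rpow_pos_of_pos (by linarith) _)

theorem wt_low {ε : ℝ} (a b : ℝ) (hε : 0 < ε) : ∃ k > 0, ∀ x, 0 < x → x < 1 → (x ≤ 1 - ε → k * x ^ a ≤ wt a b x) ∧ (ε ≤ x → k * (1-x) ^ b ≤ wt a b x) := by
  have key : ∀ b : ℝ, ∃ k > 0, ∀ x, ε ≤ x → x < 1 → k ≤ x ^ b := fun b => by
    rcases le_total 0 b with h | h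
    · exact ⟨ε ^ b, by positivity, fun x h1 h2 => Real.rpow_le_rpow hε.le h1 h⟩
    · exact ⟨1, one_pos, fun x h1 h2 => Real.one_le_rpow_of_pos_of_le_one_of_nonpos (by linarith) h2.le h⟩
  obtain ⟨k1, h1, h1'⟩ := key a
  obtain ⟨k2, h2, h2'⟩ := key b
  refine ⟨min k1 k2, by positivity, fun x hx0 hx1 => ⟨fun h => ?_, fun h => ?_⟩⟩
  · rw [wt, mul_comm]; gcongr; exact (min_le_right _ _).trans (h2' _ (by linarith) (by linarith))
  · rw [wt]; have : 0 ≤ (1 - x) ^ b := Real.rpow_nonneg (by linarith) _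
    gcongr; exact (min_le_left _ _).trans (h1' _ h hx1)

/-- combine end estimates -/
theorem wt_glue {p : ℂ → ℝ} {S : Set ℂ} {a b ε K : ℝ} (hε : 0 < ε) (hε1 : ε < 1/2) (hK : 0 < K) (hS : ∀ ζ ∈ S, 0 < ζ.re ∧ ζ.re < 1)
    (h0 : ∀ ζ ∈ S, ζ.re < ε → p ζ ≤ K * ζ.re ^ a) (h1 : ∀ ζ ∈ S, 1 - ζ.re < ε → p ζ ≤ K * (1 - ζ.re) ^ b) (h2 : ∀ ζ ∈ S, ε ≤ ζ.re → ζ.re ≤ 1 - ε → p ζ ≤ K) :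
    ∃ K' > 0, ∀ ζ ∈ S, p ζ ≤ K' * wt a b ζ.re := by
  obtain ⟨k, hk, hk'⟩ := wt_low a b hε
  obtain ⟨k3, hk3, hk3'⟩ := wt_low a 0 hε
  obtain ⟨k4, hk4, hk4'⟩ := wt_low 0 a hε
  refine ⟨K/k + K/(k * k4), by positivity, fun ζ hζ => ?_⟩
  obtain ⟨r0, r1⟩ := hS ζ hζ
  have hw := wt_pos (a := a) (b := b) r0 r1
  rw [add_mul]
  have e1 : 0 ≤ K/k * wt a b ζ.re := by positivity
  have e2 : 0 ≤ K/(k*k4) * wt a b ζ.re := by positivity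
  have e3 : ∀ t, k * t ≤ wt a b ζ.re → K * t ≤ K/k * wt a b ζ.re := fun t ht => by
    rw [div_mul_eq_mul_div, le_div_iff₀ hk]; nlinarith
  rcases lt_or_ge ζ.re ε with h | h
  · have := (h0 ζ hζ h).trans (e3 _ ((hk' _ r0 r1).1 (by linarith))); linarith
  · rcases lt_or_ge (1 - ζ.re) ε with h' | h'
    · have := (h1 ζ hζ h').trans (e3 _ ((hk' _ r0 r1).2 h)); linarith
    · have q1 := (hk' _ r0 r1).1 (by linarith)
      have q2 := (hk4' (1 - ζ.re) (by linarith) (by linarith)).1 (by linarith)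
      simp only [wt, Real.rpow_zero, mul_one, sub_sub_cancel, one_mul] at q2
      have q3 := h2 ζ hζ h (by linarith)
      have q4 : K ≤ K/(k*k4) * wt a b ζ.re := by
        rw [div_mul_eq_mul_div, le_div_iff₀ (by positivity)]
        have : k * k4 ≤ wt a b ζ.re := (mul_le_mul_of_nonneg_left q2 hk.le).trans q1
        nlinarith
      linarith

def NU (c : ℝ) : Set ℂ := {ζ | ζ ∈ Nset c ∧ 0 < ζ.im}

theorem NU_open (c : ℝ) : IsOpen (NU c) := by
  have a2 : IsOpen {ζ : ℂ | 0 < ζ.im} := isOpen_lt (by fun_prop) (by fun_prop)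
  exact (Nset_open c).inter a2

theorem NU_convex (c : ℝ) : Convex ℝ (NU c) := by
  have := half_convex c 1
  simp only [one_mul] at this
  exact this

structure Up (f : ℂ → ℂ) (c b0 b1 K : ℝ) : Prop where
  c0 : 0 < c
  c2 : c ≤ 1/2
  K0 : 0 < K
  d : DifferentiableOn ℂ f (NU c)
  lo : ∀ ζ ∈ NU c, 1/2 ≤ ‖f ζ‖
  lt : ∀ ζ ∈ NU c, ‖f ζ‖ < 1
  bd : ∀ t ∈ Ioo (0:ℝ) 1, ∀ ρ < 1, ∀ᶠ ζ in nhdsWithin (t:ℂ) (NU c), ρ < ‖f ζ‖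
  w : ∀ ζ ∈ NU c, 1 - ‖f ζ‖ ≤ K * wt b0 b1 ζ.re

theorem wt_comp {a b x y : ℝ} (h0 : 0 < x) (h1 : x < 1) (e1 : x/2 ≤ y) (e2 : y ≤ 2*x) (e3 : (1-x)/2 ≤ 1-y) (e4 : 1-y ≤ 2*(1-x)) :
    wt a b y ≤ 2^|a| * 2^|b| * wt a b x := by
  have := mul_le_mul (rp_ratio a h0 e1 e2) (rp_ratio b (by linarith) e3 e4) (Real.rpow_nonneg (by linarith) _) (by positivity)
  rw [wt, wt]; linarith

theorem wt_mul (a b a' b' : ℝ) {x : ℝ} (h0 : 0 < x) (h1 : x < 1) : wt a b x * wt a' b' x = wt (a+a') (b+b') x := by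
  rw [wt, wt, wt, Real.rpow_add h0, Real.rpow_add (by linarith)]; ring

theorem min_q {y c x : ℝ} (hc : 0 < c) (hx : 0 < x) (hx1 : x < 1) (h1 : y < c/8 * x) (h2 : y < c/8*(1-x)) : y < c * x * (1-x)/4 := by
  rcases le_total x (1/2) with h | h
  · have : c/8*x ≤ c * x * (1-x)/4 := by nlinarith [mul_pos hc hx]
    linarith
  · have : c/8*(1-x) ≤ c * x * (1-x)/4 := by nlinarith [mul_pos hc (show 0 < 1-x by linarith)]
    linarith

theorem HD_sub {c x0 : ℝ} (hc : 0 < c) (hc2 : c ≤ 1/2) (hx : 0 < x0) (hx1 : x0 < 1) {ζ : ℂ} (h : ζ ∈ HD x0 (c * x0 * (1-x0)/2)) :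
    ζ ∈ NU c ∧ x0/2 ≤ ζ.re ∧ ζ.re ≤ 2*x0 ∧ (1-x0)/2 ≤ 1-ζ.re ∧ 1-ζ.re ≤ 2*(1-x0) := by
  have h1 := (abs_re_le_norm (ζ - x0)).trans_lt h.1
  have h2 := (abs_im_le_norm (ζ - x0)).trans_lt h.1
  simp [abs_lt] at h1 h2
  have e1 : c * x0 * (1-x0)/2 ≤ c * x0/2 := by nlinarith [mul_pos hc hx]
  have e2 : c * x0 * (1-x0)/2 ≤ c * (1-x0)/2 := by nlinarith [mul_pos hc (show 0 < 1-x0 by linarith)]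
  have e3 : c * x0/2 ≤ x0/4 := by nlinarith
  have e4 : c * (1-x0)/2 ≤ (1-x0)/4 := by nlinarith
  refine ⟨⟨⟨?_, ?_⟩, h.2⟩, by linarith, by linarith, by linarith, by linarith⟩
  · rw [abs_of_pos h.2]; nlinarith
  · rw [abs_of_pos h.2]; nlinarith

theorem Up.deriv_le {f : ℂ → ℂ} {c b0 b1 K : ℝ} (h : Up f c b0 b1 K) : ∃ C > 0, ∀ ζ ∈ NU (c/8), ‖deriv f ζ‖ ≤ C * wt (b0-1) (b1-1) ζ.re := by
  have c0 := h.c0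
  have K0 := h.K0
  refine ⟨8 * (K * (2^|b0| * 2^|b1|)) * (2/c), by positivity, fun ζ hζ => ?_⟩
  obtain ⟨r0, r1⟩ := Nset_re (by positivity) hζ.1
  have h2 := hζ.1.1
  have h3 := hζ.1.2
  rw [abs_of_pos hζ.2] at h2 h3
  have hy := min_q h.c0 r0 r1 h2 h3
  have r1' : 0 < 1 - ζ.re := by linarith
  have := half_disc (x0 := ζ.re) (R := c * ζ.re * (1-ζ.re)/2) (M0 := K * (2^|b0| * 2^|b1| * wt b0 b1 ζ.re)) (by positivity)
    (h.d.mono fun w hw => (HD_sub h.c0 h.c2 r0 r1 hw).1) (fun w hw => by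
      obtain ⟨q1, q2, q3, q4, q5⟩ := HD_sub h.c0 h.c2 r0 r1 hw
      exact ⟨h.lo w q1, h.lt w q1, (h.w w q1).trans (mul_le_mul_of_nonneg_left (wt_comp r0 r1 q2 q3 q4 q5) h.K0.le)⟩)
    (fun t ht ρ hρ => (h.bd t (by
        rw [abs_lt] at ht
        have e1 : c * ζ.re * (1-ζ.re)/2 < ζ.re := by have := h.c2; nlinarith [mul_pos r0 r1']
        have e2 : c * ζ.re * (1-ζ.re)/2 < 1-ζ.re := by have := h.c2; nlinarith [mul_pos r0 r1']
        constructor <;> linarith) ρ hρ).filter_mono (nhdsWithin_mono _ fun w hw => (HD_sub h.c0 h.c2 r0 r1 hw).1)) hζ.2 (by linarith)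
  rw [re_add_im] at this
  refine this.trans_eq ?_
  have e : wt b0 b1 ζ.re = wt (b0-1) (b1-1) ζ.re * (ζ.re * (1-ζ.re)) := by
    have := wt_mul (b0-1) (b1-1) 1 1 r0 r1
    simp only [sub_add_cancel] at this
    rw [← this]; simp [wt]
  rw [e]; field_simp

theorem line_glue {U : Set ℂ} (hU : IsOpen U) {F : ℂ → ℂ} (hc : ContinuousOn F U) (hd : ∀ z ∈ U, z.im ≠ 0 → DifferentiableAt ℂ F z) :
    DifferentiableOn ℂ F U := by
  refine (isConservativeOn_and_continuousOn_iff_isDifferentiableOn hU).1 ⟨fun z w hzw => ?_, hc⟩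
  rw [eq_neg_iff_add_eq_zero, wedgeIntegral_add_wedgeIntegral_eq]
  have h1 : ∀ s ∈ uIcc z.im w.im, ∀ t ∈ uIcc z.im w.im, (0:ℝ) ∉ Ioo (min s t) (max s t) →
      (∫ x : ℝ in z.re..w.re, F (x + s * I)) - (∫ x : ℝ in z.re..w.re, F (x + t * I)) +
      I • (∫ y : ℝ in s..t, F (w.re + y * I)) - I • (∫ y : ℝ in s..t, F (z.re + y * I)) = 0 := by
    intro s hs t ht h0
    have hsub : (uIcc z.re w.re) ×ℂ (uIcc s t) ⊆ U := fun v hv => hzw ⟨hv.1, uIcc_subset_uIcc hs ht hv.2⟩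
    have := integral_boundary_rect_eq_zero_of_continuousOn_of_differentiableOn F ⟨z.re, s⟩ ⟨w.re, t⟩ (hc.mono hsub) (fun v hv =>
      (hd v (hsub ⟨Ioo_subset_Icc_self hv.1, Ioo_subset_Icc_self hv.2⟩) (fun h => h0 (h ▸ hv.2))).differentiableWithinAt)
    exact this
  by_cases h0 : (0:ℝ) ∈ Ioo (min z.im w.im) (max z.im w.im)
  · have m0 : (0:ℝ) ∈ uIcc z.im w.im := Ioo_subset_Icc_self h0
    have a1 := h1 z.im left_mem_uIcc 0 m0 (by
      rintro ⟨q1, q2⟩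
      rcases le_total z.im 0 with h | h
      · rw [max_eq_right h] at q2; exact absurd q2 (lt_irrefl _)
      · rw [min_eq_right h] at q1; exact absurd q1 (lt_irrefl _))
    have a2 := h1 0 m0 w.im right_mem_uIcc (by
      rintro ⟨q1, q2⟩
      rcases le_total w.im 0 with h | h
      · rw [max_eq_left h] at q2; exact absurd q2 (lt_irrefl _)
      · rw [min_eq_left h] at q1; exact absurd q1 (lt_irrefl _))
    have iv : ∀ u ∈ uIcc z.re w.re, ∀ s ∈ uIcc z.im w.im, ∀ t ∈ uIcc z.im w.im, IntervalIntegrable (fun y : ℝ => F (u + y * I)) volume s t := by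
      intro u hu s hs t ht
      refine (hc.comp (by fun_prop) fun y hy => hzw ?_).intervalIntegrable
      have := uIcc_subset_uIcc hs ht hy
      exact ⟨by simpa using hu, by simpa using this⟩
    rw [← intervalIntegral.integral_add_adjacent_intervals (iv _ right_mem_uIcc _ left_mem_uIcc _ m0) (iv _ right_mem_uIcc _ m0 _ right_mem_uIcc),
      ← intervalIntegral.integral_add_adjacent_intervals (iv _ left_mem_uIcc _ left_mem_uIcc _ m0) (iv _ left_mem_uIcc _ m0 _ right_mem_uIcc)]
    simp only [smul_eq_mul] at a1 a2 ⊢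
    linear_combination a1 + a2
  · exact h1 _ left_mem_uIcc _ right_mem_uIcc h0

theorem lip_lim {f : ℂ → ℂ} {A : Set ℂ} {t : ℂ} {δ : ℝ} {L : NNReal} (hδ : 0 < δ) (ht : t ∈ closure A) (hl : LipschitzOnWith L f (A ∩ ball t δ)) :
    ∃ y, Tendsto f (nhdsWithin t A) (nhds y) := by
  haveI := mem_closure_iff_nhdsWithin_neBot.1 ht
  refine cauchy_map_iff_exists_tendsto.1 ?_
  refine Cauchy.map_of_le ((cauchy_nhds (a := t)).mono nhdsWithin_le_nhds) hl.uniformContinuousOn ?_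
  exact le_principal_iff.2 (inter_mem self_mem_nhdsWithin (nhdsWithin_le_nhds (ball_mem_nhds t hδ)))

theorem NU_closure {c : ℝ} (hc : 0 < c) {z : ℂ} (hz : z ∈ Nset c) (h0 : 0 ≤ z.im) : z ∈ closure (NU c) := by
  rcases h0.lt_or_eq with h | h
  · exact subset_closure ⟨hz, h⟩
  · obtain ⟨δ, hδ, hb⟩ := Metric.isOpen_iff.1 (Nset_open c) z hz
    refine Metric.mem_closure_iff.2 fun ε hε => ⟨z + (min ε δ / 2 : ℝ) * I, ⟨hb ?_, ?_⟩, ?_⟩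
    · rw [mem_ball, dist_eq_norm, add_sub_cancel_left, norm_mul, norm_I, norm_real, mul_one, Real.norm_of_nonneg (by positivity)]
      have := min_le_right ε δ; linarith
    · simp [← h]; exact ⟨hε, hδ⟩
    · rw [dist_comm, dist_eq_norm, add_sub_cancel_left, norm_mul, norm_I, norm_real, mul_one, Real.norm_of_nonneg (by positivity)]
      have := min_le_left ε δ; linarith

theorem reflect {f : ℂ → ℂ} {c : ℝ} (c0 : 0 < c) (hd : DifferentiableOn ℂ f (NU c)) (hlo : ∀ ζ ∈ NU c, 1/2 ≤ ‖f ζ‖) (hlt : ∀ ζ ∈ NU c, ‖f ζ‖ < 1)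
    (bd : ∀ t ∈ Ioo (0:ℝ) 1, ∀ ρ < 1, ∀ᶠ ζ in nhdsWithin (t:ℂ) (NU c), ρ < ‖f ζ‖)
    (lip : ∀ t ∈ Ioo (0:ℝ) 1, ∃ δ > 0, ∃ B, ∀ ζ ∈ NU c, ‖ζ - t‖ < δ → ‖deriv f ζ‖ ≤ B) :
    ∃ F : ℂ → ℂ, DifferentiableOn ℂ F (Nset c) ∧ (∀ ζ ∈ NU c, F ζ = f ζ) ∧ (∀ ζ ∈ Nset c, ζ.im < 0 → F ζ = ((starRingEnd ℂ) (f ((starRingEnd ℂ) ζ)))⁻¹) ∧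
      ∀ t ∈ Ioo (0:ℝ) 1, ‖F t‖ = 1 := by
  have hlim : ∀ z ∈ Nset c ∩ {z | 0 ≤ z.im}, ∃ y, Tendsto f (nhdsWithin z (NU c)) (nhds y) := by
    rintro z ⟨hz, h0⟩
    change 0 ≤ z.im at h0
    rcases h0.lt_or_eq with h | h
    · exact ⟨_, ((hd.continuousOn) z ⟨hz, h⟩)⟩
    · have hr := Nset_re c0 hz
      have hz' : z = (z.re : ℝ) := by apply Complex.ext <;> simp [← h]
      obtain ⟨δ, hδ, B, hB⟩ := lip z.re hr
      rw [← hz'] at hB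
      refine lip_lim (L := B.toNNReal) hδ (NU_closure c0 hz h0) (Convex.lipschitzOnWith_of_nnnorm_deriv_le (𝕜 := ℂ) (fun w hw => hd.differentiableAt ((NU_open c).mem_nhds hw.1))
        (fun w hw => ?_) ((NU_convex c).inter (convex_ball _ _)))
      rw [← NNReal.coe_le_coe, coe_nnnorm]
      exact (hB w hw.1 (by rw [← dist_eq_norm]; exact hw.2)).trans (Real.le_coe_toNNReal B)
  obtain ⟨E, hE⟩ : ∃ E, E = extendFrom (NU c) f := ⟨_, rfl⟩
  have hcl : Nset c ∩ {z | 0 ≤ z.im} ⊆ closure (NU c) := fun z hz => NU_closure c0 hz.1 hz.2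
  have Ec : ContinuousOn E (Nset c ∩ {z | 0 ≤ z.im}) := hE ▸ continuousOn_extendFrom hcl hlim
  have Ef : ∀ ζ ∈ NU c, E ζ = f ζ := fun ζ hζ => by rw [hE]; exact extendFrom_eq (subset_closure hζ) (hd.continuousOn ζ hζ)
  have E1 : ∀ z ∈ Nset c, z.im = 0 → ‖E z‖ = 1 := fun z hz h0 => by
    have ht := (tendsto_extendFrom (hlim z ⟨hz, h0.ge⟩)).norm
    rw [← hE] at ht
    haveI := mem_closure_iff_nhdsWithin_neBot.1 (NU_closure c0 hz h0.ge)
    have hz' : ((z.re : ℝ) : ℂ) = z := by apply Complex.ext <;> simp [h0]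
    apply le_antisymm
    · exact le_of_tendsto ht (eventually_mem_nhdsWithin.mono fun w (hw : w ∈ NU c) => (hlt w hw).le)
    · refine le_of_forall_lt fun ρ hρ => ?_
      obtain ⟨ρ', q1, q2⟩ := exists_between hρ
      have := bd z.re (Nset_re c0 hz) ρ' q2
      rw [hz'] at this
      exact q1.trans_le (ge_of_tendsto ht (this.mono fun w hw => hw.le))
  have E0 : ∀ z ∈ Nset c ∩ {z | 0 ≤ z.im}, E z ≠ 0 := fun z hz => by
    rcases lt_or_eq_of_le (show 0 ≤ z.im from hz.2) with h | h
    · rw [Ef z ⟨hz.1, h⟩]; exact norm_pos_iff.1 (by linarith [hlo z ⟨hz.1, h⟩])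
    · exact norm_pos_iff.1 (by rw [E1 z hz.1 h.symm]; norm_num)
  let F : ℂ → ℂ := fun z => if 0 ≤ z.im then E z else ((starRingEnd ℂ) (E ((starRingEnd ℂ) z)))⁻¹
  have Fu : ∀ z, 0 ≤ z.im → F z = E z := fun z h => if_pos h
  have Fl : ∀ z ∈ Nset c, z.im ≤ 0 → F z = ((starRingEnd ℂ) (E ((starRingEnd ℂ) z)))⁻¹ := fun z hz h => by
    rcases h.lt_or_eq with h | h
    · exact if_neg (not_le.2 h)
    · rw [Fu z h.ge, conj_eq_iff_im.2 h]
      refine eq_inv_of_mul_eq_one_left ?_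
      rw [mul_conj', E1 z hz h]; norm_num
  have Cu : ContinuousOn F (Nset c ∩ {z | 0 ≤ z.im}) := Ec.congr fun z hz => Fu z hz.2
  have Cl : ContinuousOn F (Nset c ∩ {z | z.im ≤ 0}) := by
    have hm : ∀ z ∈ Nset c ∩ {z | z.im ≤ 0}, (starRingEnd ℂ) z ∈ Nset c ∩ {z | 0 ≤ z.im} := fun z hz => ⟨Nset_conj.2 hz.1, by simpa using hz.2⟩
    have h1 : ContinuousOn (fun z => ((starRingEnd ℂ) (E ((starRingEnd ℂ) z)))⁻¹) (Nset c ∩ {z | z.im ≤ 0}) :=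
      (continuous_conj.comp_continuousOn (Ec.comp continuous_conj.continuousOn hm)).inv₀ fun z hz h => E0 _ (hm z hz) (by simpa using h)
    exact h1.congr fun z hz => Fl z hz.1 hz.2
  have FC : ContinuousOn F (Nset c) := fun z hz => by
    have k1 : IsClosed {z : ℂ | 0 ≤ z.im} := isClosed_le (by fun_prop) (by fun_prop)
    have k2 : IsClosed {z : ℂ | z.im ≤ 0} := isClosed_le (by fun_prop) (by fun_prop)
    have : Nset c = (Nset c ∩ {z | 0 ≤ z.im}) ∪ (Nset c ∩ {z | z.im ≤ 0}) := by
      rw [← inter_union_distrib_left]; ext w; simp [le_total]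
    rw [this]
    refine ContinuousWithinAt.union ?_ ?_
    · by_cases h : 0 ≤ z.im
      · exact Cu z ⟨hz, h⟩
      · exact continuousWithinAt_of_notMem_closure fun hh => h (closure_minimal inter_subset_right k1 hh)
    · by_cases h : z.im ≤ 0
      · exact Cl z ⟨hz, h⟩
      · exact continuousWithinAt_of_notMem_closure fun hh => h (closure_minimal inter_subset_right k2 hh)
  have ff : ∀ ζ ∈ NU c, F ζ = f ζ := fun ζ hζ => (Fu ζ hζ.2.le).trans (Ef ζ hζ)
  have fl : ∀ ζ ∈ Nset c, ζ.im < 0 → F ζ = ((starRingEnd ℂ) (f ((starRingEnd ℂ) ζ)))⁻¹ := fun ζ hζ h => by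
    rw [Fl ζ hζ h.le, Ef _ ⟨Nset_conj.2 hζ, by simpa using h⟩]
  refine ⟨F, line_glue (Nset_open c) FC fun z hz h0 => ?_, ff, fl, fun t ht => ?_⟩
  · rcases h0.lt_or_gt with h | h
    · have hm : (starRingEnd ℂ) z ∈ NU c := ⟨Nset_conj.2 hz, by simpa using h⟩
      have o : IsOpen {ζ : ℂ | ζ.im < 0} := isOpen_lt (by fun_prop) (by fun_prop)
      refine DifferentiableAt.congr_of_eventuallyEq ?_ (((Nset_open c).inter o).mem_nhds ⟨hz, h⟩ |> fun hn => Filter.mem_of_superset hn fun w hw => fl w hw.1 hw.2)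
      have d1 : DifferentiableAt ℂ (fun w => (starRingEnd ℂ) (f ((starRingEnd ℂ) w))) z := by
        have := hd.differentiableAt ((NU_open c).mem_nhds hm)
        have := this.conj_conj
        simpa [Function.comp_def] using this
      refine d1.inv fun h => ?_
      have := hlo _ hm
      rw [(map_eq_zero _).1 h] at this; norm_num at this
    · exact (hd.differentiableAt ((NU_open c).mem_nhds ⟨hz, h⟩)).congr_of_eventuallyEq (Filter.mem_of_superset ((NU_open c).mem_nhds ⟨hz, h⟩) ff)
  · rw [Fu _ (by simp)]; exact E1 _ ((Nset_real c0).2 ht) (by simp)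

theorem hopf {F : ℂ → ℂ} {t r : ℝ} (hr : 0 < r) (hd : DifferentiableAt ℂ F t) (hF : DifferentiableOn ℂ F (ball (t + r * I) r)) (hlt : ∀ ζ ∈ ball (t + r * I : ℂ) r, ‖F ζ‖ < 1)
    (h1 : ∀ᶠ x : ℝ in nhds t, ‖F x‖ = 1) : deriv F t ≠ 0 ∧ deriv F t = I * ‖deriv F t‖ * F t := by
  obtain ⟨a, ha⟩ : ∃ a, a = F (t + r * I) := ⟨_, rfl⟩
  have ha1 : ‖a‖ < 1 := ha ▸ hlt _ (mem_ball_self hr)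
  have hFt : ‖F t‖ = 1 := h1.self_of_nhds
  have ha2 : 0 < 1 - ‖a‖^2 := by nlinarith [norm_nonneg a]
  obtain ⟨κ, hκ⟩ : ∃ κ, κ = (1 - ‖a‖)^2/(1 - ‖a‖^2)/r := ⟨_, rfl⟩
  have hκ0 : 0 < κ := by rw [hκ]; have : 0 < 1 - ‖a‖ := by linarith
                         positivity
  have key : ∀ y, 0 < y → y < r → ‖F (t + y * I)‖^2 ≤ 1 - κ * y := by
    intro y hy hyr
    have hn : ‖(t + y * I : ℂ) - (t + r * I)‖ = r - y := by
      rw [show (t + y * I : ℂ) - (t + r * I) = ((y - r : ℝ) : ℂ) * I by push_cast; ring, norm_mul, norm_I, norm_real, mul_one, Real.norm_of_nonpos (by linarith)]; ring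
    have hm : (t + y * I : ℂ) ∈ ball (t + r * I : ℂ) r := by rw [mem_ball, dist_eq_norm, hn]; linarith
    have hd : DifferentiableOn ℂ (fun w => mob a (F w)) (ball (t + r * I) r) := fun w hw =>
      (mob_deriv ha1 (hlt w hw)).differentiableAt.comp_differentiableWithinAt w (hF w hw)
    have h0 : mob a (F (t + r * I)) = 0 := by simp [mob, ha]
    have hs := dist_le_div_mul_dist_of_mapsTo_ball hd (R₂ := 1) (fun w hw => by
      rw [h0, mem_closedBall_zero_iff]; exact (mob_maps ha1 (hlt w hw)).le) hm
    rw [h0, dist_zero_right, dist_eq_norm, hn, mob, norm_div] at hs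
    have hD := norm_pos_iff.2 (mob_den ha1 (hlt _ hm))
    rw [div_le_iff₀ hD] at hs
    have hid := mob_id a (F (t + y * I))
    have hDl : 1 - ‖a‖ ≤ ‖1 - (starRingEnd ℂ) a * F (t + y * I)‖ := by
      have := norm_sub_norm_le 1 ((starRingEnd ℂ) a * F (t + y * I))
      rw [norm_mul, norm_one, norm_conj] at this
      nlinarith [norm_nonneg a, hlt _ hm]
    generalize ‖1 - (starRingEnd ℂ) a * F (t + y * I)‖ = Q at *
    have e1 : 1 / r * (r - y) = 1 - y/r := by field_simp
    rw [e1] at hs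
    have hyr1 : y/r < 1 := by rw [div_lt_one hr]; exact hyr
    have hyr0 : 0 < y/r := by positivity
    have q1 : ‖F (t + y * I) - a‖^2 ≤ (1 - y/r) * Q^2 := by
      calc _ ≤ ((1 - y/r) * Q)^2 := by gcongr
        _ ≤ _ := by rw [mul_pow]; gcongr; nlinarith
    have q2 : (y/r) * (1 - ‖a‖)^2 ≤ (y/r) * Q^2 := by gcongr
    have q3 : κ * y = (y/r) * (1 - ‖a‖)^2/(1 - ‖a‖^2) := by rw [hκ]; field_simp
    have q4 : κ * y ≤ 1 - ‖F (t + y * I)‖^2 := by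
      rw [q3, div_le_iff₀ ha2]; nlinarith
    linarith
  have hF' := hd.hasDerivAt
  have dx : HasDerivAt (fun x : ℝ => ‖F x‖^2) (2 * inner ℝ (F t) (deriv F t)) t := (hF'.comp_ofReal).norm_sq
  have dx0 : (2 * inner ℝ (F t) (deriv F t) : ℝ) = 0 := dx.unique ((hasDerivAt_const t (1:ℝ)).congr_of_eventuallyEq (h1.mono fun x hx => by simp [hx]))
  have dl : HasDerivAt (fun y : ℝ => F (t + y * I)) (deriv F t * I) 0 := by
    have h2 : HasDerivAt (fun y : ℝ => (t + y * I : ℂ)) I 0 := by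
      have := (((hasDerivAt_id (0:ℝ)).ofReal_comp).mul_const I).const_add (t:ℂ)
      simpa using this
    have h3 : HasDerivAt F (deriv F t) ((fun y : ℝ => (t + y * I : ℂ)) 0) := by simpa using hF'
    exact h3.comp (0:ℝ) h2
  have dy := dl.norm_sq
  have hle : 2 * inner ℝ (F (t + (0:ℝ) * I)) (deriv F t * I) ≤ -κ := by
    refine le_of_tendsto dy.tendsto_slope_zero_right ?_
    filter_upwards [Ioo_mem_nhdsGT hr] with y hy
    have := key y hy.1 hy.2
    simp only [zero_add, ofReal_zero, zero_mul, add_zero, hFt, smul_eq_mul]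
    rw [inv_mul_le_iff₀ hy.1]; linarith
  simp only [ofReal_zero, zero_mul, add_zero, Complex.inner] at hle dx0
  obtain ⟨s, hs⟩ : ∃ s, s = deriv F t * (starRingEnd ℂ) (F t) := ⟨_, rfl⟩
  have r0 : s.re = 0 := by rw [hs]; linarith
  have i0 : 0 < s.im := by rw [mul_right_comm, ← hs] at hle; simp at hle; linarith
  have sI : s = I * s.im := by apply Complex.ext <;> simp [r0]
  have hn : ‖s‖ = ‖deriv F t‖ := by rw [hs, norm_mul, norm_conj, hFt, mul_one]
  have hn2 : ‖s‖ = s.im := by rw [sI]; simp [abs_of_pos i0]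
  have hf : deriv F t = s * F t := by
    rw [hs, mul_assoc, conj_mul', hFt]; simp
  constructor
  · rw [← norm_pos_iff, ← hn, hn2]; exact i0
  · rw [← hn, hn2, ← sI]; exact hf

/-- properties of the reflected map -/
structure Rf (f F : ℂ → ℂ) (c b0 b1 C ρ : ℝ) : Prop where
  c0 : 0 < c
  c2 : c ≤ 1/2
  C0 : 0 < C
  d : DifferentiableOn ℂ F (Nset c)
  eq : ∀ ζ ∈ NU c, F ζ = f ζ
  lo : ∀ ζ ∈ Nset c, ρ ≤ ‖F ζ‖
  hi : ∀ ζ ∈ Nset c, ‖F ζ‖ ≤ ρ⁻¹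
  le : ∀ ζ ∈ Nset c, ‖deriv F ζ‖ ≤ C * wt (b0-1) (b1-1) ζ.re
  ne : ∀ ζ ∈ Nset c, deriv F ζ ≠ 0
  one : ∀ t ∈ Ioo (0:ℝ) 1, ‖F t‖ = 1
  tan : ∀ t ∈ Ioo (0:ℝ) 1, deriv F t = I * ‖deriv F t‖ * F t

theorem wt_cont {a b x : ℝ} (h0 : 0 < x) (h1 : x < 1) : ContinuousAt (wt a b) x := by
  unfold wt
  exact (Real.continuousAt_rpow_const _ _ (Or.inl h0.ne')).mul (ContinuousAt.rpow_const (by fun_prop) (Or.inl (by linarith)))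

theorem Up.ext {f : ℂ → ℂ} {c b0 b1 K ρ : ℝ} (h : Up f c b0 b1 K) (hρ : 1/2 ≤ ρ) (hρ1 : ρ < 1) (hf : ∀ ζ ∈ NU c, ρ ≤ ‖f ζ‖) (hf' : ∀ ζ ∈ NU c, deriv f ζ ≠ 0) :
    ∃ F C, Rf f F (c/8) b0 b1 C ρ := by
  have c0 := h.c0
  obtain ⟨C, C0, hC⟩ := h.deriv_le
  have c8 : 0 < c/8 := by positivity
  have hs : NU (c/8) ⊆ NU c := fun z hz => ⟨Nset_mono c8 (by linarith) hz.1, hz.2⟩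
  have wc : ∀ t ∈ Ioo (0:ℝ) 1, ContinuousAt (fun ζ : ℂ => C * wt (b0-1) (b1-1) ζ.re) (t:ℂ) := fun t ht =>
    continuousAt_const.mul (ContinuousAt.comp (g := wt (b0-1) (b1-1)) (f := fun ζ : ℂ => ζ.re) (by rw [ofReal_re]; exact wt_cont ht.1 ht.2) (by fun_prop))
  obtain ⟨F, F1, F2, F3, F4⟩ := reflect c8 (h.d.mono hs) (fun ζ hζ => h.lo ζ (hs hζ)) (fun ζ hζ => h.lt ζ (hs hζ))
    (fun t ht ρ hρ => (h.bd t ht ρ hρ).filter_mono (nhdsWithin_mono _ hs)) (fun t ht => by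
      have := (wc t ht).eventually_lt_const (lt_add_one _)
      obtain ⟨δ, hδ, hb⟩ := Metric.eventually_nhds_iff.1 this
      exact ⟨δ, hδ, _, fun ζ hζ hζt => (hC ζ hζ).trans (hb (by rwa [dist_eq_norm])).le⟩)
  have ro := fun (t : ℝ) (ht : t ∈ Ioo (0:ℝ) 1) => (Nset_real c8).2 ht
  have hcase : ∀ ζ ∈ Nset (c/8), ζ ∈ NU (c/8) ∨ (∃ t ∈ Ioo (0:ℝ) 1, ζ = t) ∨ ζ.im < 0 := fun ζ hζ => by
    rcases lt_trichotomy ζ.im 0 with q | q | q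
    · exact .inr (.inr q)
    · exact .inr (.inl ⟨ζ.re, Nset_re c8 hζ, by apply Complex.ext <;> simp [q]⟩)
    · exact .inl ⟨hζ, q⟩
  have dU : ∀ ζ ∈ NU (c/8), deriv F ζ = deriv f ζ := fun ζ hζ => Filter.EventuallyEq.deriv_eq (Filter.mem_of_superset ((NU_open _).mem_nhds hζ) F2)
  have hlow : ∀ ζ ∈ Nset (c/8), ζ.im < 0 → (starRingEnd ℂ) ζ ∈ NU (c/8) := fun ζ hζ q => ⟨Nset_conj.2 hζ, by simpa using q⟩
  have fne : ∀ ζ ∈ NU (c/8), f ζ ≠ 0 := fun ζ hζ => norm_pos_iff.1 (by linarith [h.lo ζ (hs hζ)])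
  have dL : ∀ ζ ∈ Nset (c/8), ζ.im < 0 → deriv F ζ = -(starRingEnd ℂ) (deriv f ((starRingEnd ℂ) ζ)) / ((starRingEnd ℂ) (f ((starRingEnd ℂ) ζ)))^2 := fun ζ hζ q => by
    have o : IsOpen {ζ : ℂ | ζ.im < 0} := isOpen_lt (by fun_prop) (by fun_prop)
    have hm := hlow ζ hζ q
    rw [Filter.EventuallyEq.deriv_eq (Filter.mem_of_superset (((Nset_open (c/8)).inter o).mem_nhds ⟨hζ, q⟩) fun w hw => F3 w hw.1 hw.2)]
    have d0 := (h.d.differentiableAt ((NU_open c).mem_nhds (hs hm))).hasDerivAt.conj_conj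
    rw [conj_conj] at d0
    exact (d0.fun_inv (by simpa using fne _ hm)).deriv
  have hop : ∀ t ∈ Ioo (0:ℝ) 1, deriv F t ≠ 0 ∧ deriv F t = I * ‖deriv F t‖ * F t := fun t ht => by
    have ht0 := ht.1
    have ht1 : 0 < 1 - t := by linarith [ht.2]
    have hb : ∀ ζ ∈ ball (t + (c/8 * t * (1-t)/4 : ℝ) * I : ℂ) (c/8 * t * (1-t)/4), ζ ∈ NU (c/8) := fun ζ hζ => by
      refine (HD_sub c8 (by linarith [h.c2]) ht.1 ht.2 ⟨?_, ?_⟩).1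
      · rw [mem_ball, dist_eq_norm] at hζ
        calc ‖ζ - t‖ = ‖(ζ - (t + (c/8 * t * (1-t)/4 : ℝ) * I)) + (c/8 * t * (1-t)/4 : ℝ) * I‖ := by ring_nf
          _ ≤ _ := norm_add_le _ _
          _ < _ := by rw [norm_mul, norm_I, norm_real, Real.norm_of_nonneg (by positivity)]; linarith
      · rw [mem_ball, dist_eq_norm] at hζ
        have := (abs_im_le_norm _).trans_lt hζ
        simp only [sub_im, add_im, ofReal_im, mul_im, ofReal_re, I_im, I_re, mul_one, mul_zero, add_zero, zero_add, abs_lt] at this; linarith [this.1]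
    refine hopf (r := c/8 * t * (1-t)/4) (by positivity) (F1.differentiableAt ((Nset_open _).mem_nhds (ro t ht))) (F1.mono fun ζ hζ => (hb ζ hζ).1)
      (fun ζ hζ => by rw [F2 ζ (hb ζ hζ)]; exact h.lt _ (hs (hb ζ hζ))) (Filter.mem_of_superset (Ioo_mem_nhds ht.1 ht.2) F4)
  have ρ0 : 0 < ρ := by linarith
  have ρi : 1 ≤ ρ⁻¹ := (one_le_inv₀ ρ0).2 hρ1.le
  refine ⟨F, 4 * C, c8, by linarith [h.c2], by positivity, F1, F2, fun ζ hζ => ?_, fun ζ hζ => ?_, fun ζ hζ => ?_, fun ζ hζ => ?_, F4, fun t ht => (hop t ht).2⟩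
  · rcases hcase ζ hζ with q | ⟨t, q, rfl⟩ | q
    · rw [F2 ζ q]; exact hf ζ (hs q)
    · rw [F4 t q]; linarith
    · rw [F3 ζ hζ q, norm_inv, norm_conj]
      have := h.lt _ (hs (hlow ζ hζ q))
      have h0 := norm_pos_iff.2 (fne _ (hlow ζ hζ q))
      have := (one_le_inv₀ h0).2 this.le
      linarith
  · rcases hcase ζ hζ with q | ⟨t, q, rfl⟩ | q
    · rw [F2 ζ q]; linarith [h.lt _ (hs q)]
    · rw [F4 t q]; linarith
    · rw [F3 ζ hζ q, norm_inv, norm_conj]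
      exact inv_anti₀ ρ0 (hf _ (hs (hlow ζ hζ q)))
  · obtain ⟨z0, z1⟩ := Nset_re c8 hζ
    have wp := wt_pos (a := b0-1) (b := b1-1) z0 z1
    have wp2 : 0 < C * wt (b0-1) (b1-1) ζ.re := by positivity
    rcases hcase ζ hζ with q | ⟨t, q, rfl⟩ | q
    · rw [dU ζ q]; linarith [hC ζ q]
    · have hd := (F1.deriv (Nset_open _)).continuousOn.continuousAt ((Nset_open _).mem_nhds (ro t q))
      haveI := mem_closure_iff_nhdsWithin_neBot.1 (NU_closure c8 (ro t q) (by simp))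
      have := le_of_tendsto_of_tendsto (hd.norm.tendsto.mono_left nhdsWithin_le_nhds) ((wc t q).tendsto.mono_left (nhdsWithin_le_nhds (s := NU (c/8))))
        (eventually_mem_nhdsWithin.mono fun z (hz : z ∈ NU (c/8)) => by
          show ‖deriv F z‖ ≤ C * wt (b0-1) (b1-1) z.re
          rw [dU z hz]; exact hC z hz)
      linarith
    · have hm := hlow ζ hζ q
      rw [dL ζ hζ q, norm_div, norm_neg, norm_pow, norm_conj, norm_conj]
      have e1 := hC _ hm
      rw [conj_re] at e1
      have e2 := h.lo _ (hs hm)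
      have e3 := norm_pos_iff.2 (fne _ hm)
      rw [div_le_iff₀ (by positivity)]
      have e4 : 1/4 ≤ ‖f ((starRingEnd ℂ) ζ)‖^2 := by nlinarith only [e2]
      nlinarith only [mul_le_mul_of_nonneg_left e4 wp2.le, e1]
  · rcases hcase ζ hζ with q | ⟨t, q, rfl⟩ | q
    · rw [dU ζ q]; exact hf' ζ (hs q)
    · exact (hop t q).1
    · have hm := hlow ζ hζ q
      rw [dL ζ hζ q]
      exact div_ne_zero (by simpa using hf' _ (hs hm)) (by simpa using fne _ hm)

theorem Nset_norm {c : ℝ} (hc : 0 < c) (hc2 : c ≤ 1/2) {ζ : ℂ} (h : ζ ∈ Nset c) : ‖ζ‖ ≤ 2 * ζ.re ∧ ‖1 - ζ‖ ≤ 2 * (1 - ζ.re) := by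
  obtain ⟨h0, h1⟩ := Nset_re hc h
  have a := norm_le_abs_re_add_abs_im ζ
  have b := norm_le_abs_re_add_abs_im (1 - ζ)
  simp only [sub_re, one_re, sub_im, one_im, zero_sub, abs_neg] at b
  rw [abs_of_pos h0] at a
  rw [abs_of_pos (by linarith)] at b
  have := h.1; have := h.2
  constructor <;> nlinarith

theorem unif {N : ℕ} {l : Filter ℝ} {P : ℕ → ℝ → Prop} (h : ∀ j < N, ∀ᶠ x in l, P j x) : ∀ᶠ x in l, ∀ j < N, P j x := by
  have := (Filter.eventually_all_finset (l := l) (Finset.range N) (p := P)).2 (fun i hi => h i (Finset.mem_range.1 hi))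
  exact this.mono fun x hx j hj => hx j (Finset.mem_range.2 hj)

theorem ev_small {a : ℝ} (ha : 0 < a) : ∀ᶠ x in nhdsWithin (0:ℝ) (Ioi 0), 0 < x ∧ x ≤ a :=
  (Ioc_mem_nhdsGT ha : _)

theorem IsArc.one {σ V} (h : IsArc σ V) : (1:ℂ) ∈ V := by simpa using h.seg 1 (by simp)
theorem IsArc.zero {σ V} (h : IsArc σ V) : (0:ℂ) ∈ V := by simpa using h.seg 0 (by simp)

theorem Lens.nG {D σ V c} (h : Lens D σ V c) {x : ℝ} (hx : x ∈ Icc (0:ℝ) 1) : σ x ∉ D.G := fun hh => (h.re x hx).2 (by rwa [D.isOpen.interior_eq])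

theorem Lens.bdx {D : JordanDomain} {φ : ℂ → ℂ} {σ V c} (h : CM D φ) (l : Lens D σ V c) {x ρ : ℝ} (hx : x ∈ Icc (0:ℝ) 1) (hρ : ρ < 1) :
    ∀ᶠ ζ in nhds (x:ℂ), ζ ∈ Nset c → 0 < ζ.im → ρ < ‖φ (σ ζ)‖ := by
  have h1 := eventually_nhdsWithin_iff.1 (h.bd (l.nG hx) hρ)
  have h2 := (l.arc.hasDeriv (l.arc.seg x hx)).continuousAt.eventually h1
  filter_upwards [h2] with ζ h3 h4 h5 using h3 (l.up ζ h4 h5)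

theorem rpow_le_of {x y M b : ℝ} (h0 : 0 ≤ x) (hM : 0 ≤ M) (hy : 0 ≤ y) (h : x ≤ M * y) (hb : 0 ≤ b) : x ^ b ≤ M ^ b * y ^ b := by
  rw [← Real.mul_rpow hM hy]; exact Real.rpow_le_rpow h0 h hb

theorem end_wt {D : JordanDomain} {φ σ : ℂ → ℂ} {w0 e : ℂ} {α s M r ε : ℝ} (h : CM D φ) (hc : Corner D.G w0 e α M r) (hw0 : w0 ∉ D.G) (hE : EndAt σ w0 e α s M ε) :
    ∃ K > 0, ∃ δ > 0, ∀ x ζ, ‖ζ‖ ≤ 2 * x → x < δ → 0 < x → ζ ≠ 0 → σ ζ ∈ D.G → 1 - ‖φ (σ ζ)‖ ≤ K * x ^ (1/α) := by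
  obtain ⟨K, K0, r1, r10, hK⟩ := h.corner hc hw0
  have M1 := hc.C1
  have a0 := hc.a0
  have e0 := hE.2.1
  refine ⟨K * (2*M) ^ (1/α), by positivity, min (ε/2) (r1/(2*M)), by positivity, fun x ζ hx hδ h0 hζ hG => ?_⟩
  have q1 := hδ.trans_le (min_le_left _ _)
  have q2 := hδ.trans_le (min_le_right _ _)
  rw [lt_div_iff₀ (by positivity)] at q2
  obtain ⟨-, p2, -⟩ := hE.2.2.2 ζ hζ (by linarith)
  have p3 : ‖σ ζ - w0‖ ≤ 2 * M * x := by nlinarith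
  refine (hK _ hG (by linarith)).trans ?_
  rw [mul_assoc]
  exact mul_le_mul_of_nonneg_left (rpow_le_of (norm_nonneg _) (by positivity) h0.le p3 (by positivity)) K0.le

theorem Geo.mono {D lam N σ V c M J ee al} (g : Geo D lam N σ V c M J ee al) {c' : ℝ} (h0 : 0 < c') (h : c' ≤ c) : Geo D lam N σ V c' M J ee al :=
  ⟨g.N0, fun j hj => ⟨(g.lens j hj).arc, h0, h.trans (g.lens j hj).c2, (Nset_mono h0 h).trans (g.lens j hj).sub, fun ζ hz => (g.lens j hj).up ζ (Nset_mono h0 h hz),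
    fun ζ hz => (g.lens j hj).lo ζ (Nset_mono h0 h hz), (g.lens j hj).re⟩, g.int, g.tele, g.cover, g.link, g.Jfin, g.nJ, g.J0, g.J1, g.cor, g.end0, g.end1⟩

theorem Geo.arcUp {D lam N σ V c M J ee al} (g : Geo D lam N σ V c M J ee al) {φ : ℂ → ℂ} (h : CM D φ) {ρ : ℝ} (hρ : 1/2 ≤ ρ) (hρ1 : ρ < 1) {j : ℕ} (hj : j < N) :
    ∃ c' F C, c' ≤ c ∧ Rf (fun ζ => φ (σ j ζ)) F c' (1/al (σ j 0)) (1/al (σ j 1)) C ρ := by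
  have l := g.lens j hj
  have c0 := l.c0
  obtain ⟨c', c'0, hc', hp⟩ := shrink c0 (fun x hx => l.bdx h hx hρ1)
  have hs : NU c' ⊆ NU c := fun z hz => ⟨Nset_mono c'0 hc' hz.1, hz.2⟩
  have hG : ∀ ζ ∈ NU c', σ j ζ ∈ D.G := fun ζ hζ => l.up ζ (hs hζ).1 hζ.2
  have ca0 := (g.cor _ (g.J0 j hj)).1
  have ca1 := (g.cor _ (g.J1 j hj)).1
  have n0 : σ j 0 ∉ D.G := by simpa using l.nG (x := 0) (by simp)
  have n1 : σ j 1 ∉ D.G := by simpa using l.nG (x := 1) (by simp)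
  obtain ⟨K0, K00, δ0, δ00, h0⟩ := end_wt h ca0 n0 (g.end0 j hj)
  obtain ⟨K1, K10, δ1, δ10, h1⟩ := end_wt h ca1 n1 (g.end1 j hj)
  have hc2 := hc'.trans l.c2
  obtain ⟨K, K0, hK⟩ := wt_glue (p := fun ζ => 1 - ‖φ (σ j ζ)‖) (S := NU c') (a := 1/al (σ j 0)) (b := 1/al (σ j 1)) (ε := min (1/4) (min δ0 δ1)) (K := K0 + K1 + 1)
    (by positivity) ((min_le_left _ _).trans_lt (by norm_num)) (by positivity) (fun ζ hζ => Nset_re c'0 hζ.1) (fun ζ hζ hl => by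
      have := (Nset_re c'0 hζ.1)
      refine (h0 ζ.re ζ (Nset_norm c'0 hc2 hζ.1).1 (hl.trans_le ((min_le_right _ _).trans (min_le_left _ _))) this.1 (fun hh => by simp [hh] at this) (hG ζ hζ)).trans ?_
      exact mul_le_mul_of_nonneg_right (by linarith) (Real.rpow_nonneg this.1.le _)) (fun ζ hζ hl => by
      have := (Nset_re c'0 hζ.1)
      have hr : (1 - (1 - ζ)) = ζ := by ring
      have := (h1 (1 - ζ.re) (1 - ζ) (Nset_norm c'0 hc2 hζ.1).2 (hl.trans_le ((min_le_right _ _).trans (min_le_right _ _))) (by linarith) (fun hh => by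
        rw [sub_eq_zero] at hh; simp [← hh] at this) (by rw [hr]; exact hG ζ hζ))
      rw [hr] at this
      exact this.trans (mul_le_mul_of_nonneg_right (by linarith) (Real.rpow_nonneg (by linarith) _))) (fun ζ hζ _ _ => by
      linarith [norm_nonneg (φ (σ j ζ))])
  have dφ : ∀ ζ ∈ NU c', HasDerivAt (fun ζ => φ (σ j ζ)) (deriv φ (σ j ζ) * deriv (σ j) ζ) ζ := fun ζ hζ =>
    (h.d.differentiableAt (D.isOpen.mem_nhds (hG ζ hζ))).hasDerivAt.comp ζ (l.arc.hasDeriv (l.sub (hs hζ).1))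
  have up : Up (fun ζ => φ (σ j ζ)) c' (1/al (σ j 0)) (1/al (σ j 1)) K := by
    refine ⟨c'0, hc2, K0, fun ζ hζ => (dφ ζ hζ).differentiableAt.differentiableWithinAt, fun ζ hζ => by linarith [hp ζ hζ.1 hζ.2],
      fun ζ hζ => h.lt (hG ζ hζ), fun t ht ρ hρ => ?_, hK⟩
    rw [eventually_nhdsWithin_iff]
    exact (l.bdx h ⟨ht.1.le, ht.2.le⟩ hρ).mono fun ζ hz hz' => hz (hs hz').1 hz'.2
  obtain ⟨F, C, hF⟩ := up.ext hρ hρ1 (fun ζ hζ => (hp ζ hζ.1 hζ.2).le) (fun ζ hζ => by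
    rw [(dφ ζ hζ).deriv]
    exact mul_ne_zero (inj_deriv_ne D.isOpen h.d h.b.injOn (hG ζ hζ)) (l.arc.deriv_ne (l.sub (hs hζ).1)))
  exact ⟨c'/8, F, C, by linarith, hF⟩

theorem Rf.mono {f F : ℂ → ℂ} {c b0 b1 C ρ c' C' : ℝ} (h : Rf f F c b0 b1 C ρ) (h0 : 0 < c') (hc : c' ≤ c) (hC : C ≤ C') : Rf f F c' b0 b1 C' ρ :=
  have hs := Nset_mono h0 hc
  ⟨h0, hc.trans h.c2, h.C0.trans_le hC, h.d.mono hs, fun ζ hζ => h.eq ζ ⟨hs hζ.1, hζ.2⟩, fun ζ hζ => h.lo ζ (hs hζ), fun ζ hζ => h.hi ζ (hs hζ),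
    fun ζ hζ => (h.le ζ (hs hζ)).trans (mul_le_mul_of_nonneg_right hC (wt_pos (Nset_re h0 hζ).1 (Nset_re h0 hζ).2).le), fun ζ hζ => h.ne ζ (hs hζ), h.one, h.tan⟩

theorem Nset_sc {c : ℝ} (hc : 0 < c) : SimplyConnectedSpace (Nset c) := by
  have : ContractibleSpace (Nset c) := (Nset_convex c).contractibleSpace ⟨((1/2:ℝ):ℂ), (Nset_real hc).2 (by norm_num)⟩
  infer_instance

/-- conformal map data extended across the arcs -/
structure Dat (D : JordanDomain) (N : ℕ) (σ : ℕ → ℂ → ℂ) (al : ℂ → ℝ) (φ q : ℂ → ℂ) (F Q : ℕ → ℂ → ℂ) (c C ρ : ℝ) : Prop where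
  cm : CM D φ
  C0 : 0 < C
  qd : DifferentiableOn ℂ q D.G
  q2 : ∀ z ∈ D.G, q z ^ 2 = deriv φ z
  rf : ∀ j < N, Rf (fun ζ => φ (σ j ζ)) (F j) c (1/al (σ j 0)) (1/al (σ j 1)) C ρ
  Qd : ∀ j < N, DifferentiableOn ℂ (Q j) (Nset c)
  Q2 : ∀ j < N, ∀ ζ ∈ Nset c, Q j ζ ^ 2 = deriv (F j) ζ / deriv (σ j) ζ
  Qe : ∀ j < N, ∀ ζ ∈ NU c, Q j ζ = q (σ j ζ)
  Qb : ∀ j < N, ∀ ζ ∈ Nset c, ‖Q j ζ‖ ≤ C * wt ((1/al (σ j 0)-1)/2) ((1/al (σ j 1)-1)/2) ζ.re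

theorem wt_sq {a b x : ℝ} (h0 : 0 < x) (h1 : x < 1) : wt (a/2) (b/2) x ^ 2 = wt a b x := by
  unfold wt
  rw [mul_pow, ← Real.rpow_natCast, ← Real.rpow_natCast, ← Real.rpow_mul h0.le, ← Real.rpow_mul (by linarith)]; norm_num

theorem IsArc.deriv_low {σ V} (h : IsArc σ V) : ∃ m > 0, ∃ c0 > 0, ∀ c, 0 < c → c ≤ c0 → ∀ ζ ∈ Nset c, m ≤ ‖deriv σ ζ‖ := by
  have hK : IsCompact ((fun x : ℝ => (x:ℂ)) '' Icc 0 1) := isCompact_Icc.image (by fun_prop)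
  have hc : ContinuousOn (fun ζ => ‖deriv σ ζ‖) ((fun x : ℝ => (x:ℂ)) '' Icc 0 1) := (h.contDeriv.mono (by rintro _ ⟨x, hx, rfl⟩; exact h.seg x hx)).norm
  obtain ⟨_, ⟨x, hx, rfl⟩, hm⟩ := hK.exists_isMinOn ⟨0, ⟨0, by simp, by simp⟩⟩ hc
  have m0 := norm_pos_iff.2 (h.deriv_ne (h.seg x hx))
  obtain ⟨δ, hδ, hs⟩ := hK.exists_thickening_subset_open (isOpen_interior (s := {ζ | ‖deriv σ x‖/2 ≤ ‖deriv σ ζ‖})) (by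
    rintro _ ⟨y, hy, rfl⟩
    refine mem_interior_iff_mem_nhds.2 ((h.contDeriv.continuousAt (h.op.mem_nhds (h.seg y hy))).norm.eventually_const_le (u := ‖deriv σ x‖/2) ?_)
    have : ‖deriv σ x‖ ≤ ‖deriv σ y‖ := hm ⟨y, hy, rfl⟩
    linarith)
  refine ⟨_, half_pos m0, δ/2, half_pos hδ, fun c c0 hc ζ hζ => ?_⟩
  refine (interior_subset (hs ?_) : ζ ∈ {ζ | ‖deriv σ x‖/2 ≤ ‖deriv σ ζ‖})
  rw [mem_thickening_iff]
  have := Nset_re c0 hζ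
  refine ⟨ζ.re, ⟨ζ.re, ⟨this.1.le, this.2.le⟩, rfl⟩, ?_⟩
  rw [dist_eq_norm, show ζ - ζ.re = ζ.im * I by apply Complex.ext <;> simp, norm_mul, norm_I, norm_real, Real.norm_eq_abs]
  nlinarith [hζ.1]

theorem Geo.dat {D lam N σ V c M J ee al} (g : Geo D lam N σ V c M J ee al) {φ : ℂ → ℂ} (h : CM D φ) {ρ : ℝ} (hρ : 1/2 ≤ ρ) (hρ1 : ρ < 1) :
    ∃ c' q F Q C, Geo D lam N σ V c' M J ee al ∧ Dat D N σ al φ q F Q c' C ρ := by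
  have ex := fun j hj => g.arcUp h hρ hρ1 (j := j) hj
  choose! cj F Cj hcj hF using ex
  have ex2 := fun j hj => (g.lens j hj).arc.deriv_low
  choose! m hm cm hcm hmm using ex2
  obtain ⟨c', hc'⟩ := ((unif fun j hj => (ev_small (hF j hj).c0).and (ev_small (hcm j hj))).and (ev_small (g.lens 0 g.N0).c0)).exists
  obtain ⟨hc, c0, hcc⟩ := hc'
  obtain ⟨C, hC⟩ := ((unif fun j (_ : j < N) => (eventually_ge_atTop (Cj j)).and (eventually_ge_atTop (Real.sqrt (Cj j / m j)))).and (eventually_gt_atTop 0)).exists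
  obtain ⟨hC, C0⟩ := hC
  have rf := fun j (hj : j < N) => (hF j hj).mono c0 (hc j hj).1.2 (hC j hj).1
  have g' := g.mono c0 hcc
  obtain ⟨q, qd, q2⟩ := holoSqrt D.isOpen D.simplyConnected (h.d.deriv D.isOpen) (fun z hz => inj_deriv_ne D.isOpen h.d h.b.injOn hz)
  have q0 : ∀ z ∈ D.G, q z ≠ 0 := fun z hz hh => inj_deriv_ne D.isOpen h.d h.b.injOn hz (by rw [← q2, hh]; simp)
  have exQ : ∀ j < N, ∃ Q : ℂ → ℂ, DifferentiableOn ℂ Q (Nset c') ∧ (∀ ζ ∈ Nset c', Q ζ ^ 2 = deriv (F j) ζ / deriv (σ j) ζ) ∧ ∀ ζ ∈ NU c', Q ζ = q (σ j ζ) := fun j hj => by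
    have l := g'.lens j hj
    obtain ⟨Q, Qd, Q2⟩ := holoSqrt (Nset_open c') (Nset_sc c0) (g := fun ζ => deriv (F j) ζ / deriv (σ j) ζ)
      (((rf j hj).d.deriv (Nset_open _)).div ((l.arc.diff.deriv l.arc.op).mono l.sub) (fun ζ hζ => l.arc.deriv_ne (l.sub hζ)))
      (fun ζ hζ => div_ne_zero ((rf j hj).ne ζ hζ) (l.arc.deriv_ne (l.sub hζ)))
    have hG : ∀ ζ ∈ NU c', σ j ζ ∈ D.G := fun ζ hζ => l.up ζ hζ.1 hζ.2
    have hsq : EqOn (Q ^ 2) ((fun ζ => q (σ j ζ)) ^ 2) (NU c') := fun ζ hζ => by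
      simp only [Pi.pow_apply]
      have : deriv (F j) ζ = deriv φ (σ j ζ) * deriv (σ j) ζ := by
        rw [Filter.EventuallyEq.deriv_eq (Filter.mem_of_superset ((NU_open c').mem_nhds hζ) (rf j hj).eq)]
        exact ((h.d.differentiableAt (D.isOpen.mem_nhds (hG ζ hζ))).hasDerivAt.comp ζ (l.arc.hasDeriv (l.sub hζ.1))).deriv
      rw [Q2, q2, this, mul_div_assoc, div_self (l.arc.deriv_ne (l.sub hζ.1)), mul_one]
    rcases (NU_convex c').isPreconnected.eq_or_eq_neg_of_sq_eq (Qd.continuousOn.mono fun z hz => hz.1)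
      (qd.continuousOn.comp (l.arc.diff.continuousOn.mono fun z hz => l.sub hz.1) hG) hsq (fun {ζ} hζ => q0 _ (hG ζ hζ)) with e | e
    · exact ⟨Q, Qd, fun ζ _ => Q2 ζ, e⟩
    · exact ⟨fun ζ => -Q ζ, Qd.neg, fun ζ _ => by rw [neg_sq]; exact Q2 ζ, fun ζ hζ => by have := e hζ; simp only [Pi.neg_apply, Function.comp] at this; simp [this]⟩
  choose! Q Qd Q2 Qe using exQ
  refine ⟨c', q, F, Q, C, g', h, C0, qd, fun z _ => q2 z, rf, Qd, Q2, Qe, fun j hj ζ hζ => ?_⟩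
  obtain ⟨z0, z1⟩ := Nset_re c0 hζ
  have w0 := wt_pos (a := (1/al (σ j 0)-1)/2) (b := (1/al (σ j 1)-1)/2) z0 z1
  have e1 := (hF j hj).le ζ (Nset_mono c0 (hc j hj).1.2 hζ)
  have e2 := hmm j hj c' c0 (hc j hj).2.2 ζ hζ
  have m0 := hm j hj
  have Cj0 := (hF j hj).C0
  have e3 := (Real.sqrt_le_left C0.le).1 (hC j hj).2
  have w1 := wt_pos (a := (1/al (σ j 0)-1)) (b := (1/al (σ j 1)-1)) z0 z1
  refine (sq_le_sq₀ (norm_nonneg _) (by positivity)).1 ?_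
  rw [← norm_pow, Q2 j hj ζ hζ, norm_div, mul_pow, wt_sq z0 z1]
  calc _ ≤ Cj j * wt (1/al (σ j 0)-1) (1/al (σ j 1)-1) ζ.re / m j := by gcongr
    _ = Cj j / m j * wt (1/al (σ j 0)-1) (1/al (σ j 1)-1) ζ.re := by ring
    _ ≤ _ := by gcongr

theorem prim {G : Set ℂ} (hG : IsOpen G) {φ f : ℂ → ℂ} (hφ : DifferentiableOn ℂ φ G) (hb : BijOn φ G (ball 0 1)) (hf : DifferentiableOn ℂ f G) :
    ∃ W : ℂ → ℂ, ∀ w ∈ G, HasDerivAt W (f w) w := by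
  have hd : ∀ z ∈ G, HasDerivAt (Function.invFunOn φ G) (deriv φ z)⁻¹ (φ z) := fun z hz => by
    have hinv : Function.invFunOn φ G (φ z) = z := hb.injOn.leftInvOn_invFunOn hz
    have hst : HasStrictDerivAt φ (deriv φ z) z := (hφ.analyticAt (hG.mem_nhds hz)).hasStrictDerivAt
    have hne := inj_deriv_ne hG hφ hb.injOn hz
    refine HasDerivAt.of_local_left_inverse (f := φ) ?_ (by rw [hinv]; exact hst.hasDerivAt) hne ?_
    · rw [ContinuousAt, hinv, ← hst.map_nhds_eq hne, tendsto_map'_iff]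
      refine tendsto_id.congr' ?_
      filter_upwards [hG.mem_nhds hz] with y hy using (hb.injOn.leftInvOn_invFunOn hy).symm
    · filter_upwards [isOpen_ball.mem_nhds (hb.mapsTo hz)] with y hy using Function.invFunOn_eq (hb.surjOn hy)
  obtain ⟨W, hW⟩ := DifferentiableOn.isExactOn_ball (c := 0) (r := 1) (f := fun w => f (Function.invFunOn φ G w) * (deriv φ (Function.invFunOn φ G w))⁻¹) (by
    intro w hw
    obtain ⟨z, hz, rfl⟩ := hb.surjOn hw
    have hinv : Function.invFunOn φ G (φ z) = z := hb.injOn.leftInvOn_invFunOn hz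
    have h1 : DifferentiableAt ℂ (fun z => f z * (deriv φ z)⁻¹) z :=
      (hf.differentiableAt (hG.mem_nhds hz)).mul (((hφ.deriv hG).differentiableAt (hG.mem_nhds hz)).inv (inj_deriv_ne hG hφ hb.injOn hz))
    exact (DifferentiableAt.comp (g := fun z => f z * (deriv φ z)⁻¹) (φ z) (by rwa [hinv]) (hd z hz).differentiableAt).differentiableWithinAt)
  refine ⟨fun z => W (φ z), fun z hz => ?_⟩
  have := (hW _ (hb.mapsTo hz)).comp z (hφ.differentiableAt (hG.mem_nhds hz)).hasDerivAt
  beta_reduce at this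
  rw [hb.injOn.leftInvOn_invFunOn hz, mul_assoc, inv_mul_cancel₀ (inj_deriv_ne hG hφ hb.injOn hz), mul_one] at this
  exact this

theorem cone_convex (t : ℝ) : Convex ℝ {ω : ℂ | |ω.im| < t * ω.re} := by
  intro p hp q hq a b ha hb hab
  have h1 : |p.im| < t * p.re := hp
  have h2 : |q.im| < t * q.re := hq
  show |(a • p + b • q).im| < t * (a • p + b • q).re
  simp only [add_im, smul_im, add_re, smul_re, smul_eq_mul]
  rw [abs_lt] at *
  rcases ha.eq_or_lt with rfl | ha
  · have : b = 1 := by linarith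
    subst this; constructor <;> nlinarith
  · constructor <;> nlinarith

theorem sec_lim {w0 e : ℂ} {h r : ℝ} (he : ‖e‖ = 1) (h0 : 0 < h) (hπ : h < Real.pi) (hr : 0 < r) {W f : ℂ → ℂ}
    (hW : ∀ w ∈ Sec w0 e h 0 r, HasDerivAt W (f w) w)
    (hf : f =O[nhdsWithin w0 (Sec w0 e h 0 r)] fun w => ‖w - w0‖ ^ (-(1/2) : ℝ)) : ∃ v, Tendsto W (nhdsWithin w0 (Sec w0 e h 0 r)) (nhds v) := by
  obtain ⟨C, C0, hC⟩ := hf.exists_pos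
  rw [Asymptotics.IsBigOWith, eventually_nhdsWithin_iff, Metric.eventually_nhds_iff] at hC
  obtain ⟨r1, r10, hC⟩ := hC
  have hc : 0 < Real.cos (h/2) := Real.cos_pos_of_mem_Ioo ⟨by linarith, by linarith⟩
  have hsn : 0 < Real.sin (h/2) := Real.sin_pos_of_pos_of_lt_pi (by linarith) (by linarith)
  set t := Real.tan (h/2) with ht
  have tp : 0 < t := by rw [ht, Real.tan_eq_sin_div_cos]; positivity
  set A : Set ℂ := {ω : ℂ | |ω.im| < t * ω.re} with hA
  set m := min r r1 with hm
  have m0 : 0 < m := by positivity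
  have hAS : ∀ ω ∈ A ∩ ball 0 (Real.sqrt m), w0 + e * ω^2 ∈ Sec w0 e h 0 m ∧ ω ≠ 0 := fun ω hω => by
    have h1 : |ω.im| < t * ω.re := hω.1
    have hre : 0 < ω.re := by by_contra hn; push Not at hn; nlinarith [abs_nonneg ω.im]
    have hne : ω ≠ 0 := fun hh => by simp [hh] at hre
    have hn := norm_pos_iff.2 hne
    have h2 := mem_ball_zero_iff.1 hω.2
    refine ⟨⟨‖ω‖^2, 2 * arg ω, by positivity, ?_, ?_, ?_⟩, hne⟩
    · calc ‖ω‖^2 < Real.sqrt m ^ 2 := by gcongr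
        _ = m := Real.sq_sqrt m0.le
    · have ha : |arg ω| < h/2 := by
        have hab := abs_arg_lt_pi_div_two_iff.2 (Or.inl hre)
        rw [abs_lt] at hab ⊢
        rw [abs_lt] at h1
        have hta := tan_arg ω
        have hin := Real.strictMonoOn_tan
        constructor
        · by_contra hn
          push Not at hn
          have := hin.monotoneOn ⟨hab.1, hab.2⟩ ⟨by linarith, by linarith⟩ hn
          rw [Real.tan_neg, hta, div_le_iff₀ hre] at this; linarith [h1.1]
        · by_contra hn
          push Not at hn
          have := hin.monotoneOn ⟨by linarith, by linarith⟩ ⟨hab.1, hab.2⟩ hn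
          rw [hta, le_div_iff₀ hre] at this; linarith [h1.2]
      rw [abs_mul, abs_two]; linarith
    · conv_lhs => rw [← norm_mul_exp_arg_mul_I ω]
      rw [mul_pow, ← Complex.exp_nat_mul]; push_cast; ring_nf
  have hLip : LipschitzOnWith (2 * C).toNNReal (fun ω => W (w0 + e * ω^2)) (A ∩ ball 0 (Real.sqrt m)) := by
    refine Convex.lipschitzOnWith_of_nnnorm_hasDerivWithin_le (𝕜 := ℂ) (f' := fun ω => f (w0 + e * ω^2) * (e * (2 * ω))) ((cone_convex t).inter (convex_ball _ _)) (fun ω hω => ?_) (fun ω hω => ?_)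
    · have h1 : HasDerivAt (fun ω : ℂ => w0 + e * ω^2) (e * (2 * ω)) ω := by
        have := ((hasDerivAt_pow 2 ω).const_mul e).const_add w0
        simpa using this
      exact ((hW _ (Sec_mono le_rfl (min_le_left _ _) (hAS ω hω).1)).comp ω h1).hasDerivWithinAt
    · obtain ⟨h1, h2⟩ := hAS ω hω
      have hn := norm_pos_iff.2 h2
      have h3 : ‖w0 + e * ω^2 - w0‖ = ‖ω‖^2 := by rw [add_sub_cancel_left, norm_mul, he, one_mul, norm_pow]
      have h4 : ‖ω‖^2 < m := by
        calc ‖ω‖^2 < Real.sqrt m ^ 2 := by gcongr; exact mem_ball_zero_iff.1 hω.2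
          _ = m := Real.sq_sqrt m0.le
      have h5 := hC (y := w0 + e * ω^2) (by rw [dist_eq_norm, h3]; exact h4.trans_le (min_le_right _ _)) (Sec_mono le_rfl (min_le_left _ _) h1)
      rw [h3, Real.norm_of_nonneg (by positivity)] at h5
      rw [← NNReal.coe_le_coe, coe_nnnorm, Real.coe_toNNReal _ (by positivity), norm_mul, norm_mul, he, norm_mul]
      have h6 : (‖ω‖^2) ^ (-(1/2) : ℝ) = ‖ω‖⁻¹ := by
        rw [← Real.rpow_natCast, ← Real.rpow_mul hn.le, ← Real.rpow_neg_one]; norm_num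
      rw [h6] at h5
      calc _ ≤ C * ‖ω‖⁻¹ * (1 * (‖(2:ℂ)‖ * ‖ω‖)) := by gcongr
        _ = 2 * C := by simp; field_simp
  have hcl : (0:ℂ) ∈ closure A := by
    rw [Metric.mem_closure_iff]; intro ε hε
    refine ⟨((ε/2:ℝ):ℂ), ?_, ?_⟩
    · show |((ε/2:ℝ):ℂ).im| < t * ((ε/2:ℝ):ℂ).re
      rw [ofReal_im, abs_zero, ofReal_re]; positivity
    · rw [dist_zero_left, norm_real, Real.norm_of_nonneg (by positivity)]; linarith
  obtain ⟨v, hv⟩ := lip_lim (Real.sqrt_pos.2 m0) hcl hLip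
  refine ⟨v, ?_⟩
  rw [Metric.tendsto_nhdsWithin_nhds] at hv ⊢
  intro ε hε
  obtain ⟨δ, δ0, hδ⟩ := hv ε hε
  refine ⟨δ^2, by positivity, ?_⟩
  rintro w ⟨ρ, θ, h1, h2, h3, rfl⟩ hd
  have hh : ‖(ρ * exp (θ * I) : ℂ)‖ = ρ := by rw [norm_mul, norm_exp_ofReal_mul_I, norm_real, Real.norm_of_nonneg h1.le, mul_one]
  rw [dist_eq_norm, add_sub_cancel_left, norm_mul, he, one_mul, hh] at hd
  have h4 : (Real.sqrt ρ * exp ((θ/2 : ℝ) * I) : ℂ)^2 = ρ * exp (θ * I) := by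
    rw [mul_pow, ← ofReal_pow, Real.sq_sqrt h1.le, ← Complex.exp_nat_mul]; push_cast; ring_nf
  have := hδ (x := (Real.sqrt ρ * exp ((θ/2 : ℝ) * I) : ℂ)) ?_ ?_
  · rwa [h4] at this
  · show |_| < t * _
    rw [re_ofReal_mul, im_ofReal_mul, exp_ofReal_mul_I_re, exp_ofReal_mul_I_im, abs_mul, abs_of_nonneg (Real.sqrt_nonneg _)]
    have hs : 0 < Real.sqrt ρ := Real.sqrt_pos.2 h1
    rw [zero_mul, sub_zero] at h3
    have ha : |θ/2| < h/2 := by rw [abs_div, abs_two]; linarith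
    have hcθ : 0 < Real.cos (θ/2) := Real.cos_pos_of_mem_Ioo (by rw [abs_lt] at ha; constructor <;> linarith)
    have : |Real.sin (θ/2)| < t * Real.cos (θ/2) := by
      have e1 : |Real.tan (θ/2)| < t := by
        rw [abs_lt] at ha ⊢
        rw [ht, ← Real.tan_neg]
        exact ⟨Real.strictMonoOn_tan ⟨by linarith, by linarith⟩ ⟨by linarith, by linarith⟩ ha.1, Real.strictMonoOn_tan ⟨by linarith, by linarith⟩ ⟨by linarith, by linarith⟩ ha.2⟩
      rwa [Real.tan_eq_sin_div_cos, abs_div, abs_of_pos hcθ, div_lt_iff₀ hcθ] at e1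
    nlinarith
  · rw [dist_zero_right, norm_mul, norm_exp_ofReal_mul_I, norm_real, mul_one, Real.norm_of_nonneg (Real.sqrt_nonneg _)]
    exact (Real.sqrt_lt' δ0).2 hd

theorem wt_int {a b : ℝ} (ha : -1 < a) (hb : -1 < b) : IntervalIntegrable (wt a b) volume 0 1 := by
  have := (betaIntegral_convergent (u := (a+1:ℝ)) (v := (b+1:ℝ)) (by simp; linarith) (by simp; linarith)).norm
  refine this.congr ?_
  rw [uIoc_of_le zero_le_one]
  refine fun x hx => ?_
  have h1 : (0:ℝ) ≤ 1 - x := by linarith [hx.2]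
  simp only [norm_mul, wt]
  rw [show (((a+1:ℝ):ℂ) - 1) = ((a:ℝ):ℂ) by push_cast; ring, show (((b+1:ℝ):ℂ) - 1) = ((b:ℝ):ℂ) by push_cast; ring, norm_cpow_eq_rpow_re_of_pos hx.1,
    ← ofReal_one, ← ofReal_sub, ← ofReal_cpow h1, norm_real, Real.norm_of_nonneg (Real.rpow_nonneg h1 _), ofReal_re]

theorem ii_wt {a b C : ℝ} (ha : -1 < a) (hb : -1 < b) {p : ℝ → ℂ} (hc : ContinuousOn p (Ioo 0 1)) (h : ∀ x ∈ Ioo (0:ℝ) 1, ‖p x‖ ≤ C * wt a b x) :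
    IntervalIntegrable p volume 0 1 := by
  have := (wt_int ha hb).const_mul C
  rw [intervalIntegrable_iff_integrableOn_Ioo_of_le zero_le_one] at this ⊢
  exact this.mono' (hc.aestronglyMeasurable measurableSet_Ioo) ((ae_restrict_iff' measurableSet_Ioo).2 (ae_of_all _ h))

theorem glueR {p : ℝ → ℂ} {a b : ℝ} (hc : ContinuousOn p (Ioo 0 1)) (h0 : p =O[nhdsWithin 0 (Ioi 0)] fun x => x ^ a) (h1 : p =O[nhdsWithin 1 (Iio 1)] fun x => (1 - x) ^ b) :
    ∃ K > 0, ∀ x ∈ Ioo (0:ℝ) 1, ‖p x‖ ≤ K * wt a b x := by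
  obtain ⟨C0, C00, hC0⟩ := h0.exists_pos
  obtain ⟨C1, C10, hC1⟩ := h1.exists_pos
  rw [Asymptotics.IsBigOWith] at hC0 hC1
  obtain ⟨e0, e00, he0⟩ := mem_nhdsGT_iff_exists_Ioo_subset.1 hC0
  obtain ⟨e1, e10, he1⟩ := mem_nhdsLT_iff_exists_Ioo_subset.1 hC1
  have e00 : 0 < e0 := e00
  have e10 : 0 < 1 - e1 := by have : e1 < 1 := e10; linarith
  obtain ⟨ε, hε⟩ : ∃ ε, ε = min (1/4) (min e0 (1 - e1)) := ⟨_, rfl⟩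
  have ε0 : 0 < ε := by rw [hε]; positivity
  have l1 : ε ≤ 1/4 := hε ▸ min_le_left _ _
  have l2 : ε ≤ e0 := hε ▸ (min_le_right _ _).trans (min_le_left _ _)
  have l3 : ε ≤ 1 - e1 := hε ▸ (min_le_right _ _).trans (min_le_right _ _)
  obtain ⟨B, hB⟩ := isCompact_Icc.exists_bound_of_continuousOn (hc.mono (fun x (hx : x ∈ Icc ε (1-ε)) => ⟨by linarith [hx.1], by linarith [hx.2]⟩))
  obtain ⟨K, K0, hK⟩ := wt_glue (p := fun ζ => ‖p ζ.re‖) (S := {ζ | 0 < ζ.re ∧ ζ.re < 1}) (a := a) (b := b) (ε := ε) (K := C0 + C1 + |B|) ε0 (by linarith) (by positivity) (fun ζ h => h)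
    (fun ζ h hl => by
      have := he0 ⟨h.1, hl.trans_le l2⟩
      have e : ‖p ζ.re‖ ≤ C0 * ‖ζ.re ^ a‖ := this
      have hp := Real.rpow_nonneg h.1.le a
      rw [Real.norm_of_nonneg hp] at e
      exact e.trans (mul_le_mul_of_nonneg_right (by linarith [abs_nonneg B]) hp)) (fun ζ h hl => by
      have := he1 ⟨by linarith, h.2⟩
      have e : ‖p ζ.re‖ ≤ C1 * ‖(1-ζ.re) ^ b‖ := this
      have hp := Real.rpow_nonneg (by linarith [h.2] : 0 ≤ 1 - ζ.re) b
      rw [Real.norm_of_nonneg hp] at e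
      exact e.trans (mul_le_mul_of_nonneg_right (by linarith [abs_nonneg B]) hp)) (fun ζ h h1 h2 => by
      have := hB ζ.re ⟨h1, h2⟩
      linarith [le_abs_self B])
  exact ⟨K, K0, fun x hx => by simpa using hK x (by simpa using hx)⟩

noncomputable def zp (c x : ℝ) : ℂ := x - (c * x * (1 - x) : ℝ) * I
noncomputable def zd (c x : ℝ) : ℂ := 1 - (c * (1 - 2 * x) : ℝ) * I

theorem zp_re (c x : ℝ) : (zp c x).re = x := by simp [zp]
theorem zp_im (c x : ℝ) : (zp c x).im = -(c * x * (1 - x)) := by simp [zp]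
theorem zp_rev (c x : ℝ) : 1 - zp c x = zp (-c) (1 - x) := by simp only [zp]; push_cast; ring
theorem zp_zero (c : ℝ) : zp c 0 = 0 := by simp [zp]
theorem zp_one (c : ℝ) : zp c 1 = 1 := by simp [zp]
theorem zp_c0 (x : ℝ) : zp 0 x = x := by simp [zp]
theorem zd_c0 (x : ℝ) : zd 0 x = 1 := by simp [zd]
theorem zp_cont (c : ℝ) : Continuous (zp c) := by unfold zp; fun_prop
theorem zd_cont (c : ℝ) : Continuous (zd c) := by unfold zd; fun_prop
theorem zp_deriv (c x : ℝ) : HasDerivAt (zp c) (zd c x) x := by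
  have h1 : HasDerivAt (fun x : ℝ => c * x * (1 - x)) (c * (1 - 2 * x)) x := by
    have := ((hasDerivAt_id x).const_mul c).fun_mul ((hasDerivAt_id x).const_sub 1)
    refine this.congr_deriv ?_; simp; ring
  exact ((hasDerivAt_id x).ofReal_comp).fun_sub (h1.ofReal_comp.mul_const I) |>.congr_deriv (by simp [zd])
theorem zd_le {c : ℝ} (hc : |c| ≤ 1) {x : ℝ} (h0 : 0 ≤ x) (h1 : x ≤ 1) : ‖zd c x‖ ≤ 2 := by
  unfold zd
  refine (norm_sub_le _ _).trans ?_
  rw [norm_one, norm_mul, norm_I, norm_real, Real.norm_eq_abs, abs_mul, mul_one]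
  have : |1 - 2 * x| ≤ 1 := by rw [abs_le]; constructor <;> linarith
  nlinarith [abs_nonneg c, abs_nonneg (1 - 2*x)]
theorem zp_abs {c x : ℝ} (h0 : 0 < x) (h1 : x < 1) : |(zp c x).im| ≤ |c| * x ∧ |(zp c x).im| ≤ |c| * (1 - x) := by
  have h2 : 0 < 1 - x := by linarith
  rw [zp_im, abs_neg, abs_mul, abs_mul, abs_of_pos h0, abs_of_pos h2]
  have := mul_nonneg (abs_nonneg c) h0.le
  have := mul_nonneg (abs_nonneg c) h2.le
  constructor <;> nlinarith
theorem zp_mem {c c1 x : ℝ} (hc : |c| < c1) (h0 : 0 < x) (h1 : x < 1) : zp c x ∈ Nset c1 := by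
  obtain ⟨a, b⟩ := zp_abs (c := c) h0 h1
  have h2 : 0 < 1 - x := by linarith
  refine ⟨a.trans_lt ?_, b.trans_lt ?_⟩ <;> rw [zp_re] <;> gcongr
theorem zp_norm {c x : ℝ} (hc : |c| ≤ 1) (h0 : 0 < x) (h1 : x < 1) : x ≤ ‖zp c x‖ ∧ ‖zp c x‖ ≤ 2 * x := by
  constructor
  · have := re_le_norm (zp c x); rwa [zp_re] at this
  · have := norm_le_abs_re_add_abs_im (zp c x)
    rw [zp_re, abs_of_pos h0] at this
    nlinarith [(zp_abs (c := c) h0 h1).1]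
theorem zp_ne {c x : ℝ} (h0 : 0 < x) : zp c x ≠ 0 := fun h => by have := zp_re c x; rw [h] at this; simp at this; linarith

theorem zp_sec {c c1 x : ℝ} (c10 : 0 < c1) (c12 : c1 ≤ 1/2) (hc : |c| ≤ c1/4) (h0 : 0 < x) (h1 : x < 1/16) : zp c x ∈ Sec 0 1 (c1/2) 0 (1/8) := by
  have h2 := zp_norm (c := c) (by linarith) h0 (by linarith)
  refine ⟨‖zp c x‖, arg (zp c x), norm_pos_iff.2 (zp_ne h0), by linarith, ?_, by rw [norm_mul_exp_arg_mul_I]; ring⟩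
  have := arg_cone (ζ := zp c x) (c := |c|) (by rwa [zp_re]) (by rw [zp_re]; exact (zp_abs h0 (by linarith)).1) (by linarith)
  linarith

theorem sec_Nset {c : ℝ} (c0 : 0 < c) (c2 : c ≤ 1/2) : Sec 0 1 (c/2) 0 (1/8) ⊆ Nset c := by
  rintro w ⟨ρ, θ, h1, h2, h3, rfl⟩
  rw [zero_mul, sub_zero] at h3
  simp only [Nset, mem_ofPred_eq, zero_add, one_mul, re_ofReal_mul, im_ofReal_mul, exp_ofReal_mul_I_re, exp_ofReal_mul_I_im]
  rw [abs_mul, abs_of_pos h1]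
  have a := Real.abs_sin_le_abs (x := θ)
  have b := Real.one_sub_sq_div_two_le_cos (x := θ)
  have b' := Real.cos_le_one θ
  have hb : θ^2 ≤ 1/16 := by rw [← sq_abs]; nlinarith [abs_nonneg θ]
  have d : ρ * |Real.sin θ| ≤ ρ * (c/2) := by gcongr; linarith
  constructor
  · have : c * (ρ * (1/2)) < c * (ρ * Real.cos θ) := by gcongr; linarith
    linarith
  · have : ρ * Real.cos θ ≤ 1/8 := by nlinarith
    nlinarith

theorem zp_lim0 {c c1 : ℝ} (c10 : 0 < c1) (c12 : c1 ≤ 1/2) (hc : |c| ≤ c1/4) : Tendsto (zp c) (nhdsWithin 0 (Ioi 0)) (nhdsWithin 0 (Sec 0 1 (c1/2) 0 (1/8))) := by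
  refine tendsto_nhdsWithin_iff.2 ⟨?_, ?_⟩
  · have := (zp_cont c).tendsto 0
    rw [zp_zero] at this; exact this.mono_left nhdsWithin_le_nhds
  · filter_upwards [Ioo_mem_nhdsGT (show (0:ℝ) < 1/16 by norm_num)] with x hx using zp_sec c10 c12 hc hx.1 hx.2

theorem sec_rev {h r : ℝ} : Tendsto (fun w : ℂ => 1 - w) (nhdsWithin 1 (Sec 1 (-1) h 0 r)) (nhdsWithin 0 (Sec 0 1 h 0 r)) ∧ Tendsto (fun w : ℂ => 1 - w) (nhdsWithin 0 (Sec 0 1 h 0 r)) (nhdsWithin 1 (Sec 1 (-1) h 0 r)) := by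
  have hc : Continuous (fun w : ℂ => 1 - w) := by fun_prop
  constructor
  · refine tendsto_nhdsWithin_iff.2 ⟨?_, ?_⟩
    · have := hc.tendsto 1
      simp only [sub_self] at this; exact this.mono_left nhdsWithin_le_nhds
    · refine eventually_mem_nhdsWithin.mono ?_
      rintro w ⟨ρ, θ, h1, h2, h3, rfl⟩; exact ⟨ρ, θ, h1, h2, h3, by ring⟩
  · refine tendsto_nhdsWithin_iff.2 ⟨?_, ?_⟩
    · have := hc.tendsto 0
      simp only [sub_zero] at this; exact this.mono_left nhdsWithin_le_nhds
    · refine eventually_mem_nhdsWithin.mono ?_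
      rintro w ⟨ρ, θ, h1, h2, h3, rfl⟩; exact ⟨ρ, θ, h1, h2, h3, by ring⟩

theorem rev_lim : Tendsto (fun x : ℝ => 1 - x) (nhdsWithin 1 (Iio 1)) (nhdsWithin 0 (Ioi 0)) := by
  have hc : Continuous (fun w : ℝ => 1 - w) := by fun_prop
  refine tendsto_nhdsWithin_iff.2 ⟨?_, eventually_mem_nhdsWithin.mono fun x (hx : x < 1) => by simpa using hx⟩
  have := hc.tendsto 1
  simp only [sub_self] at this; exact this.mono_left nhdsWithin_le_nhds

theorem zp_lim1 {c c1 : ℝ} (c10 : 0 < c1) (c12 : c1 ≤ 1/2) (hc : |c| ≤ c1/4) : Tendsto (zp c) (nhdsWithin 1 (Iio 1)) (nhdsWithin 1 (Sec 1 (-1) (c1/2) 0 (1/8))) := by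
  have := sec_rev.2.comp ((zp_lim0 c10 c12 (c := -c) (by rwa [abs_neg])).comp rev_lim)
  refine this.congr fun x => ?_
  simp only [Function.comp]; rw [← zp_rev]; ring

theorem sec_Nset1 {c : ℝ} (c0 : 0 < c) (c2 : c ≤ 1/2) : Sec 1 (-1) (c/2) 0 (1/8) ⊆ Nset c := by
  rintro w ⟨ρ, θ, h1, h2, h3, rfl⟩
  rw [← Nset_rev]
  exact sec_Nset c0 c2 ⟨ρ, θ, h1, h2, h3, by ring⟩

theorem path_O {c c1 s : ℝ} (c10 : 0 < c1) (c12 : c1 ≤ 1/2) (hc : |c| ≤ c1/4) (hs : s ≤ 0) {g : ℂ → ℂ} :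
    (g =O[nhdsWithin 0 (Nset c1)] (fun ζ => ‖ζ‖ ^ s) → (fun x => g (zp c x)) =O[nhdsWithin 0 (Ioi 0)] fun x => x ^ s) ∧
    (g =O[nhdsWithin 1 (Nset c1)] (fun ζ => ‖ζ - 1‖ ^ s) → (fun x => g (zp c x)) =O[nhdsWithin 1 (Iio 1)] fun x => (1 - x) ^ s) := by
  constructor
  · intro h
    refine (h.comp_tendsto ((zp_lim0 c10 c12 hc).mono_right (nhdsWithin_mono _ (sec_Nset c10 c12)))).trans (Asymptotics.IsBigO.of_bound 1 ?_)
    filter_upwards [Ioo_mem_nhdsGT one_pos] with x hx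
    have hx0 := hx.1
    rw [Function.comp, one_mul, Real.norm_of_nonneg (by positivity), Real.norm_of_nonneg (by positivity)]
    exact Real.rpow_le_rpow_of_nonpos hx0 (zp_norm (by linarith) hx.1 hx.2).1 hs
  · intro h
    refine (h.comp_tendsto ((zp_lim1 c10 c12 hc).mono_right (nhdsWithin_mono _ (sec_Nset1 c10 c12)))).trans (Asymptotics.IsBigO.of_bound 1 ?_)
    filter_upwards [Ioo_mem_nhdsLT one_pos] with x hx
    have hx0 : 0 < 1 - x := by linarith [hx.2]
    rw [Function.comp, one_mul, Real.norm_of_nonneg (by positivity), Real.norm_of_nonneg (by positivity), norm_sub_rev, zp_rev]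
    exact Real.rpow_le_rpow_of_nonpos hx0 (zp_norm (by rw [abs_neg]; linarith) hx0 (by linarith [hx.1])).1 hs

theorem path_ii {c c1 : ℝ} (c10 : 0 < c1) (c12 : c1 ≤ 1/2) (hc : |c| ≤ c1/4) {g : ℂ → ℂ} (hd : ContinuousOn (fun x => g (zp c x)) (Ioo 0 1))
    (h0 : g =O[nhdsWithin 0 (Nset c1)] fun ζ => ‖ζ‖ ^ (-(1/2) : ℝ)) (h1 : g =O[nhdsWithin 1 (Nset c1)] fun ζ => ‖ζ - 1‖ ^ (-(1/2) : ℝ)) :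
    IntervalIntegrable (fun x => g (zp c x) * zd c x) volume 0 1 := by
  have e := path_O c10 c12 hc (s := -(1/2)) (by norm_num) (g := g)
  obtain ⟨K, -, hK⟩ := glueR hd (e.1 h0) (e.2 h1)
  exact (ii_wt (by norm_num) (by norm_num) hd hK).mul_continuousOn (zd_cont c).continuousOn

theorem arc_path {c1 : ℝ} (c10 : 0 < c1) (c12 : c1 ≤ 1/2) {g : ℂ → ℂ} (hd : DifferentiableOn ℂ g (Nset c1))
    (h0 : g =O[nhdsWithin 0 (Nset c1)] fun ζ => ‖ζ‖ ^ (-(1/2) : ℝ)) (h1 : g =O[nhdsWithin 1 (Nset c1)] fun ζ => ‖ζ - 1‖ ^ (-(1/2) : ℝ)) :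
    (∀ c, |c| ≤ c1/4 → IntervalIntegrable (fun x => g (zp c x) * zd c x) volume 0 1) ∧ ∃ v, ∀ c, |c| ≤ c1/4 → ∫ x in (0:ℝ)..1, g (zp c x) * zd c x = v := by
  have hcp : ∀ c, |c| ≤ c1/4 → ContinuousOn (fun x => g (zp c x)) (Ioo 0 1) := fun c hc =>
    hd.continuousOn.comp (zp_cont c).continuousOn fun x hx => zp_mem (by linarith) hx.1 hx.2
  have hii := fun c hc => path_ii c10 c12 hc (hcp c hc) h0 h1
  have hbd : Bornology.IsBounded (Nset c1) := isBounded_iff_forall_norm_le.2 ⟨2, fun ζ hζ => (Nset_norm c10 c12 hζ).1.trans (by linarith [(Nset_re c10 hζ).2])⟩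
  obtain ⟨φ, hφ, hb⟩ := rmt (Nset_open c1) (Nset_sc c10) hbd (Nset_convex c1).isPreconnected ((Nset_real c10).2 (show (1/2:ℝ) ∈ Ioo (0:ℝ) 1 by norm_num))
  obtain ⟨Φ, hΦ⟩ := prim (Nset_open c1) hφ hb hd
  obtain ⟨v0, hv0⟩ := sec_lim (w0 := 0) (e := 1) (h := c1/2) (r := 1/8) (by simp) (by linarith) (by linarith [Real.pi_gt_three]) (by norm_num)
    (fun w hw => hΦ w (sec_Nset c10 c12 hw)) (by simpa only [sub_zero] using h0.mono (nhdsWithin_mono _ (sec_Nset c10 c12)))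
  obtain ⟨v1, hv1⟩ := sec_lim (w0 := 1) (e := -1) (h := c1/2) (r := 1/8) (by simp) (by linarith) (by linarith [Real.pi_gt_three]) (by norm_num)
    (fun w hw => hΦ w (sec_Nset1 c10 c12 hw)) (h1.mono (nhdsWithin_mono _ (sec_Nset1 c10 c12)))
  refine ⟨hii, v1 - v0, fun c hc => ?_⟩
  exact intervalIntegral.integral_eq_sub_of_hasDerivAt_of_tendsto zero_lt_one (f := fun x => Φ (zp c x))
    (fun x hx => (hΦ _ (zp_mem (by linarith) hx.1 hx.2)).comp x (zp_deriv c x)) (hii c hc) (hv0.comp (zp_lim0 c10 c12 hc)) (hv1.comp (zp_lim1 c10 c12 hc))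

theorem end_path {τ : ℂ → ℂ} {w0 e : ℂ} {h s M ε c r : ℝ} (hs : s = 1 ∨ s = -1) (ε0 : 0 < ε) (M1 : 1 ≤ M)
    (hb : ∀ ζ : ℂ, ζ ≠ 0 → ‖ζ‖ < ε → ‖ζ‖ ≤ M * ‖τ ζ - w0‖ ∧ ‖τ ζ - w0‖ ≤ M * ‖ζ‖)
    (X : ∀ ζ : ℂ, ζ ≠ 0 → ‖ζ‖ < ε → 0 ≤ s * arg ζ → s * arg ζ ≤ h → ∃ θ : ℝ, |θ| ≤ h - |arg ζ| + M * ‖τ ζ - w0‖ ∧ τ ζ = w0 + e * (‖τ ζ - w0‖ * exp (θ * I)))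
    (c0 : 0 < c) (c2 : c ≤ 1/2) (hc : 3/2 * c ≤ h) (hr : 0 < r) :
    ∀ᶠ y in nhdsWithin (0:ℝ) (Ioi 0), τ (zp (-s * c) y) ∈ Sec w0 e (h - c/8) 0 r := by
  have hs1 : |s| = 1 := by rcases hs with rfl | rfl <;> simp
  have hss : s * s = 1 := by rcases hs with rfl | rfl <;> simp
  have hca : |-s * c| = c := by rw [abs_mul, abs_neg, hs1, one_mul, abs_of_pos c0]
  filter_upwards [ev_small (a := 1/2) (by norm_num), ev_small (a := ε/4) (by positivity), ev_small (a := c/(32*(M*M))) (by positivity), ev_small (a := r/(4*M)) (by positivity)] with y h1 h2 h3 h4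
  have y0 := h1.1
  obtain ⟨n1, n2⟩ := zp_norm (c := -s * c) (by rw [hca]; linarith) y0 (by linarith)
  have z0 : zp (-s * c) y ≠ 0 := zp_ne y0
  have him := zp_im (-s * c) y
  have hre := zp_re (-s * c) y
  have hcy : 0 < c * y * (1 - y) := mul_pos (mul_pos c0 y0) (by linarith)
  have hia : |(zp (-s * c) y).im| = c * y * (1 - y) := by
    rw [him, show -(-s * c * y * (1 - y)) = s * (c * y * (1 - y)) by ring, abs_mul, hs1, one_mul, abs_of_pos hcy]
  have l1 := arg_cone (ζ := zp (-s * c) y) (c := c) (by rw [hre]; exact y0) (by rw [hia, hre]; nlinarith only [mul_pos (mul_pos c0 y0) y0]) c2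
  have l2 := arg_lower (zp (-s * c) y)
  rw [hia, div_le_iff₀ (by linarith)] at l2
  have l3 : c / 4 ≤ |arg (zp (-s * c) y)| := by
    by_contra hh
    push Not at hh
    nlinarith only [l2, h1.2, mul_lt_mul_of_pos_right hh (norm_pos_iff.2 z0), mul_le_mul_of_nonneg_left n2 c0.le, mul_pos c0 y0]
  have sg : 0 ≤ s * arg (zp (-s * c) y) := by
    rcases hs with rfl | rfl
    · rw [one_mul]; exact arg_nonneg_iff.2 (by rw [him]; linarith)
    · have : arg (zp (- -1 * c) y) < 0 := arg_neg_iff.2 (by rw [him]; linarith)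
      linarith
  have sa : s * arg (zp (-s * c) y) = |arg (zp (-s * c) y)| := by rw [← abs_of_nonneg sg, abs_mul, hs1, one_mul]
  have ne : ‖zp (-s * c) y‖ < ε := by linarith
  obtain ⟨b1, b2⟩ := hb _ z0 ne
  obtain ⟨θ, t1, t2⟩ := X _ z0 ne sg (by rw [sa]; linarith)
  have k3 := (le_div_iff₀ (by positivity)).1 h3.2
  have k4 := (le_div_iff₀ (by positivity)).1 h4.2
  have M0 : 0 < M := by linarith
  have b3 : ‖τ (zp (-s * c) y) - w0‖ ≤ M * (2 * y) := b2.trans (mul_le_mul_of_nonneg_left n2 M0.le)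
  refine ⟨‖τ (zp (-s * c) y) - w0‖, θ, ?_, ?_, ?_, t2⟩
  · by_contra hh
    nlinarith only [hh, b1, norm_pos_iff.2 z0, M0]
  · nlinarith only [b3, k4, hr]
  · have := mul_le_mul_of_nonneg_left b3 M0.le
    linarith

theorem EndAt.lim {τ : ℂ → ℂ} {w0 e : ℂ} {α s M ε : ℝ} (hE : EndAt τ w0 e α s M ε) {c : ℝ} : Tendsto (fun y => τ (zp c y)) (nhdsWithin (0:ℝ) (Ioi 0)) (nhds w0) := by
  obtain ⟨h0, ε0, -, h⟩ := hE
  rw [tendsto_iff_norm_sub_tendsto_zero]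
  have h1 : Tendsto (zp c) (nhdsWithin (0:ℝ) (Ioi 0)) (nhds 0) := by
    have := ((zp_cont c).tendsto 0).mono_left (nhdsWithin_le_nhds (s := Ioi 0)); rwa [zp_zero] at this
  refine squeeze_zero' (g := fun y => M * ‖zp c y‖) (Eventually.of_forall fun _ => norm_nonneg _) ?_ (by simpa using (h1.norm.const_mul M))
  filter_upwards [h1.norm.eventually_lt_const (by simpa using ε0), self_mem_nhdsWithin] with y h1 h2
  exact (h _ (zp_ne h2) h1).2.1

theorem EndAt.inn {τ : ℂ → ℂ} {w0 e : ℂ} {α s M ε : ℝ} (hs : s = 1 ∨ s = -1) (M1 : 1 ≤ M) (hE : EndAt τ w0 e α s M ε) {c r : ℝ}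
    (c0 : 0 < c) (c2 : c ≤ 1/2) (hc : 3/2 * c ≤ α * Real.pi / 2) (hr : 0 < r) :
    ∀ᶠ y in nhdsWithin (0:ℝ) (Ioi 0), τ (zp (-s * c) y) ∈ Sec w0 e (α * Real.pi / 2 - c/8) 0 r :=
  end_path hs hE.2.1 M1 (fun ζ h1 h2 => let h := hE.2.2.2 ζ h1 h2; ⟨h.1, h.2.1⟩) (fun ζ h1 h2 h3 h4 => end_inn hs hE h1 h2 h3 h4) c0 c2 hc hr

theorem EndAt.out {τ : ℂ → ℂ} {w0 e : ℂ} {α s M ε : ℝ} (hs : s = 1 ∨ s = -1) (M1 : 1 ≤ M) (hE : EndAt τ w0 e α s M ε) {c r : ℝ}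
    (c0 : 0 < c) (c2 : c ≤ 1/2) (hc : 3/2 * c ≤ Real.pi - α * Real.pi / 2) (hr : 0 < r) :
    ∀ᶠ y in nhdsWithin (0:ℝ) (Ioi 0), τ (zp (s * c) y) ∈ Sec w0 (-e) (Real.pi - α * Real.pi / 2 - c/8) 0 r := by
  have := end_path (τ := τ) (w0 := w0) (e := -e) (h := Real.pi - α * Real.pi / 2) (s := -s) (by rcases hs with rfl | rfl <;> simp) hE.2.1 M1 (fun ζ h1 h2 => let h := hE.2.2.2 ζ h1 h2; ⟨h.1, h.2.1⟩)
    (fun ζ h1 h2 h3 h4 => end_out hs hE h1 h2 (by linarith) (by linarith)) c0 c2 hc hr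
  rwa [neg_neg] at this

/-- power bound at a point -/
def Bd (f : ℂ → ℂ) (S : Set ℂ) (w : ℂ) (s : ℝ) : Prop := f =O[nhdsWithin w S] fun z => ‖z - w‖ ^ s

theorem Bd.mul {f g S w s t} (hw : w ∉ S) (h : Bd f S w s) (h' : Bd g S w t) : Bd (fun z => f z * g z) S w (s + t) := by
  refine (Asymptotics.IsBigO.mul h h').trans (Asymptotics.IsBigO.of_bound 1 (eventually_mem_nhdsWithin.mono fun z (hz : z ∈ S) => ?_))
  rw [one_mul, Real.rpow_add (norm_pos_iff.2 (sub_ne_zero.2 (by rintro rfl; exact hw hz)))]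

theorem Bd.weak {f S w s t} (hw : w ∉ S) (h : Bd f S w s) (hst : t ≤ s) : Bd f S w t := by
  refine Asymptotics.IsBigO.trans h (Asymptotics.IsBigO.of_bound 1 ?_)
  filter_upwards [self_mem_nhdsWithin, nhdsWithin_le_nhds (ball_mem_nhds w one_pos)] with z hz hb
  have := norm_pos_iff.2 (sub_ne_zero.2 (show z ≠ w by rintro rfl; exact hw hz))
  rw [one_mul, Real.norm_of_nonneg (by positivity), Real.norm_of_nonneg (by positivity)]
  exact Real.rpow_le_rpow_of_exponent_ge this (mem_ball_iff_norm.1 hb).le hst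

theorem Bd.of {f S w} (C : ℝ) (h : ∀ᶠ z in nhdsWithin w S, ‖f z‖ ≤ C) : Bd f S w 0 :=
  Asymptotics.IsBigO.of_bound C (by simpa using h)

theorem Bd.congr {f g S w s} (h : Bd f S w s) (e : ∀ᶠ z in nhdsWithin w S, f z = g z) : Bd g S w s := Asymptotics.IsBigO.congr' h e (EventuallyEq.refl _ _)

theorem Bd.cont {f S w} (h : ContinuousAt f w) : Bd f S w 0 :=
  Bd.of (‖f w‖ + 1) (nhdsWithin_le_nhds ((h.norm.eventually_lt_const (lt_add_one _)).mono fun _ h => h.le))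

structure Nice (D : JordanDomain) (N : ℕ) (σ : ℕ → ℂ → ℂ) (c : ℝ) (J : Set ℂ) (ee : ℂ → ℂ) (al : ℂ → ℝ) (f : ℂ → ℂ) (fj : ℕ → ℂ → ℂ) (s : ℝ) : Prop where
  d : DifferentiableOn ℂ f D.G
  dj : ∀ j < N, DifferentiableOn ℂ (fj j) (Nset c)
  eq : ∀ j < N, ∀ ζ ∈ NU c, fj j ζ = f (σ j ζ)
  b0 : ∀ j < N, Bd (fj j) (Nset c) 0 s
  b1 : ∀ j < N, Bd (fj j) (Nset c) 1 s
  bs : ∀ w ∈ J, ∀ δ > 0, Bd f (Sec w (ee w) (al w * Real.pi / 2 - δ) 0 1) w s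

theorem nN0 {c : ℝ} (hc : 0 < c) : (0:ℂ) ∉ Nset c := fun h => by simpa using (Nset_re hc h).1
theorem nN1 {c : ℝ} (hc : 0 < c) : (1:ℂ) ∉ Nset c := fun h => by simpa using (Nset_re hc h).2
theorem nSec {w e : ℂ} {h C r : ℝ} (he : ‖e‖ = 1) : w ∉ Sec w e h C r := by
  rintro ⟨ρ, θ, h0, -, -, h⟩
  have : e ≠ 0 := by rintro rfl; simp at he
  simp [this, h0.ne'] at h

theorem Geo.c0 {D lam N σ V c M J ee al} (g : Geo D lam N σ V c M J ee al) : 0 < c := (g.lens 0 g.N0).c0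
theorem Geo.c2 {D lam N σ V c M J ee al} (g : Geo D lam N σ V c M J ee al) : c ≤ 1/2 := (g.lens 0 g.N0).c2

theorem Nice.mul {D lam N σ V c M J ee al} (g : Geo D lam N σ V c M J ee al) {f fj s f' fj' s'} (h : Nice D N σ c J ee al f fj s) (h' : Nice D N σ c J ee al f' fj' s') :
    Nice D N σ c J ee al (fun z => f z * f' z) (fun j ζ => fj j ζ * fj' j ζ) (s + s') :=
  ⟨h.d.mul h'.d, fun j hj => (h.dj j hj).mul (h'.dj j hj), fun j hj ζ hz => by beta_reduce; rw [h.eq j hj ζ hz, h'.eq j hj ζ hz], fun j hj => (h.b0 j hj).mul (nN0 g.c0) (h'.b0 j hj),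
    fun j hj => (h.b1 j hj).mul (nN1 g.c0) (h'.b1 j hj), fun w hw δ hδ => (h.bs w hw δ hδ).mul (nSec (g.cor w hw).1.ne) (h'.bs w hw δ hδ)⟩

theorem Nice.weak {D lam N σ V c M J ee al} (g : Geo D lam N σ V c M J ee al) {f fj s t} (h : Nice D N σ c J ee al f fj s) (hst : t ≤ s) :
    Nice D N σ c J ee al f fj t :=
  ⟨h.d, h.dj, h.eq, fun j hj => (h.b0 j hj).weak (nN0 g.c0) hst, fun j hj => (h.b1 j hj).weak (nN1 g.c0) hst, fun w hw δ hδ => (h.bs w hw δ hδ).weak (nSec (g.cor w hw).1.ne) hst⟩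

theorem Corner.nG {D : JordanDomain} {w e α C r} (h : Corner D.G w e α C r) : w ∉ D.G := fun hw => by
  have hp : 0 < Real.pi - α * Real.pi / 2 := by nlinarith [h.a2, Real.pi_pos]
  have C0 : 0 < C := by linarith [h.C1]
  have h1 : Tendsto (fun ρ : ℝ => w + -e * (ρ * exp ((0:ℝ) * I))) (nhdsWithin 0 (Ioi 0)) (nhds w) := by
    have : Continuous (fun ρ : ℝ => w + -e * (ρ * exp ((0:ℝ) * I))) := by fun_prop
    simpa using (this.tendsto 0).mono_left (nhdsWithin_le_nhds (s := Ioi 0))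
  obtain ⟨ρ, hρ, h2, h3⟩ := (((h1.eventually (D.isOpen.mem_nhds hw)).and ((ev_small (a := r/2) (half_pos h.r0)).and (ev_small (a := (Real.pi - α * Real.pi / 2)/(2*C)) (by positivity))))).exists
  refine h.out (a := w + -e * (ρ * exp ((0:ℝ) * I))) ⟨ρ, 0, h2.1, by linarith [h.r0], ?_, rfl⟩ (subset_closure hρ)
  have := (le_div_iff₀ (by positivity)).1 h3.2
  rw [abs_zero]; nlinarith

theorem Corner.sub {G : Set ℂ} {w e α C r} (h : Corner G w e α C r) {δ : ℝ} (hδ : 0 < δ) : Sec w e (α * Real.pi / 2 - δ) 0 (min r (δ / C)) ⊆ G := by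
  have C0 : 0 < C := by linarith [h.C1]
  rintro z ⟨ρ, θ, h1, h2, h3, h4⟩
  refine h.inn ⟨ρ, θ, h1, h2.trans_le (min_le_left _ _), ?_, h4⟩
  have := (lt_div_iff₀ C0).1 (h2.trans_le (min_le_right _ _))
  linarith

theorem Sec_near {w e : ℂ} {h r r' : ℝ} (he : ‖e‖ = 1) (hr : 0 < r') : ∀ᶠ z in nhdsWithin w (Sec w e h 0 r), z ∈ Sec w e h 0 r' := by
  filter_upwards [self_mem_nhdsWithin, nhdsWithin_le_nhds (ball_mem_nhds w hr)] with z hz hb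
  obtain ⟨ρ, θ, h1, h2, h3, rfl⟩ := hz
  refine ⟨ρ, θ, h1, ?_, by simpa using h3, rfl⟩
  rw [mem_ball_iff_norm, add_sub_cancel_left, norm_mul, he, norm_mul, norm_exp_ofReal_mul_I, norm_real, Real.norm_of_nonneg h1.le] at hb
  linarith

theorem Corner.ev {G : Set ℂ} {w e α C r} (h : Corner G w e α C r) {δ : ℝ} (hδ : 0 < δ) : nhdsWithin w (Sec w e (α * Real.pi / 2 - δ) 0 1) ≤ nhdsWithin w G := by
  have C0 : 0 < C := by linarith [h.C1]
  refine le_inf inf_le_left (le_principal_iff.2 ?_)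
  filter_upwards [Sec_near h.ne (lt_min h.r0 (div_pos hδ C0))] with z hz using h.sub hδ hz

theorem CT {D lam N σ V c M J ee al} (g : Geo D lam N σ V c M J ee al) {φ : ℂ → ℂ} (hφ : CM D φ) {f fj} (h : Nice D N σ c J ee al f fj (-(1/2))) :
    (∀ c', |c'| ≤ c/4 → ∀ j < N, IntervalIntegrable (fun x => fj j (zp c' x) * deriv (σ j) (zp c' x) * zd c' x) volume 0 1) ∧
    ∀ c', |c'| ≤ c/4 → ∑ j ∈ Finset.range N, ∫ x in (0:ℝ)..1, fj j (zp c' x) * deriv (σ j) (zp c' x) * zd c' x = 0 := by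
  have c0 := g.c0
  have c2 := g.c2
  have ap := fun j (hj : j < N) => arc_path c0 c2 (g := fun ζ => fj j ζ * deriv (σ j) ζ) ((h.dj j hj).mul fun ζ hζ => (((g.lens j hj).arc.diff.deriv (g.lens j hj).arc.op).mono (g.lens j hj).sub) ζ hζ)
    (by
      have := (h.b0 j hj).mul (nN0 c0) (Bd.cont ((g.lens j hj).arc.contDeriv.continuousAt ((g.lens j hj).arc.op.mem_nhds (g.lens j hj).arc.zero)))
      simpa [Bd] using this)
    (by
      have := (h.b1 j hj).mul (nN1 c0) (Bd.cont ((g.lens j hj).arc.contDeriv.continuousAt ((g.lens j hj).arc.op.mem_nhds (g.lens j hj).arc.one)))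
      simpa [Bd] using this)
  refine ⟨fun c' hc' j hj => (ap j hj).1 c' hc', fun c' hc' => ?_⟩
  have hal : ∀ w ∈ J, 0 < al w * Real.pi / 2 := fun w hw => by have := (g.cor w hw).1.a0; have := Real.pi_pos; positivity
  obtain ⟨d, hd, hd2, hd3⟩ := ((ev_small (a := c/4) (by positivity)).and ((unif (N := N) fun j hj => ev_small (a := al (σ j 0) * Real.pi / 2 / 2) (half_pos (hal _ (g.J0 j hj)))).and
    (unif (N := N) fun j hj => ev_small (a := al (σ j 1) * Real.pi / 2 / 2) (half_pos (hal _ (g.J1 j hj)))))).exists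
  have hdc : |-d| ≤ c/4 := by rw [abs_neg, abs_of_pos hd.1]; exact hd.2
  obtain ⟨W, hW⟩ := prim D.isOpen hφ.d hφ.b h.d
  have hv : ∀ w, ∃ v, w ∈ J → 3/2 * d ≤ al w * Real.pi / 2 → ∃ r > 0, Tendsto W (nhdsWithin w (Sec w (ee w) (al w * Real.pi / 2 - d/8) 0 r)) (nhds v) := fun w => by
    by_cases hw : w ∈ J ∧ 3/2 * d ≤ al w * Real.pi / 2
    · have hC := (g.cor w hw.1).1
      have M0 : 0 < M := by linarith [hC.C1]
      have r0 : 0 < min M⁻¹ (d/8/M) := lt_min (by positivity) (div_pos (by linarith [hd.1]) M0)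
      have := sec_lim (W := W) (f := f) hC.ne (h := al w * Real.pi / 2 - d/8) (r := min 1 (min M⁻¹ (d/8/M))) (by linarith [hd.1]) (by nlinarith [hC.a2, Real.pi_pos, hd.1]) (lt_min one_pos r0)
        (fun z hz => hW z (hC.sub (by linarith [hd.1]) (Sec_mono le_rfl (min_le_right _ _) hz)))
        (Asymptotics.IsBigO.mono (h.bs w hw.1 (d/8) (by linarith [hd.1])) (nhdsWithin_mono _ (Sec_mono le_rfl (min_le_left _ _))))
      obtain ⟨v, hv⟩ := this
      exact ⟨v, fun _ _ => ⟨_, lt_min one_pos r0, hv⟩⟩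
    · exact ⟨0, fun h1 h2 => absurd ⟨h1, h2⟩ hw⟩
  choose v hv using hv
  have key : ∀ j < N, ∫ x in (0:ℝ)..1, fj j (zp c' x) * deriv (σ j) (zp c' x) * zd c' x = v (σ j 1) - v (σ j 0) := fun j hj => by
    obtain ⟨hi, u, hu⟩ := ap j hj
    rw [hu c' hc', ← hu (-d) hdc]
    have L := g.lens j hj
    have M1 := (g.cor _ (g.J0 j hj)).1.C1
    obtain ⟨r0, hr0, t0⟩ := hv _ (g.J0 j hj) (by linarith [(hd2 j hj).2])
    obtain ⟨r1, hr1, t1⟩ := hv _ (g.J1 j hj) (by linarith [(hd3 j hj).2])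
    refine intervalIntegral.integral_eq_sub_of_hasDerivAt_of_tendsto zero_lt_one (f := fun x => W (σ j (zp (-d) x))) (fun x hx => ?_) (hi _ hdc) (t0.comp ?_) (t1.comp ?_)
    · have hm : zp (-d) x ∈ NU c := ⟨zp_mem (by linarith) hx.1 hx.2, by
        rw [zp_im]; nlinarith [mul_pos (mul_pos hd.1 hx.1) (sub_pos.2 hx.2)]⟩
      have := ((hW _ (L.up _ hm.1 hm.2)).comp (zp (-d) x) (L.arc.hasDeriv (L.sub hm.1))).comp x (zp_deriv (-d) x)
      rw [h.eq j hj _ hm]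
      exact this
    · refine tendsto_nhdsWithin_iff.2 ⟨(g.end0 j hj).lim, ?_⟩
      simpa using (g.end0 j hj).inn (Or.inl rfl) M1 hd.1 (by linarith [hd.2]) (by linarith [(hd2 j hj).2]) hr0
    · have e : (fun x : ℝ => σ j (zp (-d) x)) = (fun y => (fun ζ => σ j (1 - ζ)) (zp d y)) ∘ fun x => 1 - x := by
        funext x; simp only [Function.comp]; rw [zp_rev]; simp
      rw [e]
      refine Tendsto.comp (tendsto_nhdsWithin_iff.2 ⟨(g.end1 j hj).lim, ?_⟩) rev_lim
      simpa using (g.end1 j hj).inn (Or.inr rfl) M1 hd.1 (by linarith [hd.2]) (by linarith [(hd3 j hj).2]) hr1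
  rw [Finset.sum_congr rfl fun j hj => key j (Finset.mem_range.1 hj)]
  exact g.tele v

theorem wt_O {a b c : ℝ} (ha : -(1/4) ≤ a) (hb : -(1/4) ≤ b) (c0 : 0 < c) (c2 : c ≤ 1/2) {f : ℂ → ℂ} {C : ℝ} (C0 : 0 < C) (h : ∀ ζ ∈ Nset c, ‖f ζ‖ ≤ C * wt a b ζ.re) :
    Bd f (Nset c) 0 (-(1/4)) ∧ Bd f (Nset c) 1 (-(1/4)) := by
  have key : ∀ {a b : ℝ}, -(1/4) ≤ a → ∀ x y : ℝ, 0 < x → x < 1/2 → 0 < y → y ≤ 2 * x → (1 - x) ^ b ≤ 2 → C * wt a b x ≤ C * 4 * y ^ (-(1/4) : ℝ) := fun {a b} ha x y x0 x1 y0 hy hb => by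
    have e1 : x ^ a ≤ x ^ (-(1/4) : ℝ) := Real.rpow_le_rpow_of_exponent_ge x0 (by linarith) ha
    have e2 : x ^ (-(1/4) : ℝ) ≤ (y/2) ^ (-(1/4) : ℝ) := Real.rpow_le_rpow_of_nonpos (by positivity) (by linarith) (by norm_num)
    have e3 : (y/2) ^ (-(1/4) : ℝ) ≤ 2 * y ^ (-(1/4) : ℝ) := by
      rw [div_eq_mul_inv, mul_comm, Real.mul_rpow (by positivity) y0.le, Real.inv_rpow (by norm_num), ← Real.rpow_neg (by norm_num), neg_neg]
      refine mul_le_mul_of_nonneg_right ?_ (by positivity)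
      exact (Real.rpow_le_rpow_of_exponent_le (by norm_num) (by norm_num : (1/4:ℝ) ≤ 1)).trans (by simp)
    unfold wt
    have := mul_le_mul (e1.trans (e2.trans e3)) hb (Real.rpow_nonneg (by linarith) _) (by positivity)
    nlinarith
  have hb2 : ∀ b : ℝ, ∀ᶠ x in nhds (0:ℝ), (1 - x) ^ b ≤ 2 := fun b => by
    have : ContinuousAt (fun x : ℝ => (1 - x) ^ b) 0 := ContinuousAt.rpow_const (by fun_prop) (Or.inl (by norm_num))
    exact (this.eventually_lt_const (u := 2) (by simp)).mono fun _ h => h.le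
  have l0 : Tendsto (fun ζ : ℂ => ζ.re) (nhds 0) (nhds 0) := by simpa using (continuous_re.tendsto (0:ℂ))
  have l1 : Tendsto (fun ζ : ℂ => 1 - ζ.re) (nhds 1) (nhds 0) := by
    have : Continuous (fun ζ : ℂ => 1 - ζ.re) := by fun_prop
    simpa using this.tendsto 1
  constructor
  · refine Asymptotics.IsBigO.of_bound (C * 4) ?_
    filter_upwards [self_mem_nhdsWithin, nhdsWithin_le_nhds (l0.eventually (hb2 b)), nhdsWithin_le_nhds (l0.eventually (gt_mem_nhds (show (0:ℝ) < 1/2 by norm_num)))] with ζ hz h1 h2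
    rw [Real.norm_of_nonneg (by positivity), sub_zero]
    exact (h ζ hz).trans (key ha _ _ (Nset_re c0 hz).1 h2 (norm_pos_iff.2 (by rintro rfl; exact nN0 c0 hz)) (Nset_norm c0 c2 hz).1 h1)
  · refine Asymptotics.IsBigO.of_bound (C * 4) ?_
    filter_upwards [self_mem_nhdsWithin, nhdsWithin_le_nhds (l1.eventually (hb2 a)), nhdsWithin_le_nhds (l1.eventually (gt_mem_nhds (show (0:ℝ) < 1/2 by norm_num)))] with ζ hz h1 h2
    rw [Real.norm_of_nonneg (by positivity), norm_sub_rev]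
    have := key (b := a) hb (1 - ζ.re) ‖1 - ζ‖ (by linarith [(Nset_re c0 hz).2]) h2 (norm_pos_iff.2 (sub_ne_zero.2 (by rintro rfl; exact nN1 c0 hz))) (Nset_norm c0 c2 hz).2 h1
    refine (h ζ hz).trans (Eq.trans_le ?_ this)
    simp only [wt, sub_sub_cancel]; ring

section
variable {D : JordanDomain} {lam : ℝ} {N : ℕ} {σ : ℕ → ℂ → ℂ} {V : ℕ → Set ℂ} {c M : ℝ} {J : Set ℂ} {ee : ℂ → ℂ} {al : ℂ → ℝ} {φ q : ℂ → ℂ} {F Q : ℕ → ℂ → ℂ} {C ρ : ℝ}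

theorem Geo.al_ge (g : Geo D lam N σ V c M J ee al) {w : ℂ} (hw : w ∈ J) : -(1/4) ≤ (1/al w - 1)/2 := by
  have h := (g.cor w hw).1
  have : 1/2 ≤ 1/al w := one_div_le_one_div_of_le h.a0 h.a2.le
  linarith

theorem nice_q (g : Geo D lam N σ V c M J ee al) (d : Dat D N σ al φ q F Q c C ρ) : Nice D N σ c J ee al q Q (-(1/4)) := by
  have hw := fun j hj => wt_O (g.al_ge (g.J0 j hj)) (g.al_ge (g.J1 j hj)) g.c0 g.c2 d.C0 (d.Qb j hj)
  refine ⟨d.qd, d.Qd, d.Qe, fun j hj => (hw j hj).1, fun j hj => (hw j hj).2, fun w hw δ hδ => ?_⟩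
  have hC := (g.cor w hw).1
  have hp : 0 < al w * Real.pi / 2 := by have := hC.a0; have := Real.pi_pos; positivity
  obtain ⟨K, K0, r1, r10, hK⟩ := d.cm.corner hC hC.nG
  obtain ⟨κ, κ0, r2, r20, -, r21, hb⟩ := sec_ball (w0 := w) (h := al w * Real.pi / 2) (δ := min δ (al w * Real.pi / 4)) hC.ne (by nlinarith [hC.a2, Real.pi_pos]) (lt_min hδ (by linarith))
    ((min_le_right _ _).trans_lt (by linarith)) hC.C1 hC.r0
  refine Asymptotics.IsBigO.of_bound (Real.sqrt (2 * K / κ)) ?_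
  filter_upwards [Sec_near hC.ne r20, nhdsWithin_le_nhds (ball_mem_nhds w r10), nhdsWithin_le_nhds (ball_mem_nhds w one_pos), hC.ev hδ self_mem_nhdsWithin] with z hz h1 h3 h2
  have hz' : z ∈ Sec w (ee w) (al w * Real.pi / 2 - min δ (al w * Real.pi / 4)) 0 r2 := by
    obtain ⟨ρ, θ, k1, k2, k3, k4⟩ := hz
    exact ⟨ρ, θ, k1, k2, k3.trans_le (by linarith [min_le_left δ (al w * Real.pi / 4)]), k4⟩
  have hsub := (hb z hz').trans hC.inn
  have rp : 0 < ‖z - w‖ := norm_pos_iff.2 (sub_ne_zero.2 (by rintro rfl; exact hC.nG h2))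
  have h4 := sp_pick (mul_pos κ0 rp) (d.cm.d.mono hsub) fun y hy => d.cm.lt (hsub hy)
  have h5 := hK z h2 (mem_ball_iff_norm.1 h1)
  have h6 : ‖z - w‖ ^ (1/al w) ≤ ‖z - w‖ ^ (-(1/2):ℝ) * ‖z - w‖ := by
    rw [← Real.rpow_add_one rp.ne']
    exact Real.rpow_le_rpow_of_exponent_ge rp (mem_ball_iff_norm.1 h3).le (by linarith [g.al_ge hw])
  have h7 : ‖deriv φ z‖ ≤ 2 * K / κ * ‖z - w‖ ^ (-(1/2):ℝ) := by
    refine h4.trans ((div_le_iff₀ (mul_pos κ0 rp)).2 ?_)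
    have := mul_le_mul_of_nonneg_left h6 K0.le
    have e : 2 * K / κ * ‖z - w‖ ^ (-(1/2):ℝ) * (κ * ‖z - w‖) = 2 * (K * (‖z - w‖ ^ (-(1/2):ℝ) * ‖z - w‖)) := by field_simp
    rw [e]; linarith
  rw [← d.q2 z h2, norm_pow] at h7
  rw [Real.norm_of_nonneg (by positivity)]
  refine abs_le_of_sq_le_sq' ?_ (by positivity) |>.2
  rw [mul_pow, Real.sq_sqrt (by positivity), ← Real.rpow_natCast (‖z - w‖ ^ _), ← Real.rpow_mul rp.le]
  norm_num at h7 ⊢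
  exact h7

theorem inv_lb (ρ0 : 0 < ρ) {a v : ℂ} (hv : ‖v‖ ≤ ρ⁻¹) : 1 - ‖a‖/ρ ≤ ‖1 - v * (starRingEnd ℂ) a‖ := by
  have h1 := norm_sub_norm_le 1 (v * (starRingEnd ℂ) a)
  rw [norm_mul, RCLike.norm_conj, norm_one] at h1
  have := mul_le_mul_of_nonneg_right hv (norm_nonneg a)
  rw [div_eq_inv_mul]; linarith

theorem nice_k (g : Geo D lam N σ V c M J ee al) (d : Dat D N σ al φ q F Q c C ρ) (ρ0 : 0 < ρ) (ρ1 : ρ < 1) {a : ℂ} (ha : ‖a‖ < ρ) :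
    Nice D N σ c J ee al (fun z => (1 - φ z * (starRingEnd ℂ) a)⁻¹) (fun j ζ => (1 - F j ζ * (starRingEnd ℂ) a)⁻¹) 0 := by
  have h0 : 0 < 1 - ‖a‖/ρ := by rw [sub_pos, div_lt_one ρ0]; exact ha
  have k1 : ∀ {v : ℂ}, ‖v‖ ≤ ρ⁻¹ → 1 - v * (starRingEnd ℂ) a ≠ 0 ∧ ‖(1 - v * (starRingEnd ℂ) a)⁻¹‖ ≤ (1 - ‖a‖/ρ)⁻¹ := fun {v} hv => by
    have := inv_lb ρ0 (a := a) hv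
    refine ⟨norm_pos_iff.1 (h0.trans_le this), ?_⟩
    rw [norm_inv]; exact inv_anti₀ h0 this
  have k2 : ∀ z ∈ D.G, ‖φ z‖ ≤ ρ⁻¹ := fun z hz => (d.cm.lt hz).le.trans ((one_le_inv₀ ρ0).2 ρ1.le)
  refine ⟨?_, fun j hj => ?_, fun j hj ζ hz => by beta_reduce; rw [(d.rf j hj).eq ζ hz], fun j hj => ?_, fun j hj => ?_, fun w hw δ hδ => ?_⟩
  · exact ((differentiableOn_const 1).sub (d.cm.d.mul_const _)).inv fun z hz => (k1 (k2 z hz)).1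
  · exact ((differentiableOn_const 1).sub ((d.rf j hj).d.mul_const _)).inv fun z hz => (k1 ((d.rf j hj).hi z hz)).1
  · exact Bd.of _ (eventually_mem_nhdsWithin.mono fun z hz => (k1 ((d.rf j hj).hi z hz)).2)
  · exact Bd.of _ (eventually_mem_nhdsWithin.mono fun z hz => (k1 ((d.rf j hj).hi z hz)).2)
  · exact Bd.of _ ((eventually_mem_nhdsWithin.filter_mono ((g.cor w hw).1.ev hδ)).mono fun z hz => (k1 (k2 z hz)).2)

theorem Geo.dσ (g : Geo D lam N σ V c M J ee al) {j : ℕ} (hj : j < N) : DifferentiableOn ℂ (σ j) (Nset c) ∧ ContinuousAt (σ j) 0 ∧ ContinuousAt (σ j) 1 :=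
  have L := (g.lens j hj)
  ⟨L.arc.diff.mono L.sub, (L.arc.hasDeriv L.arc.zero).continuousAt, (L.arc.hasDeriv L.arc.one).continuousAt⟩

theorem nice_P (g : Geo D lam N σ V c M J ee al) (P : Polynomial ℂ) : Nice D N σ c J ee al (fun z => P.eval z) (fun j ζ => P.eval (σ j ζ)) 0 :=
  ⟨P.differentiable.differentiableOn, fun j hj => P.differentiable.comp_differentiableOn (g.dσ hj).1, fun j hj ζ hz => rfl,
    fun j hj => Bd.cont (P.continuous.continuousAt.comp (g.dσ hj).2.1), fun j hj => Bd.cont (P.continuous.continuousAt.comp (g.dσ hj).2.2), fun w hw δ hδ => Bd.cont P.continuous.continuousAt⟩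

theorem Dat.ne (g : Geo D lam N σ V c M J ee al) (d : Dat D N σ al φ q F Q c C ρ) {t : ℂ} (ht : t ∈ D.G) (h : ‖φ t‖ < ρ) {j : ℕ} (hj : j < N) {ζ : ℂ} (hz : ζ ∈ Nset c) : σ j ζ - t ≠ 0 := sub_ne_zero.2 fun e => by
  have L := g.lens j hj
  rcases lt_trichotomy ζ.im 0 with h1 | h1 | h1
  · exact L.lo ζ hz h1 (e ▸ subset_closure ht)
  · have hr := Nset_re g.c0 hz
    have := L.nG (x := ζ.re) ⟨hr.1.le, hr.2.le⟩
    rw [show ((ζ.re : ℝ) : ℂ) = ζ from Complex.ext (by simp) (by simp [h1]), e] at this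
    exact this ht
  · have := (d.rf j hj).lo ζ hz
    rw [(d.rf j hj).eq ζ ⟨hz, h1⟩, e] at this
    linarith

theorem ev_ne {w t : ℂ} (h : w ≠ t) {S : Set ℂ} : Bd (fun z => (z - t)⁻¹) S w 0 :=
  Bd.cont (ContinuousAt.inv₀ (by fun_prop) (sub_ne_zero.2 h))

theorem nice_D (g : Geo D lam N σ V c M J ee al) (d : Dat D N σ al φ q F Q c C ρ) (ρ1 : ρ < 1) {t : ℂ} (ht : t ∈ D.G) (h : ‖φ t‖ < ρ) :
    Nice D N σ c J ee al (fun z => (dslope φ t z)⁻¹) (fun j ζ => (σ j ζ - t) * (F j ζ - φ t)⁻¹) 0 := by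
  have k1 : ∀ {v : ℂ}, ρ ≤ ‖v‖ → v - φ t ≠ 0 ∧ ‖(v - φ t)⁻¹‖ ≤ (ρ - ‖φ t‖)⁻¹ := fun {v} hv => by
    have := norm_sub_norm_le v (φ t)
    refine ⟨norm_pos_iff.1 (by linarith), ?_⟩
    rw [norm_inv]; exact inv_anti₀ (by linarith) (by linarith)
  have e1 : ∀ {z}, z ≠ t → (dslope φ t z)⁻¹ = (z - t) * (φ z - φ t)⁻¹ := fun {z} hz => by
    rw [dslope_of_ne _ hz, slope_def_field, inv_div, div_eq_mul_inv]
  refine ⟨((Complex.differentiableOn_dslope (D.isOpen.mem_nhds ht)).2 d.cm.d).inv fun z hz => ?_, fun j hj => ?_, fun j hj ζ hz => ?_, fun j hj => ?_, fun j hj => ?_, fun w hw δ hδ => ?_⟩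
  · by_cases e : z = t
    · subst e; rw [dslope_same]; exact inj_deriv_ne D.isOpen d.cm.d d.cm.b.injOn hz
    · rw [dslope_of_ne _ e, slope_def_field]
      exact div_ne_zero (sub_ne_zero.2 fun h => e (d.cm.b.injOn hz ht h)) (sub_ne_zero.2 e)
  · exact ((g.dσ hj).1.sub_const t).mul (((d.rf j hj).d.sub_const _).inv fun z hz => (k1 ((d.rf j hj).lo z hz)).1)
  · beta_reduce
    rw [e1 (sub_ne_zero.1 (d.ne g ht h hj hz.1)), (d.rf j hj).eq ζ hz]
  · simpa using (Bd.cont (f := fun ζ => σ j ζ - t) (w := 0) ((g.dσ hj).2.1.sub continuousAt_const)).mul (nN0 g.c0) (Bd.of _ (eventually_mem_nhdsWithin.mono fun z hz => (k1 ((d.rf j hj).lo z hz)).2))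
  · simpa using (Bd.cont (f := fun ζ => σ j ζ - t) (w := 1) ((g.dσ hj).2.2.sub continuousAt_const)).mul (nN1 g.c0) (Bd.of _ (eventually_mem_nhdsWithin.mono fun z hz => (k1 ((d.rf j hj).lo z hz)).2))
  · have hC := (g.cor w hw).1
    have h1 := (Bd.cont (S := Sec w (ee w) (al w * Real.pi / 2 - δ) 0 1) (f := fun z => z - t) (w := w) (by fun_prop)).mul (nSec hC.ne) (Bd.of (f := fun z => (φ z - φ t)⁻¹) _ (((d.cm.bd hC.nG ρ1).filter_mono (hC.ev hδ)).mono fun z hz => (k1 hz.le).2))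
    rw [add_zero] at h1
    refine h1.congr ?_
    filter_upwards [nhdsWithin_le_nhds (isOpen_ne.mem_nhds (show w ≠ t from fun e => hC.nG (e ▸ ht)))] with z hz using (e1 hz).symm

theorem nice_dsl (g : Geo D lam N σ V c M J ee al) (d : Dat D N σ al φ q F Q c C ρ) {t : ℂ} (ht : t ∈ D.G) (h : ‖φ t‖ < ρ) {u uj}
    (hu : Nice D N σ c J ee al u uj (-(1/2))) :
    Nice D N σ c J ee al (dslope u t) (fun j ζ => (uj j ζ - u t) * (σ j ζ - t)⁻¹) (-(1/2)) := by
  have e1 : ∀ {z}, z ≠ t → dslope u t z = (u z - u t) * (z - t)⁻¹ := fun {z} hz => by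
    rw [dslope_of_ne _ hz, slope_def_field, div_eq_mul_inv]
  have k : ∀ {f S w}, w ∉ S → Bd f S w (-(1/2)) → Bd (fun z => f z - u t) S w (-(1/2)) := fun {f S w} hw hf =>
    Asymptotics.IsBigO.sub hf ((Bd.cont (f := fun _ => u t) continuousAt_const).weak hw (by norm_num))
  have hne : ∀ j < N, σ j 0 ≠ t ∧ σ j 1 ≠ t := fun j hj => ⟨fun e => (g.cor _ (g.J0 j hj)).1.nG (e ▸ ht), fun e => (g.cor _ (g.J1 j hj)).1.nG (e ▸ ht)⟩
  refine ⟨(Complex.differentiableOn_dslope (D.isOpen.mem_nhds ht)).2 hu.d, fun j hj => ?_, fun j hj ζ hz => ?_, fun j hj => ?_, fun j hj => ?_, fun w hw δ hδ => ?_⟩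
  · exact ((hu.dj j hj).sub_const _).mul (((g.dσ hj).1.sub_const t).inv fun z hz => d.ne g ht h hj hz)
  · beta_reduce
    rw [e1 (sub_ne_zero.1 (d.ne g ht h hj hz.1)), hu.eq j hj ζ hz]
  · have := (k (nN0 g.c0) (hu.b0 j hj)).mul (nN0 g.c0) (Bd.cont (f := fun ζ => (σ j ζ - t)⁻¹) (((g.dσ hj).2.1.sub continuousAt_const).inv₀ (sub_ne_zero.2 (hne j hj).1)))
    rwa [add_zero] at this
  · have := (k (nN1 g.c0) (hu.b1 j hj)).mul (nN1 g.c0) (Bd.cont (f := fun ζ => (σ j ζ - t)⁻¹) (((g.dσ hj).2.2.sub continuousAt_const).inv₀ (sub_ne_zero.2 (hne j hj).2)))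
    rwa [add_zero] at this
  · have hC := (g.cor w hw).1
    have hwt : w ≠ t := fun e => hC.nG (e ▸ ht)
    have := (k (nSec hC.ne) (hu.bs w hw δ hδ)).mul (nSec hC.ne) (ev_ne hwt)
    rw [add_zero] at this
    refine this.congr ?_
    filter_upwards [nhdsWithin_le_nhds (isOpen_ne.mem_nhds hwt)] with z hz using (e1 hz).symm
end

section
variable {D : JordanDomain} {lam : ℝ} {N : ℕ} {σ : ℕ → ℂ → ℂ} {V : ℕ → Set ℂ} {c M : ℝ} {J : Set ℂ} {ee : ℂ → ℂ} {al : ℂ → ℝ} {φ q : ℂ → ℂ} {F Q : ℕ → ℂ → ℂ} {C ρ : ℝ}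

theorem re_pos {v a : ℂ} (hv : ‖v‖ = 1) (ha : ‖a‖ < 1) : 0 < (v * (v - a)⁻¹).re := by
  have v0 : v ≠ 0 := norm_pos_iff.1 (by rw [hv]; exact one_pos)
  have e : v * (v - a)⁻¹ = (1 - a / v)⁻¹ := by
    rw [one_sub_div v0, inv_div, div_eq_mul_inv]
  have h1 := re_le_norm (a / v)
  rw [norm_div, hv, div_one] at h1
  have h2 : 0 < (1 - a / v).re := by rw [sub_re, one_re]; linarith
  rw [e, inv_re]
  exact div_pos h2 (normSq_pos.2 fun h => by rw [h] at h2; simp at h2)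

theorem inv_path (g : Geo D lam N σ V c M J ee al) (d : Dat D N σ al φ q F Q c C ρ) {t : ℂ} (ht : t ∈ D.G) (h : ‖φ t‖ < ρ) {j : ℕ} (hj : j < N) :
    (∀ c', |c'| ≤ c/4 → IntervalIntegrable (fun x => (σ j (zp c' x) - t)⁻¹ * deriv (σ j) (zp c' x) * zd c' x) volume 0 1) ∧
    ∃ v, ∀ c', |c'| ≤ c/4 → ∫ x in (0:ℝ)..1, (σ j (zp c' x) - t)⁻¹ * deriv (σ j) (zp c' x) * zd c' x = v := by
  have L := g.lens j hj
  have hne : σ j 0 ≠ t ∧ σ j 1 ≠ t := ⟨fun e => (g.cor _ (g.J0 j hj)).1.nG (e ▸ ht), fun e => (g.cor _ (g.J1 j hj)).1.nG (e ▸ ht)⟩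
  refine arc_path g.c0 g.c2 (g := fun ζ => (σ j ζ - t)⁻¹ * deriv (σ j) ζ) ((((g.dσ hj).1.sub_const t).inv fun z hz => d.ne g ht h hj hz).mul ((L.arc.diff.deriv L.arc.op).mono L.sub)) ?_ ?_
  · have : Bd (fun ζ => (σ j ζ - t)⁻¹ * deriv (σ j) ζ) (Nset c) 0 (-(1/2)) := (Bd.cont (ContinuousAt.mul (((g.dσ hj).2.1.sub continuousAt_const).inv₀ (sub_ne_zero.2 hne.1))
      (L.arc.contDeriv.continuousAt (L.arc.op.mem_nhds L.arc.zero)))).weak (nN0 g.c0) (by norm_num)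
    simpa [Bd] using this
  · exact (Bd.cont (ContinuousAt.mul (((g.dσ hj).2.2.sub continuousAt_const).inv₀ (sub_ne_zero.2 hne.2))
      (L.arc.contDeriv.continuousAt (L.arc.op.mem_nhds L.arc.one)))).weak (nN1 g.c0) (by norm_num)

noncomputable def Iv (N : ℕ) (σ : ℕ → ℂ → ℂ) (t : ℂ) : ℂ := ∑ j ∈ Finset.range N, ∫ x in (0:ℝ)..1, deriv (σ j) x / (t - σ j x)

theorem cau1 (g : Geo D lam N σ V c M J ee al) (d : Dat D N σ al φ q F Q c C ρ) {t : ℂ} (ht : t ∈ D.G) (h : ‖φ t‖ < ρ) {u uj} (hu : Nice D N σ c J ee al u uj (-(1/2))) {c' : ℝ} (hc : |c'| ≤ c/4) :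
    (∀ j < N, IntervalIntegrable (fun x => uj j (zp c' x) * (σ j (zp c' x) - t)⁻¹ * deriv (σ j) (zp c' x) * zd c' x) volume 0 1) ∧
    ∑ j ∈ Finset.range N, ∫ x in (0:ℝ)..1, uj j (zp c' x) * (σ j (zp c' x) - t)⁻¹ * deriv (σ j) (zp c' x) * zd c' x = - (u t * Iv N σ t) := by
  obtain ⟨h1, h2⟩ := CT g d.cm (nice_dsl g d ht h hu)
  have e : ∀ j < N, ∀ x : ℝ, uj j (zp c' x) * (σ j (zp c' x) - t)⁻¹ * deriv (σ j) (zp c' x) * zd c' x = (uj j (zp c' x) - u t) * (σ j (zp c' x) - t)⁻¹ * deriv (σ j) (zp c' x) * zd c' x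
      + u t * ((σ j (zp c' x) - t)⁻¹ * deriv (σ j) (zp c' x) * zd c' x) := fun j hj x => by ring
  have i2 := fun j hj => ((inv_path g d ht h (j := j) hj).1 c' hc).const_mul (u t)
  refine ⟨fun j hj => ((h1 c' hc j hj).add (i2 j hj)).congr fun x _ => (e j hj x).symm, ?_⟩
  have h3 := h2 c' hc
  rw [Finset.sum_congr rfl fun j hj => ?_]
  rotate_left
  · exact fun j => (∫ x in (0:ℝ)..1, (uj j (zp c' x) - u t) * (σ j (zp c' x) - t)⁻¹ * deriv (σ j) (zp c' x) * zd c' x) - u t * ∫ x in (0:ℝ)..1, deriv (σ j) x / (t - σ j x)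
  · have hj' := Finset.mem_range.1 hj
    rw [intervalIntegral.integral_congr fun x _ => e j hj' x, intervalIntegral.integral_add (h1 c' hc j hj') (i2 j hj'), intervalIntegral.integral_const_mul, sub_eq_add_neg, ← mul_neg, ← intervalIntegral.integral_neg]
    congr 2
    obtain ⟨v, hv⟩ := (inv_path g d ht h hj').2
    rw [hv c' hc, ← hv 0 (by rw [abs_zero]; linarith [g.c0])]
    refine intervalIntegral.integral_congr fun x _ => ?_
    simp only [zp_c0, zd_c0, mul_one]
    rw [← neg_sub t, inv_neg]; ring
  · rw [Finset.sum_sub_distrib, h3, Iv, Finset.mul_sum, zero_sub]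

theorem Iv_const (g : Geo D lam N σ V c M J ee al) : ∃ I0, ∀ t ∈ D.G, Iv N σ t = I0 := by
  have hd : ∀ t ∈ D.G, HasDerivAt (Iv N σ) 0 t := fun t ht => by
    have key : ∀ j ∈ Finset.range N, HasDerivAt (fun t => ∫ x in (0:ℝ)..1, deriv (σ j) x / (t - σ j x)) (-((t - σ j 1)⁻¹ - (t - σ j 0)⁻¹)) t := fun j hj => by
      have hj := Finset.mem_range.1 hj
      have L := g.lens j hj
      obtain ⟨d0, d1, hd⟩ : ∃ d > 0, ∀ s ∈ Icc (0:ℝ) 1, d ≤ ‖t - σ j s‖ := by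
        obtain ⟨d0, d1, h⟩ := Metric.isOpen_iff.1 D.isOpen t ht
        refine ⟨d0, d1, fun s hs => ?_⟩
        by_contra hh
        push Not at hh
        exact L.nG hs (h (by rwa [mem_ball', dist_eq_norm]))
      have hsub : uIoc (0:ℝ) 1 ⊆ Icc 0 1 := by rw [uIoc_of_le zero_le_one]; exact Ioc_subset_Icc_self
      have cR : ContinuousOn (fun x : ℝ => σ j x) (Icc 0 1) := L.arc.contR
      have dR : ContinuousOn (fun x : ℝ => deriv (σ j) x) (Icc 0 1) := L.arc.contDeriv.comp (by fun_prop) fun x hx => L.arc.seg x hx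
      refine (par_diff (p := fun x : ℝ => deriv (σ j) x) (g := fun x : ℝ => σ j x) (a := 0) (b := 1) (by rw [← uIcc_of_le (zero_le_one' ℝ)] at dR; exact dR.intervalIntegrable) (cR.mono hsub) d1 fun s hs => hd s (hsub hs)).congr_deriv ?_
      have hne : ∀ s ∈ Icc (0:ℝ) 1, t - σ j s ≠ 0 := fun s hs => norm_pos_iff.1 (d1.trans_le (hd s hs))
      have : ∫ x in (0:ℝ)..1, -deriv (σ j) x / (t - σ j x) ^ 2 = -(t - σ j (1:ℝ))⁻¹ - -(t - σ j (0:ℝ))⁻¹ :=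
        intervalIntegral.integral_eq_sub_of_hasDerivAt (f := fun x : ℝ => -(t - σ j x)⁻¹) (fun x hx => by
          rw [uIcc_of_le zero_le_one] at hx
          have h1 := ((L.arc.hasDerivR hx).const_sub t).fun_inv (hne x hx)
          exact h1.neg.congr_deriv (by ring))
          (by
            rw [← uIcc_of_le (zero_le_one' ℝ)] at dR cR hne
            exact (dR.neg.div ((continuousOn_const.sub cR).pow 2) fun x hx => pow_ne_zero 2 (hne x hx)).intervalIntegrable)
      rw [this]; push_cast; ring
    have h1 := HasDerivAt.fun_sum key
    refine h1.congr_deriv ?_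
    rw [Finset.sum_neg_distrib, g.tele fun w => (t - w)⁻¹, neg_zero]
  obtain ⟨t0, h0⟩ := D.nonempty
  exact ⟨Iv N σ t0, fun t ht => D.isOpen.is_const_of_deriv_eq_zero D.connected.isPreconnected (fun t ht => (hd t ht).differentiableAt.differentiableWithinAt) (fun t ht => (hd t ht).deriv) ht h0⟩

theorem Iv_ne (g : Geo D lam N σ V c M J ee al) (d : Dat D N σ al φ q F Q c C ρ) (ρ0 : 0 < ρ) (ρ1 : ρ < 1) {t : ℂ} (ht : t ∈ D.G) (h : ‖φ t‖ < ρ) : Iv N σ t ≠ 0 := by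
  have hq := nice_q g d
  have hu := ((hq.mul g hq).mul g (nice_D g d ρ1 ht h)).weak g (t := -(1/2)) (by norm_num)
  obtain ⟨hi, he⟩ := cau1 g d ht h hu (c' := 0) (by rw [abs_zero]; linarith [g.c0])
  have hut : q t * q t * (dslope φ t t)⁻¹ = 1 := by
    rw [dslope_same, ← pow_two, d.q2 t ht, mul_inv_cancel₀ (inj_deriv_ne D.isOpen d.cm.d d.cm.b.injOn ht)]
  rw [hut, one_mul] at he
  intro h0
  rw [h0, neg_zero] at he
  have pos : ∀ j ∈ Finset.range N, 0 < (∫ x in (0:ℝ)..1, Q j (zp 0 x) * Q j (zp 0 x) * ((σ j (zp 0 x) - t) * (F j (zp 0 x) - φ t)⁻¹) * (σ j (zp 0 x) - t)⁻¹ * deriv (σ j) (zp 0 x) * zd 0 x).im := fun j hj => by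
    have hj := Finset.mem_range.1 hj
    have e : ∀ f : ℝ → ℂ, IntervalIntegrable f volume 0 1 → (∫ x in (0:ℝ)..1, f x).im = ∫ x in (0:ℝ)..1, (f x).im := fun f hf => (Complex.imCLM.intervalIntegral_comp_comm hf).symm
    rw [e _ (hi j hj)]
    have hi2 : IntervalIntegrable (fun x => (Q j (zp 0 x) * Q j (zp 0 x) * ((σ j (zp 0 x) - t) * (F j (zp 0 x) - φ t)⁻¹) * (σ j (zp 0 x) - t)⁻¹ * deriv (σ j) (zp 0 x) * zd 0 x).im) volume 0 1 :=
      ⟨Complex.imCLM.integrable_comp (hi j hj).1, Complex.imCLM.integrable_comp (hi j hj).2⟩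
    refine intervalIntegral.intervalIntegral_pos_of_pos_on hi2 (fun x hx => ?_) zero_lt_one
    have hz := (Nset_real g.c0).2 hx
    have R := d.rf j hj
    have L := g.lens j hj
    have hF : F j x - φ t ≠ 0 := sub_ne_zero.2 fun e => by have := R.lo x hz; rw [e] at this; linarith
    have hσ := d.ne g ht h hj hz
    have e1 : Q j x * Q j x * ((σ j x - t) * (F j x - φ t)⁻¹) * (σ j x - t)⁻¹ * deriv (σ j) x * 1 = I * (‖deriv (F j) x‖ * (F j x * (F j x - φ t)⁻¹)) := by
      rw [← pow_two, d.Q2 j hj _ hz]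
      have := L.arc.deriv_ne (L.sub hz)
      have e2 := R.tan x hx
      field_simp
      linear_combination e2
    beta_reduce
    rw [zp_c0, zd_c0, e1]
    have := re_pos (R.one x hx) (h.trans ρ1)
    have h3 := norm_pos_iff.2 (R.ne x hz)
    rw [I_mul_im, re_ofReal_mul]
    positivity
  have := congrArg Complex.im he
  rw [Complex.im_sum] at this
  have h2 := Finset.sum_pos pos ⟨0, Finset.mem_range.2 g.N0⟩
  rw [this] at h2
  exact lt_irrefl _ h2
end

section
variable {D : JordanDomain} {lam : ℝ} {N : ℕ} {σ : ℕ → ℂ → ℂ} {V : ℕ → Set ℂ} {c M : ℝ} {J : Set ℂ} {ee : ℂ → ℂ} {al : ℂ → ℝ} {φ q : ℂ → ℂ} {F Q : ℕ → ℂ → ℂ} {C ρ : ℝ}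

theorem zpI (g : Geo D lam N σ V c M J ee al) {j : ℕ} (hj : j < N) : (∀ x ∈ Icc (0:ℝ) 1, zp (c/4) x ∈ V j) ∧ ContinuousOn (fun x => σ j (zp (c/4) x)) (Icc 0 1) ∧ ∀ x ∈ Ioo (0:ℝ) 1, σ j (zp (c/4) x) ∈ (closure D.G)ᶜ := by
  have L := g.lens j hj
  have c0 := g.c0
  have hm : ∀ x ∈ Ioo (0:ℝ) 1, zp (c/4) x ∈ Nset c := fun x hx => zp_mem (by rw [abs_of_pos (by linarith)]; linarith) hx.1 hx.2
  have h1 : ∀ x ∈ Icc (0:ℝ) 1, zp (c/4) x ∈ V j := fun x hx => by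
    rcases hx.1.eq_or_lt with rfl | h0
    · rw [zp_zero]; exact L.arc.zero
    rcases hx.2.eq_or_lt with rfl | h1
    · rw [zp_one]; exact L.arc.one
    exact L.sub (hm x ⟨h0, h1⟩)
  refine ⟨h1, L.arc.diff.continuousOn.comp (zp_cont _).continuousOn h1, fun x hx => L.lo _ (hm x hx) ?_⟩
  rw [zp_im]
  have := mul_pos (mul_pos (show 0 < c/4 by linarith) hx.1) (sub_pos.2 hx.2)
  linarith

theorem out_dist (g : Geo D lam N σ V c M J ee al) {w : ℂ} (hw : w ∈ closure D.G) (hJ : w ∉ J) {j : ℕ} (hj : j < N) : ∃ d0 > 0, ∀ x ∈ Icc (0:ℝ) 1, d0 ≤ ‖w - σ j (zp (c/4) x)‖ := by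
  obtain ⟨-, h2, h3⟩ := zpI g hj
  obtain ⟨x, hx, hm⟩ := isCompact_Icc.exists_isMinOn (nonempty_Icc.2 zero_le_one) (continuousOn_const (c := w) |>.sub h2).norm
  refine ⟨_, norm_pos_iff.2 (sub_ne_zero.2 fun e => ?_), fun y hy => hm hy⟩
  beta_reduce at e
  rcases hx.1.eq_or_lt with rfl | h0
  · rw [zp_zero] at e; exact hJ (e ▸ g.J0 j hj)
  rcases hx.2.eq_or_lt with rfl | h1
  · rw [zp_one] at e; exact hJ (e ▸ g.J1 j hj)
  exact h3 x ⟨h0, h1⟩ (e ▸ hw)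

theorem hrep (g : Geo D lam N σ V c M J ee al) (d : Dat D N σ al φ q F Q c C ρ) (ρ0 : 0 < ρ) {I0 : ℂ} (hI : ∀ t ∈ D.G, Iv N σ t = I0) {k kj} (hk : Nice D N σ c J ee al k kj (-(1/2)))
    {i : ℕ} (hi : i < N) {x0 : ℝ} (hx0 : x0 ∈ Ioo (0:ℝ) 1) :
    ∑ j ∈ Finset.range N, ∫ x in (0:ℝ)..1, kj j (zp (c/4) x) * deriv (σ j) (zp (c/4) x) * zd (c/4) x / (σ i x0 - σ j (zp (c/4) x)) = kj i x0 * I0 := by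
  have c0 := g.c0
  have hc4 : |c/4| ≤ c/4 := by rw [abs_of_pos (by linarith)]
  set H : ℂ → ℂ := fun w => ∑ j ∈ Finset.range N, ∫ x in (0:ℝ)..1, kj j (zp (c/4) x) * deriv (σ j) (zp (c/4) x) * zd (c/4) x / (w - σ j (zp (c/4) x)) with hH
  have hsub : uIoc (0:ℝ) 1 ⊆ Icc 0 1 := by rw [uIoc_of_le zero_le_one]; exact Ioc_subset_Icc_self
  have hd : ∀ w ∈ closure D.G, w ∉ J → DifferentiableAt ℂ H w := fun w hw hJ => by
    refine DifferentiableAt.fun_sum fun j hj => ?_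
    have hj := Finset.mem_range.1 hj
    obtain ⟨d0, d1, h⟩ := out_dist g hw hJ hj
    exact (par_diff ((CT g d.cm hk).1 _ hc4 j hj) ((zpI g hj).2.1.mono hsub) d1 fun s hs => h s (hsub hs)).differentiableAt
  have hJG : ∀ w ∈ D.G, w ∉ J := fun w hw hJ => (g.cor w hJ).1.nG hw
  have h1 : ∀ t ∈ D.G, ‖φ t‖ < ρ → H t = k t * I0 := fun t ht h => by
    have := (cau1 g d ht h hk hc4).2
    rw [hI t ht] at this
    rw [← neg_neg (k t * I0), ← this, ← Finset.sum_neg_distrib]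
    refine Finset.sum_congr rfl fun j hj => ?_
    rw [← intervalIntegral.integral_neg]
    refine intervalIntegral.integral_congr fun x _ => ?_
    beta_reduce
    rw [div_eq_mul_inv, ← neg_sub, inv_neg]; ring
  obtain ⟨t0, ht0, hφ0⟩ := d.cm.b.surjOn (mem_ball_self one_pos)
  have hE : EqOn H (fun t => k t * I0) D.G := by
    refine AnalyticOnNhd.eqOn_of_preconnected_of_eventuallyEq (z₀ := t0) (DifferentiableOn.analyticOnNhd (fun w hw => (hd w (subset_closure hw) (hJG w hw)).differentiableWithinAt) D.isOpen)
      (DifferentiableOn.analyticOnNhd (hk.d.mul_const I0) D.isOpen) D.connected.isPreconnected ht0 ?_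
    have : ContinuousAt φ t0 := (d.cm.d.differentiableAt (D.isOpen.mem_nhds ht0)).continuousAt
    filter_upwards [D.isOpen.mem_nhds ht0, this.norm.eventually_lt_const (u := ρ) (by beta_reduce; rw [hφ0, norm_zero]; exact ρ0)] with t h2 h3 using h1 t h2 h3
  have L := g.lens i hi
  have hz := (Nset_real c0).2 hx0
  have hcl : σ i x0 ∈ closure D.G := (L.re x0 ⟨hx0.1.le, hx0.2.le⟩).1
  have l1 : Tendsto (fun ζ => H (σ i ζ)) (nhdsWithin (x0:ℂ) (NU c)) (nhds (H (σ i x0))) :=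
    ((hd _ hcl (g.nJ i hi x0 hx0)).continuousAt.tendsto.comp (L.arc.hasDeriv (L.sub hz)).continuousAt.tendsto).mono_left nhdsWithin_le_nhds
  have l2 : Tendsto (fun ζ => kj i ζ * I0) (nhdsWithin (x0:ℂ) (NU c)) (nhds (kj i x0 * I0)) :=
    ((((hk.dj i hi).differentiableAt ((Nset_open c).mem_nhds hz)).continuousAt.mul continuousAt_const).tendsto).mono_left nhdsWithin_le_nhds
  have l3 : Tendsto (fun y : ℝ => (x0:ℂ) + y * I) (nhdsWithin 0 (Ioi 0)) (nhdsWithin (x0:ℂ) (NU c)) := by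
    have hc : Continuous (fun y : ℝ => (x0:ℂ) + y * I) := by fun_prop
    have ht : Tendsto (fun y : ℝ => (x0:ℂ) + y * I) (nhdsWithin 0 (Ioi 0)) (nhds (x0:ℂ)) := by simpa using (hc.tendsto 0).mono_left (nhdsWithin_le_nhds (s := Ioi 0))
    refine tendsto_nhdsWithin_iff.2 ⟨ht, ?_⟩
    filter_upwards [self_mem_nhdsWithin, ht.eventually ((Nset_open c).mem_nhds hz)] with y hy h2
    exact ⟨h2, by simpa using hy⟩
  haveI : NeBot (nhdsWithin (x0:ℂ) (NU c)) := l3.neBot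
  refine tendsto_nhds_unique (l1.congr' ?_) l2
  filter_upwards [self_mem_nhdsWithin] with ζ hζ
  rw [hE (L.up ζ hζ.1 hζ.2), hk.eq i hi ζ hζ]
end

theorem Dat.mono {D : JordanDomain} {N : ℕ} {σ : ℕ → ℂ → ℂ} {al : ℂ → ℝ} {φ q : ℂ → ℂ} {F Q : ℕ → ℂ → ℂ} {c C ρ c' : ℝ} (d : Dat D N σ al φ q F Q c C ρ) (h0 : 0 < c') (h : c' ≤ c) : Dat D N σ al φ q F Q c' C ρ := by
  have m := Nset_mono h0 h
  have m2 : NU c' ⊆ NU c := fun z hz => ⟨m hz.1, hz.2⟩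
  refine ⟨d.cm, d.C0, d.qd, d.q2, fun j hj => ?_, fun j hj => (d.Qd j hj).mono m, fun j hj ζ hz => d.Q2 j hj ζ (m hz), fun j hj ζ hz => d.Qe j hj ζ (m2 hz), fun j hj ζ hz => d.Qb j hj ζ (m hz)⟩
  have r := d.rf j hj
  exact ⟨h0, h.trans r.c2, r.C0, r.d.mono m, fun z hz => r.eq z (m2 hz), fun z hz => r.lo z (m hz), fun z hz => r.hi z (m hz), fun z hz => r.le z (m hz), fun z hz => r.ne z (m hz), r.one, r.tan⟩

section
variable {D : JordanDomain} {lam : ℝ} {N : ℕ} {σ : ℕ → ℂ → ℂ} {V : ℕ → Set ℂ} {c M : ℝ} {J : Set ℂ} {ee : ℂ → ℂ} {al : ℂ → ℝ} {φ q : ℂ → ℂ} {F Q : ℕ → ℂ → ℂ} {C ρ : ℝ}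

theorem end_est (g : Geo D lam N σ V c M J ee al) {τ : ℂ → ℂ} {w0 e : ℂ} {α s d : ℝ} (hs : s = 1 ∨ s = -1) (hE : EndAt τ w0 e α s M M⁻¹) (hC : Corner D.G w0 e α M M⁻¹)
    (hA : Sec w0 (-e) (Real.pi - α * Real.pi / 2) M M⁻¹ ⊆ RA D) (c0 : 0 < d) (c2 : d ≤ 1/2) (hc : 3/2 * d ≤ Real.pi - α * Real.pi / 2) :
    ∃ ε > 0, ∃ C > 0, ∃ κ > 0, ∀ x, 0 < x → x < ε → κ * x ≤ infDist (τ (zp (s*d) x)) (frontier D.G) ∧ ∀ (n : ℕ) P, 1 ≤ n → Orth D P n →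
      ‖Cau D P (τ (zp (s*d) x))‖ ≤ C * x ^ (-(1/2) : ℝ) * Real.exp (-(κ * n * x ^ (1/(2-α)))) := by
  have M1 := hC.C1
  have M0 : 0 < M := by linarith
  have h0 : 0 < Real.pi - α * Real.pi / 2 := by linarith
  have hπ : Real.pi - α * Real.pi / 2 < Real.pi := by have := mul_pos hC.a0 Real.pi_pos; linarith
  have hα : 0 < 2 - α := by linarith [hC.a2]
  have ha : 1/(2-α) * (Real.pi - α * Real.pi / 2) = Real.pi / 2 := by field_simp
  have he : ‖-e‖ = 1 := by rw [norm_neg, hC.ne]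
  obtain ⟨κ1, hκ1, r1, hr1, -, -, hb⟩ := sec_ball (w0 := w0) he hπ (show 0 < d/8 by linarith) (by linarith) M1 hC.r0
  obtain ⟨C, C0, κ2, hκ2, r2, hr2, hK⟩ := g.Cau_corner he h0 hπ ha M1 hC.r0 (show 0 < d/8 by linarith) (by linarith) hA
  have ev := EndAt.out hs M1 hE c0 c2 hc (lt_min hr1 hr2)
  obtain ⟨ε, ε0, hε⟩ := mem_nhdsGT_iff_exists_Ioo_subset.1 (ev.and (Ioo_mem_nhdsGT (show (0:ℝ) < min (M⁻¹/2) 1 by positivity)))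
  refine ⟨ε, ε0, C * (M⁻¹) ^ (-(1/2) : ℝ), by positivity, min (κ1 * M⁻¹) (κ2 * (M⁻¹) ^ (1/(2-α))), by positivity, fun x x0 hx => ?_⟩
  obtain ⟨h1, h2⟩ := hε ⟨x0, hx⟩
  set w := τ (zp (s*d) x)
  have hx1 := h2.2.trans_le (min_le_right _ _)
  have hx2 := h2.2.trans_le (min_le_left _ _)
  have hz := zp_norm (c := s*d) (by rw [abs_mul, abs_of_pos c0]; rcases hs with rfl | rfl <;> norm_num <;> linarith) x0 hx1
  obtain ⟨h3, -⟩ := hE.2.2.2 _ (zp_ne x0) (by linarith)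
  have hw : M⁻¹ * x ≤ ‖w - w0‖ := by rw [inv_mul_le_iff₀ M0]; exact hz.1.trans h3
  have hp : 0 < M⁻¹ * x := by positivity
  constructor
  · refine (le_infDist (fr_ne D)).2 fun y hy => ?_
    by_contra hn
    push Not at hn
    refine (hA (hb w (Sec_mono le_rfl (min_le_left _ _) h1) (mem_ball'.2 (hn.trans_le ?_)))).1 (frontier_subset_closure hy)
    calc _ ≤ κ1 * M⁻¹ * x := by gcongr; exact min_le_left _ _
      _ ≤ _ := by rw [mul_assoc]; gcongr
  · intro n P hn hP
    refine (hK w (Sec_mono le_rfl (min_le_right _ _) h1) n P hn hP).trans ?_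
    refine mul_le_mul ?_ (Real.exp_le_exp.2 (neg_le_neg ?_)) (Real.exp_pos _).le (by positivity)
    · rw [mul_assoc, ← Real.mul_rpow (by positivity) x0.le]
      exact mul_le_mul_of_nonneg_left (Real.rpow_le_rpow_of_nonpos hp hw (by norm_num)) C0.le
    · calc _ ≤ κ2 * (M⁻¹) ^ (1/(2-α)) * n * x ^ (1/(2-α)) := by gcongr; exact min_le_right _ _
        _ = κ2 * n * (M⁻¹ * x) ^ (1/(2-α)) := by rw [Real.mul_rpow (by positivity) x0.le]; ring
        _ ≤ _ := by gcongr
end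

theorem W_int {s a κ : ℝ} (hs : -1 < s) (ha : 0 < a) (hκ : 0 < κ) : ∃ C > 0, ∀ n : ℕ, 1 ≤ n → IntervalIntegrable (fun x : ℝ => x ^ s * Real.exp (-(κ * n * x ^ a))) volume 0 1 ∧
    ∫ x in (0:ℝ)..1, x ^ s * Real.exp (-(κ * n * x ^ a)) ≤ C * (n:ℝ) ^ (-((s+1)/a)) := by
  have G : 0 < Real.Gamma ((s+1)/a) := Real.Gamma_pos_of_pos (div_pos (by linarith) ha)
  refine ⟨κ ^ (-(s+1)/a) * (1/a) * Real.Gamma ((s+1)/a), by positivity, fun n hn => ?_⟩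
  have n0 : (0:ℝ) < n := by exact_mod_cast hn
  have e := integral_rpow_mul_exp_neg_mul_rpow ha hs (mul_pos hκ n0)
  simp only [neg_mul] at e
  have hi : IntegrableOn (fun x : ℝ => x ^ s * Real.exp (-(κ * n * x ^ a))) (Ioi 0) := by
    by_contra h
    rw [integral_undef h] at e
    exact (by positivity : (0:ℝ) < (κ * n) ^ (-(s+1)/a) * (1/a) * Real.Gamma ((s+1)/a)).ne e
  rw [intervalIntegrable_iff_integrableOn_Ioc_of_le zero_le_one, intervalIntegral.integral_of_le zero_le_one]
  refine ⟨hi.mono_set Ioc_subset_Ioi_self, (setIntegral_mono_set hi ?_ Ioc_subset_Ioi_self.eventuallyLE).trans_eq ?_⟩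
  · refine (ae_restrict_iff' measurableSet_Ioi).2 (ae_of_all _ fun x (hx : 0 < x) => ?_)
    simp only [Pi.zero_apply]; positivity
  · rw [e, Real.mul_rpow hκ.le n0.le, neg_div]; ring

section
variable {D : JordanDomain} {lam : ℝ} {N : ℕ} {σ : ℕ → ℂ → ℂ} {V : ℕ → Set ℂ} {c M : ℝ} {J : Set ℂ} {ee : ℂ → ℂ} {al : ℂ → ℝ} {φ q : ℂ → ℂ} {F Q : ℕ → ℂ → ℂ} {C ρ : ℝ}

theorem half_est (g : Geo D lam N σ V c M J ee al) {τ : ℂ → ℂ} {w0 e : ℂ} {α s d : ℝ} (hs : s = 1 ∨ s = -1) (hE : EndAt τ w0 e α s M M⁻¹) (hC : Corner D.G w0 e α M M⁻¹)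
    (hA : Sec w0 (-e) (Real.pi - α * Real.pi / 2) M M⁻¹ ⊆ RA D) (c0 : 0 < d) (c2 : d ≤ 1/2) (hc : 3/2 * d ≤ Real.pi - α * Real.pi / 2)
    (hτ : ContinuousOn (fun x => τ (zp (s*d) x)) (Icc 0 1)) (hR : ∀ x ∈ Ioo (0:ℝ) 1, τ (zp (s*d) x) ∈ RA D) :
    ∃ C > 0, ∃ κ > 0, ∀ x, 0 < x → x ≤ 1/2 → κ * x ≤ infDist (τ (zp (s*d) x)) (frontier D.G) ∧ ∀ (n : ℕ) P, 1 ≤ n → Orth D P n →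
      ‖Cau D P (τ (zp (s*d) x))‖ ≤ C * x ^ (-(1/2) : ℝ) * Real.exp (-(κ * n * x ^ (1/(2-α)))) := by
  obtain ⟨ε, ε0, C, C0, κ, κ0, h⟩ := end_est g hs hE hC hA c0 c2 hc
  have hsub : Icc ε (1/2) ⊆ Ioo (0:ℝ) 1 := fun x hx => ⟨by linarith [hx.1], by linarith [hx.2]⟩
  have hcon := hτ.mono (hsub.trans Ioo_subset_Icc_self)
  obtain ⟨m, m0, hm⟩ := isCompact_Icc.exists_forall_le' (a := 0) ((continuous_infDist_pt (frontier D.G)).comp_continuousOn hcon) fun x hx => d_pos D fun h => (hR x (hsub hx)).1 (frontier_subset_closure h)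
  obtain ⟨C', C0', κ', κ0', h'⟩ := Cau_cpt D (isCompact_Icc.image_of_continuousOn hcon) (by rintro _ ⟨x, hx, rfl⟩; exact hR x (hsub hx))
  refine ⟨max C C', by positivity, min κ (min κ' m), by positivity, fun x x0 hx => ?_⟩
  rcases lt_or_ge x ε with hxe | hxe
  · obtain ⟨h1, h2⟩ := h x x0 hxe
    refine ⟨(mul_le_mul_of_nonneg_right (min_le_left _ _) x0.le).trans h1, fun n P hn hP => (h2 n P hn hP).trans ?_⟩
    gcongr
    exacts [le_max_left _ _, min_le_left _ _]
  · have hx' : x ∈ Icc ε (1/2) := ⟨hxe, hx⟩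
    constructor
    · calc _ ≤ m * 1 := by gcongr; exacts [(min_le_right _ _).trans (min_le_right _ _), by linarith]
        _ ≤ _ := by rw [mul_one]; exact hm x hx'
    · intro n P hn hP
      refine (h' _ ⟨x, hx', rfl⟩ n P hP).trans ?_
      have e1 : 1 ≤ x ^ (-(1/2):ℝ) := Real.one_le_rpow_of_pos_of_le_one_of_nonpos x0 (by linarith) (by norm_num)
      have e2 : x ^ (1/(2-α)) ≤ 1 := Real.rpow_le_one x0.le (by linarith) (by have := hC.a2; apply one_div_nonneg.2; linarith)
      refine (congrArg (· * Real.exp (-(κ' * n))) (mul_one C').symm).trans_le ?_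
      refine mul_le_mul (mul_le_mul (le_max_right _ _) e1 zero_le_one (by positivity)) (Real.exp_le_exp.2 (neg_le_neg ?_)) (Real.exp_pos _).le (by positivity)
      calc _ ≤ κ' * n * 1 := by gcongr; exact (min_le_right _ _).trans (min_le_left _ _)
        _ = _ := mul_one _

theorem path_est (g : Geo D lam N σ V c M J ee al) (l0 : 0 < lam) (hc : c ≤ lam) {j : ℕ} (hj : j < N) : ∃ C > 0, ∃ κ > 0, ∀ x ∈ Ioo (0:ℝ) 1, κ * (x * (1-x)) ≤ infDist (σ j (zp (c/4) x)) (frontier D.G) ∧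
    ∀ (n : ℕ) P, 1 ≤ n → Orth D P n → (x ≤ 1/2 → ‖Cau D P (σ j (zp (c/4) x))‖ ≤ C * x ^ (-(1/2) : ℝ) * Real.exp (-(κ * n * x ^ (1/(2-al (σ j 0)))))) ∧
      (1/2 ≤ x → ‖Cau D P (σ j (zp (c/4) x))‖ ≤ C * (1-x) ^ (-(1/2) : ℝ) * Real.exp (-(κ * n * (1-x) ^ (1/(2-al (σ j 1)))))) := by
  obtain ⟨h1, h2, h3⟩ := g.acc (RA_open D) (fun w hw => hw.1) (RA_coopen D) (RA_ne D) j hj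
  have c0 := g.c0
  have c2 := g.c2
  have hL : ∀ w ∈ J, 3/2 * (c/4) ≤ Real.pi - al w * Real.pi / 2 := fun w hw => by
    have := (g.cor w hw).2; have p := Real.pi_gt_three
    nlinarith
  obtain ⟨-, z2, -⟩ := zpI g hj
  have hR : ∀ x ∈ Ioo (0:ℝ) 1, σ j (zp (c/4) x) ∈ RA D := fun x hx => h1 _ (zp_mem (by rw [abs_of_pos (by linarith)]; linarith) hx.1 hx.2) (by
    rw [zp_im]; have := mul_pos (mul_pos (show 0 < c/4 by linarith) hx.1) (sub_pos.2 hx.2); linarith)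
  obtain ⟨C, C0, κ, κ0, H⟩ := half_est g (Or.inl rfl) (g.end0 j hj) (g.cor _ (g.J0 j hj)).1 h2 (show 0 < c/4 by linarith) (by linarith) (hL _ (g.J0 j hj)) (by simpa only [one_mul] using z2) (by simpa only [one_mul] using hR)
  have e : ∀ x, 1 - zp (-1 * (c/4)) x = zp (c/4) (1-x) := fun x => by rw [zp_rev]; congr 1; ring
  obtain ⟨C', C0', κ', κ0', H'⟩ := half_est g (Or.inr rfl) (g.end1 j hj) (g.cor _ (g.J1 j hj)).1 h3 (show 0 < c/4 by linarith) (by linarith) (hL _ (g.J1 j hj))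
    (by simp only [e]; exact z2.comp (by fun_prop) fun x hx => ⟨by linarith [hx.2], by linarith [hx.1]⟩) (by simp only [e]; exact fun x hx => hR _ ⟨by linarith [hx.2], by linarith [hx.1]⟩)
  simp only [e] at H'
  simp only [one_mul] at H
  refine ⟨max C C', by positivity, min κ κ', by positivity, fun x hx => ⟨?_, fun n P hn hP => ⟨fun h => ?_, fun h => ?_⟩⟩⟩
  · have k1 := min_le_left κ κ'
    have k2 := min_le_right κ κ'
    have k0 : 0 < min κ κ' := by positivity
    have x0 := hx.1
    have x1 : 0 < 1 - x := by linarith [hx.2]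
    rcases le_total x (1/2) with h | h
    · refine le_trans ?_ (H x x0 h).1
      gcongr; nlinarith
    · have := (H' (1-x) x1 (by linarith)).1
      rw [sub_sub_cancel] at this
      refine le_trans ?_ this
      gcongr; nlinarith
  · refine ((H x hx.1 h).2 n P hn hP).trans ?_
    have x0 := hx.1
    gcongr
    exacts [le_max_left _ _, min_le_left _ _]
  · have x1 : 0 < 1 - x := by linarith [hx.2]
    have := (H' (1-x) x1 (by linarith)).2 n P hn hP
    rw [sub_sub_cancel] at this
    refine this.trans ?_
    gcongr
    exacts [le_max_right _ _, min_le_right _ _]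
end

theorem wt_half {a b x : ℝ} (hb : -(1/4) ≤ b) (h0 : 0 < x) (h1 : x ≤ 1/2) : wt a b x ≤ 2 * x ^ a := by
  have e : (1-x) ^ b ≤ 2 := by
    refine (Real.rpow_le_rpow_of_exponent_ge (by linarith) (by linarith) (show -1 ≤ b by linarith)).trans ?_
    rw [Real.rpow_neg_one]; exact inv_le_of_inv_le₀ two_pos (by linarith)
  have := Real.rpow_pos_of_pos h0 a
  unfold wt; nlinarith

theorem W_half {α lam κ : ℝ} (h0 : 0 < α) (h2 : α < 2) (l0 : 0 < lam) (hl : lam ≤ 2 - α) (hκ : 0 < κ) : ∃ C > 0, ∀ n : ℕ, 1 ≤ n →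
    IntervalIntegrable (fun x : ℝ => x ^ ((1/α-1)/2 + -(1/2)) * Real.exp (-(κ * n * x ^ (1/(2-α))))) volume 0 1 ∧
    ∫ x in (0:ℝ)..1, x ^ ((1/α-1)/2 + -(1/2)) * Real.exp (-(κ * n * x ^ (1/(2-α)))) ≤ C * (n:ℝ) ^ (-(lam / (2 * (2-lam)))) := by
  have h3 : 0 < 2 - α := by linarith
  obtain ⟨C, C0, h⟩ := W_int (s := (1/α-1)/2 + -(1/2)) (a := 1/(2-α)) (by have := one_div_pos.2 h0; linarith) (by positivity) hκ
  refine ⟨C, C0, fun n hn => ⟨(h n hn).1, (h n hn).2.trans ?_⟩⟩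
  refine mul_le_mul_of_nonneg_left (Real.rpow_le_rpow_of_exponent_le (by exact_mod_cast hn) (neg_le_neg ?_)) C0.le
  · have : ((1/α-1)/2 + -(1/2) + 1) / (1/(2-α)) = (2-α)/(2*α) := by field_simp; ring
    rw [this, div_le_div_iff₀ (by linarith) (by linarith)]
    nlinarith

section
variable {D : JordanDomain} {lam : ℝ} {N : ℕ} {σ : ℕ → ℂ → ℂ} {V : ℕ → Set ℂ} {c M : ℝ} {J : Set ℂ} {ee : ℂ → ℂ} {al : ℂ → ℝ} {φ q : ℂ → ℂ} {F Q : ℕ → ℂ → ℂ} {C ρ : ℝ}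

theorem path_int (g : Geo D lam N σ V c M J ee al) (l0 : 0 < lam) (hc : c ≤ lam) {j : ℕ} (hj : j < N) : ∃ C > 0, ∀ (h : ℝ → ℂ) (B : ℝ), 0 ≤ B →
    (∀ x ∈ Ioo (0:ℝ) 1, ‖h x‖ ≤ B * wt ((1/al (σ j 0)-1)/2) ((1/al (σ j 1)-1)/2) x) → ∀ (n : ℕ) P, 1 ≤ n → Orth D P n →
      ‖∫ x in (0:ℝ)..1, h x * Cau D P (σ j (zp (c/4) x))‖ ≤ B * C * (n:ℝ) ^ (-(lam / (2 * (2-lam)))) := by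
  obtain ⟨C, C0, κ, κ0, H⟩ := path_est g l0 hc hj
  obtain ⟨k0, l1⟩ := g.cor _ (g.J0 j hj)
  obtain ⟨k1, l2⟩ := g.cor _ (g.J1 j hj)
  have b0 := g.al_ge (g.J0 j hj)
  have b1 := g.al_ge (g.J1 j hj)
  obtain ⟨C1, C10, w1⟩ := W_half k0.a0 k0.a2 l0 l1 κ0
  obtain ⟨C2, C20, w2⟩ := W_half k1.a0 k1.a2 l0 l2 κ0
  refine ⟨2 * C * (C1 + C2), by positivity, fun h B hB hh n P hn hP => ?_⟩
  obtain ⟨i1, e1⟩ := w1 n hn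
  obtain ⟨i2, e2⟩ := w2 n hn
  set f1 := fun x : ℝ => x ^ ((1/al (σ j 0)-1)/2 + -(1/2)) * Real.exp (-(κ * n * x ^ (1/(2-al (σ j 0))))) with hf1
  set f2 := fun x : ℝ => x ^ ((1/al (σ j 1)-1)/2 + -(1/2)) * Real.exp (-(κ * n * x ^ (1/(2-al (σ j 1))))) with hf2
  have i2' : IntervalIntegrable (fun x => f2 (1-x)) volume 0 1 := by simpa using (i2.comp_sub_left 1).symm
  have key : ∀ x ∈ Ioo (0:ℝ) 1, ‖h x * Cau D P (σ j (zp (c/4) x))‖ ≤ B * 2 * C * (f1 x + f2 (1-x)) := fun x hx => by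
    have x0 := hx.1
    have x1 : 0 < 1 - x := by linarith [hx.2]
    have p1 : 0 < f1 x := by simp only [hf1]; positivity
    have p2 : 0 < f2 (1-x) := by simp only [hf2]; positivity
    have hc := (H x hx).2 n P hn hP
    rw [norm_mul]
    rcases le_total x (1/2) with hx2 | hx2
    · calc _ ≤ (B * (2 * x ^ ((1/al (σ j 0)-1)/2))) * (C * x ^ (-(1/2) : ℝ) * Real.exp (-(κ * n * x ^ (1/(2-al (σ j 0)))))) :=
            mul_le_mul ((hh x hx).trans (mul_le_mul_of_nonneg_left (wt_half b1 x0 hx2) hB)) (hc.1 hx2) (norm_nonneg _) (by positivity)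
        _ = B * 2 * C * f1 x := by simp only [hf1]; rw [Real.rpow_add x0]; ring
        _ ≤ _ := by gcongr; linarith
    · have hw : wt ((1/al (σ j 0)-1)/2) ((1/al (σ j 1)-1)/2) x ≤ 2 * (1-x) ^ ((1/al (σ j 1)-1)/2) := by
        have := wt_half (a := (1/al (σ j 1)-1)/2) b0 x1 (by linarith)
        unfold wt at this ⊢; rw [sub_sub_cancel] at this; linarith
      calc _ ≤ (B * (2 * (1-x) ^ ((1/al (σ j 1)-1)/2))) * (C * (1-x) ^ (-(1/2) : ℝ) * Real.exp (-(κ * n * (1-x) ^ (1/(2-al (σ j 1)))))) :=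
            mul_le_mul ((hh x hx).trans (mul_le_mul_of_nonneg_left hw hB)) (hc.2 hx2) (norm_nonneg _) (by positivity)
        _ = B * 2 * C * f2 (1-x) := by simp only [hf2]; rw [Real.rpow_add x1]; ring
        _ ≤ _ := by gcongr; linarith
  have e3 : ∫ x in (0:ℝ)..1, f2 (1-x) = ∫ x in (0:ℝ)..1, f2 x := by rw [intervalIntegral.integral_comp_sub_left]; simp
  calc _ ≤ ∫ x in (0:ℝ)..1, B * 2 * C * (f1 x + f2 (1-x)) := by
        refine intervalIntegral.norm_integral_le_of_norm_le zero_le_one ?_ ((i1.add i2').const_mul _)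
        filter_upwards [compl_mem_ae_iff.2 (measure_singleton (1:ℝ))] with x hx h2
        exact key x ⟨h2.1, lt_of_le_of_ne h2.2 hx⟩
    _ = B * 2 * C * ((∫ x in (0:ℝ)..1, f1 x) + ∫ x in (0:ℝ)..1, f2 x) := by
        rw [intervalIntegral.integral_const_mul, intervalIntegral.integral_add i1 i2', e3]
    _ ≤ B * 2 * C * (C1 * (n:ℝ) ^ (-(lam / (2 * (2-lam)))) + C2 * (n:ℝ) ^ (-(lam / (2 * (2-lam))))) := by gcongr
    _ = _ := by ring
end

theorem arc_inv_one {σ V} (h : IsArc σ V) : ∃ C > 0, ∀ w : ℂ, ∀ d > 0, (∀ x ∈ Icc (0:ℝ) 1, d ≤ ‖w - σ x‖) →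
    ∫ x in (0:ℝ)..1, ‖deriv σ x‖ * ‖w - σ x‖⁻¹ ≤ C * (√d)⁻¹ := by
  obtain ⟨C, C0, hC⟩ := arc_inv_sq h
  have hdc : ContinuousOn (fun x : ℝ => ‖deriv σ x‖) (Icc 0 1) := (h.contDeriv.comp (by fun_prop) (fun x hx => h.seg x hx)).norm
  have hsc : ContinuousOn (fun x : ℝ => σ x) (Icc 0 1) := h.diff.continuousOn.comp (by fun_prop) (fun x hx => h.seg x hx)
  set A := ∫ x in (0:ℝ)..1, ‖deriv σ x‖ with hA
  have A0 : 0 ≤ A := intervalIntegral.integral_nonneg zero_le_one fun _ _ => norm_nonneg _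
  refine ⟨(C + A)/2, by linarith, fun w d d0 hd => ?_⟩
  have hn : ContinuousOn (fun x : ℝ => ‖w - σ x‖) (Icc 0 1) := (continuousOn_const.sub hsc).norm
  have hne : ∀ x ∈ Icc (0:ℝ) 1, ‖w - σ x‖ ≠ 0 := fun x hx => (d0.trans_le (hd x hx)).ne'
  have t0 := Real.sqrt_pos.2 d0
  have i1 : IntervalIntegrable (fun x : ℝ => ‖deriv σ x‖ * (‖w - σ x‖ ^ 2)⁻¹) volume 0 1 := (hdc.mul ((hn.pow 2).inv₀ fun x hx => pow_ne_zero 2 (hne x hx))).intervalIntegrable_of_Icc zero_le_one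
  have i2 : IntervalIntegrable (fun x : ℝ => ‖deriv σ x‖) volume 0 1 := hdc.intervalIntegrable_of_Icc zero_le_one
  calc _ ≤ ∫ x in (0:ℝ)..1, (√d/2 * (‖deriv σ x‖ * (‖w - σ x‖ ^ 2)⁻¹) + (√d)⁻¹/2 * ‖deriv σ x‖) := by
        refine intervalIntegral.integral_mono_on zero_le_one ((hdc.mul (hn.inv₀ hne)).intervalIntegrable_of_Icc zero_le_one) ((i1.const_mul _).add (i2.const_mul _)) fun x hx => ?_
        have : ‖w - σ x‖⁻¹ ≤ √d/2 * (‖w - σ x‖ ^ 2)⁻¹ + (√d)⁻¹/2 := by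
          rw [← inv_pow]
          set u := ‖w - σ x‖⁻¹
          have e : √d/2 * u^2 + (√d)⁻¹/2 - u = (√d)⁻¹/2 * (√d * u - 1)^2 := by field_simp; ring
          have : 0 ≤ (√d)⁻¹/2 * (√d * u - 1)^2 := by positivity
          linarith
        nlinarith [norm_nonneg (deriv σ x)]
    _ = √d/2 * (∫ x in (0:ℝ)..1, ‖deriv σ x‖ * (‖w - σ x‖ ^ 2)⁻¹) + (√d)⁻¹/2 * A := by
        rw [intervalIntegral.integral_add (i1.const_mul _) (i2.const_mul _), intervalIntegral.integral_const_mul, intervalIntegral.integral_const_mul]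
    _ ≤ √d/2 * (C/(√d*√d)) + (√d)⁻¹/2 * A := by rw [Real.mul_self_sqrt d0.le]; gcongr; exact hC w d d0 hd
    _ = _ := by field_simp

section
variable {D : JordanDomain} {lam : ℝ} {N : ℕ} {σ : ℕ → ℂ → ℂ} {V : ℕ → Set ℂ} {c M : ℝ} {J : Set ℂ} {ee : ℂ → ℂ} {al : ℂ → ℝ} {φ q : ℂ → ℂ} {F Q : ℕ → ℂ → ℂ} {C ρ : ℝ}

theorem swap_int (g : Geo D lam N σ V c M J ee al) (l0 : 0 < lam) (hc : c ≤ lam) {i j : ℕ} (hi : i < N) (hj : j < N) {h p : ℝ → ℂ} {B : ℝ} (hB : 0 ≤ B) (hh : ContinuousOn h (Ioo 0 1)) (hp : ContinuousOn p (Icc 0 1))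
    (hb : ∀ x ∈ Ioo (0:ℝ) 1, ‖h x‖ ≤ B * wt ((1/al (σ j 0)-1)/2) ((1/al (σ j 1)-1)/2) x) :
    IntervalIntegrable (fun x => ∫ y in (0:ℝ)..1, h x * ((‖deriv (σ i) y‖:ℂ) * (p y / (σ j (zp (c/4) x) - σ i y)))) volume 0 1 ∧
    IntervalIntegrable (fun y => ∫ x in (0:ℝ)..1, h x * ((‖deriv (σ i) y‖:ℂ) * (p y / (σ j (zp (c/4) x) - σ i y)))) volume 0 1 ∧
    ∫ x in (0:ℝ)..1, (∫ y in (0:ℝ)..1, h x * ((‖deriv (σ i) y‖:ℂ) * (p y / (σ j (zp (c/4) x) - σ i y)))) = ∫ y in (0:ℝ)..1, (∫ x in (0:ℝ)..1, h x * ((‖deriv (σ i) y‖:ℂ) * (p y / (σ j (zp (c/4) x) - σ i y)))) := by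
  obtain ⟨C, C0, κ, κ0, H⟩ := path_est g l0 hc hj
  have L := g.lens i hi
  obtain ⟨A, A0, hA⟩ := arc_inv_one L.arc
  obtain ⟨b, hbp⟩ := isCompact_Icc.exists_bound_of_continuousOn hp
  have hdc : ContinuousOn (fun x : ℝ => (‖deriv (σ i) x‖:ℂ)) (Icc 0 1) := continuous_ofReal.comp_continuousOn (L.arc.contDeriv.comp (by fun_prop) (fun x hx => L.arc.seg x hx)).norm
  have hsc : ContinuousOn (fun x : ℝ => σ i x) (Icc 0 1) := L.arc.diff.continuousOn.comp (by fun_prop) (fun x hx => L.arc.seg x hx)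
  have b0 := g.al_ge (g.J0 j hj)
  have b1 := g.al_ge (g.J1 j hj)
  have hd : ∀ x ∈ Ioo (0:ℝ) 1, ∀ y ∈ Icc (0:ℝ) 1, κ * (x * (1-x)) ≤ ‖σ j (zp (c/4) x) - σ i y‖ := fun x hx y hy => by
    rw [← dist_eq]; exact (H x hx).1.trans (infDist_le_dist_of_mem (L.re y hy))
  have hk : ∀ x ∈ Ioo (0:ℝ) 1, 0 < κ * (x * (1-x)) := fun x hx => mul_pos κ0 (mul_pos hx.1 (sub_pos.2 hx.2))
  have hne : ∀ x ∈ Ioo (0:ℝ) 1, ∀ y ∈ Icc (0:ℝ) 1, σ j (zp (c/4) x) - σ i y ≠ 0 := fun x hx y hy => norm_pos_iff.1 ((hk x hx).trans_le (hd x hx y hy))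
  have hb' : 0 ≤ b := (norm_nonneg _).trans (hbp 0 (by simp))
  simp only [intervalIntegral.integral_of_le zero_le_one, integral_Ioc_eq_integral_Ioo]
  rw [intervalIntegrable_iff_integrableOn_Ioo_of_le zero_le_one, intervalIntegrable_iff_integrableOn_Ioo_of_le zero_le_one]
  suffices hs : Integrable (Function.uncurry fun x y : ℝ => h x * ((‖deriv (σ i) y‖:ℂ) * (p y / (σ j (zp (c/4) x) - σ i y)))) ((volume.restrict (Ioo (0:ℝ) 1)).prod (volume.restrict (Ioo (0:ℝ) 1))) from
    ⟨hs.integral_prod_left, hs.integral_prod_right, integral_integral_swap hs⟩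
  have hm : AEStronglyMeasurable (Function.uncurry fun x y : ℝ => h x * ((‖deriv (σ i) y‖:ℂ) * (p y / (σ j (zp (c/4) x) - σ i y)))) ((volume.restrict (Ioo (0:ℝ) 1)).prod (volume.restrict (Ioo (0:ℝ) 1))) := by
    rw [Measure.prod_restrict]
    refine ContinuousOn.aestronglyMeasurable ?_ (measurableSet_Ioo.prod measurableSet_Ioo)
    have m1 : MapsTo Prod.fst (Ioo (0:ℝ) 1 ×ˢ Ioo (0:ℝ) 1) (Ioo 0 1) := fun z hz => hz.1
    have m2 : MapsTo Prod.snd (Ioo (0:ℝ) 1 ×ˢ Ioo (0:ℝ) 1) (Icc 0 1) := fun z hz => Ioo_subset_Icc_self hz.2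
    exact (hh.comp continuousOn_fst m1).mul ((hdc.comp continuousOn_snd m2).mul ((hp.comp continuousOn_snd m2).div
      (((zpI g hj).2.1.comp continuousOn_fst fun z hz => Ioo_subset_Icc_self hz.1).sub (hsc.comp continuousOn_snd m2)) fun z hz => hne _ hz.1 _ (Ioo_subset_Icc_self hz.2)))
  refine (integrable_prod_iff hm).2 ⟨(ae_restrict_iff' measurableSet_Ioo).2 (ae_of_all _ fun x hx => ?_), ?_⟩
  · have : ContinuousOn (fun y : ℝ => h x * ((‖deriv (σ i) y‖:ℂ) * (p y / (σ j (zp (c/4) x) - σ i y)))) (Icc 0 1) := continuousOn_const.mul (hdc.mul (hp.div (continuousOn_const.sub hsc) (hne x hx)))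
    exact (this.integrableOn_Icc).mono_set Ioo_subset_Icc_self
  · refine Integrable.mono' (g := fun x => B * b * A * (√κ)⁻¹ * wt ((1/al (σ j 0)-1)/2 + -(1/2)) ((1/al (σ j 1)-1)/2 + -(1/2)) x) ?_ hm.norm.integral_prod_right' ((ae_restrict_iff' measurableSet_Ioo).2 (ae_of_all _ fun x hx => ?_))
    · refine Integrable.const_mul ?_ _
      exact (intervalIntegrable_iff_integrableOn_Ioo_of_le zero_le_one).1 (wt_int (by linarith) (by linarith))
    have x1 : 0 < 1 - x := sub_pos.2 hx.2
    rw [Real.norm_of_nonneg (integral_nonneg fun _ => norm_nonneg _), ← integral_Ioc_eq_integral_Ioo, ← intervalIntegral.integral_of_le zero_le_one]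
    have hn : ContinuousOn (fun y : ℝ => ‖deriv (σ i) y‖ * ‖σ j (zp (c/4) x) - σ i y‖⁻¹) (Icc 0 1) :=
      (L.arc.contDeriv.comp (by fun_prop) (fun x hx => L.arc.seg x hx)).norm.mul ((continuousOn_const.sub hsc).norm.inv₀ fun y hy => norm_ne_zero_iff.2 (hne x hx y hy))
    have hn2 : ContinuousOn (fun y : ℝ => ‖h x * ((‖deriv (σ i) y‖:ℂ) * (p y / (σ j (zp (c/4) x) - σ i y)))‖) (Icc 0 1) := (continuousOn_const.mul (hdc.mul (hp.div (continuousOn_const.sub hsc) (hne x hx)))).norm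
    calc _ ≤ ∫ y in (0:ℝ)..1, ‖h x‖ * b * (‖deriv (σ i) y‖ * ‖σ j (zp (c/4) x) - σ i y‖⁻¹) := by
          refine intervalIntegral.integral_mono_on zero_le_one (hn2.intervalIntegrable_of_Icc zero_le_one) ((hn.intervalIntegrable_of_Icc zero_le_one).const_mul _) fun y hy => ?_
          simp only [norm_mul, norm_div, norm_real, norm_norm, Function.uncurry]
          have := hbp y hy
          calc _ = ‖h x‖ * ‖p y‖ * (‖deriv (σ i) y‖ * ‖σ j (zp (c/4) x) - σ i y‖⁻¹) := by ring
            _ ≤ _ := by gcongr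
      _ ≤ (B * wt ((1/al (σ j 0)-1)/2) ((1/al (σ j 1)-1)/2) x) * b * (A * (√(κ * (x * (1-x))))⁻¹) := by
          rw [intervalIntegral.integral_const_mul]
          have := hb x hx
          have := hA _ _ (hk x hx) (hd x hx)
          have i0 : 0 ≤ ∫ y in (0:ℝ)..1, ‖deriv (σ i) y‖ * ‖σ j (zp (c/4) x) - σ i y‖⁻¹ := intervalIntegral.integral_nonneg zero_le_one fun _ _ => by positivity
          have := (wt_pos (a := (1/al (σ j 0)-1)/2) (b := (1/al (σ j 1)-1)/2) hx.1 hx.2).le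
          gcongr
      _ = _ := by
          rw [← wt_mul _ _ _ _ hx.1 hx.2, Real.sqrt_mul κ0.le, Real.sqrt_mul hx.1.le]
          simp only [wt, Real.sqrt_eq_rpow, Real.rpow_neg hx.1.le, Real.rpow_neg x1.le]
          rw [mul_inv, mul_inv]; ring
end

section
variable {D : JordanDomain} {lam : ℝ} {N : ℕ} {σ : ℕ → ℂ → ℂ} {V : ℕ → Set ℂ} {c M : ℝ} {J : Set ℂ} {ee : ℂ → ℂ} {al : ℂ → ℝ} {φ q : ℂ → ℂ} {F Q : ℕ → ℂ → ℂ} {C ρ : ℝ}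

theorem bdry_id {a f f' s Q : ℂ} (hf : ‖f‖ = 1) (ha : ‖a‖ < 1) (h' : f' = I * ‖f'‖ * f) (hs : s ≠ 0) (hQ : Q ^ 2 = f' / s) (hQ0 : Q ≠ 0) :
    Q * (f - a)⁻¹ * s = I * (starRingEnd ℂ) ((‖s‖:ℂ) * (Q * (1 - f * (starRingEnd ℂ) a)⁻¹)) := by
  have hf0 : f ≠ 0 := by rintro rfl; simp at hf
  have hfa : f - a ≠ 0 := sub_ne_zero.2 fun e => by rw [e] at hf; linarith
  have cf : (starRingEnd ℂ) f = f⁻¹ := by rw [Complex.inv_def, normSq_eq_norm_sq, hf]; simp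
  have e1 : Q * (starRingEnd ℂ) Q * ‖s‖ = ‖f'‖ := by
    rw [mul_conj, normSq_eq_norm_sq, ← norm_pow, hQ, norm_div, ← ofReal_mul, div_mul_cancel₀ _ (norm_ne_zero_iff.2 hs)]
  have e2 : Q ^ 2 * s = f' := by rw [hQ]; field_simp
  have e3 : Q * s = I * (starRingEnd ℂ) Q * ‖s‖ * f := by
    refine mul_left_cancel₀ hQ0 ?_
    calc _ = f' := by rw [← e2]; ring
      _ = I * ‖f'‖ * f := h'
      _ = _ := by rw [← e1]; ring
  simp only [map_mul, map_inv₀, map_sub, map_one, conj_ofReal, conj_conj, cf]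
  have e4 : 1 - f⁻¹ * a = (f - a) * f⁻¹ := by field_simp
  rw [e4, mul_inv, inv_inv]
  calc _ = Q * s * (f - a)⁻¹ := by ring
    _ = _ := by rw [e3]; ring

theorem rep_P (g : Geo D lam N σ V c M J ee al) (d : Dat D N σ al φ q F Q c C ρ) (ρ0 : 0 < ρ) (ρ1 : ρ < 1) {z : ℂ} (hz : z ∈ D.G) (h : ‖φ z‖ < ρ) (P : Polynomial ℂ) :
    P.eval z * Iv N σ z = -(q z * (I * (starRingEnd ℂ) (∑ i ∈ Finset.range N, ∫ y in (0:ℝ)..1, (‖deriv (σ i) y‖:ℂ) * (starRingEnd ℂ) (P.eval (σ i y)) * (Q i y * (1 - F i y * (starRingEnd ℂ) (φ z))⁻¹)))) := by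
  have hu := ((nice_P g P).mul g ((nice_q g d).mul g (nice_D g d ρ1 hz h))).weak g (t := -(1/2)) (by norm_num)
  have he := (cau1 g d hz h hu (c' := 0) (by rw [abs_zero]; linarith [g.c0])).2
  have hq0 : q z ≠ 0 := fun e => by
    have := d.q2 z hz; rw [e] at this
    exact inj_deriv_ne D.isOpen d.cm.d d.cm.b.injOn hz (by rw [← this]; simp)
  have hs : dslope φ z z = q z ^ 2 := by rw [dslope_same, d.q2 z hz]
  have e2 : ∑ j ∈ Finset.range N, ∫ x in (0:ℝ)..1, P.eval (σ j (zp 0 x)) * (Q j (zp 0 x) * ((σ j (zp 0 x) - z) * (F j (zp 0 x) - φ z)⁻¹)) * (σ j (zp 0 x) - z)⁻¹ * deriv (σ j) (zp 0 x) * zd 0 x =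
    I * (starRingEnd ℂ) (∑ i ∈ Finset.range N, ∫ y in (0:ℝ)..1, (‖deriv (σ i) y‖:ℂ) * (starRingEnd ℂ) (P.eval (σ i y)) * (Q i y * (1 - F i y * (starRingEnd ℂ) (φ z))⁻¹)) := by
    rw [map_sum, Finset.mul_sum]
    refine Finset.sum_congr rfl fun j hj => ?_
    have hj := Finset.mem_range.1 hj
    rw [intervalIntegral.integral_of_le zero_le_one, intervalIntegral.integral_of_le zero_le_one, ← integral_conj, ← integral_const_mul, integral_Ioc_eq_integral_Ioo, integral_Ioc_eq_integral_Ioo]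
    refine setIntegral_congr_fun measurableSet_Ioo fun x hx => ?_
    have hN := (Nset_real g.c0).2 hx
    have r := d.rf j hj
    have L := g.lens j hj
    have hs0 : deriv (σ j) x ≠ 0 := L.arc.deriv_ne (L.sub hN)
    have hn := Dat.ne g d hz h hj hN
    have := bdry_id (r.one x hx) (h.trans ρ1) (r.tan x hx) hs0 (d.Q2 j hj _ hN) fun e => by
      have := d.Q2 j hj _ hN
      rw [e, zero_pow two_ne_zero] at this
      exact div_ne_zero (r.ne _ hN) hs0 this.symm
    simp only [zp_c0, zd_c0]
    calc _ = P.eval (σ j x) * (Q j x * (F j x - φ z)⁻¹ * deriv (σ j) x) := by field_simp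
      _ = _ := by rw [this]; simp only [map_mul, conj_conj]; ring
  rw [← e2, he, hs]
  field_simp
end

section
variable {D : JordanDomain} {lam : ℝ} {N : ℕ} {σ : ℕ → ℂ → ℂ} {V : ℕ → Set ℂ} {c M : ℝ} {J : Set ℂ} {ee : ℂ → ℂ} {al : ℂ → ℝ} {φ q : ℂ → ℂ} {F Q : ℕ → ℂ → ℂ} {C ρ : ℝ}

theorem rep_S (g : Geo D lam N σ V c M J ee al) (d : Dat D N σ al φ q F Q c C ρ) (ρ0 : 0 < ρ) (l0 : 0 < lam) (hc : c ≤ lam) {I0 : ℂ} (hI : ∀ t ∈ D.G, Iv N σ t = I0) {k kj} (hk : Nice D N σ c J ee al k kj (-(1/2)))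
    {B : ℕ → ℝ} (hB : ∀ j < N, 0 ≤ B j) (hb : ∀ j < N, ∀ x ∈ Ioo (0:ℝ) 1, ‖kj j (zp (c/4) x) * deriv (σ j) (zp (c/4) x) * zd (c/4) x‖ ≤ B j * wt ((1/al (σ j 0)-1)/2) ((1/al (σ j 1)-1)/2) x) (P : Polynomial ℂ) :
    (∑ i ∈ Finset.range N, ∫ y in (0:ℝ)..1, (‖deriv (σ i) y‖:ℂ) * (starRingEnd ℂ) (P.eval (σ i y)) * kj i y) * I0 =
      -∑ j ∈ Finset.range N, ∫ x in (0:ℝ)..1, kj j (zp (c/4) x) * deriv (σ j) (zp (c/4) x) * zd (c/4) x * Cau D P (σ j (zp (c/4) x)) := by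
  set h := fun (j : ℕ) (x : ℝ) => kj j (zp (c/4) x) * deriv (σ j) (zp (c/4) x) * zd (c/4) x with hh
  set p := fun (i : ℕ) (y : ℝ) => (starRingEnd ℂ) (P.eval (σ i y)) with hp
  have c0 := g.c0
  have hm : ∀ x ∈ Ioo (0:ℝ) 1, zp (c/4) x ∈ Nset c := fun x hx => zp_mem (by rw [abs_of_pos (by linarith)]; linarith) hx.1 hx.2
  have hhc : ∀ j < N, ContinuousOn (h j) (Ioo 0 1) := fun j hj =>
    (((hk.dj j hj).continuousOn.comp (zp_cont _).continuousOn hm).mul ((g.lens j hj).arc.contDeriv.comp (zp_cont _).continuousOn fun x hx => (zpI g hj).1 x (Ioo_subset_Icc_self hx))).mul (zd_cont _).continuousOn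
  have hpc : ∀ i < N, ContinuousOn (p i) (Icc 0 1) := fun i hi =>
    (continuous_conj.comp P.continuous).comp_continuousOn ((g.lens i hi).arc.diff.continuousOn.comp (by fun_prop) fun x hx => (g.lens i hi).arc.seg x hx)
  have sw := fun i (hi : i < N) j (hj : j < N) => swap_int g l0 hc hi hj (hB j hj) (hhc j hj) (hpc i hi) (hb j hj)
  have e1 : ∀ i < N, (∫ y in (0:ℝ)..1, (‖deriv (σ i) y‖:ℂ) * p i y * kj i y) * I0 =
      -∑ j ∈ Finset.range N, ∫ x in (0:ℝ)..1, (∫ y in (0:ℝ)..1, h j x * ((‖deriv (σ i) y‖:ℂ) * (p i y / (σ j (zp (c/4) x) - σ i y)))) := fun i hi => by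
    rw [Finset.sum_congr rfl fun j hj => (sw i hi j (Finset.mem_range.1 hj)).2.2, ← intervalIntegral.integral_finsetSum fun j hj => (sw i hi j (Finset.mem_range.1 hj)).2.1, ← intervalIntegral.integral_mul_const,
      ← intervalIntegral.integral_neg]
    rw [intervalIntegral.integral_of_le zero_le_one, intervalIntegral.integral_of_le zero_le_one, integral_Ioc_eq_integral_Ioo, integral_Ioc_eq_integral_Ioo]
    refine setIntegral_congr_fun measurableSet_Ioo fun y hy => ?_
    beta_reduce
    rw [mul_assoc, ← hrep g d ρ0 hI hk hi hy, Finset.mul_sum, ← Finset.sum_neg_distrib]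
    refine Finset.sum_congr rfl fun j hj => ?_
    rw [← intervalIntegral.integral_const_mul, ← intervalIntegral.integral_neg]
    refine intervalIntegral.integral_congr fun x _ => ?_
    simp only [hh]
    rw [← neg_sub (σ i y), div_neg]; ring
  rw [Finset.sum_mul, Finset.sum_congr rfl fun i hi => e1 i (Finset.mem_range.1 hi), Finset.sum_neg_distrib, Finset.sum_comm]
  congr 1
  refine Finset.sum_congr rfl fun j hj => ?_
  have hj := Finset.mem_range.1 hj
  rw [← intervalIntegral.integral_finsetSum fun i hi => (sw i (Finset.mem_range.1 hi) j hj).1]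
  rw [intervalIntegral.integral_of_le zero_le_one, intervalIntegral.integral_of_le zero_le_one, integral_Ioc_eq_integral_Ioo, integral_Ioc_eq_integral_Ioo]
  refine setIntegral_congr_fun measurableSet_Ioo fun x hx => ?_
  have hw : σ j (zp (c/4) x) ∉ frontier D.G := fun hf => (zpI g hj).2.2 x hx (frontier_subset_closure hf)
  have := g.int (fun t => (starRingEnd ℂ) (P.eval t) / (σ j (zp (c/4) x) - t)) ((continuous_conj.comp P.continuous).continuousOn.div (continuousOn_const.sub continuousOn_id) fun t ht => sub_ne_zero.2 fun e => hw (e ▸ ht))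
  beta_reduce
  rw [Cau, this, Finset.mul_sum]
  refine Finset.sum_congr rfl fun i hi => ?_
  rw [intervalIntegral.integral_const_mul]

theorem main_est (g : Geo D lam N σ V c M J ee al) (d : Dat D N σ al φ q F Q c C ρ) (ρ0 : 0 < ρ) (ρ1 : ρ < 1) (l0 : 0 < lam) (hc : c ≤ lam) {K : Set ℂ} {r b : ℝ} (hr : r < ρ) (hK : ∀ z ∈ K, z ∈ D.G ∧ ‖φ z‖ ≤ r ∧ ‖q z‖ ≤ b) :
    ∃ C, ∀ z ∈ K, ∀ (n : ℕ) P, 1 ≤ n → Orth D P n → ‖P.eval z‖ ≤ C * (n:ℝ) ^ (-(lam / (2 * (2-lam)))) := by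
  obtain ⟨I0, hI⟩ := Iv_const g
  choose! A A0 hA using fun j hj => path_int g l0 hc (j := j) hj
  have c0 := g.c0
  have c2 := g.c2
  have ex : ∀ j < N, ∃ S, ∀ x ∈ Icc (0:ℝ) 1, ‖deriv (σ j) (zp (c/4) x)‖ ≤ S := fun j hj =>
    isCompact_Icc.exists_bound_of_continuousOn ((g.lens j hj).arc.contDeriv.comp (zp_cont _).continuousOn (zpI g hj).1)
  choose! S hS using ex
  have S0 : ∀ j < N, 0 ≤ S j := fun j hj => (norm_nonneg _).trans (hS j hj 0 (by simp))
  set B := fun j => C * (1 - r/ρ)⁻¹ * S j * 2 with hBd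
  have h0 : 0 < 1 - r/ρ := by rw [sub_pos, div_lt_one ρ0]; exact hr
  have C0 := d.C0
  have hB : ∀ j < N, 0 ≤ B j := fun j hj => by have := S0 j hj; positivity
  refine ⟨b * (∑ j ∈ Finset.range N, B j * A j) / ‖I0‖ ^ 2, fun z hz n P hn hP => ?_⟩
  obtain ⟨hG, hφ, hq⟩ := hK z hz
  have hφ' := hφ.trans_lt hr
  have I1 : I0 ≠ 0 := hI z hG ▸ Iv_ne g d ρ0 ρ1 hG hφ'
  have hk := ((nice_q g d).mul g (nice_k g d ρ0 ρ1 hφ')).weak g (t := -(1/2)) (by norm_num)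
  have hb : ∀ j < N, ∀ x ∈ Ioo (0:ℝ) 1, ‖(Q j (zp (c/4) x) * (1 - F j (zp (c/4) x) * (starRingEnd ℂ) (φ z))⁻¹) * deriv (σ j) (zp (c/4) x) * zd (c/4) x‖ ≤ B j * wt ((1/al (σ j 0)-1)/2) ((1/al (σ j 1)-1)/2) x := fun j hj x hx => by
    have hm : zp (c/4) x ∈ Nset c := zp_mem (by rw [abs_of_pos (by linarith)]; linarith) hx.1 hx.2
    have h1 := d.Qb j hj _ hm
    rw [zp_re] at h1
    have h2 : ‖(1 - F j (zp (c/4) x) * (starRingEnd ℂ) (φ z))⁻¹‖ ≤ (1 - r/ρ)⁻¹ := by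
      rw [norm_inv]
      refine inv_anti₀ h0 (le_trans ?_ (inv_lb ρ0 ((d.rf j hj).hi _ hm)))
      gcongr
    have h3 := hS j hj x (Ioo_subset_Icc_self hx)
    have h4 := zd_le (c := c/4) (by rw [abs_of_pos (by linarith)]; linarith) hx.1.le hx.2.le
    have w0 := (wt_pos (a := (1/al (σ j 0)-1)/2) (b := (1/al (σ j 1)-1)/2) hx.1 hx.2).le
    have s0 := S0 j hj
    rw [norm_mul, norm_mul, norm_mul]
    calc _ ≤ (C * wt ((1/al (σ j 0)-1)/2) ((1/al (σ j 1)-1)/2) x) * (1 - r/ρ)⁻¹ * S j * 2 := by gcongr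
      _ = _ := by simp only [hBd]; ring
  have e1 := congrArg norm (rep_P g d ρ0 ρ1 hG hφ' P)
  have e2 := congrArg norm (rep_S g d ρ0 l0 hc hI hk hB hb P)
  rw [norm_mul, norm_neg, norm_mul, norm_mul, norm_I, one_mul, RCLike.norm_conj, hI z hG] at e1
  rw [norm_mul, norm_neg] at e2
  have e3 : ‖∑ j ∈ Finset.range N, ∫ x in (0:ℝ)..1, (Q j (zp (c/4) x) * (1 - F j (zp (c/4) x) * (starRingEnd ℂ) (φ z))⁻¹) * deriv (σ j) (zp (c/4) x) * zd (c/4) x * Cau D P (σ j (zp (c/4) x))‖ ≤ (∑ j ∈ Finset.range N, B j * A j) * (n:ℝ) ^ (-(lam / (2 * (2-lam)))) := by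
    rw [Finset.sum_mul]
    exact norm_sum_le_of_le _ fun j hj => let hj := Finset.mem_range.1 hj; hA j hj _ _ (hB j hj) (hb j hj) n P hn hP
  have n0 := norm_pos_iff.2 I1
  rw [div_mul_eq_mul_div, le_div_iff₀ (by positivity), sq, ← mul_assoc, e1, mul_assoc, e2, mul_assoc]
  exact mul_le_mul hq e3 (norm_nonneg _) ((norm_nonneg _).trans hq)
end

theorem on_orth {D : JordanDomain} {p : ℕ → Polynomial ℂ} (hp : D.IsONPolys p) (k : ℕ) : ∀ m ≤ k, ∀ Q : Polynomial ℂ, Q.degree < m →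
    ∫ s in (0:ℝ)..D.l, (starRingEnd ℂ) ((p k).eval (D.γ s)) * Q.eval (D.γ s) = 0 := by
  have hc := D.γ_cont
  intro m
  induction m with
  | zero =>
    intro _ Q hQ
    have : Q = 0 := by simpa using hQ
    simp [this]
  | succ m ih =>
    intro hm Q hQ
    obtain ⟨c, c0, hl⟩ := hp.2.1 m
    have hcm : (p m).coeff m = c := by rw [← hl, Polynomial.leadingCoeff, hp.1 m]
    have hcc : (c:ℂ) ≠ 0 := by exact_mod_cast c0.ne'
    set a : ℂ := Q.coeff m / c with ha
    have h1 := ih (by omega) (Q - Polynomial.C a * p m) (by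
      rw [Polynomial.degree_lt_iff_coeff_zero]
      intro j hj
      rcases hj.eq_or_lt with rfl | hj
      · rw [Polynomial.coeff_sub, Polynomial.coeff_C_mul, hcm, ha]; field_simp; ring
      · rw [Polynomial.coeff_sub, Polynomial.coeff_C_mul, Polynomial.coeff_eq_zero_of_natDegree_lt (p := p m) (by rw [hp.1 m]; exact hj),
          (Polynomial.degree_lt_iff_coeff_zero _ _).1 hQ j (by omega)]; simp)
    have h2 : ∫ s in (0:ℝ)..D.l, (p m).eval (D.γ s) * (starRingEnd ℂ) ((p k).eval (D.γ s)) = 0 := by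
      have := hp.2.2 m k
      rw [if_neg (by omega)] at this
      exact (mul_eq_zero.1 this).resolve_left (by have := D.l_pos.ne'; simpa using this)
    have e : ∀ s, (starRingEnd ℂ) ((p k).eval (D.γ s)) * Q.eval (D.γ s) = (starRingEnd ℂ) ((p k).eval (D.γ s)) * (Q - Polynomial.C a * p m).eval (D.γ s)
        + a * ((p m).eval (D.γ s) * (starRingEnd ℂ) ((p k).eval (D.γ s))) := by
      intro s; simp; ring
    simp_rw [e]
    rw [intervalIntegral.integral_add (Continuous.intervalIntegrable (by fun_prop) _ _) (Continuous.intervalIntegrable (by fun_prop) _ _), h1,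
      intervalIntegral.integral_const_mul, h2]; simp

theorem on_sum {D : JordanDomain} {p : ℕ → Polynomial ℂ} (hp : D.IsONPolys p) (s : Finset ℕ) (a : ℕ → ℂ) :
    ∫ t in (0:ℝ)..D.l, ‖(∑ k ∈ s, Polynomial.C (a k) * p k).eval (D.γ t)‖ ^ 2 = D.l * ∑ k ∈ s, ‖a k‖^2 := by
  have hc := D.γ_cont
  have hl : (D.l:ℂ) ≠ 0 := by exact_mod_cast D.l_pos.ne'
  have h : ∀ j k, ∫ s in (0:ℝ)..D.l, (p j).eval (D.γ s) * (starRingEnd ℂ) ((p k).eval (D.γ s)) = if j = k then (D.l:ℂ) else 0 := by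
    intro j k
    have := hp.2.2 j k
    split_ifs at this ⊢ <;> field_simp at this <;> simpa using this
  apply Complex.ofReal_injective
  rw [← intervalIntegral.integral_ofReal]
  have e : ∀ t, ((‖(∑ k ∈ s, Polynomial.C (a k) * p k).eval (D.γ t)‖ ^ 2 : ℝ) : ℂ) = ∑ j ∈ s, ∑ k ∈ s, a j * (starRingEnd ℂ) (a k) * ((p j).eval (D.γ t) * (starRingEnd ℂ) ((p k).eval (D.γ t))) := by
    intro t
    rw [ofReal_pow, ← Complex.mul_conj', Polynomial.eval_finset_sum, map_sum, Finset.sum_mul_sum]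
    refine Finset.sum_congr rfl fun j _ => Finset.sum_congr rfl fun k _ => ?_
    simp; ring
  simp_rw [e]
  rw [intervalIntegral.integral_finsetSum fun j _ => Continuous.intervalIntegrable (by fun_prop) _ _]
  push_cast
  rw [Finset.mul_sum]
  refine Finset.sum_congr rfl fun j hj => ?_
  rw [intervalIntegral.integral_finsetSum fun j _ => Continuous.intervalIntegrable (by fun_prop) _ _]
  simp_rw [intervalIntegral.integral_const_mul, h]
  simp [hj, Complex.mul_conj']; ring

theorem on_tail {D : JordanDomain} {p : ℕ → Polynomial ℂ} (hp : D.IsONPolys p) {n : ℕ} {z : ℂ} {B : ℝ} (hB : ∀ P, Orth D P n → ‖P.eval z‖ ≤ B) (m : ℕ) :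
    ∑ k ∈ Finset.Ico (n+1) m, ‖(p k).eval z‖^2 ≤ B^2 := by
  have hc := D.γ_cont
  set s := Finset.Ico (n+1) m
  set S := ∑ k ∈ s, ‖(p k).eval z‖^2 with hS
  rcases (show 0 ≤ S from Finset.sum_nonneg fun _ _ => by positivity).eq_or_lt with h0 | h0
  · rw [← h0]; positivity
  set r := Real.sqrt S
  have r0 : 0 < r := Real.sqrt_pos.2 h0
  have r2 : r^2 = S := Real.sq_sqrt h0.le
  have rc : (r:ℂ) ≠ 0 := by exact_mod_cast r0.ne'
  set a : ℕ → ℂ := fun k => (starRingEnd ℂ) ((p k).eval z) / r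
  have o : Orth D (∑ k ∈ s, Polynomial.C (a k) * p k) n := by
    constructor
    · intro Q hQ
      have e : ∀ t, (starRingEnd ℂ) ((∑ k ∈ s, Polynomial.C (a k) * p k).eval (D.γ t)) * Q.eval (D.γ t) =
          ∑ k ∈ s, (starRingEnd ℂ) (a k) * ((starRingEnd ℂ) ((p k).eval (D.γ t)) * Q.eval (D.γ t)) := by
        intro t
        rw [Polynomial.eval_finset_sum, map_sum, Finset.sum_mul]
        refine Finset.sum_congr rfl fun k _ => ?_
        simp; ring
      simp_rw [e]
      rw [intervalIntegral.integral_finsetSum fun j _ => Continuous.intervalIntegrable (by fun_prop) _ _]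
      refine Finset.sum_eq_zero fun k hk => ?_
      rw [intervalIntegral.integral_const_mul, on_orth hp k k le_rfl Q, mul_zero]
      refine Polynomial.degree_le_natDegree.trans_lt ?_
      have := (Finset.mem_Ico.1 hk).1
      exact_mod_cast (show Q.natDegree < k by omega)
    · rw [on_sum hp]
      have : ∑ k ∈ s, ‖a k‖^2 = 1 := by
        simp only [a, norm_div, RCLike.norm_conj, div_pow, Complex.norm_real, Real.norm_of_nonneg r0.le]
        rw [← Finset.sum_div, r2]; exact div_self h0.ne'
      rw [this, mul_one]
  have := hB _ o
  have e : (∑ k ∈ s, Polynomial.C (a k) * p k).eval z = r := by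
    rw [Polynomial.eval_finset_sum]
    have : ∀ k, (Polynomial.C (a k) * p k).eval z = ((‖(p k).eval z‖^2 : ℝ):ℂ) / r := by
      intro k; simp only [a, Polynomial.eval_mul, Polynomial.eval_C]
      rw [ofReal_pow, ← Complex.conj_mul']; ring
    simp_rw [this]
    rw [← Finset.sum_div, ← ofReal_sum, ← hS, ← r2]; push_cast; field_simp
  rw [e, Complex.norm_real, Real.norm_of_nonneg r0.le] at this
  rw [← r2]; gcongr

theorem fin_est (D : JordanDomain) (B : PiecewiseAnalyticBoundary D) (lam : ℝ) (hlam0 : 0 < lam) (hmin : ∀ i, lam ≤ B.extAngle i)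
    (F : Set ℂ) (hF : IsCompact F) (hFG : F ⊆ D.G) : ∃ C, ∀ z ∈ F, ∀ (n:ℕ) P, 1 ≤ n → Orth D P n → ‖P.eval z‖ ≤ C * (n:ℝ)^(-(lam/(2*(2-lam)))) := by
  obtain ⟨z₀, hz₀⟩ := D.nonempty
  obtain ⟨φ, hd, hb⟩ := rmt D.isOpen D.simplyConnected D.bounded D.connected.isPreconnected hz₀
  have cm : CM D φ := ⟨hd, hb⟩
  rcases F.eq_empty_or_nonempty with rfl | hne
  · exact ⟨0, by simp⟩
  obtain ⟨w, hw, hm⟩ := hF.exists_isMaxOn hne (hd.continuousOn.mono hFG).norm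
  have r1 := cm.lt (hFG hw)
  set ρ := max (1/2) ((‖φ w‖+1)/2) with hρ
  have ρh : 1/2 ≤ ρ := le_max_left _ _
  have ρ1 : ρ < 1 := max_lt (by norm_num) (by linarith)
  have ρr : ‖φ w‖ < ρ := lt_of_lt_of_le (by linarith) (le_max_right _ _)
  obtain ⟨N, σ, V, c, M, J, ee, al, hM, g⟩ := geo B hmin
  obtain ⟨c', q, Fs, Q, C, g', d⟩ := g.dat cm ρh ρ1
  have c0 : 0 < c' := g'.c0
  have m0 : 0 < min c' lam := lt_min c0 hlam0
  obtain ⟨b, hb⟩ := hF.exists_bound_of_continuousOn (d.qd.continuousOn.mono hFG)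
  exact main_est (g'.mono m0 (min_le_left _ _)) (d.mono m0 (min_le_left _ _)) (by linarith) ρ1 hlam0 (min_le_right _ _) ρr
    (fun z hz => ⟨hFG hz, hm hz, hb z hz⟩)

theorem szegoKernel_pointwise_rate
    (D : JordanDomain) (B : PiecewiseAnalyticBoundary D)
    (lam : ℝ) (hlam0 : 0 < lam) (hlam2 : lam < 2)
    (hmin : ∀ i, lam ≤ B.extAngle i) (hattained : ∃ i, B.extAngle i = lam)
    (p : ℕ → Polynomial ℂ) (hp : D.IsONPolys p)
    (F : Set ℂ) (hF : IsCompact F) (hFG : F ⊆ D.G)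
    (hsum : ∀ ζ ∈ F, ∀ z ∈ F,
      Summable fun k : ℕ => (starRingEnd ℂ) ((p k).eval ζ) * (p k).eval z) :
    ∃ C : ℝ, 0 < C ∧ ∀ ζ ∈ F, ∀ z ∈ F, ∀ n : ℕ, 0 < n →
      ‖szegoKernel p ζ z - partialSum p ζ n z‖ ≤
        C * (n : ℝ) ^ (-(lam / (2 - lam))) := by
  obtain ⟨C, hC⟩ := fin_est D B lam hlam0 hmin F hF hFG
  refine ⟨C^2+1, by positivity, fun ζ hζ z hz n hn => ?_⟩
  have hB : (C * (n:ℝ)^(-(lam/(2*(2-lam)))))^2 = C^2 * (n : ℝ) ^ (-(lam / (2 - lam))) := by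
    rw [mul_pow, ← Real.rpow_natCast ((n:ℝ)^_), ← Real.rpow_mul n.cast_nonneg]
    congr 2
    have : 2 - lam ≠ 0 := by linarith
    push_cast; field_simp
  have key : ‖szegoKernel p ζ z - partialSum p ζ n z‖ ≤ C^2 * (n : ℝ) ^ (-(lam / (2 - lam))) := by
    rw [← hB]
    have t := (hsum ζ hζ z hz).hasSum.tendsto_sum_nat
    refine le_of_tendsto (t.sub_const (partialSum p ζ n z)).norm (eventually_atTop.2 ⟨n+1, fun m hm => ?_⟩)
    unfold partialSum
    rw [← Finset.sum_Ico_eq_sub _ hm]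
    have h1 := on_tail hp (fun P hP => hC ζ hζ n P hn hP) m
    have h2 := on_tail hp (fun P hP => hC z hz n P hn hP) m
    calc _ ≤ ∑ k ∈ Finset.Ico (n+1) m, (1/2*‖(p k).eval ζ‖^2 + 1/2*‖(p k).eval z‖^2) := by
          refine (norm_sum_le _ _).trans (Finset.sum_le_sum fun k _ => ?_)
          rw [norm_mul, RCLike.norm_conj]
          nlinarith [sq_nonneg (‖(p k).eval ζ‖ - ‖(p k).eval z‖)]
      _ ≤ _ := by rw [Finset.sum_add_distrib, ← Finset.mul_sum, ← Finset.mul_sum]; linarith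
  have : 0 ≤ (n : ℝ) ^ (-(lam / (2 - lam))) := by positivity
  linarith
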